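/- Let K be an algebraically closed field of characteristic 0 and let m ≥ 7. Suppose the Gelfand–Kirillov conjecture holds for so_m(K), i.e. there exist natural numbers r, s and a K-algebra isomorphism D(so_m(K)) ≅ D_{r,s}(K). Then there exists N ∈ ℕ such that for every prime p > N the following holds: letting k be an algebraic closure of 𝔽_p, R the polynomial algebra over k in the m(m−1)/2 coordinates of a skew-symmetric m×m matrix (i.e. the algebra of polynomial functions on so_m(k)), and F = Frac(R) its field of fractions, equipped with the action of the special orthogonal group SO_m(k) = {g ∈ GL_m(k) : gᵀg = 1, det g = 1} induced by conjugation on so_m(k) (namely (g·f)(A) = f(g⁻¹Ag)), the field F is purely transcendental over the fixed field F^{SO_m(k)}; that is, there exists a finite subset {f_1,…,f_d} of F which is algebraically independent over F^{SO_m(k)} and generates F as a field extension of F^{SO_m(k)}. (This instantiates the paper's Theorem that the Gelfand–Kirillov conjecture in characteristic 0 forces purity of k(g)/k(g)^{G} for p ≫ 0, using the trace-form identification of so_m with its dual.) -/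

import Mathlib

noncomputable section

/-- Generators of the algebra `A_{r,s}(F)`:  `u_1, …, u_r, v_1, …, v_r, y_1, …, y_s`. -/
inductive WeylPolyGen (r s : ℕ) : Type
  | u : Fin r → WeylPolyGen r s
  | v : Fin r → WeylPolyGen r s
  | y : Fin s → WeylPolyGen r s

/-- The defining relations of `A_{r,s}(F)`:  `u_i u_j = u_j u_i`, `v_i v_j = v_j v_i`,
`u_i v_j = v_j u_i + δ_{ij}`, and each `y_k` commutes with every generator. -/
inductive WeylPolyRel (F : Type) [Field F] (r s : ℕ) :
    FreeAlgebra F (WeylPolyGen r s) → FreeAlgebra F (WeylPolyGen r s) → Prop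
  | uu (i j : Fin r) :
      WeylPolyRel F r s
        (FreeAlgebra.ι F (WeylPolyGen.u i) * FreeAlgebra.ι F (WeylPolyGen.u j))
        (FreeAlgebra.ι F (WeylPolyGen.u j) * FreeAlgebra.ι F (WeylPolyGen.u i))
  | vv (i j : Fin r) :
      WeylPolyRel F r s
        (FreeAlgebra.ι F (WeylPolyGen.v i) * FreeAlgebra.ι F (WeylPolyGen.v j))
        (FreeAlgebra.ι F (WeylPolyGen.v j) * FreeAlgebra.ι F (WeylPolyGen.v i))
  | uv (i j : Fin r) :
      WeylPolyRel F r s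
        (FreeAlgebra.ι F (WeylPolyGen.u i) * FreeAlgebra.ι F (WeylPolyGen.v j))
        (FreeAlgebra.ι F (WeylPolyGen.v j) * FreeAlgebra.ι F (WeylPolyGen.u i)
          + if i = j then 1 else 0)
  | central (a : Fin s) (z : WeylPolyGen r s) :
      WeylPolyRel F r s
        (FreeAlgebra.ι F (WeylPolyGen.y a) * FreeAlgebra.ι F z)
        (FreeAlgebra.ι F z * FreeAlgebra.ι F (WeylPolyGen.y a))

/-- The algebra `A_{r,s}(F)`, the tensor product of the `r`-th Weyl algebra over `F`
with a polynomial ring in `s` variables. -/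
abbrev WeylPolyAlgebra (F : Type) [Field F] (r s : ℕ) : Type :=
  RingQuot (WeylPolyRel F r s)

/-- `f : R →ₐ[F] D` realises the division ring `D` as the (left) Ore division ring of
fractions of `R`:  `f` is injective and every element of `D` has the form
`(f b)⁻¹ * f a` with `a b : R`, `b ≠ 0`. -/
def IsFractionDivisionRing (F : Type) [Field F] {R D : Type} [Ring R] [Algebra F R]
    [DivisionRing D] [Algebra F D] (f : R →ₐ[F] D) : Prop :=
  Function.Injective f ∧ ∀ d : D, ∃ a b : R, b ≠ 0 ∧ f b * d = f a

/-- A witness to the Gelfand–Kirillov conjecture for the Lie algebra `L` over `F`: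
natural numbers `r, s`, a division ring of fractions `D₁` of the universal enveloping
algebra `U(L)`, a division ring of fractions `D₂` of `A_{r,s}(F)`, and an `F`-algebra
isomorphism `D₁ ≃ D₂`. -/
structure GelfandKirillovWitness (F : Type) [Field F]
    (L : Type) [LieRing L] [LieAlgebra F L] : Type 1 where
  r : ℕ
  s : ℕ
  D₁ : Type
  D₂ : Type
  [div₁ : DivisionRing D₁]
  [div₂ : DivisionRing D₂]
  [alg₁ : Algebra F D₁]
  [alg₂ : Algebra F D₂]
  f₁ : UniversalEnvelopingAlgebra F L →ₐ[F] D₁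
  f₂ : WeylPolyAlgebra F r s →ₐ[F] D₂
  frac₁ : IsFractionDivisionRing F f₁
  frac₂ : IsFractionDivisionRing F f₂
  iso : D₁ ≃ₐ[F] D₂

/-- The Gelfand–Kirillov conjecture holds for the Lie algebra `L` over the field `F`:
the division ring of fractions `D(L)` of `U(L)` is isomorphic, as an `F`-algebra, to
`D_{r,s}(F)` (the division ring of fractions of `A_{r,s}(F)`) for some `r, s`. -/
def GelfandKirillovHolds (F : Type) [Field F]
    (L : Type) [LieRing L] [LieAlgebra F L] : Prop :=
  Nonempty (GelfandKirillovWitness F L)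


/-- The index set of the coordinates on `so_m`: the `m(m−1)/2` positions `(i,j)`, `i < j`,
of a skew-symmetric `m × m` matrix. -/
abbrev SkewIdx (m : ℕ) : Type := {ij : Fin m × Fin m // ij.1 < ij.2}

/-- The entry `A_{a b}` of a skew-symmetric matrix of variables, as a polynomial in the
coordinates `X_{(i,j)}`, `i < j`:  it equals `X_{(a,b)}` if `a < b`, `−X_{(b,a)}` if
`b < a`, and `0` if `a = b`. -/
def skewEntry (k : Type) [Field k] (m : ℕ) (a b : Fin m) : MvPolynomial (SkewIdx m) k :=
  if h : a < b then MvPolynomial.X ⟨(a, b), h⟩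
  else if h' : b < a then - MvPolynomial.X ⟨(b, a), h'⟩
  else 0

/-- The `k`-algebra endomorphism of the polynomial algebra `k[so_m]` induced by the
conjugation action of `g`:  it sends a polynomial function `f` to `A ↦ f (g⁻¹ A g)`,
i.e. substitutes for the coordinate `X_{(i,j)}` the `(i,j)` entry
`∑_{a,b} (g⁻¹)_{i a} A_{a b} g_{b j}` of the conjugated skew-symmetric matrix. -/
def conjSubst (k : Type) [Field k] (m : ℕ) (g : Matrix (Fin m) (Fin m) k) :
    MvPolynomial (SkewIdx m) k →ₐ[k] MvPolynomial (SkewIdx m) k :=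
  MvPolynomial.aeval fun c : SkewIdx m =>
    ∑ a : Fin m, ∑ b : Fin m,
      MvPolynomial.C (g⁻¹ c.1.1 a * g b c.1.2) * skewEntry k m a b

/-- An element `x` of the fraction field `F = Frac k[so_m]` is invariant under the action
of the special orthogonal group `SO_m(k) = {g : gᵀ g = 1, det g = 1}` induced by
conjugation:  for every such `g` and every representation `x = a / b` with
`a, b ∈ k[so_m]`, `b ≠ 0`, one also has `x = (g·a) / (g·b)`. -/
def SOConjInvariant (k : Type) [Field k] (m : ℕ)
    (x : FractionRing (MvPolynomial (SkewIdx m) k)) : Prop :=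
  ∀ g : Matrix (Fin m) (Fin m) k, g.transpose * g = 1 → g.det = 1 →
    ∀ a b : MvPolynomial (SkewIdx m) k, b ≠ 0 →
      algebraMap (MvPolynomial (SkewIdx m) k) (FractionRing (MvPolynomial (SkewIdx m) k)) b * x
        = algebraMap (MvPolynomial (SkewIdx m) k) (FractionRing (MvPolynomial (SkewIdx m) k)) a →
      algebraMap (MvPolynomial (SkewIdx m) k) (FractionRing (MvPolynomial (SkewIdx m) k))
          (conjSubst k m g b) * x
        = algebraMap (MvPolynomial (SkewIdx m) k) (FractionRing (MvPolynomial (SkewIdx m) k))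
          (conjSubst k m g a)

namespace SoGK

open MvPolynomial Matrix

attribute [local instance] LieRing.ofAssociativeRing

section Representation

variable (k : Type) [Field k] (m : ℕ)

/-- Polynomials in the entries of two generic square matrices. -/
abbrev TwoMat : Type := MvPolynomial ((Fin m × Fin m) ⊕ (Fin m × Fin m)) k

/-- The left-invariant vector field on matrices attached to `x`. -/
def leftDer (x : Matrix (Fin m) (Fin m) k) : Derivation k (TwoMat k m) (TwoMat k m) :=
  mkDerivation k (Sum.elim
    (fun ab => ∑ j, X (Sum.inl (ab.1, j)) * C (x j ab.2)) (fun _ => 0))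

/-- The moment map of the cotangent bundle of the space of matrices. -/
def moment (x : Matrix (Fin m) (Fin m) k) : TwoMat k m :=
  ∑ a, ∑ b, X (Sum.inr (a, b)) * ∑ j, X (Sum.inl (a, j)) * C (x j b)

variable {k m}

lemma leftDer_X_inl (x : Matrix (Fin m) (Fin m) k) (a b : Fin m) :
    leftDer k m x (X (Sum.inl (a, b))) = ∑ j, X (Sum.inl (a, j)) * C (x j b) := by
  simp [leftDer, mkDerivation_X]

lemma leftDer_X_inr (x : Matrix (Fin m) (Fin m) k) (ab) :
    leftDer k m x (X (Sum.inr ab)) = 0 := by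
  simp [leftDer, mkDerivation_X]

lemma leftDer_C (x : Matrix (Fin m) (Fin m) k) (c : k) : leftDer k m x (C c) = 0 :=
  by
  rw [← algebraMap_eq]; exact Derivation.map_algebraMap _ _

lemma leftDer_sum (x y : Matrix (Fin m) (Fin m) k) (a b : Fin m) :
    leftDer k m x (∑ j, X (Sum.inl (a, j)) * C (y j b)) =
      ∑ j, X (Sum.inl (a, j)) * C ((x * y) j b) := by
  simp only [map_sum, Derivation.leibniz, leftDer_C, leftDer_X_inl, mul_zero, zero_add,
    smul_eq_mul, Matrix.mul_apply, map_sum, Finset.mul_sum]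
  rw [Finset.sum_comm]
  refine Finset.sum_congr rfl fun i _ => Finset.sum_congr rfl fun j _ => ?_
  rw [C_mul]; ring

lemma leftDer_moment (x y : Matrix (Fin m) (Fin m) k) :
    leftDer k m x (moment k m y) = moment k m (x * y) := by
  rw [moment, moment, map_sum]
  refine Finset.sum_congr rfl fun a _ => ?_
  rw [map_sum]
  refine Finset.sum_congr rfl fun b _ => ?_
  rw [Derivation.leibniz, leftDer_sum, leftDer_X_inr, smul_zero, add_zero, smul_eq_mul]

lemma leftDer_add (x y : Matrix (Fin m) (Fin m) k) :
    leftDer k m (x + y) = leftDer k m x + leftDer k m y := by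
  apply MvPolynomial.derivation_ext
  rintro (⟨a, b⟩ | ab)
  · simp [leftDer_X_inl, mul_add, Finset.sum_add_distrib]
  · simp [leftDer_X_inr]

lemma leftDer_smul (c : k) (x : Matrix (Fin m) (Fin m) k) :
    leftDer k m (c • x) = c • leftDer k m x := by
  apply MvPolynomial.derivation_ext
  rintro (⟨a, b⟩ | ab)
  · simp only [leftDer_X_inl, Derivation.smul_apply, Finset.smul_sum, Matrix.smul_apply,
      smul_eq_mul, C_mul, MvPolynomial.smul_eq_C_mul]
    exact Finset.sum_congr rfl fun j _ => by ring
  · simp [leftDer_X_inr]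

lemma leftDer_lie (x y : Matrix (Fin m) (Fin m) k) :
    leftDer k m ⁅x, y⁆ = ⁅leftDer k m x, leftDer k m y⁆ := by
  apply MvPolynomial.derivation_ext
  rintro (⟨a, b⟩ | ab)
  · rw [Derivation.commutator_apply]
    simp only [leftDer_X_inl, leftDer_sum, LieRing.of_associative_ring_bracket, Matrix.sub_apply,
      C_sub, mul_sub, Finset.sum_sub_distrib]
  · rw [Derivation.commutator_apply]
    simp [leftDer_X_inr]

lemma moment_add (x y : Matrix (Fin m) (Fin m) k) :
    moment k m (x + y) = moment k m x + moment k m y := by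
  simp [moment, mul_add, Finset.sum_add_distrib]

lemma moment_smul (c : k) (x : Matrix (Fin m) (Fin m) k) :
    moment k m (c • x) = c • moment k m x := by
  simp only [moment, Matrix.smul_apply, smul_eq_mul, C_mul, Finset.smul_sum, Finset.mul_sum,
    MvPolynomial.smul_eq_C_mul]
  refine Finset.sum_congr rfl fun a _ => Finset.sum_congr rfl fun b _ =>
    Finset.sum_congr rfl fun j _ => by ring

lemma moment_sub (x y : Matrix (Fin m) (Fin m) k) :
    moment k m (x - y) = moment k m x - moment k m y := by
  rw [sub_eq_add_neg, moment_add, ← neg_one_smul k y, moment_smul]; simp [sub_eq_add_neg]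

variable (k m)

/-- The twisted action of a matrix on sequences, the grading of which remembers the order of
differential operators. -/
def shiftAct (x : Matrix (Fin m) (Fin m) k) :
    (ℕ → TwoMat k m) →ₗ[k] (ℕ → TwoMat k m) where
  toFun f n := leftDer k m x (f n) + Nat.casesOn n 0 fun n => moment k m x * f n
  map_add' f g := by
    ext1 n
    cases n <;> simp [mul_add, add_add_add_comm]
  map_smul' c f := by
    ext1 n
    cases n <;> simp

/-- The action of matrices on sequences as a homomorphism of Lie algebras. -/
def shiftRep : Matrix (Fin m) (Fin m) k →ₗ⁅k⁆ Module.End k (ℕ → TwoMat k m) where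
  toFun := shiftAct k m
  map_add' x y := by
    refine LinearMap.ext fun f => funext fun n => ?_
    cases n <;> simp [shiftAct, leftDer_add, moment_add] ; ring
  map_smul' c x := by
    refine LinearMap.ext fun f => funext fun n => ?_
    cases n <;> simp [shiftAct, leftDer_smul, moment_smul]
  map_lie' {x y} := by
    refine LinearMap.ext fun f => funext fun n => ?_
    have h : moment k m ⁅x, y⁆ = moment k m (x * y) - moment k m (y * x) := by
      rw [LieRing.of_associative_ring_bracket, moment_sub]
    rw [LieRing.of_associative_ring_bracket (shiftAct k m x)]
    simp only [shiftAct, leftDer_lie, h]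
    rcases n with _ | _ | n
    · simp [Derivation.commutator_apply]
    · simp [Derivation.commutator_apply, leftDer_moment]; ring
    · simp [Derivation.commutator_apply, leftDer_moment]; ring

end Representation

/-- The orthogonal Lie algebra of skew-symmetric matrices. -/
abbrev So (k : Type) [Field k] (m : ℕ) := LieAlgebra.Orthogonal.so (Fin m) k

/-- The enveloping algebra of the orthogonal Lie algebra. -/
abbrev Env (k : Type) [Field k] (m : ℕ) := UniversalEnvelopingAlgebra k (So k m)

section Symbol

variable (k : Type) [Field k] (m : ℕ)

/-- The skew-symmetric matrix `e_ij - e_ji`. -/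
def skewMat (i j : Fin m) : Matrix (Fin m) (Fin m) k :=
  Matrix.single i j 1 - Matrix.single j i 1

/-- The element `e_ij - e_ji` of the orthogonal Lie algebra. -/
def skewGen (i j : Fin m) : So k m :=
  ⟨skewMat k m i j, by rw [LieAlgebra.Orthogonal.mem_so]; simp [skewMat]⟩

/-- The action of the enveloping algebra on sequences. -/
def envAct : Env k m →ₐ[k] Module.End k (ℕ → TwoMat k m) :=
  UniversalEnvelopingAlgebra.lift k ((shiftRep k m).comp (So k m).incl)

/-- The elements of the enveloping algebra of filtration degree at most one. -/
def filOne : Submodule k (Env k m) :=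
  1 ⊔ LinearMap.range (UniversalEnvelopingAlgebra.ι k : So k m →ₗ⁅k⁆ Env k m).toLinearMap

/-- The standard filtration of the enveloping algebra. -/
def fil (d : ℕ) : Submodule k (Env k m) := filOne k m ^ d

/-- The elements of filtration degree less than `d`. -/
def filLT : ℕ → Submodule k (Env k m)
  | 0 => ⊥
  | d + 1 => fil k m d

/-- Specialisation of the two generic matrices to the identity and to the strictly upper
triangular part of the generic skew-symmetric matrix. -/
def specHom : TwoMat k m →ₐ[k] MvPolynomial (SkewIdx m) k :=
  aeval (Sum.elim (fun ab => if ab.1 = ab.2 then 1 else 0)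
    (fun ab => if h : ab.1 < ab.2 then X ⟨ab, h⟩ else 0))

/-- The initial sequence. -/
def vac : ℕ → TwoMat k m := Pi.single 0 1

/-- The symbol in degree `d`. -/
def symb (d : ℕ) : Env k m →ₗ[k] MvPolynomial (SkewIdx m) k :=
  (specHom k m).toLinearMap ∘ₗ LinearMap.proj d ∘ₗ
    (LinearMap.applyₗ (vac k m)) ∘ₗ (envAct k m).toLinearMap

variable {k m}

lemma symb_apply (d : ℕ) (c : Env k m) :
    symb k m d c = specHom k m (envAct k m c (vac k m) d) := rfl

lemma envAct_ι (x : So k m) (f : ℕ → TwoMat k m) :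
    envAct k m (UniversalEnvelopingAlgebra.ι k x) f = shiftAct k m x.1 f := by
  rw [envAct, UniversalEnvelopingAlgebra.lift_ι_apply]; rfl

lemma one_le_filOne : 1 ≤ filOne k m := le_sup_left

lemma fil_mono {d e : ℕ} (h : d ≤ e) : fil k m d ≤ fil k m e :=
  pow_le_pow_right' one_le_filOne h

lemma ι_mem_filOne (x : So k m) : UniversalEnvelopingAlgebra.ι k x ∈ filOne k m :=
  Submodule.mem_sup_right ⟨x, rfl⟩

lemma ι_mem_fil (x : So k m) : UniversalEnvelopingAlgebra.ι k x ∈ fil k m 1 := by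
  rw [fil, pow_one]; exact ι_mem_filOne x

lemma mem_filOne {c : Env k m} (hc : c ∈ filOne k m) :
    ∃ (a : k) (x : So k m), c = algebraMap k _ a + UniversalEnvelopingAlgebra.ι k x := by
  obtain ⟨u, hu, v, ⟨x, hx⟩, rfl⟩ := Submodule.mem_sup.1 hc
  obtain ⟨a, rfl⟩ := Submodule.mem_one.1 hu
  exact ⟨a, x, by rw [← hx]; rfl⟩

lemma mul_mem_fil {d e : ℕ} {c c' : Env k m} (h : c ∈ fil k m d) (h' : c' ∈ fil k m e) :
    c * c' ∈ fil k m (d + e) := by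
  rw [fil, pow_add]; exact Submodule.mul_mem_mul h h'

lemma fil_le_filLT {d e : ℕ} (h : d < e) : fil k m d ≤ filLT k m e := by
  cases e with
  | zero => omega
  | succ e => exact fil_mono (by omega)

lemma mul_filLT {d e : ℕ} {c c' : Env k m} (h : c ∈ fil k m d) (h' : c' ∈ filLT k m e) :
    c * c' ∈ filLT k m (d + e) := by
  cases e with
  | zero => rw [show c' = 0 from h', mul_zero]; exact zero_mem _
  | succ d => exact fil_le_filLT (by omega) (mul_mem_fil h h')

lemma shiftAct_apply_top (x : Matrix (Fin m) (Fin m) k) {f : ℕ → TwoMat k m} {e : ℕ}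
    (hf : ∀ n, e < n → f n = 0) :
    (∀ n, e + 1 < n → shiftAct k m x f n = 0) ∧
      shiftAct k m x f (e + 1) = moment k m x * f e := by
  constructor
  · intro n hn
    obtain ⟨n, rfl⟩ : ∃ j, n = j + 1 := ⟨n - 1, by omega⟩
    simp [shiftAct, hf (n + 1) (by omega), hf n (by omega)]
  · simp [shiftAct, hf (e + 1) (by omega)]

lemma envAct_top {d : ℕ} {c : Env k m} (hc : c ∈ fil k m d) :
    ∃ s : TwoMat k m, ∀ (e : ℕ) (f : ℕ → TwoMat k m), (∀ n, e < n → f n = 0) →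
      (∀ n, d + e < n → envAct k m c f n = 0) ∧ envAct k m c f (d + e) = s * f e := by
  unfold fil at hc
  induction hc using Submodule.pow_induction_on_left' with
  | algebraMap r =>
    refine ⟨C r, fun e f hf => ⟨fun n hn => ?_, ?_⟩⟩
    · rw [AlgHom.commutes, Module.algebraMap_end_apply, Pi.smul_apply, hf n (by omega), smul_zero]
    · rw [AlgHom.commutes, Module.algebraMap_end_apply, Pi.smul_apply, zero_add,
        MvPolynomial.smul_eq_C_mul]
  | add x y i hx hy ihx ihy =>
    obtain ⟨s, hs⟩ := ihx
    obtain ⟨t, ht⟩ := ihy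
    refine ⟨s + t, fun e f hf => ⟨fun n hn => ?_, ?_⟩⟩
    · rw [map_add, LinearMap.add_apply, Pi.add_apply, (hs e f hf).1 n hn, (ht e f hf).1 n hn,
        add_zero]
    · rw [map_add, LinearMap.add_apply, Pi.add_apply, (hs e f hf).2, (ht e f hf).2, add_mul]
  | mem_mul u hu i x hx ih =>
    obtain ⟨s, hs⟩ := ih
    obtain ⟨a, y, rfl⟩ := mem_filOne hu
    refine ⟨moment k m y.1 * s, fun e f hf => ?_⟩
    have key := shiftAct_apply_top y.1 (hs e f hf).1
    have hform : ∀ n, envAct k m ((algebraMap k _ a + UniversalEnvelopingAlgebra.ι k y) * x) f n =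
        a • envAct k m x f n + shiftAct k m y.1 (envAct k m x f) n := by
      intro n
      rw [map_mul, map_add, AlgHom.commutes, Module.End.mul_apply, LinearMap.add_apply,
        Pi.add_apply, Module.algebraMap_end_apply, Pi.smul_apply, envAct_ι]
    refine ⟨fun n hn => ?_, ?_⟩
    · rw [hform, (hs e f hf).1 n (by omega), key.1 n (by omega), smul_zero, add_zero]
    · rw [hform, Nat.succ_add, (hs e f hf).1 _ (by omega), smul_zero, zero_add, key.2,
        (hs e f hf).2, mul_assoc]

lemma vac_support (n : ℕ) (hn : 0 < n) : vac k m n = 0 := by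
  simp [vac, Pi.single_apply, hn.ne']

lemma symb_mul {d e : ℕ} {c c' : Env k m} (h : c ∈ fil k m d) (h' : c' ∈ fil k m e) :
    symb k m (d + e) (c * c') = symb k m d c * symb k m e c' := by
  obtain ⟨s, hs⟩ := envAct_top h
  obtain ⟨t, ht⟩ := envAct_top h'
  have h1 := hs 0 (vac k m) vac_support
  have h2 := ht 0 (vac k m) vac_support
  simp only [add_zero] at h1 h2
  have h3 := hs e _ h2.1
  rw [symb_apply, symb_apply, symb_apply, map_mul, Module.End.mul_apply, h3.2, h1.2, map_mul,
    map_mul]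
  simp [vac]

lemma symb_of_lt {d e : ℕ} (hde : d < e) {c : Env k m} (h : c ∈ fil k m d) :
    symb k m e c = 0 := by
  obtain ⟨s, hs⟩ := envAct_top h
  rw [symb_apply, (hs 0 (vac k m) vac_support).1 e hde, map_zero]

lemma symb_filLT {d : ℕ} {c : Env k m} (h : c ∈ filLT k m d) : symb k m d c = 0 := by
  cases d with
  | zero => rw [show c = 0 from h, map_zero]
  | succ d => exact symb_of_lt d.lt_succ_self h

lemma symb_one : symb k m 0 1 = 1 := by
  simp [symb_apply, vac]

lemma one_mem_fil (d : ℕ) : (1 : Env k m) ∈ fil k m d :=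
  fil_mono (Nat.zero_le d) (by rw [fil, pow_zero]; exact Submodule.one_le.1 le_rfl)

lemma symb_algebraMap (a : k) : symb k m 0 (algebraMap k _ a) = C a := by
  rw [Algebra.algebraMap_eq_smul_one, map_smul, symb_one, MvPolynomial.smul_eq_C_mul, mul_one]

/-- The linear form on the dual of skew matrices given by a skew matrix. -/
def linForm (x : Matrix (Fin m) (Fin m) k) : MvPolynomial (SkewIdx m) k :=
  ∑ c : SkewIdx m, C (x c.1.1 c.1.2) * X c

lemma sum_skewIdx {M : Type*} [AddCommMonoid M] (g : ∀ a b : Fin m, a < b → M) :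
    (∑ a, ∑ b, if h : a < b then g a b h else 0) = ∑ c : SkewIdx m, g c.1.1 c.1.2 c.2 := by
  rw [← Fintype.sum_prod_type' (f := fun a b => if h : a < b then g a b h else 0),
    ← Fintype.sum_subtype_add_sum_subtype (fun ij : Fin m × Fin m => ij.1 < ij.2),
    Finset.sum_eq_zero (s := (Finset.univ : Finset {ij : Fin m × Fin m // ¬ ij.1 < ij.2}))
      (fun c _ => dif_neg c.2), add_zero]
  exact Finset.sum_congr rfl fun c _ => dif_pos c.2

lemma specHom_moment (x : Matrix (Fin m) (Fin m) k) :
    specHom k m (moment k m x) = linForm x := by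
  have h1 : specHom k m (moment k m x) = ∑ a, ∑ b,
      if h : a < b then C (x a b) * X (⟨(a, b), h⟩ : SkewIdx m) else 0 := by
    rw [moment, map_sum]
    refine Finset.sum_congr rfl fun a _ => ?_
    rw [map_sum]
    refine Finset.sum_congr rfl fun b _ => ?_
    have h2 : specHom k m (∑ j, X (Sum.inl (a, j)) * C (x j b)) = C (x a b) := by
      simp [specHom, algebraMap_eq]
    rw [map_mul, h2]
    simp only [specHom, aeval_X, Sum.elim_inr]
    split_ifs
    · ring
    · ring
  rw [h1, sum_skewIdx fun a b h => C (x a b) * X (⟨(a, b), h⟩ : SkewIdx m), linForm]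

lemma symb_ι (x : So k m) : symb k m 1 (UniversalEnvelopingAlgebra.ι k x) = linForm x.1 := by
  rw [symb_apply, envAct_ι, (shiftAct_apply_top x.1 vac_support).2, map_mul, specHom_moment]
  simp [vac]

end Symbol

end SoGK

namespace SoGK

open MvPolynomial Matrix

attribute [local instance] LieRing.ofAssociativeRing

section PBW

variable {k : Type} [Field k] {m : ℕ}

/-- The standard basis vector of the orthogonal Lie algebra. -/
abbrev gen (k : Type) [Field k] {m : ℕ} (c : SkewIdx m) : So k m := skewGen k m c.1.1 c.1.2

/-- The canonical map to the enveloping algebra. -/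
abbrev envι (k : Type) [Field k] {m : ℕ} (x : So k m) : Env k m :=
  UniversalEnvelopingAlgebra.ι k x

lemma skewMat_apply (i j a b : Fin m) :
    skewMat k m i j a b = (if i = a ∧ j = b then 1 else 0) - (if j = a ∧ i = b then 1 else 0) := by
  simp [skewMat, Matrix.single_apply]

lemma So.apply_swap (x : So k m) (a b : Fin m) : x.1 b a = - x.1 a b := by
  have h := (LieAlgebra.Orthogonal.mem_so (Fin m) k x.1).1 x.2
  simpa using congrFun (congrFun h a) b

lemma linForm_gen (c : SkewIdx m) : linForm (gen k c).1 = X c := by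
  rw [linForm, Finset.sum_eq_single c]
  · have h1 : ¬ (c.1.2 = c.1.1 ∧ c.1.1 = c.1.2) := fun h => c.2.ne h.2
    simp only [gen, skewGen, skewMat_apply, h1, and_self, if_true, if_false, sub_zero, C_1, one_mul]
  · intro b _ hb
    have h1 : ¬ (c.1.1 = b.1.1 ∧ c.1.2 = b.1.2) := fun h => hb (Subtype.ext (Prod.ext h.1 h.2)).symm
    have h2 : ¬ (c.1.2 = b.1.1 ∧ c.1.1 = b.1.2) := fun h => by
      have := c.2; have := b.2; rw [← h.1, ← h.2] at this; exact absurd this (lt_asymm c.2)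
    simp only [gen, skewGen, skewMat_apply, h1, h2, if_false, sub_zero, C_0, zero_mul]
  · simp

/-- Two skew matrices with the same upper triangular part agree. -/
lemma So.ext_upper [NeZero (2 : k)] {x y : So k m} (h : ∀ c : SkewIdx m, x.1 c.1.1 c.1.2 = y.1 c.1.1 c.1.2) :
    x = y := by
  refine Subtype.ext (Matrix.ext fun a b => ?_)
  rcases lt_trichotomy a b with hab | rfl | hab
  · exact h ⟨(a, b), hab⟩
  · have h1 := So.apply_swap x a a
    have h2 := So.apply_swap y a a
    have h3 : (2 : k) * x.1 a a = 2 * y.1 a a := by linear_combination h1 - h2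
    exact mul_left_cancel₀ (NeZero.ne (2 : k)) h3
  · rw [So.apply_swap x b a, So.apply_swap y b a, h ⟨(b, a), hab⟩]

lemma gen_apply (c b : SkewIdx m) : (gen k c).1 b.1.1 b.1.2 = if b = c then 1 else 0 := by
  split_ifs with h
  · subst h
    have h1 : ¬ (b.1.2 = b.1.1 ∧ b.1.1 = b.1.2) := fun h => b.2.ne h.2
    simp only [gen, skewGen, skewMat_apply, h1, and_self, if_true, if_false, sub_zero]
  · have h1 : ¬ (c.1.1 = b.1.1 ∧ c.1.2 = b.1.2) := fun h' => h (Subtype.ext (Prod.ext h'.1 h'.2)).symm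
    have h2 : ¬ (c.1.2 = b.1.1 ∧ c.1.1 = b.1.2) := fun h' => by
      have := c.2; have := b.2; rw [← h'.1, ← h'.2] at this; exact absurd this (lt_asymm c.2)
    simp only [gen, skewGen, skewMat_apply, h1, h2, if_false, sub_zero]

variable [NeZero (2 : k)]

lemma So.eq_sum (x : So k m) : x = ∑ c : SkewIdx m, x.1 c.1.1 c.1.2 • gen k c := by
  refine So.ext_upper fun b => ?_
  have h1 : ((∑ c : SkewIdx m, x.1 c.1.1 c.1.2 • gen k c : So k m) : Matrix (Fin m) (Fin m) k) =
      ∑ c : SkewIdx m, x.1 c.1.1 c.1.2 • (gen k c).1 := by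
    exact map_sum (So k m).subtype _ _
  rw [h1, Matrix.sum_apply]
  simp only [Matrix.smul_apply, gen_apply, smul_eq_mul, mul_ite, mul_one, mul_zero]
  simp

omit [NeZero (2 : k)]

variable (k) in
/-- The product of basis vectors in the enveloping algebra along a list. -/
def prodE (L : List (SkewIdx m)) : Env k m := (L.map fun c => envι k (gen k c)).prod

lemma prodE_cons (c : SkewIdx m) (L : List (SkewIdx m)) :
    prodE k (c :: L) = envι k (gen k c) * prodE k L := by simp [prodE]

lemma prodE_mem (L : List (SkewIdx m)) : prodE k L ∈ fil k m L.length := by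
  induction L with
  | nil => exact one_mem_fil 0
  | cons c L ih =>
    rw [prodE_cons, List.length_cons, add_comm]
    exact mul_mem_fil (ι_mem_fil _) ih

lemma symb_prodE (L : List (SkewIdx m)) : symb k m L.length (prodE k L) = (L.map X).prod := by
  induction L with
  | nil => exact symb_one
  | cons c L ih =>
    rw [prodE_cons, List.length_cons, add_comm, symb_mul (ι_mem_fil _) (prodE_mem L), ih, symb_ι,
      linForm_gen, List.map_cons, List.prod_cons]

lemma ι_lie_eq (x y : So k m) : envι k x * envι k y - envι k y * envι k x = envι k ⁅x, y⁆ := by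
  rw [envι, envι, envι, LieHom.map_lie, LieRing.of_associative_ring_bracket]

lemma prodE_perm {L L' : List (SkewIdx m)} (h : L.Perm L') :
    prodE k L - prodE k L' ∈ filLT k m L.length := by
  induction h with
  | nil => simp
  | cons c h ih =>
    rw [prodE_cons, prodE_cons, ← mul_sub, List.length_cons, add_comm]
    exact mul_filLT (ι_mem_fil _) ih
  | swap a b L =>
    have h1 : prodE k (b :: a :: L) - prodE k (a :: b :: L) =
        envι k ⁅gen k b, gen k a⁆ * prodE k L := by
      rw [← ι_lie_eq]; simp only [prodE_cons]; noncomm_ring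
    rw [h1]
    exact fil_le_filLT (by simp; omega) (mul_mem_fil (ι_mem_fil _) (prodE_mem L))
  | trans h1 h2 ih1 ih2 =>
    rw [← sub_add_sub_cancel]
    exact add_mem ih1 (by rw [h1.length_eq]; exact ih2)

variable (k) in
/-- The ordered monomial in the enveloping algebra. -/
def envMon (a : SkewIdx m →₀ ℕ) : Env k m := prodE k a.toMultiset.toList

lemma length_toList (a : SkewIdx m →₀ ℕ) : a.toMultiset.toList.length = a.degree := by
  rw [Multiset.length_toList, Finsupp.card_toMultiset, Finsupp.degree_eq_sum,
    Finsupp.sum_fintype _ _ fun _ => rfl]; rfl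

lemma envMon_mem (a : SkewIdx m →₀ ℕ) : envMon k a ∈ fil k m a.degree := by
  rw [← length_toList]; exact prodE_mem _

lemma symb_envMon (a : SkewIdx m →₀ ℕ) : symb k m a.degree (envMon k a) = monomial a 1 := by
  rw [← length_toList, envMon, symb_prodE, ← Multiset.prod_coe, ← Multiset.map_coe,
    Multiset.coe_toList, Finsupp.toMultiset_map, Finsupp.prod_toMultiset,
    Finsupp.prod_mapDomain_index (fun _ => pow_zero _) fun _ _ _ => pow_add _ _ _, monomial_eq,
    C_1, one_mul]

variable (k m) in
/-- The linear map sending monomials to ordered monomials. -/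
def pbw : MvPolynomial (SkewIdx m) k →ₗ[k] Env k m :=
  (basisMonomials (SkewIdx m) k).constr k (envMon k)

lemma pbw_monomial (a : SkewIdx m →₀ ℕ) (c : k) : pbw k m (monomial a c) = c • envMon k a := by
  have h : monomial a c = c • basisMonomials (SkewIdx m) k a := by
    simp [smul_monomial]
  rw [h, map_smul, pbw, Module.Basis.constr_basis]

lemma pbw_homogeneous {P : MvPolynomial (SkewIdx m) k} {d : ℕ} (h : P.IsHomogeneous d) :
    pbw k m P ∈ fil k m d ∧ symb k m d (pbw k m P) = P := by
  have h1 : ∀ a ∈ P.support, a.degree = d := fun a ha => by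
    rw [Finsupp.degree_eq_weight_one]; exact h (mem_support_iff.1 ha)
  have h2 : pbw k m P = ∑ a ∈ P.support, P.coeff a • envMon k a := by
    conv_lhs => rw [P.as_sum]
    simp only [map_sum, pbw_monomial]
  rw [h2]
  constructor
  · refine sum_mem fun a ha => Submodule.smul_mem _ _ ?_
    rw [← h1 a ha]; exact envMon_mem a
  · rw [map_sum]
    conv_rhs => rw [P.as_sum]
    refine Finset.sum_congr rfl fun a ha => ?_
    rw [map_smul, ← h1 a ha, symb_envMon, smul_monomial, smul_eq_mul, mul_one]

variable [NeZero (2 : k)]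

lemma fil_le_prodE (d : ℕ) :
    fil k m d ≤ Submodule.span k {z | ∃ L : List (SkewIdx m), L.length = d ∧ z = prodE k L} ⊔
      filLT k m d := by
  induction d with
  | zero =>
    intro z hz
    rw [fil, pow_zero] at hz
    obtain ⟨a, rfl⟩ := Submodule.mem_one.1 hz
    refine Submodule.mem_sup_left ?_
    rw [Algebra.algebraMap_eq_smul_one]
    exact Submodule.smul_mem _ _ (Submodule.subset_span ⟨[], rfl, rfl⟩)
  | succ d ih =>
    rw [fil, pow_succ', Submodule.mul_le]
    intro u hu c hc
    obtain ⟨a, x, rfl⟩ := mem_filOne hu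
    rw [add_mul]
    refine add_mem (Submodule.mem_sup_right ?_) ?_
    · rw [← Algebra.smul_def]; exact Submodule.smul_mem _ _ hc
    · obtain ⟨s, hs, t, ht, rfl⟩ := Submodule.mem_sup.1 (ih hc)
      rw [mul_add]
      refine add_mem (Submodule.mem_sup_left ?_) (Submodule.mem_sup_right ?_)
      · clear hc
        induction hs using Submodule.span_induction with
        | mem z hz =>
          obtain ⟨L, hL, rfl⟩ := hz
          rw [So.eq_sum x, map_sum, Finset.sum_mul]
          refine sum_mem fun c _ => ?_
          rw [map_smul, smul_mul_assoc]
          exact Submodule.smul_mem _ _ (Submodule.subset_span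
            ⟨c :: L, by simp [hL], (prodE_cons c L).symm⟩)
        | zero => rw [mul_zero]; exact zero_mem _
        | add y z _ _ hy hz => rw [mul_add]; exact add_mem hy hz
        | smul a y _ hy => rw [mul_smul_comm]; exact Submodule.smul_mem _ _ hy
      · rw [add_comm d]; exact mul_filLT (ι_mem_fil _) ht

lemma exists_pbw {d : ℕ} {z : Env k m} (hz : z ∈ fil k m d) :
    ∃ P : MvPolynomial (SkewIdx m) k, P.IsHomogeneous d ∧ z - pbw k m P ∈ filLT k m d := by
  obtain ⟨s, hs, t, ht, rfl⟩ := Submodule.mem_sup.1 (fil_le_prodE d hz)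
  clear hz
  suffices h : ∃ P : MvPolynomial (SkewIdx m) k, P.IsHomogeneous d ∧ s - pbw k m P ∈ filLT k m d by
    obtain ⟨P, hP, h⟩ := h
    exact ⟨P, hP, by rw [add_sub_right_comm]; exact add_mem h ht⟩
  induction hs using Submodule.span_induction with
  | mem z hz =>
    obtain ⟨L, rfl, rfl⟩ := hz
    refine ⟨monomial (Multiset.toFinsupp (L : Multiset (SkewIdx m))) 1, ?_, ?_⟩
    · refine isHomogeneous_monomial _ ?_
      rw [← length_toList]; simp
    · rw [pbw_monomial, one_smul, envMon]
      refine prodE_perm ?_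
      rw [← Multiset.coe_eq_coe]; simp
  | zero => exact ⟨0, isHomogeneous_zero _ _ _, by simp⟩
  | add y z _ _ hy hz =>
    obtain ⟨P, hP, h⟩ := hy
    obtain ⟨Q, hQ, h'⟩ := hz
    exact ⟨P + Q, hP.add hQ, by rw [map_add, add_sub_add_comm]; exact add_mem h h'⟩
  | smul a y _ hy =>
    obtain ⟨P, hP, h⟩ := hy
    refine ⟨a • P, ?_, by rw [map_smul, ← smul_sub]; exact Submodule.smul_mem _ _ h⟩
    exact (homogeneousSubmodule _ _ d).smul_mem a hP

/-- The symbol is injective on the associated graded space. -/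
lemma mem_filLT_of_symb {d : ℕ} {z : Env k m} (hz : z ∈ fil k m d) (h : symb k m d z = 0) :
    z ∈ filLT k m d := by
  obtain ⟨P, hP, h'⟩ := exists_pbw hz
  have h1 := symb_filLT h'
  rw [map_sub, h, (pbw_homogeneous hP).2, zero_sub, neg_eq_zero] at h1
  rwa [h1, map_zero, sub_zero] at h'

lemma fil_le_range_pbw (d : ℕ) : fil k m d ≤ LinearMap.range (pbw k m) := by
  induction d with
  | zero =>
    intro z hz
    obtain ⟨P, hP, h⟩ := exists_pbw hz
    exact ⟨P, (sub_eq_zero.1 h).symm⟩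
  | succ d ih =>
    intro z hz
    obtain ⟨P, hP, h⟩ := exists_pbw hz
    obtain ⟨Q, hQ⟩ := ih h
    exact ⟨Q + P, by rw [map_add, hQ, sub_add_cancel]⟩

omit [NeZero (2 : k)] in
lemma exists_mem_fil (z : Env k m) : ∃ d, z ∈ fil k m d := by
  let S : Subalgebra k (Env k m) :=
    { carrier := {z | ∃ d, z ∈ fil k m d}
      mul_mem' := fun ⟨d, hd⟩ ⟨e, he⟩ => ⟨d + e, mul_mem_fil hd he⟩
      add_mem' := fun ⟨d, hd⟩ ⟨e, he⟩ =>
        ⟨max d e, add_mem (fil_mono (le_max_left _ _) hd) (fil_mono (le_max_right _ _) he)⟩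
      algebraMap_mem' := fun r => ⟨0, by
        rw [Algebra.algebraMap_eq_smul_one]; exact Submodule.smul_mem _ _ (one_mem_fil 0)⟩ }
  let f : So k m →ₗ⁅k⁆ S :=
    { toFun := fun x => ⟨envι k x, 1, ι_mem_fil x⟩
      map_add' := fun x y => Subtype.ext (map_add _ x y)
      map_smul' := fun c x => Subtype.ext (map_smul _ c x)
      map_lie' := fun {x y} => Subtype.ext (LieHom.map_lie _ x y) }
  have h : S.val.comp (UniversalEnvelopingAlgebra.lift k f) = AlgHom.id k _ := by
    apply UniversalEnvelopingAlgebra.hom_ext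
    ext x
    simp only [LieHom.comp_apply, AlgHom.toLieHom_apply, AlgHom.comp_apply, AlgHom.id_apply]
    rw [UniversalEnvelopingAlgebra.lift_ι_apply]; rfl
  have h2 := DFunLike.congr_fun h z
  rw [← show _ = z from h2]
  exact (UniversalEnvelopingAlgebra.lift k f z).2

lemma pbw_surjective : Function.Surjective (pbw k m) := fun z => by
  obtain ⟨d, hd⟩ := exists_mem_fil z
  exact fil_le_range_pbw d hd

omit [NeZero (2 : k)] in
lemma pbw_mem_fil {P : MvPolynomial (SkewIdx m) k} {d : ℕ} (h : P.totalDegree ≤ d) :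
    pbw k m P ∈ fil k m d := by
  rw [← sum_homogeneousComponent P, map_sum]
  refine sum_mem fun i hi => ?_
  exact fil_mono (by simp at hi; omega)
    (pbw_homogeneous (homogeneousComponent_isHomogeneous i P)).1

omit [NeZero (2 : k)] in
lemma pbw_injective : Function.Injective (pbw k m) := by
  rw [injective_iff_map_eq_zero]
  intro P hP
  by_contra hne
  have h1 : symb k m P.totalDegree (pbw k m P) = homogeneousComponent P.totalDegree P := by
    have h0 := congrArg (pbw k m) (sum_homogeneousComponent P)
    rw [← h0, map_sum, map_sum, Finset.sum_range_succ, Finset.sum_eq_zero, zero_add,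
      (pbw_homogeneous (homogeneousComponent_isHomogeneous _ P)).2]
    intro i hi
    exact symb_of_lt (Finset.mem_range.1 hi)
      (pbw_homogeneous (homogeneousComponent_isHomogeneous i P)).1
  rw [hP, map_zero] at h1
  obtain ⟨a, ha, h2⟩ := Finset.exists_mem_eq_sup P.support (support_nonempty.2 hne)
    fun s => s.sum fun _ e => e
  have h3 := congrArg (coeff a) h1
  rw [coeff_homogeneousComponent, if_pos (show a.degree = P.totalDegree from h2.symm),
    coeff_zero] at h3
  exact mem_support_iff.1 ha h3.symm

lemma exists_symb_ne_zero {z : Env k m} (hz : z ≠ 0) :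
    ∃ d, z ∈ fil k m d ∧ symb k m d z ≠ 0 := by
  classical
  have h := exists_mem_fil z
  refine ⟨Nat.find h, Nat.find_spec h, fun h0 => ?_⟩
  have h1 := mem_filLT_of_symb (Nat.find_spec h) h0
  generalize hd : Nat.find h = d at h1
  cases d with
  | zero => exact hz h1
  | succ d => exact Nat.find_min h (m := d) (by omega) h1

instance : IsDomain (Env k m) := by
  haveI : Nontrivial (Env k m) := ⟨⟨1, 0, fun h => by
    have := symb_one (k := k) (m := m)
    rw [h, map_zero] at this
    exact zero_ne_one this⟩⟩
  haveI : NoZeroDivisors (Env k m) := ⟨fun {a b} hab => by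
    by_contra! hne
    obtain ⟨d, hd, h1⟩ := exists_symb_ne_zero hne.1
    obtain ⟨e, he, h2⟩ := exists_symb_ne_zero hne.2
    have h3 := symb_mul hd he
    rw [hab, map_zero] at h3
    exact mul_ne_zero h1 h2 h3.symm⟩
  exact NoZeroDivisors.to_isDomain _

/-- The Hamiltonian vector field on the dual of the orthogonal Lie algebra. -/
def hamil (x : So k m) : Derivation k (MvPolynomial (SkewIdx m) k) (MvPolynomial (SkewIdx m) k) :=
  mkDerivation k fun c => linForm ⁅x, gen k c⁆.1

lemma linForm_add (x y : Matrix (Fin m) (Fin m) k) :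
    linForm (x + y) = linForm x + linForm y := by
  simp [linForm, add_mul, Finset.sum_add_distrib]

lemma linForm_smul (c : k) (x : Matrix (Fin m) (Fin m) k) :
    linForm (c • x) = c • linForm x := by
  simp [linForm, Finset.smul_sum, MvPolynomial.smul_eq_C_mul, mul_assoc]

lemma hamil_linForm (x y : So k m) : hamil x (linForm y.1) = linForm ⁅x, y⁆.1 := by
  have h1 : linForm ⁅x, y⁆.1 =
      ∑ c : SkewIdx m, y.1 c.1.1 c.1.2 • linForm ⁅x, gen k c⁆.1 := by
    let f : So k m →ₗ[k] MvPolynomial (SkewIdx m) k :=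
      { toFun := fun z => linForm z.1
        map_add' := fun a b => linForm_add _ _
        map_smul' := fun c a => linForm_smul _ _ }
    change f ⁅x, y⁆ = ∑ c : SkewIdx m, y.1 c.1.1 c.1.2 • f ⁅x, gen k c⁆
    conv_lhs => rw [So.eq_sum y]
    rw [lie_sum, map_sum]
    refine Finset.sum_congr rfl fun c _ => ?_
    rw [lie_smul, map_smul]
  rw [h1, linForm, map_sum]
  refine Finset.sum_congr rfl fun c _ => ?_
  rw [Derivation.leibniz, ← algebraMap_eq, Derivation.map_algebraMap, smul_zero, add_zero, hamil,
    mkDerivation_X, algebraMap_eq, smul_eq_mul, MvPolynomial.smul_eq_C_mul]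

lemma symb_lie (x : So k m) {d : ℕ} {z : Env k m} (hz : z ∈ fil k m d) :
    envι k x * z - z * envι k x ∈ fil k m d ∧
      symb k m d (envι k x * z - z * envι k x) = hamil x (symb k m d z) := by
  unfold fil at hz
  induction hz using Submodule.pow_induction_on_left' with
  | algebraMap r =>
    rw [symb_algebraMap, ← Algebra.commutes, sub_self, map_zero, ← algebraMap_eq,
      Derivation.map_algebraMap]
    exact ⟨zero_mem _, rfl⟩
  | add a b i ha hb iha ihb =>
    have h1 : envι k x * (a + b) - (a + b) * envι k x =
      (envι k x * a - a * envι k x) + (envι k x * b - b * envι k x) := by noncomm_ring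
    rw [h1, map_add, map_add, map_add, iha.2, ihb.2]
    exact ⟨add_mem iha.1 ihb.1, rfl⟩
  | mem_mul u hu i z hz ih =>
    obtain ⟨a, y, rfl⟩ := mem_filOne hu
    have h1 : envι k x * ((algebraMap k _ a + envι k y) * z) -
        ((algebraMap k _ a + envι k y) * z) * envι k x =
        envι k ⁅x, y⁆ * z + (algebraMap k _ a + envι k y) * (envι k x * z - z * envι k x) := by
      rw [← ι_lie_eq]
      have := Algebra.commutes a (envι k x)
      have h2 : algebraMap k _ a * z * envι k x = a • (z * envι k x) := by
        rw [Algebra.smul_def, mul_assoc]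
      have h3 : envι k x * (algebraMap k _ a * z) = a • (envι k x * z) := by
        rw [← mul_assoc, ← this, Algebra.smul_def, mul_assoc]
      simp only [add_mul, mul_add, mul_sub, sub_mul, h2, h3, ← Algebra.smul_def, smul_sub,
        mul_smul_comm, smul_mul_assoc]
      simp only [← mul_assoc]
      abel
    have hu1 : algebraMap k _ a + envι k y ∈ fil k m 1 := by rwa [fil, pow_one]
    have hs : symb k m 1 (algebraMap k _ a + envι k y) = linForm y.1 := by
      rw [map_add, symb_ι, symb_of_lt zero_lt_one, zero_add]
      rw [Algebra.algebraMap_eq_smul_one]; exact Submodule.smul_mem _ _ (one_mem_fil 0)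
    rw [h1, Nat.succ_eq_add_one, add_comm i 1]
    refine ⟨add_mem (mul_mem_fil (ι_mem_fil _) hz) (mul_mem_fil hu1 ih.1), ?_⟩
    rw [map_add, symb_mul (ι_mem_fil _) hz, symb_mul hu1 ih.1, symb_mul hu1 hz, ih.2, hs, symb_ι,
      Derivation.leibniz, hamil_linForm, smul_eq_mul, smul_eq_mul]
    ring

end PBW

end SoGK

namespace SoGK

attribute [local instance] LieRing.ofAssociativeRing

section Jacobson

open Polynomial

lemma choose_pred_prime {R : Type*} [Ring R] (p : ℕ) [Fact p.Prime] [CharP R p] {i : ℕ}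
    (hi : i < p) : ((p - 1).choose i : R) = (-1) ^ i := by
  induction i with
  | zero => simp
  | succ i ih =>
    have hp := (Fact.out : p.Prime).pos
    have h1 : (p - 1).choose i + (p - 1).choose (i + 1) = p.choose (i + 1) := by
      obtain ⟨q, rfl⟩ : ∃ q, p = q + 1 := ⟨p - 1, by omega⟩
      simp [Nat.choose_succ_succ]
    have h2 : ((p.choose (i + 1) : ℕ) : R) = 0 :=
      (CharP.cast_eq_zero_iff R p _).2 ((Fact.out : p.Prime).dvd_choose_self (by omega) hi)
    rw [← h1, Nat.cast_add, ih (by omega)] at h2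
    rw [pow_succ, mul_neg_one]
    exact eq_neg_of_add_eq_zero_right h2

lemma sub_pow_pred_prime {R : Type*} [Ring R] (p : ℕ) [Fact p.Prime] [CharP R p] (hp : Odd p)
    {a b : R} (h : Commute a b) :
    (a - b) ^ (p - 1) = ∑ i ∈ Finset.range p, a ^ i * b ^ (p - 1 - i) := by
  have hp1 := (Fact.out : p.Prime).pos
  rw [sub_eq_add_neg, (h.neg_right).add_pow, Nat.sub_add_cancel hp1]
  refine Finset.sum_congr rfl fun i hi => ?_
  have hi := Finset.mem_range.1 hi
  have he : Even (p - 1 - i + i) := by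
    rw [Nat.sub_add_cancel (by omega)]; exact hp.tsub_odd odd_one
  rw [choose_pred_prime p hi, neg_pow b, ((Commute.neg_one_left (b ^ (p - 1 - i))).pow_left _).eq,
    mul_assoc, mul_assoc, ← pow_add, he.neg_one_pow, mul_one]

variable {R : Type*} [Ring R]

lemma derivative_pow_noncomm (W : R[X]) (n : ℕ) :
    derivative (W ^ (n + 1)) = ∑ j ∈ Finset.range (n + 1), W ^ j * derivative W * W ^ (n - j) := by
  induction n with
  | zero => simp
  | succ n ih =>
    rw [pow_succ, derivative_mul, ih, Finset.sum_range_succ _ (n + 1), Finset.sum_mul]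
    congr 1
    · refine Finset.sum_congr rfl fun j hj => ?_
      rw [Finset.mem_range] at hj
      rw [show n + 1 - j = n - j + 1 by omega, pow_succ, mul_assoc _ _ W]
    · simp

/-- The commutator with `w` as a linear map. -/
abbrev adInt (w : R) : Module.End ℤ R := LinearMap.mulLeft ℤ w - LinearMap.mulRight ℤ w

lemma charP_end (p : ℕ) [CharP R p] : CharP (Module.End ℤ R) p := by
  refine ⟨fun n => ?_⟩
  rw [← CharP.cast_eq_zero_iff R p n]
  constructor
  · intro h
    have := DFunLike.congr_fun h (1 : R)
    simpa using this
  · intro h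
    ext y
    simp [h]

lemma ad_pow_pred_prime (p : ℕ) [Fact p.Prime] [CharP R p] (hp : Odd p) (w x : R) :
    (adInt w ^ (p - 1)) x = ∑ j ∈ Finset.range p, w ^ j * x * w ^ (p - 1 - j) := by
  haveI : CharP (Module.End ℤ R) p := charP_end p
  rw [sub_pow_pred_prime p hp (LinearMap.commute_mulLeft_right w w), LinearMap.sum_apply]
  refine Finset.sum_congr rfl fun j _ => ?_
  rw [Module.End.mul_apply, LinearMap.pow_mulLeft, LinearMap.pow_mulRight]
  simp [mul_assoc]

/-- The coefficients of `(ad (t a + b)) ^ n a` as a polynomial in `t`. -/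
def jacCoeff {L : Type*} [LieRing L] (a b : L) : ℕ → ℕ → L
  | 0, 0 => a
  | 0, _ + 1 => 0
  | n + 1, 0 => ⁅b, jacCoeff a b n 0⁆
  | n + 1, j + 1 => ⁅a, jacCoeff a b n j⁆ + ⁅b, jacCoeff a b n (j + 1)⁆

lemma map_jacCoeff {k L L' : Type*} [CommRing k] [LieRing L] [LieRing L'] [LieAlgebra k L]
    [LieAlgebra k L'] (f : L →ₗ⁅k⁆ L') (a b : L) (n j : ℕ) :
    f (jacCoeff a b n j) = jacCoeff (f a) (f b) n j := by
  induction n generalizing j with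
  | zero => cases j <;> simp [jacCoeff]
  | succ n ih => cases j <;> simp [jacCoeff, ih]

lemma jacCoeff_eq (a b : R) (n j : ℕ) :
    ((adInt (C a * X + C b) ^ n) (C a)).coeff j = jacCoeff a b n j := by
  induction n generalizing j with
  | zero => cases j <;> simp [jacCoeff, coeff_C]
  | succ n ih =>
    have h1 : ∀ g : R[X], (C a * X + C b) * g = C a * (X * g) + C b * g := fun g => by
      rw [add_mul, mul_assoc]
    have h2 : ∀ g : R[X], g * (C a * X + C b) = (g * C a) * X + g * C b := fun g => by
      rw [mul_add, mul_assoc]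
    rw [pow_succ', Module.End.mul_apply, LinearMap.sub_apply, LinearMap.mulLeft_apply,
      LinearMap.mulRight_apply, h1, h2]
    cases j with
    | zero =>
      simp [jacCoeff, ih, LieRing.of_associative_ring_bracket]
    | succ j =>
      simp only [coeff_sub, coeff_add, coeff_C_mul, coeff_X_mul, coeff_mul_X, coeff_mul_C, ih,
        jacCoeff, LieRing.of_associative_ring_bracket]
      abel

/-- Jacobson's formula for the `p`-th power of a sum. -/
lemma add_pow_jacobson (k : Type*) [Field k] [Algebra k R] (p : ℕ) [Fact p.Prime] [CharP R p]
    [CharP k p] (hp : Odd p) (a b : R) :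
    (a + b) ^ p = a ^ p + b ^ p +
      ∑ i ∈ Finset.range (p - 1), ((i + 1 : ℕ) : k)⁻¹ • jacCoeff a b (p - 1) i := by
  have hp1 := (Fact.out : p.Prime).one_lt
  set W : R[X] := C a * X + C b with hW
  have hder : ∀ i, (W ^ p).coeff (i + 1) * ((i : R) + 1) = jacCoeff a b (p - 1) i := by
    intro i
    haveI : CharP R[X] p := inferInstance
    rw [← coeff_derivative, ← jacCoeff_eq, ad_pow_pred_prime (R := R[X]) p hp]
    have h := derivative_pow_noncomm W (p - 1)
    rw [Nat.sub_add_cancel hp1.le] at h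
    rw [h]
    have hd : derivative W = C a := by simp [hW]
    rw [hd]
  have hdeg : W.natDegree ≤ 1 := natDegree_linear_le
  have hdegp : (W ^ p).natDegree ≤ p := (natDegree_pow_le_of_le p hdeg).trans (by simp)
  let ev : R[X] →+* R := eval₂RingHom' (RingHom.id R) 1 fun a => Commute.one_right _
  have hev : ev (W ^ p) = (a + b) ^ p := by
    rw [map_pow]; congr 1
    change eval₂ (RingHom.id R) 1 W = _
    simp [hW]
  have hev2 : ev (W ^ p) = ∑ i ∈ Finset.range (p + 1), (W ^ p).coeff i := by
    change eval₂ (RingHom.id R) 1 (W ^ p) = _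
    rw [eval₂_eq_sum_range' _ (Nat.lt_succ_of_le hdegp)]
    simp
  have h0 : (W ^ p).coeff 0 = b ^ p := by
    change constantCoeff (W ^ p) = _
    rw [map_pow]; simp [hW]
  have htop : (W ^ p).coeff p = a ^ p := by
    have := coeff_pow_of_natDegree_le (p := W) (m := p) (n := 1) hdeg
    rw [mul_one] at this
    rw [this]; simp [hW]
  rw [← hev, hev2, Finset.sum_range_succ, htop]
  obtain ⟨q, rfl⟩ : ∃ q, p = q + 1 := ⟨p - 1, by omega⟩
  rw [Finset.sum_range_succ', h0, add_comm, add_comm _ (b ^ _), ← add_assoc]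
  congr 1
  refine Finset.sum_congr rfl fun i hi => ?_
  have hi := Finset.mem_range.1 hi
  have hne : ((i + 1 : ℕ) : k) ≠ 0 := fun h => by
    rw [CharP.cast_eq_zero_iff k (q + 1)] at h
    exact absurd (Nat.le_of_dvd (by omega) h) (by omega)
  rw [eq_inv_smul_iff₀ hne, ← hder i, Algebra.smul_def, map_natCast]
  rw [Nat.cast_comm]; push_cast; rfl

/-- The `p`-power defect of a Lie algebra homomorphism is additive. -/
lemma pow_defect_add {k S : Type*} [Field k] [Ring S] [Algebra k S] [Algebra k R] (p : ℕ)
    [Fact p.Prime] [CharP R p] [CharP S p] [CharP k p] (hp : Odd p) (L : LieSubalgebra k S)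
    (hL : ∀ x ∈ L, x ^ p ∈ L) (ρ : L →ₗ⁅k⁆ R) (x y : L) :
    ρ (x + y) ^ p - ρ ⟨(x + y).1 ^ p, hL _ (x + y).2⟩ =
      (ρ x ^ p - ρ ⟨x.1 ^ p, hL _ x.2⟩) + (ρ y ^ p - ρ ⟨y.1 ^ p, hL _ y.2⟩) := by
  set J : L := ∑ i ∈ Finset.range (p - 1), ((i + 1 : ℕ) : k)⁻¹ • jacCoeff x y (p - 1) i with hJ
  have h1 : (⟨(x + y).1 ^ p, hL _ (x + y).2⟩ : L) =
      ⟨x.1 ^ p, hL _ x.2⟩ + ⟨y.1 ^ p, hL _ y.2⟩ + J := by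
    apply Subtype.ext
    change (x.1 + y.1) ^ p = x.1 ^ p + y.1 ^ p + L.incl J
    rw [add_pow_jacobson k p hp, hJ, map_sum]
    simp only [map_smul, map_jacCoeff]
    rfl
  have h2 : ρ (x + y) ^ p = ρ x ^ p + ρ y ^ p + ρ J := by
    rw [map_add, add_pow_jacobson k p hp, hJ, map_sum]
    simp only [map_smul, map_jacCoeff]
  rw [h1, h2, map_add, map_add]
  abel

end Jacobson

end SoGK

namespace SoGK

section PCentre

attribute [local instance] LieRing.ofAssociativeRing
open MvPolynomial Matrix

variable {k : Type} [Field k] {m : ℕ} [NeZero m] (p : ℕ) [Fact p.Prime] [CharP k p]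
  [NeZero (2 : k)]

omit [NeZero m] in
include k in
variable (k) in
lemma odd_char : Odd p := by
  refine (Fact.out : p.Prime).odd_of_ne_two fun h => ?_
  subst h
  exact NeZero.ne (2 : k) (by exact_mod_cast CharP.cast_eq_zero k 2)

omit [NeZero m] [Fact p.Prime] in
instance charP_env : CharP (Env k m) p :=
  charP_of_injective_algebraMap (algebraMap k _).injective p

omit [NeZero m] in
lemma pow_mem_so {x : Matrix (Fin m) (Fin m) k} (hx : x ∈ So k m) : x ^ p ∈ So k m := by
  rw [LieAlgebra.Orthogonal.mem_so] at hx ⊢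
  rw [transpose_pow, hx, (odd_char k p).neg_pow]

/-- The restricted `p`-power map on the orthogonal Lie algebra. -/
def powSo (x : So k m) : So k m := ⟨x.1 ^ p, pow_mem_so p x.2⟩

/-- The generators of the `p`-centre. -/
def ycen (x : So k m) : Env k m := envι k x ^ p - envι k (powSo p x)

lemma ycen_add (x y : So k m) : ycen p (x + y) = ycen p x + ycen p y :=
  pow_defect_add p (odd_char k p) (So k m) (fun x hx => pow_mem_so p hx)
    (UniversalEnvelopingAlgebra.ι k) x y

omit [NeZero m] in
lemma ycen_smul (c : k) (x : So k m) : ycen p (c • x) = c ^ p • ycen p x := by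
  have h : powSo p (c • x) = c ^ p • powSo p x := Subtype.ext (smul_pow c x.1 p)
  have h2 : ∀ (c : k) (x : So k m), envι k (c • x) = c • envι k x := fun c x => map_smul _ c x
  rw [ycen, ycen, h, h2, h2, smul_pow, smul_sub]

lemma adInt_pow_char {R : Type*} [Ring R] [CharP R p] (a b : R) :
    (adInt a ^ p) b = a ^ p * b - b * a ^ p := by
  haveI : CharP (Module.End ℤ R) p := charP_end p
  rw [sub_pow_char_of_commute p (LinearMap.commute_mulLeft_right a a), LinearMap.sub_apply,
    LinearMap.pow_mulLeft, LinearMap.pow_mulRight]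
  rfl

lemma ycen_commute_ι (x z : So k m) : Commute (ycen p x) (envι k z) := by
  have h1 : ∀ j, (adInt (envι k x) ^ j) (envι k z) = envι k (((LieAlgebra.ad k (So k m) x) ^ j) z) := by
    intro j
    induction j with
    | zero => rfl
    | succ j ih =>
      rw [pow_succ', Module.End.mul_apply, ih, pow_succ', Module.End.mul_apply, LieAlgebra.ad_apply,
        ← ι_lie_eq]
      rfl
  have h2 : ∀ j, (adInt x.1 ^ j) z.1 = (((LieAlgebra.ad k (So k m) x) ^ j) z).1 := by
    intro j
    induction j with
    | zero => rfl
    | succ j ih =>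
      rw [pow_succ', Module.End.mul_apply, ih, pow_succ', Module.End.mul_apply, LieAlgebra.ad_apply]
      rfl
  have h4 : ((LieAlgebra.ad k (So k m) x) ^ p) z = ⁅powSo p x, z⁆ := by
    apply Subtype.ext
    rw [← h2, adInt_pow_char]; rfl
  have h5 := h1 p
  rw [adInt_pow_char, h4, ← ι_lie_eq, sub_eq_sub_iff_sub_eq_sub] at h5
  rw [commute_iff_eq, ycen, sub_mul, mul_sub, h5]

lemma commute_of_ι {a : Env k m} (h : ∀ c : SkewIdx m, Commute a (envι k (gen k c))) (z : Env k m) :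
    Commute a z := by
  have h0 : ∀ L : List (SkewIdx m), Commute a (prodE k L) := by
    intro L
    induction L with
    | nil => exact Commute.one_right a
    | cons c L ih => rw [prodE_cons]; exact (h c).mul_right ih
  obtain ⟨P, rfl⟩ := pbw_surjective z
  induction P using MvPolynomial.induction_on' with
  | monomial u c => rw [pbw_monomial]; exact (h0 _).smul_right c
  | add P Q hP hQ => rw [map_add]; exact hP.add_right hQ

lemma ycen_mem_center (x : So k m) : ycen p x ∈ Subalgebra.center k (Env k m) := by
  rw [Subalgebra.mem_center_iff]
  exact fun z => (commute_of_ι (fun c => ycen_commute_ι p x _) z).symm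

variable (m) in
/-- The indices of the generators of the `p`-centre. -/
structure YVar (_p : ℕ) where
  /-- the underlying index -/
  idx : SkewIdx m

/-- The index types of the generators of the enveloping algebra and its `p`-centre agree. -/
def YVar.equiv : YVar m p ≃ SkewIdx m := ⟨YVar.idx, YVar.mk, fun _ => rfl, fun _ => rfl⟩

instance : Fintype (YVar m p) := Fintype.ofEquiv _ (YVar.equiv p).symm

variable (k m) in
/-- The polynomial ring mapping isomorphically onto the `p`-centre. -/
abbrev YAlg : Type := MvPolynomial (YVar m p) k

variable (k m) in
/-- The map of the polynomial ring to the centre of the enveloping algebra. -/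
def pcenHom : YAlg k m p →ₐ[k] Subalgebra.center k (Env k m) :=
  aeval (R := k) fun c : YVar m p => ⟨ycen p (gen k c.idx), ycen_mem_center p _⟩

variable (k m) in
/-- The map of the polynomial ring to the enveloping algebra. -/
def pcenMap : YAlg k m p →ₐ[k] Env k m := (Subalgebra.center k (Env k m)).val.comp (pcenHom k m p)

lemma pcenMap_commutes (c : YAlg k m p) (x : Env k m) :
    pcenMap k m p c * x = x * pcenMap k m p c :=
  (Subalgebra.mem_center_iff.1 (pcenHom k m p c).2 x).symm

instance : Algebra (YAlg k m p) (Env k m) :=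
  RingHom.toAlgebra' (pcenMap k m p : YAlg k m p →+* Env k m) (pcenMap_commutes p)

lemma yalg_algebraMap (P : YAlg k m p) : algebraMap (YAlg k m p) (Env k m) P = pcenMap k m p P :=
  rfl

lemma pcenMap_X (c : YVar m p) : pcenMap k m p (X c) = ycen p (gen k c.idx) := by
  rw [pcenMap, AlgHom.comp_apply, pcenHom, aeval_X]
  rfl

instance : IsScalarTower k (YAlg k m p) (Env k m) :=
  IsScalarTower.of_algebraMap_eq fun x => by rw [yalg_algebraMap, AlgHom.commutes]

lemma algebraMap_yX (c : YVar m p) :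
    algebraMap (YAlg k m p) (Env k m) (X c) = ycen p (gen k c.idx) := by
  rw [yalg_algebraMap, pcenMap_X]

omit [NeZero m] in
lemma ycen_mem_fil (x : So k m) : ycen p x ∈ fil k m p ∧ symb k m p (ycen p x) = linForm x.1 ^ p := by
  have h1 : ∀ n, envι k x ^ n ∈ fil k m n ∧ symb k m n (envι k x ^ n) = linForm x.1 ^ n := by
    intro n
    induction n with
    | zero => rw [pow_zero, pow_zero]; exact ⟨one_mem_fil 0, symb_one⟩
    | succ n ih =>
      rw [pow_succ]
      exact ⟨mul_mem_fil ih.1 (ι_mem_fil x), by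
        rw [symb_mul ih.1 (ι_mem_fil x), ih.2, symb_ι, pow_succ]⟩
  have hp := (Fact.out : p.Prime).one_lt
  refine ⟨sub_mem (h1 p).1 (fil_mono hp.le (ι_mem_fil _)), ?_⟩
  rw [ycen, map_sub, (h1 p).2, symb_of_lt hp (ι_mem_fil _), sub_zero]

variable (k m) in
/-- The symbol map on the `p`-centre. -/
def ySymb : YAlg k m p →ₐ[k] MvPolynomial (SkewIdx m) k := aeval fun c => X c.idx ^ p

omit [NeZero m] in
lemma ySymb_injective : Function.Injective (ySymb k m p) := by
  have h : ySymb k m p = (expand p).comp (rename (YVar.equiv p)) := by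
    ext c : 1
    simp [ySymb, YVar.equiv]
  rw [h]
  have h1 : Function.Injective (rename (YVar.equiv p) : YAlg k m p →ₐ[k] _) :=
    rename_injective _ (YVar.equiv p).injective
  exact (expand_injective (Fact.out : p.Prime).pos).comp h1

lemma algebraMap_yMon (b : YVar m p →₀ ℕ) :
    algebraMap (YAlg k m p) (Env k m) (monomial b 1) ∈ fil k m (p * b.degree) ∧
      symb k m (p * b.degree) (algebraMap (YAlg k m p) (Env k m) (monomial b 1)) =
        ySymb k m p (monomial b 1) := by
  induction b using Finsupp.induction_linear with
  | zero =>
    rw [show monomial (0 : YVar m p →₀ ℕ) (1 : k) = 1 from rfl, map_one, map_one (ySymb k m p)]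
    simpa using And.intro (one_mem_fil (k := k) (m := m) 0) symb_one
  | add f g hf hg =>
    rw [← one_mul (1 : k), ← monomial_mul, map_mul, map_add, mul_add, map_mul (ySymb k m p)]
    exact ⟨mul_mem_fil hf.1 hg.1, by rw [symb_mul hf.1 hg.1, hf.2, hg.2]⟩
  | single c n =>
    induction n with
    | zero =>
      rw [Finsupp.single_zero, show monomial (0 : YVar m p →₀ ℕ) (1 : k) = 1 from rfl, map_one, map_one (ySymb k m p)]
      simpa using And.intro (one_mem_fil (k := k) (m := m) 0) symb_one
    | succ n ih =>
      have h := ycen_mem_fil p (gen k c.idx)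
      have h2 : p * (Finsupp.single c (n + 1)).degree = p * (Finsupp.single c n).degree + p := by
        simp [mul_add]
      rw [h2, Finsupp.single_add, ← one_mul (1 : k), ← monomial_mul, map_mul, map_mul (ySymb k m p),
        show monomial (Finsupp.single c 1) (1 : k) = X c from rfl, algebraMap_yX]
      refine ⟨mul_mem_fil ih.1 h.1, ?_⟩
      rw [symb_mul ih.1 h.1, ih.2, h.2, linForm_gen, ySymb, aeval_X]

lemma symb_pcen {P : YAlg k m p} {d : ℕ} (h : P.IsHomogeneous d) :
    algebraMap (YAlg k m p) (Env k m) P ∈ fil k m (p * d) ∧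
      symb k m (p * d) (algebraMap (YAlg k m p) (Env k m) P) = ySymb k m p P := by
  have h1 : ∀ a ∈ P.support, a.degree = d := fun a ha => by
    rw [Finsupp.degree_eq_weight_one]; exact h (mem_support_iff.1 ha)
  have h3 : P = ∑ a ∈ P.support, P.coeff a • (monomial a (1 : k)) := by
    conv_lhs => rw [P.as_sum]
    refine Finset.sum_congr rfl fun a _ => ?_
    rw [smul_monomial, smul_eq_mul, mul_one]
  have h2 : algebraMap (YAlg k m p) (Env k m) P =
      ∑ a ∈ P.support, P.coeff a • algebraMap (YAlg k m p) (Env k m) (monomial a 1) := by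
    conv_lhs => rw [h3]
    rw [map_sum]
    exact Finset.sum_congr rfl fun a _ => map_smul (pcenMap k m p) _ _
  rw [h2]
  constructor
  · refine sum_mem fun a ha => Submodule.smul_mem _ _ ?_
    rw [← h1 a ha]; exact (algebraMap_yMon p a).1
  · rw [map_sum]
    conv_rhs => rw [h3]
    rw [map_sum]
    refine Finset.sum_congr rfl fun a ha => ?_
    rw [map_smul, ← h1 a ha, (algebraMap_yMon p a).2, map_smul]

lemma pcenMap_injective : Function.Injective (pcenMap k m p) := by
  rw [injective_iff_map_eq_zero]
  intro P hP
  by_contra hne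
  have hp := (Fact.out : p.Prime).pos
  have h1 : symb k m (p * P.totalDegree) (pcenMap k m p P) =
      ySymb k m p (homogeneousComponent P.totalDegree P) := by
    have h0 := congrArg (pcenMap k m p) (sum_homogeneousComponent P)
    rw [← h0, map_sum, map_sum, Finset.sum_range_succ, Finset.sum_eq_zero, zero_add]
    · exact (symb_pcen p (homogeneousComponent_isHomogeneous _ P)).2
    intro i hi
    exact symb_of_lt (Nat.mul_lt_mul_of_pos_left (Finset.mem_range.1 hi) hp)
      (symb_pcen p (homogeneousComponent_isHomogeneous i P)).1
  rw [hP, map_zero, ← map_zero (ySymb k m p)] at h1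
  have h1 := ySymb_injective p h1
  obtain ⟨a, ha, h2⟩ := Finset.exists_mem_eq_sup P.support (support_nonempty.2 hne)
    fun s => s.sum fun _ e => e
  have h3 := congrArg (coeff a) h1
  rw [coeff_homogeneousComponent, if_pos (show a.degree = P.totalDegree from h2.symm),
    coeff_zero] at h3
  exact mem_support_iff.1 ha h3.symm

instance : FaithfulSMul (YAlg k m p) (Env k m) :=
  (faithfulSMul_iff_algebraMap_injective _ _).2 (pcenMap_injective p)

/-- The exponents of the monomials spanning the enveloping algebra over its `p`-centre. -/
def restrictedMon (a : SkewIdx m → Fin p) : Env k m :=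
  envMon k (Finsupp.equivFunOnFinite.symm fun c => (a c : ℕ))

lemma fil_le_span (d : ℕ) (z : Env k m) (hz : z ∈ fil k m d) :
    z ∈ Submodule.span (YAlg k m p) (Set.range (restrictedMon (k := k) (m := m) p)) := by
  have hp := (Fact.out : p.Prime).pos
  set S := Submodule.span (YAlg k m p) (Set.range (restrictedMon (k := k) (m := m) p)) with hS
  induction d using Nat.strong_induction_on generalizing z with
  | _ d ih =>
    have hlt : ∀ z, z ∈ filLT k m d → z ∈ S := by
      intro z hz
      cases d with
      | zero => rw [show z = 0 from hz]; exact zero_mem _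
      | succ d => exact ih d (Nat.lt_succ_self d) z hz
    obtain ⟨P, hP, h⟩ := exists_pbw hz
    have h1 : ∀ a ∈ P.support, a.degree = d := fun a ha => by
      rw [Finsupp.degree_eq_weight_one]; exact hP (mem_support_iff.1 ha)
    rw [← sub_add_cancel z (pbw k m P)]
    refine add_mem (hlt _ h) ?_
    rw [P.as_sum, map_sum]
    refine sum_mem fun a ha => ?_
    rw [pbw_monomial, ← algebraMap_smul (YAlg k m p)]
    refine Submodule.smul_mem _ _ ?_
    let b : YVar m p →₀ ℕ := Finsupp.equivFunOnFinite.symm fun c => a c.idx / p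
    let r : SkewIdx m → Fin p := fun c => ⟨a c % p, Nat.mod_lt _ hp⟩
    let r' : SkewIdx m →₀ ℕ := Finsupp.equivFunOnFinite.symm fun c => (r c : ℕ)
    have hdeg : p * b.degree + r'.degree = d := by
      rw [← h1 a ha]
      simp only [Finsupp.degree_eq_sum]
      rw [← (YVar.equiv p).symm.sum_comp, Finset.mul_sum, ← Finset.sum_add_distrib]
      exact Finset.sum_congr rfl fun c _ => Nat.div_add_mod _ _
    have hb := algebraMap_yMon (k := k) p b
    have hr : restrictedMon p r ∈ fil k m r'.degree := envMon_mem r'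
    have hmul := mul_mem_fil hb.1 hr
    have hsymb : symb k m d (envMon k a) = symb k m d
        (algebraMap (YAlg k m p) (Env k m) (monomial b 1) * restrictedMon p r) := by
      rw [← hdeg, symb_mul hb.1 hr, hb.2, hdeg, ← h1 a ha, symb_envMon]
      have : symb k m r'.degree (restrictedMon p r) = monomial r' 1 := symb_envMon r'
      rw [this, ySymb, aeval_monomial, map_one (algebraMap k _), one_mul, Finsupp.prod_fintype _ _ (by simp),
        ← (YVar.equiv p).symm.prod_comp, monomial_eq, monomial_eq,
        Finsupp.prod_fintype _ _ (by simp), Finsupp.prod_fintype _ _ (by simp), C_1, one_mul,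
        one_mul, ← Finset.prod_mul_distrib]
      refine Finset.prod_congr rfl fun c _ => ?_
      rw [show ((YVar.equiv p).symm c).idx = c from rfl, ← pow_mul, ← pow_add]
      congr 1
      exact (Nat.div_add_mod _ _).symm
    rw [hdeg] at hmul
    have ha' : envMon k a ∈ fil k m d := by rw [← h1 a ha]; exact envMon_mem a
    have h2 := mem_filLT_of_symb (sub_mem ha' hmul) (by rw [map_sub, hsymb, sub_self])
    rw [← sub_add_cancel (envMon k a)
      (algebraMap (YAlg k m p) (Env k m) (monomial b 1) * restrictedMon p r)]
    refine add_mem (hlt _ h2) ?_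
    rw [← Algebra.smul_def]
    exact Submodule.smul_mem _ _ (Submodule.subset_span ⟨r, rfl⟩)

lemma span_restrictedMon :
    Submodule.span (YAlg k m p) (Set.range (restrictedMon (k := k) (m := m) p)) = ⊤ := by
  refine eq_top_iff.2 fun z _ => ?_
  obtain ⟨d, hd⟩ := exists_mem_fil z
  exact fil_le_span p d z hd

instance : Module.Finite (YAlg k m p) (Env k m) :=
  ⟨⟨(Set.finite_range (restrictedMon (k := k) (m := m) p)).toFinset, by
    rw [Set.Finite.coe_toFinset, span_restrictedMon]⟩⟩

end PCentre

end SoGK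

namespace SoGK

section CFrac

open TensorProduct nonZeroDivisors

variable (A U : Type) [CommRing A] [IsDomain A] [Ring U] [IsDomain U] [Algebra A U]

/-- The localization of an algebra at the nonzero elements of a central domain. -/
def CFrac : Type := FractionRing A ⊗[A] U

instance : Ring (CFrac A U) := inferInstanceAs (Ring (FractionRing A ⊗[A] U))
instance : Algebra (FractionRing A) (CFrac A U) :=
  inferInstanceAs (Algebra (FractionRing A) (FractionRing A ⊗[A] U))
instance (k : Type) [Field k] [Algebra k A] : Algebra k (CFrac A U) :=
  inferInstanceAs (Algebra k (FractionRing A ⊗[A] U))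
instance (k : Type) [Field k] [Algebra k A] : IsScalarTower k (FractionRing A) (CFrac A U) :=
  inferInstanceAs (IsScalarTower k (FractionRing A) (FractionRing A ⊗[A] U))

/-- The canonical map to the central localization. -/
def toCFrac : U →+* CFrac A U :=
  (Algebra.TensorProduct.includeRight : U →ₐ[A] FractionRing A ⊗[A] U).toRingHom

variable {A U}

lemma toCFrac_algebraMap (a : A) :
    toCFrac A U (algebraMap A U a) = algebraMap (FractionRing A) (CFrac A U) (algebraMap A _ a) := by
  change (1 : FractionRing A) ⊗ₜ[A] (algebraMap A U a) = (algebraMap A (FractionRing A) a) ⊗ₜ[A] (1 : U)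
  rw [Algebra.algebraMap_eq_smul_one, TensorProduct.tmul_smul, TensorProduct.smul_tmul',
    Algebra.algebraMap_eq_smul_one]

lemma toCFrac_smul (k : Type) [Field k] [Algebra k A] [Algebra k U] [IsScalarTower k A U] (c : k)
    (u : U) : toCFrac A U (c • u) = c • toCFrac A U u := by
  rw [← algebraMap_smul A c u, Algebra.smul_def, map_mul, toCFrac_algebraMap,
    ← IsScalarTower.algebraMap_apply k A, Algebra.smul_def,
    IsScalarTower.algebraMap_apply k (FractionRing A) (CFrac A U)]

instance : IsLocalizedModule A⁰ (TensorProduct.mk A (FractionRing A) U 1) := inferInstance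

lemma toCFrac_injective [FaithfulSMul A U] : Function.Injective (toCFrac A U) := by
  intro x y hxy
  have h : (TensorProduct.mk A (FractionRing A) U 1) x = (TensorProduct.mk A (FractionRing A) U 1) y := hxy
  obtain ⟨c, hc⟩ := (IsLocalizedModule.eq_iff_exists A⁰ _).1 h
  have hc0 : algebraMap A U c ≠ 0 := fun h0 => nonZeroDivisors.coe_ne_zero c
    ((FaithfulSMul.algebraMap_injective A U) (by rw [h0, map_zero]))
  rw [Submonoid.smul_def, Submonoid.smul_def, Algebra.smul_def, Algebra.smul_def] at hc
  exact mul_left_cancel₀ hc0 hc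

lemma CFrac.exists_smul_eq (x : CFrac A U) :
    ∃ a : A, a ≠ 0 ∧ ∃ u : U, toCFrac A U (algebraMap A U a) * x = toCFrac A U u := by
  obtain ⟨⟨u, a⟩, h⟩ := IsLocalizedModule.surj A⁰ (TensorProduct.mk A (FractionRing A) U 1) x
  refine ⟨a, nonZeroDivisors.coe_ne_zero a, u, ?_⟩
  rw [toCFrac_algebraMap, ← Algebra.smul_def]
  have : algebraMap A (FractionRing A) a • x = (a : A) • (show FractionRing A ⊗[A] U from x) :=
    algebraMap_smul (M := FractionRing A ⊗[A] U) (FractionRing A) (a : A) x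
  rw [this]; exact h

instance [FaithfulSMul A U] : IsDomain (CFrac A U) := by
  haveI : Nontrivial (CFrac A U) := (toCFrac_injective (A := A) (U := U)).nontrivial
  have hcom : ∀ (a : A) (x : CFrac A U), toCFrac A U (algebraMap A U a) * x =
      x * toCFrac A U (algebraMap A U a) := fun a x => by
    rw [toCFrac_algebraMap, Algebra.commutes]
  haveI : NoZeroDivisors (CFrac A U) := ⟨fun {x y} hxy => by
    obtain ⟨a, ha, u, hu⟩ := CFrac.exists_smul_eq x
    obtain ⟨b, hb, v, hv⟩ := CFrac.exists_smul_eq y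
    have h1 : toCFrac A U (u * v) = 0 := by
      rw [map_mul, ← hu, ← hv, mul_assoc, ← mul_assoc x, ← hcom b x, mul_assoc, hxy, mul_zero,
        mul_zero]
    have h2 : ∀ (a : A) (x : CFrac A U), a ≠ 0 → toCFrac A U (algebraMap A U a) * x = 0 → x = 0 := by
      intro a x ha h
      rw [toCFrac_algebraMap, ← Algebra.smul_def] at h
      refine (smul_eq_zero.1 h).resolve_left ?_
      simpa using ha
    rw [map_eq_zero_iff _ toCFrac_injective, mul_eq_zero] at h1
    rcases h1 with h1 | h1
    · exact Or.inl (h2 a x ha (by rw [hu, h1, map_zero]))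
    · exact Or.inr (h2 b y hb (by rw [hv, h1, map_zero]))⟩
  exact NoZeroDivisors.to_isDomain _

instance [Module.Finite A U] : Module.Finite (FractionRing A) (CFrac A U) :=
  inferInstanceAs (Module.Finite (FractionRing A) (FractionRing A ⊗[A] U))

variable (A U) in
lemma CFrac.exists_inv [FaithfulSMul A U] [Module.Finite A U] (x : CFrac A U) (hx : x ≠ 0) :
    ∃ y, x * y = 1 :=
  FiniteDimensional.exists_mul_eq_one (FractionRing A) hx

instance [FaithfulSMul A U] [Module.Finite A U] : DivisionRing (CFrac A U) where
  inv x := open Classical in if h : x = 0 then 0 else (CFrac.exists_inv A U x h).choose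
  mul_inv_cancel x hx := by
    simp only [dif_neg hx]; exact (CFrac.exists_inv A U x hx).choose_spec
  inv_zero := by simp
  nnqsmul := _
  qsmul := _

lemma CFrac.finrank_le {ι : Type} [Fintype ι] (b : ι → U)
    (hb : Submodule.span A (Set.range b) = ⊤) :
    Module.finrank (FractionRing A) (CFrac A U) ≤ Fintype.card ι := by
  have h : Submodule.span (FractionRing A) (Set.range fun i => toCFrac A U (b i)) = ⊤ := by
    have hmem : ∀ u, toCFrac A U u ∈
        Submodule.span (FractionRing A) (Set.range fun i => toCFrac A U (b i)) := by
      intro u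
      have : u ∈ Submodule.span A (Set.range b) := hb ▸ Submodule.mem_top
      induction this using Submodule.span_induction with
      | mem x hx => obtain ⟨i, rfl⟩ := hx; exact Submodule.subset_span ⟨i, rfl⟩
      | zero => rw [map_zero]; exact zero_mem _
      | add x y _ _ hx hy => rw [map_add]; exact add_mem hx hy
      | smul c x _ hx =>
        rw [Algebra.smul_def, map_mul, toCFrac_algebraMap, ← Algebra.smul_def]
        exact Submodule.smul_mem _ _ hx
    refine eq_top_iff.2 fun x _ => ?_
    obtain ⟨a, ha, u, hu⟩ := CFrac.exists_smul_eq x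
    rw [toCFrac_algebraMap, ← Algebra.smul_def] at hu
    rw [← inv_smul_smul₀ (show algebraMap A (FractionRing A) a ≠ 0 by simpa using ha) x, hu]
    exact Submodule.smul_mem _ _ (hmem u)
  exact finrank_le_of_span_eq_top h

end CFrac

section DEnv

variable (k : Type) [Field k] (m : ℕ) [NeZero m] (p : ℕ) [Fact p.Prime] [CharP k p]
  [NeZero (2 : k)]

/-- The division ring of fractions of the enveloping algebra of the orthogonal Lie algebra. -/
abbrev DEnv : Type := CFrac (YAlg k m p) (Env k m)

/-- The inclusion of the enveloping algebra in its division ring of fractions. -/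
abbrev envD : Env k m →+* DEnv k m p := toCFrac (YAlg k m p) (Env k m)

lemma finrank_DEnv_le :
    Module.finrank (FractionRing (YAlg k m p)) (DEnv k m p) ≤ p ^ Fintype.card (SkewIdx m) := by
  refine (CFrac.finrank_le _ (span_restrictedMon p)).trans ?_
  simp

end DEnv

end SoGK

namespace SoGK

section Indep

variable {ι : Type} [Fintype ι] [DecidableEq ι]

/-- Linear independence of restricted monomials from lowering operators. -/
lemma linearIndependent_of_lowering {C V : Type*} [Field C] [AddCommGroup V] [Module C V] (p : ℕ)
    [Fact p.Prime] [CharP C p] (d : ι → V →ₗ[C] V) (M : (ι → ℕ) → V) (h0 : M 0 ≠ 0)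
    (hd : ∀ i b, d i (M b) = (b i) • M (Function.update b i (b i - 1))) :
    LinearIndependent C fun a : ι → Fin p => M fun i => a i := by
  have key : ∀ (N : ℕ) (a : ι → ℕ), ∑ i, a i = N → (∀ i, a i < p) →
      ∃ T : V →ₗ[C] V, (∃ c : C, c ≠ 0 ∧ T (M a) = c • M 0) ∧
        ∀ b, b ≠ a → ∑ i, b i ≤ N → T (M b) = 0 := by
    intro N
    induction N with
    | zero =>
      intro a ha _
      have ha0 : a = 0 := funext fun i => by simpa using (Finset.sum_eq_zero_iff.1 ha i (by simp))
      refine ⟨LinearMap.id, ⟨1, one_ne_zero, by simp [ha0]⟩, fun b hb hb0 => absurd ?_ hb⟩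
      rw [ha0]
      exact funext fun i => by simpa using (Finset.sum_eq_zero_iff.1 (Nat.le_zero.1 hb0) i (by simp))
    | succ N ih =>
      intro a ha hp
      obtain ⟨i, hi⟩ : ∃ i, a i ≠ 0 := by
        by_contra! h
        simp [h] at ha
      have hsum : ∀ b : ι → ℕ, b i ≠ 0 →
          ∑ j, Function.update b i (b i - 1) j + 1 = ∑ j, b j := by
        intro b hb
        have h1 : ∑ j ∈ Finset.univ.erase i, Function.update b i (b i - 1) j =
            ∑ j ∈ Finset.univ.erase i, b j := Finset.sum_congr rfl fun j hj =>
              Function.update_of_ne (Finset.ne_of_mem_erase hj) _ _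
        have h2 := Finset.add_sum_erase _ (Function.update b i (b i - 1)) (Finset.mem_univ i)
        have h3 := Finset.add_sum_erase _ b (Finset.mem_univ i)
        rw [Function.update_self] at h2
        omega
      obtain ⟨T, ⟨c, hc, hT⟩, hT'⟩ := ih (Function.update a i (a i - 1))
        (by have := hsum a hi; omega) (fun j => by
          rcases eq_or_ne j i with rfl | hj
          · rw [Function.update_self]; have := hp j; omega
          · rw [Function.update_of_ne hj]; exact hp j)
      refine ⟨T ∘ₗ d i, ⟨(a i : C) * c, mul_ne_zero (fun h => ?_) hc, ?_⟩, fun b hb hbN => ?_⟩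
      · rw [CharP.cast_eq_zero_iff C p] at h
        exact absurd (Nat.le_of_dvd (Nat.pos_of_ne_zero hi) h) (by have := hp i; omega)
      · rw [LinearMap.comp_apply, hd, map_nsmul, hT, mul_smul, Nat.cast_smul_eq_nsmul]
      · rw [LinearMap.comp_apply, hd, map_nsmul]
        rcases eq_or_ne (b i) 0 with hbi | hbi
        · rw [hbi, zero_smul]
        · rw [hT', smul_zero]
          · intro h
            apply hb
            funext j
            have := congrFun h j
            rcases eq_or_ne j i with rfl | hj
            · simp only [Function.update_self] at this; omega
            · simpa only [Function.update_of_ne hj] using this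
          · have := hsum b hbi; omega
  rw [Fintype.linearIndependent_iff]
  intro c hc
  by_contra! hne
  classical
  obtain ⟨a0, ha0⟩ := hne
  obtain ⟨a, ha, hmax⟩ := Finset.exists_max_image (Finset.univ.filter fun a => c a ≠ 0)
    (fun a => ∑ i, (a i : ℕ)) ⟨a0, by simpa using ha0⟩
  obtain ⟨T, ⟨e, he, hT⟩, hT'⟩ := key _ (fun i => (a i : ℕ)) rfl fun i => (a i).2
  have h1 := congrArg T hc
  rw [map_sum, map_zero, Finset.sum_eq_single a] at h1
  · rw [map_smul, hT, smul_smul] at h1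
    have ha' : c a ≠ 0 := by simpa using ha
    exact (smul_ne_zero (mul_ne_zero ha' he) h0) h1
  · intro b _ hb
    rw [map_smul]
    rcases eq_or_ne (c b) 0 with h | h
    · rw [h, zero_smul]
    · rw [hT', smul_zero]
      · exact fun h' => hb (funext fun i => Fin.ext (congrFun h' i))
      · exact hmax b (by simpa using h)
  · simp

/-- Ordered monomials in a family. -/
def ordMon {R : Type*} [Monoid R] (w : ι → R) (b : ι → ℕ) : R :=
  ((Finset.univ.toList : List ι).map fun i => w i ^ b i).prod

omit [DecidableEq ι] in
lemma ordMon_comm {R : Type*} [CommMonoid R] (w : ι → R) (b : ι → ℕ) :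
    ordMon w b = ∏ i, w i ^ b i := by
  rw [ordMon, Finset.prod_map_toList]

lemma derivation_ordMon {R : Type*} [Ring R] (d : R →+ R)
    (hd : ∀ x y, d (x * y) = d x * y + x * d y) (w : ι → R) (i : ι) (h1 : d (w i) = 1)
    (h2 : ∀ j, j ≠ i → d (w j) = 0) (b : ι → ℕ) :
    d (ordMon w b) = b i • ordMon w (Function.update b i (b i - 1)) := by
  have hone : d 1 = 0 := by simpa using hd 1 1
  have hp1 : ∀ n, d (w i ^ n) = n • w i ^ (n - 1) := by
    intro n
    induction n with
    | zero => simp [hone]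
    | succ n ih =>
      rw [pow_succ, hd, ih, h1, mul_one, Nat.add_sub_cancel, add_smul, one_smul, smul_mul_assoc]
      cases n with
      | zero => simp
      | succ n => rw [Nat.add_sub_cancel, ← pow_succ]
  have hp2 : ∀ j, j ≠ i → ∀ n, d (w j ^ n) = 0 := by
    intro j hj n
    induction n with
    | zero => simp [hone]
    | succ n ih => rw [pow_succ, hd, ih, h2 j hj]; simp
  have hl : ∀ l : List ι, l.Nodup → d (l.map fun j => w j ^ b j).prod =
      if i ∈ l then b i • (l.map fun j => w j ^ Function.update b i (b i - 1) j).prod else 0 := by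
    intro l hl
    induction l with
    | nil => simp [hone]
    | cons j l ih =>
      rw [List.nodup_cons] at hl
      rw [List.map_cons, List.prod_cons, hd, ih hl.2]
      rcases eq_or_ne j i with rfl | hj
      · rw [if_neg hl.1, if_pos (List.mem_cons_self), hp1, mul_zero, add_zero, List.map_cons,
          List.prod_cons, Function.update_self, smul_mul_assoc]
        congr 3
        refine List.map_congr_left fun a ha => ?_
        rw [Function.update_of_ne]
        rintro rfl; exact hl.1 ha
      · rw [hp2 j hj, zero_mul, zero_add, List.map_cons, List.prod_cons, Function.update_of_ne hj]
        simp only [List.mem_cons, hj.symm, false_or]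
        split_ifs
        · rw [mul_smul_comm]
        · simp
  rw [ordMon, hl _ (Finset.nodup_toList _), if_pos (by simp), ordMon]

/-- Restricted ordered monomials are linearly independent if there are partial derivatives. -/
lemma linearIndependent_ordMon {C R : Type*} [Field C] [Ring R] [Nontrivial R] [Algebra C R] (p : ℕ)
    [Fact p.Prime] [CharP C p] (w : ι → R) (d : ι → R →ₗ[C] R)
    (hd : ∀ i x y, d i (x * y) = d i x * y + x * d i y)
    (hdw : ∀ i j, d i (w j) = if i = j then 1 else 0) :
    LinearIndependent C fun a : ι → Fin p => ordMon w fun i => a i := by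
  refine linearIndependent_of_lowering p d (ordMon w) ?_ fun i b => ?_
  · have : ordMon w 0 = 1 := by
      rw [ordMon]; simp
    rw [this]; exact one_ne_zero
  · exact derivation_ordMon (d i).toAddMonoidHom (hd i) w i (by simp [hdw])
      (fun j hj => by simp [hdw, hj.symm]) b

end Indep

end SoGK

namespace SoGK

open MvPolynomial Matrix

section Weights

variable {m : ℕ}

/-- Weights for the reversal involution without integral relations modulo constants. -/
structure GenericWeights {R : Type*} [CommRing R] (x : Fin m → R) : Prop where
  odd : ∀ i, x i.rev = - x i
  indep : ∀ (b : Fin m → ℤ) (t : ℤ), ∑ i, (b i : R) * x i = t → ∀ i, (b i : R) = b i.rev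

lemma exists_genericWeights (m : ℕ) (k : Type) [Field k] [Infinite k] (p : ℕ) [Fact p.Prime]
    [CharP k p] : ∃ τ : Fin m → k, GenericWeights τ := by
  let _ : Algebra (ZMod p) k := ZMod.algebra k p
  have hnf : ¬ Module.Finite (ZMod p) k := fun h =>
    not_finite_iff_infinite.2 ‹Infinite k› (Module.finite_of_finite (ZMod p))
  have hrk : ((m + 1 : ℕ) : Cardinal) ≤ Module.rank (ZMod p) k := by
    refine le_trans (Cardinal.natCast_le_aleph0) ?_
    by_contra! h
    exact hnf (Module.rank_lt_aleph0_iff.1 h)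
  obtain ⟨g, hg⟩ := exists_linearIndependent_of_le_rank hrk
  have hg0 : g (Fin.last m) ≠ 0 := hg.ne_zero _
  refine ⟨fun i => (g i.castSucc - g i.rev.castSucc) / g (Fin.last m),
    fun i => by rw [Fin.rev_rev, ← neg_div, neg_sub], fun b t h i => ?_⟩
  have h1 : ∑ i : Fin m, ((b i : k) - b i.rev) * g i.castSucc + (-(t : k)) * g (Fin.last m) = 0 := by
    have h2 : ∑ i : Fin m, (b i : k) * (g i.castSucc - g i.rev.castSucc) = t * g (Fin.last m) := by
      rw [← h, Finset.sum_mul]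
      exact Finset.sum_congr rfl fun i _ => by field_simp
    have h3 : ∑ i : Fin m, (b i : k) * g i.rev.castSucc =
        ∑ i : Fin m, (b i.rev : k) * g i.castSucc := by
      refine (Equiv.sum_comp (Fin.revPerm (n := m)) _).symm.trans ?_
      simp [Fin.revPerm]
    simp only [mul_sub, Finset.sum_sub_distrib, sub_mul] at h2 ⊢
    rw [← h3]; linear_combination h2
  have h4 := Fintype.linearIndependent_iff.1 hg
    (Fin.lastCases (-(t : ZMod p)) fun i : Fin m => ((b i : ZMod p) - b i.rev)) (by
      rw [Fin.sum_univ_castSucc]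
      simp only [Fin.lastCases_castSucc, Fin.lastCases_last, Algebra.smul_def, map_sub, map_neg,
        map_intCast]
      exact h1) i.castSucc
  rw [Fin.lastCases_castSucc] at h4
  have := congrArg (algebraMap (ZMod p) k) h4
  simpa [sub_eq_zero] using this

variable {R : Type*} [Field R] {x : Fin m → R} (hx : GenericWeights x)

include hx in
lemma GenericWeights.sub_ne_int (h2 : (2 : R) ≠ 0) {i j : Fin m} (hij : i ≠ j) (t : ℤ) :
    x i - x j ≠ t := by
  intro h
  have h1 := hx.indep (Pi.single i 1 - Pi.single j 1) t (by
    rw [← h, ← Finset.add_sum_erase _ _ (Finset.mem_univ i), ← Finset.add_sum_erase _ _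
      (Finset.mem_erase.2 ⟨hij.symm, Finset.mem_univ j⟩), Finset.sum_eq_zero]
    · simp [hij, hij.symm]; ring
    · intro l hl
      simp only [Finset.mem_erase] at hl
      simp [hl.1, hl.2.1])
  have hi := h1 i
  have hj := h1 j
  simp only [Pi.sub_apply, Pi.single_eq_same, Pi.single_eq_of_ne hij, Pi.single_eq_of_ne hij.symm,
    Pi.single_apply] at hi hj
  have hr : ∀ a b : Fin m, a.rev = b ↔ a = b.rev := fun a b => Fin.rev_eq_iff
  have h1' : (1 : R) ≠ -1 := fun h => h2 (by linear_combination h)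
  rcases eq_or_ne i.rev i with hii | hii
  · rcases eq_or_ne j.rev j with hjj | hjj
    · apply hij
      have h3 := congrArg Fin.val hii
      have h4 := congrArg Fin.val hjj
      rw [Fin.val_rev] at h3 h4
      ext; omega
    · have : j.rev ≠ i := fun h => hij (by rw [← Fin.rev_rev j, h, hii])
      simp [hjj, this] at hj
  · rcases eq_or_ne i.rev j with hjj | hjj
    · simp [hii, hjj] at hi
      exact h1' (by simpa [hij.symm] using hi)
    · simp [hii, hjj] at hi

include hx in
lemma GenericWeights.injective (h2 : (2 : R) ≠ 0) : Function.Injective x := by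
  intro i j h
  by_contra hij
  exact hx.sub_ne_int h2 hij 0 (by simp [h])

lemma exists_int_of_pow_eq (p : ℕ) [Fact p.Prime] [CharP R p] {a : R} (h : a ^ p = a) :
    ∃ t : ℤ, a = t := by
  let _ : Algebra (ZMod p) R := ZMod.algebra R p
  have h1 : ∃ z : ZMod p, algebraMap (ZMod p) R z = a := by
    by_contra! hne
    have hp := (Fact.out : p.Prime)
    have hdeg : (Polynomial.X ^ p - Polynomial.X : Polynomial R).natDegree = p :=
      FiniteField.X_pow_card_sub_X_natDegree_eq _ hp.one_lt
    have hne0 : (Polynomial.X ^ p - Polynomial.X : Polynomial R) ≠ 0 :=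
      FiniteField.X_pow_card_sub_X_ne_zero _ hp.one_lt
    classical
    have hc : (insert a (Finset.univ.image (algebraMap (ZMod p) R))).card ≤ p := by
      refine le_trans ?_ hdeg.le
      refine (Finset.card_le_card fun b hb => ?_).trans (Multiset.toFinset_card_le _ |>.trans
        (Polynomial.card_roots' _))
      rw [Multiset.mem_toFinset, Polynomial.mem_roots hne0, Polynomial.IsRoot]
      rcases Finset.mem_insert.1 hb with rfl | hb
      · simp [h]
      · obtain ⟨z, -, rfl⟩ := Finset.mem_image.1 hb
        simp [← map_pow, ZMod.pow_card]
    rw [Finset.card_insert_of_notMem, Finset.card_image_of_injective _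
      (algebraMap (ZMod p) R).injective, Finset.card_univ, ZMod.card] at hc
    · omega
    · intro hmem
      obtain ⟨z, -, hz⟩ := Finset.mem_image.1 hmem
      exact hne z hz
  obtain ⟨z, rfl⟩ := h1
  refine ⟨(z.val : ℤ), ?_⟩
  have := map_natCast (algebraMap (ZMod p) R) z.val
  rw [ZMod.natCast_zmod_val] at this
  simpa using this

include hx in
lemma GenericWeights.artinSchreier_injective (p : ℕ) [Fact p.Prime] [CharP R p]
    (h2 : (2 : R) ≠ 0) : Function.Injective fun i => x i ^ p - x i := by
  intro i j h
  by_contra hij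
  obtain ⟨t, ht⟩ := exists_int_of_pow_eq p (a := x i - x j) (by
    rw [sub_pow_char]; linear_combination h)
  exact hx.sub_ne_int h2 hij t ht

include hx in
lemma GenericWeights.sum_sq_injective (h2 : (2 : R) ≠ 0) (a a' : Fin m → ℤ)
    (ha : ∀ i, a i.rev = - a i) (ha' : ∀ i, a' i.rev = - a' i)
    (h : ∑ i, (x i + a i) ^ 2 = ∑ i, (x i + a' i) ^ 2) (i : Fin m) : (a i : R) = a' i := by
  have h1 := hx.indep (fun i => 2 * (a i - a' i)) (∑ i, (a' i ^ 2 - a i ^ 2)) (by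
    rw [← sub_eq_zero] at h ⊢
    rw [← h]
    push_cast
    simp only [← Finset.sum_sub_distrib]
    refine Finset.sum_congr rfl fun i _ => by ring) i
  rw [ha, ha'] at h1
  push_cast at h1
  have h4 : (2 * 2 : R) ≠ 0 := mul_ne_zero h2 h2
  have : (2 * 2 : R) * (a i - a' i) = 0 := by linear_combination h1
  exact sub_eq_zero.1 ((mul_eq_zero.1 this).resolve_left h4)

end Weights

end SoGK

namespace SoGK

open MvPolynomial Matrix

section Eigen

variable {m : ℕ} {Ω : Type*} [Field Ω]

/-- A basis of eigenvectors which is dual to itself up to reversal. -/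
structure EigenBasis (X : Matrix (Fin m) (Fin m) Ω) (x : Fin m → Ω) (W : Fin m → Fin m → Ω) :
    Prop where
  eig : ∀ i, X *ᵥ W i = x i • W i
  dot : ∀ i j, W i ⬝ᵥ W j = if j = i.rev then 1 else 0

lemma dotProduct_mulVec_skew {R : Type*} [CommRing R] {X : Matrix (Fin m) (Fin m) R}
    (hX : Xᵀ = -X) (a b : Fin m → R) : a ⬝ᵥ X *ᵥ b = - ((X *ᵥ a) ⬝ᵥ b) := by
  rw [dotProduct_mulVec, ← mulVec_transpose, hX, neg_mulVec, neg_dotProduct]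

lemma exists_eigenBasis [IsAlgClosed Ω] {X : Matrix (Fin m) (Fin m) Ω} (hX : Xᵀ = -X)
    {x : Fin m → Ω} (hinj : Function.Injective x) (hodd : ∀ i, x i.rev = - x i)
    (hroot : ∀ i, X.charpoly.IsRoot (x i)) : ∃ W, EigenBasis X x W := by
  have h1 : ∀ i, ∃ v : Fin m → Ω, v ≠ 0 ∧ X *ᵥ v = x i • v := by
    intro i
    have h2 : Module.End.HasEigenvalue (Matrix.toLin' X) (x i) := by
      rw [Module.End.hasEigenvalue_iff_isRoot_charpoly]
      simpa using hroot i
    obtain ⟨v, hv⟩ := h2.exists_hasEigenvector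
    exact ⟨v, hv.2, by simpa using hv.apply_eq_smul⟩
  choose v hv0 hv using h1
  have hli : LinearIndependent Ω v :=
    Module.End.eigenvectors_linearIndependent' (Matrix.toLin' X) x hinj v fun i =>
      ⟨by simpa [Module.End.mem_eigenspace_iff] using hv i, hv0 i⟩
  have hdot : ∀ i j, j ≠ i.rev → v i ⬝ᵥ v j = 0 := by
    intro i j hij
    have h2 := dotProduct_mulVec_skew hX (v i) (v j)
    rw [hv, hv, dotProduct_smul, smul_dotProduct, smul_eq_mul, smul_eq_mul] at h2
    have h3 : (x j - x i.rev) * (v i ⬝ᵥ v j) = 0 := by rw [hodd]; linear_combination h2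
    refine (mul_eq_zero.1 h3).resolve_left fun h => hij (hinj (sub_eq_zero.1 h))
  have hdot' : ∀ i, v i ⬝ᵥ v i.rev ≠ 0 := by
    intro i h
    have hspan := hli.span_eq_top_of_card_eq_finrank' (by simp)
    apply hv0 i
    have h4 : ∀ w : Fin m → Ω, v i ⬝ᵥ w = 0 := by
      intro w
      have hw : w ∈ Submodule.span Ω (Set.range v) := by rw [hspan]; trivial
      induction hw using Submodule.span_induction with
      | mem w hw =>
        obtain ⟨j, rfl⟩ := hw
        rcases eq_or_ne j i.rev with rfl | hj
        · exact h
        · exact hdot i j hj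
      | zero => simp
      | add a b _ _ ha hb => rw [dotProduct_add, ha, hb, add_zero]
      | smul c a _ ha => rw [dotProduct_smul, ha, smul_zero]
    funext j
    simpa using h4 (Pi.single j 1)
  have hs : ∀ d : Ω, ∃ e, e * e = d := fun d => by
    obtain ⟨e, he⟩ := IsAlgClosed.exists_eq_mul_self d
    exact ⟨e, he.symm⟩
  choose sq hsq using hs
  refine ⟨fun i => (sq (v i ⬝ᵥ v i.rev))⁻¹ • v i, fun i => ?_, fun i j => ?_⟩
  · rw [mulVec_smul, hv, smul_comm]
  · rw [smul_dotProduct, dotProduct_smul]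
    split_ifs with h
    · subst h
      rw [Fin.rev_rev, dotProduct_comm (v i.rev) (v i), smul_eq_mul, smul_eq_mul]
      have := hsq (v i ⬝ᵥ v i.rev)
      have h5 : sq (v i ⬝ᵥ v i.rev) ≠ 0 := fun h6 => hdot' i (by rw [← this, h6, zero_mul])
      rw [← mul_assoc, ← mul_inv, this, inv_mul_cancel₀ (hdot' i)]
    · rw [hdot i j h, smul_zero, smul_zero]

variable {X : Matrix (Fin m) (Fin m) Ω} {x : Fin m → Ω} {W : Fin m → Fin m → Ω}

/-- The matrix with given eigenvalues in the basis `W`. -/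
def specMat (W : Fin m → Fin m → Ω) (t : Fin m → Ω) : Matrix (Fin m) (Fin m) Ω :=
  ∑ i, t i • vecMulVec (W i) (W i.rev)

lemma specMat_transpose (t : Fin m → Ω) : (specMat W t)ᵀ = specMat W fun i => t i.rev := by
  rw [specMat, specMat, transpose_sum, ← Equiv.sum_comp (Fin.revPerm (n := m))]
  refine Finset.sum_congr rfl fun i _ => ?_
  rw [transpose_smul, transpose_vecMulVec]
  simp [Fin.revPerm]

lemma specMat_sub (t t' : Fin m → Ω) : specMat W (t - t') = specMat W t - specMat W t' := by
  simp [specMat, sub_smul, Finset.sum_sub_distrib]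

lemma specMat_neg (t : Fin m → Ω) : specMat W (-t) = - specMat W t := by
  simp [specMat, Finset.sum_neg_distrib]

namespace EigenBasis

variable (h : EigenBasis X x W)
include h

lemma specMat_mulVec (t : Fin m → Ω) (j : Fin m) : specMat W t *ᵥ W j = t j • W j := by
  rw [specMat, sum_mulVec, Finset.sum_eq_single j]
  · rw [smul_mulVec, vecMulVec_mulVec, h.dot, if_pos (Fin.rev_rev j).symm]; simp
  · intro i _ hij
    rw [smul_mulVec, vecMulVec_mulVec, h.dot, Fin.rev_rev, if_neg hij.symm]; simp
  · simp

lemma ext_mulVec {A B : Matrix (Fin m) (Fin m) Ω} (hAB : ∀ i, A *ᵥ W i = B *ᵥ W i) : A = B := by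
  have hli : LinearIndependent Ω W := by
    rw [Fintype.linearIndependent_iff]
    intro g hg i
    have := congrArg (fun w => w ⬝ᵥ W i.rev) hg
    simpa [sum_dotProduct, h.dot] using this
  have hspan := hli.span_eq_top_of_card_eq_finrank' (by simp)
  have h1 : A.mulVecLin = B.mulVecLin := LinearMap.ext_on hspan (by
    rintro _ ⟨i, rfl⟩; exact hAB i)
  exact Matrix.toLin'.injective h1

lemma eq_specMat : X = specMat W x :=
  h.ext_mulVec fun i => by rw [h.eig, h.specMat_mulVec]

lemma specMat_mul (t t' : Fin m → Ω) : specMat W t * specMat W t' = specMat W (t * t') :=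
  h.ext_mulVec fun i => by
    rw [← mulVec_mulVec, h.specMat_mulVec, mulVec_smul, h.specMat_mulVec, h.specMat_mulVec,
      smul_smul, mul_comm]; rfl

lemma specMat_one : specMat W 1 = 1 :=
  h.ext_mulVec fun i => by rw [h.specMat_mulVec, one_mulVec]; simp

lemma specMat_pow (t : Fin m → Ω) (n : ℕ) : specMat W t ^ n = specMat W (t ^ n) := by
  induction n with
  | zero => rw [pow_zero, pow_zero, h.specMat_one]
  | succ n ih => rw [pow_succ, ih, h.specMat_mul, pow_succ]

lemma specMat_trace (t : Fin m → Ω) : (specMat W t).trace = ∑ i, t i := by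
  rw [specMat, trace_sum]
  refine Finset.sum_congr rfl fun i _ => ?_
  rw [trace_smul, trace_vecMulVec, h.dot, if_pos rfl]; simp

end EigenBasis

end Eigen

end SoGK

namespace SoGK

open MvPolynomial Matrix

section Generic

variable (k : Type) [Field k] (m : ℕ)

/-- The generic skew-symmetric matrix. -/
def genX : Matrix (Fin m) (Fin m) (MvPolynomial (SkewIdx m) k) := Matrix.of (skewEntry k m)

variable {k m}

lemma skewEntry_lt {a b : Fin m} (h : a < b) : skewEntry k m a b = X ⟨(a, b), h⟩ := by
  simp [skewEntry, h]

lemma skewEntry_self (a : Fin m) : skewEntry k m a a = 0 := by simp [skewEntry]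

lemma skewEntry_swap (a b : Fin m) : skewEntry k m b a = - skewEntry k m a b := by
  rcases lt_trichotomy a b with h | rfl | h
  · simp [skewEntry, h, h.le, h.not_gt]
  · simp [skewEntry]
  · simp [skewEntry, h, h.le, h.not_gt]

lemma genX_transpose : (genX k m)ᵀ = - genX k m :=
  Matrix.ext fun a b => skewEntry_swap _ _

variable {R : Type*} [CommRing R] [Algebra k R]

variable (k) in
/-- Evaluation of polynomial functions at a matrix. -/
def evalSkew (Z : Matrix (Fin m) (Fin m) R) : MvPolynomial (SkewIdx m) k →ₐ[k] R :=
  aeval fun c => Z c.1.1 c.1.2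

lemma diag_eq_zero [NeZero (2 : k)] {Z : Matrix (Fin m) (Fin m) R} (hZ : Zᵀ = -Z) (a : Fin m) :
    Z a a = 0 := by
  have h1 : Z a a = - Z a a := by simpa using congrFun (congrFun hZ a) a
  have h2 : (2 : k) • Z a a = 0 := by
    rw [two_smul]; nth_rewrite 2 [h1]; exact add_neg_cancel _
  simpa [NeZero.ne] using congrArg ((2 : k)⁻¹ • ·) h2

lemma evalSkew_skewEntry [NeZero (2 : k)] {Z : Matrix (Fin m) (Fin m) R} (hZ : Zᵀ = -Z)
    (a b : Fin m) : evalSkew k Z (skewEntry k m a b) = Z a b := by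
  rcases lt_trichotomy a b with h | rfl | h
  · rw [skewEntry_lt h, evalSkew, aeval_X]
  · rw [skewEntry_self, map_zero, diag_eq_zero (k := k) hZ]
  · rw [skewEntry_swap, skewEntry_lt h, map_neg, evalSkew, aeval_X]
    simpa using (congrFun (congrFun hZ b) a).symm

lemma evalSkew_genX [NeZero (2 : k)] {Z : Matrix (Fin m) (Fin m) R} (hZ : Zᵀ = -Z) :
    (evalSkew k Z).toRingHom.mapMatrix (genX k m) = Z :=
  Matrix.ext fun a b => evalSkew_skewEntry hZ a b

lemma exists_skew_of_weights [IsAlgClosed k] [NeZero (2 : k)] {τ : Fin m → k}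
    (hτ : ∀ i, τ i.rev = - τ i) : ∃ Z : Matrix (Fin m) (Fin m) k, Zᵀ = -Z ∧
      ∀ i, Z.charpoly.IsRoot (τ i) := by
  obtain ⟨ι, hι⟩ := IsAlgClosed.exists_pow_nat_eq (-1 : k) (n := 2) (by norm_num)
  refine ⟨Matrix.of fun i j => if j = i.rev then - ι * τ i else 0, ?_, fun i => ?_⟩
  · refine Matrix.ext fun i j => ?_
    change (if i = j.rev then -ι * τ j else 0) = -(if j = i.rev then -ι * τ i else 0)
    by_cases h : j = i.rev
    · subst h; simp [hτ]
    · rw [if_neg h, if_neg (fun h' => h (by rw [h', Fin.rev_rev])), neg_zero]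
  · have h1 : Module.End.HasEigenvector (Matrix.toLin'
        (Matrix.of fun i j : Fin m => if j = i.rev then - ι * τ i else 0)) (τ i)
        (Pi.single i 1 + Pi.single i.rev ι) := by
      refine ⟨?_, ?_⟩
      · rw [Module.End.mem_eigenspace_iff, toLin'_apply]
        funext j
        simp only [mulVec_add, mulVec_single, Pi.add_apply, Pi.smul_apply, col_apply, of_apply,
          MulOpposite.smul_eq_mul_unop, MulOpposite.unop_op, smul_eq_mul, Pi.single_apply, mul_one,
          MulOpposite.op_one, one_smul]
        have e1 : (i = j.rev) = (j = i.rev) :=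
          propext ⟨fun h => by rw [h, Fin.rev_rev], fun h => by rw [h, Fin.rev_rev]⟩
        have e2 : (i.rev = j.rev) = (j = i) :=
          propext ⟨fun h => (Fin.rev_injective h).symm, fun h => by rw [h]⟩
        simp only [e1, e2]
        by_cases hj : j = i <;> by_cases hj' : j = i.rev
        · have : τ i = - τ i := by rw [← hτ, ← hj', hj]
          have h0 : τ i = 0 := by
            have : (2 : k) * τ i = 0 := by linear_combination this
            exact (mul_eq_zero.1 this).resolve_left (NeZero.ne _)
          rw [hj, h0]; simp
        · subst hj; rw [if_neg hj', if_pos rfl, if_pos rfl, if_neg hj']; linear_combination (-τ j) * hι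
        · subst hj'
          rw [if_pos rfl, if_neg hj, if_neg hj, if_pos rfl, hτ]; ring
        · simp [hj, hj']
      · intro h
        have h2 := congrFun h i
        simp only [Pi.add_apply, Pi.single_eq_same, Pi.zero_apply, Pi.single_apply] at h2
        split_ifs at h2
        · have : ι = -1 := by linear_combination h2
          rw [this] at hι
          exact NeZero.ne (2 : k) (by linear_combination hι)
        · simp at h2
    rw [← Matrix.charpoly_toLin', ← Module.End.hasEigenvalue_iff_isRoot_charpoly]
    exact Module.End.hasEigenvalue_of_hasEigenvector h1

/-- Extension of a specialisation to an integral extension. -/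
lemma exists_integral_specialisation {k A S : Type*} [Field k] [IsAlgClosed k] [CommRing A]
    [CommRing S] [Algebra k A] [Algebra k S] [Algebra A S] [IsScalarTower k A S]
    [Algebra.IsIntegral A S] (hinj : Function.Injective (algebraMap A S)) (f : A →ₐ[k] k) :
    ∃ χ : S →+* k, ∀ a, χ (algebraMap A S a) = f a := by
  have hsurj : Function.Surjective f := fun y => ⟨algebraMap k A y, by simp⟩
  have hmax : (RingHom.ker f.toRingHom).IsMaximal :=
    RingHom.ker_isMaximal_of_surjective f.toRingHom hsurj
  obtain ⟨M, hM, hMc⟩ := Ideal.exists_ideal_over_maximal_of_isIntegral (S := S)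
    (RingHom.ker f.toRingHom) (by
      rw [(RingHom.injective_iff_ker_eq_bot _).1 hinj]; exact bot_le)
  let _ : Field (S ⧸ M) := Ideal.Quotient.field M
  have hfac : ∀ a, Ideal.Quotient.mk M (algebraMap A S a) = algebraMap k (S ⧸ M) (f a) := by
    intro a
    have h1 : a - algebraMap k A (f a) ∈ RingHom.ker f.toRingHom := by
      rw [RingHom.mem_ker]; simp
    rw [← hMc, Ideal.mem_comap, map_sub, ← IsScalarTower.algebraMap_apply] at h1
    exact (Ideal.Quotient.eq.2 h1)
  have h_int : Algebra.IsIntegral k (S ⧸ M) := ⟨fun y => by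
    obtain ⟨s, rfl⟩ := Ideal.Quotient.mk_surjective y
    obtain ⟨P, hP, hPs⟩ := Algebra.IsIntegral.isIntegral (R := A) s
    refine ⟨P.map f.toRingHom, hP.map _, ?_⟩
    have h2 := congrArg (Ideal.Quotient.mk M) hPs
    rw [Polynomial.hom_eval₂, map_zero] at h2
    rw [Polynomial.eval₂_map, ← h2]
    congr 1
    exact RingHom.ext fun a => (hfac a).symm⟩
  have hbij := IsAlgClosed.algebraMap_bijective_of_isIntegral (k := k) (K := S ⧸ M)
  let e := RingEquiv.ofBijective (algebraMap k (S ⧸ M)) hbij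
  refine ⟨e.symm.toRingHom.comp (Ideal.Quotient.mk M), fun a => ?_⟩
  change e.symm (Ideal.Quotient.mk M (algebraMap A S a)) = f a
  rw [hfac, RingEquiv.symm_apply_eq]; rfl

lemma exists_generic_roots [IsAlgClosed k] (p : ℕ) [Fact p.Prime] [CharP k p] [NeZero (2 : k)]
    (Ω : Type) [Field Ω] [IsAlgClosed Ω] [Algebra (MvPolynomial (SkewIdx m) k) Ω] [Algebra k Ω]
    [IsScalarTower k (MvPolynomial (SkewIdx m) k) Ω]
    (hinj : Function.Injective (algebraMap (MvPolynomial (SkewIdx m) k) Ω)) :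
    ∃ x : Fin m → Ω, GenericWeights x ∧
      ∀ i, ((genX k m).map (algebraMap _ Ω)).charpoly.IsRoot (x i) := by
  have hinf : Infinite k := IsAlgClosed.instInfinite
  obtain ⟨τ, hτ⟩ := exists_genericWeights m k p
  obtain ⟨Z, hZ, hroot⟩ := exists_skew_of_weights hτ.odd
  set A := MvPolynomial (SkewIdx m) k
  have hinjS : Function.Injective (algebraMap A (integralClosure A Ω)) := fun a b h =>
    hinj (congrArg (algebraMap (integralClosure A Ω) Ω) h)
  obtain ⟨χ, hχ⟩ := exists_integral_specialisation hinjS (evalSkew k Z)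
  set f := (genX k m).charpoly with hf
  have hfm : f.Monic := charpoly_monic _
  have hsplit : (f.map (algebraMap A Ω)).Splits := IsAlgClosed.splits _
  have hfΩ : ((genX k m).map (algebraMap _ Ω)).charpoly = f.map (algebraMap A Ω) := by
    rw [hf, charpoly_map]
  have hfk : Z.charpoly = f.map (evalSkew k Z).toRingHom := by
    rw [hf, ← charpoly_map]; congr 1; exact (evalSkew_genX hZ).symm
  have hmem : ∀ r ∈ (f.map (algebraMap A Ω)).roots, r ∈ integralClosure A Ω := by
    intro r hr
    refine ⟨f, hfm, ?_⟩
    rw [Polynomial.mem_roots (hfm.map _).ne_zero, Polynomial.IsRoot, Polynomial.eval_map] at hr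
    exact hr
  have hprod : f.map (algebraMap A (integralClosure A Ω)) =
      ((f.map (algebraMap A Ω)).roots.attach.map fun r =>
        (Polynomial.X - Polynomial.C (⟨r.1, hmem _ r.2⟩ : integralClosure A Ω))).prod := by
    apply Polynomial.map_injective (algebraMap (integralClosure A Ω) Ω) Subtype.val_injective
    rw [Polynomial.map_map, Polynomial.map_multiset_prod, Multiset.map_map]
    conv_lhs => rw [← IsScalarTower.algebraMap_eq A (integralClosure A Ω) Ω,
      hsplit.eq_prod_roots_of_monic (hfm.map _), ← Multiset.attach_map_val (Polynomial.roots _),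
      Multiset.map_map]
    congr 1
    refine Multiset.map_congr rfl fun r _ => ?_
    simp only [Function.comp_apply, Polynomial.map_sub, Polynomial.map_X, Polynomial.map_C,
      Multiset.attach_map_val]
    rfl
  have hx : ∀ i, ∃ s : integralClosure A Ω, χ s = τ i ∧
      (f.map (algebraMap A Ω)).IsRoot (s : Ω) := by
    intro i
    have h1 := hroot i
    have h2 : f.map (evalSkew k Z).toRingHom = (f.map (algebraMap A (integralClosure A Ω))).map χ := by
      rw [Polynomial.map_map]; congr 1; exact RingHom.ext fun a => (hχ a).symm
    rw [hfk, h2, hprod, Polynomial.map_multiset_prod, Polynomial.IsRoot,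
      Polynomial.eval_multiset_prod, Multiset.prod_eq_zero_iff] at h1
    simp only [Multiset.map_map, Multiset.mem_map, Function.comp_apply, Polynomial.map_sub,
      Polynomial.map_X, Polynomial.map_C, Polynomial.eval_sub, Polynomial.eval_X,
      Polynomial.eval_C, sub_eq_zero] at h1
    obtain ⟨r, -, hr⟩ := h1
    exact ⟨⟨r.1, hmem _ r.2⟩, hr.symm, (Polynomial.mem_roots (hfm.map _).ne_zero).1 r.2⟩
  choose s hs hsroot using hx
  have h2k : (2 : k) ≠ 0 := NeZero.ne _
  have hsinj : Function.Injective s := fun i j h => hτ.injective h2k (by rw [← hs, ← hs, h])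
  have hall : ∀ r, (f.map (algebraMap A Ω)).IsRoot r → ∃ i, (s i : Ω) = r := by
    intro r hr
    classical
    have himg : Finset.univ.image (fun i => (s i : Ω)) =
        (f.map (algebraMap A Ω)).roots.toFinset := by
      apply Finset.eq_of_subset_of_card_le
      · intro y hy
        obtain ⟨i, -, rfl⟩ := Finset.mem_image.1 hy
        rw [Multiset.mem_toFinset, Polynomial.mem_roots (hfm.map _).ne_zero]; exact hsroot i
      · rw [Finset.card_image_of_injective _ (show Function.Injective fun i => (s i : Ω) from
          Subtype.val_injective.comp hsinj), Finset.card_univ,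
          Fintype.card_fin]
        refine (Multiset.toFinset_card_le _).trans ((Polynomial.card_roots' _).trans ?_)
        rw [hfm.natDegree_map, hf, charpoly_natDegree_eq_dim, Fintype.card_fin]
    have : r ∈ (f.map (algebraMap A Ω)).roots.toFinset := by
      rw [Multiset.mem_toFinset, Polynomial.mem_roots (hfm.map _).ne_zero]; exact hr
    rw [← himg] at this
    obtain ⟨i, -, h⟩ := Finset.mem_image.1 this
    exact ⟨i, h⟩
  have hcast : ∀ a b : ℤ, (a : k) = b → (a : Ω) = b := by
    intro a b h
    simpa using congrArg (algebraMap k Ω) h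
  refine ⟨fun i => s i, ⟨fun i => ?_, fun b t h i => hcast _ _ (hτ.indep b t ?_ i)⟩,
    fun i => by rw [hfΩ]; exact hsroot i⟩
  · have hneg : (f.map (algebraMap A Ω)).IsRoot (- (s i : Ω)) := by
      have h1 := hsroot i
      rw [← hfΩ] at h1 ⊢
      have hT : ((genX k m).map (algebraMap A Ω))ᵀ = - (genX k m).map (algebraMap A Ω) := by
        rw [← transpose_map, genX_transpose]; ext; simp
      rw [← charpoly_transpose, hT, Polynomial.IsRoot, eval_charpoly]
      rw [Polynomial.IsRoot, eval_charpoly] at h1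
      have : scalar (Fin m) (-(s i : Ω)) - -(genX k m).map (algebraMap A Ω) =
          -(scalar (Fin m) (s i : Ω) - (genX k m).map (algebraMap A Ω)) := by
        rw [map_neg]; abel
      rw [this, det_neg, h1, mul_zero]
    obtain ⟨j, hj⟩ := hall _ hneg
    have hj' : s j = - s i := Subtype.ext hj
    have : j = i.rev := hτ.injective h2k (by rw [hτ.odd, ← hs, ← hs, hj', map_neg])
    rw [← this, hj]
  · have h1 : ∑ i, (b i : integralClosure A Ω) * s i = t := by
      apply Subtype.val_injective
      simpa using h
    have h2 := congrArg χ h1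
    simpa [hs] using h2

end Generic

end SoGK

namespace SoGK

attribute [local instance] LieRing.ofAssociativeRing

open MvPolynomial Matrix

section Hamil

variable {k : Type} [Field k] {m : ℕ} [NeZero (2 : k)]

lemma two_linForm (x : So k m) : 2 * linForm x.1 = - ((x.1.map C) * genX k m).trace := by
  have h1 : ((x.1.map C) * genX k m).trace = ∑ a, ∑ b, C (x.1 a b) * skewEntry k m b a := by
    simp [trace, mul_apply, genX]
  have h2 : linForm x.1 = ∑ a, ∑ b, if a < b then C (x.1 a b) * skewEntry k m a b else 0 := by
    rw [← Finset.sum_product', linForm, Finset.univ_product_univ, ← Finset.sum_filter]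
    refine Finset.sum_bij (fun c _ => c.1) (fun c _ => by simpa using c.2)
      (fun _ _ _ _ h => Subtype.ext h) (fun ab hab => ⟨⟨ab, by simpa using hab⟩, by simp⟩)
      (fun c _ => by rw [skewEntry_lt c.2])
  have h3 : linForm x.1 = ∑ a, ∑ b, if b < a then C (x.1 a b) * skewEntry k m a b else 0 := by
    rw [h2, Finset.sum_comm]
    refine Finset.sum_congr rfl fun a _ => Finset.sum_congr rfl fun b _ => ?_
    rw [So.apply_swap x a b, skewEntry_swap a b]; simp
  rw [two_mul]
  nth_rewrite 2 [h3]
  rw [h2, h1, ← Finset.sum_add_distrib, ← Finset.sum_neg_distrib]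
  refine Finset.sum_congr rfl fun a _ => ?_
  rw [← Finset.sum_add_distrib, ← Finset.sum_neg_distrib]
  refine Finset.sum_congr rfl fun b _ => ?_
  rw [skewEntry_swap a b]
  rcases lt_trichotomy a b with h | rfl | h
  · simp [h, h.not_gt]
  · simp [skewEntry_self]
  · simp [h, h.not_gt]

lemma two_ne_zero_mvPolynomial : (2 : MvPolynomial (SkewIdx m) k) ≠ 0 := by
  have h := (C_injective (SkewIdx m) k).ne (NeZero.ne (2 : k))
  rw [map_zero, map_ofNat] at h
  exact h

lemma hamil_skewEntry (x : So k m) (a b : Fin m) : hamil x (skewEntry k m a b) =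
    (genX k m * x.1.map C - x.1.map C * genX k m :
      Matrix (Fin m) (Fin m) (MvPolynomial (SkewIdx m) k)) a b := by
  set N : Matrix (Fin m) (Fin m) (MvPolynomial (SkewIdx m) k) :=
    genX k m * x.1.map C - x.1.map C * genX k m with hN
  have hxT : (x.1.map (C : k →+* MvPolynomial (SkewIdx m) k))ᵀ = - x.1.map C := by
    rw [← transpose_map, (LieAlgebra.Orthogonal.mem_so (Fin m) k x.1).1 x.2]
    ext1 i j; simp
  have hNT : ∀ i j, N j i = - N i j := by
    have : Nᵀ = - N := by
      rw [hN, transpose_sub, transpose_mul, transpose_mul, hxT, genX_transpose]; simp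
    exact fun i j => by simpa using congrFun (congrFun this i) j
  have key : ∀ c : SkewIdx m, hamil x (X c) = N c.1.1 c.1.2 := by
    intro c
    rw [hamil, mkDerivation_X]
    apply mul_left_cancel₀ (two_ne_zero_mvPolynomial (k := k) (m := m))
    have hb : (⁅x, gen k c⁆ : So k m).1 = x.1 * (gen k c).1 - (gen k c).1 * x.1 := rfl
    have hg : (gen k c).1.map (C : k →+* MvPolynomial (SkewIdx m) k) =
        Matrix.single c.1.1 c.1.2 1 - Matrix.single c.1.2 c.1.1 1 := by
      change (skewMat k m _ _).map _ = _
      rw [skewMat]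
      ext1 i j
      simp only [map_apply, Matrix.sub_apply, single_apply, map_sub, apply_ite C, map_one, map_zero]
    rw [two_linForm, hb]
    have h1 : ((x.1 * (gen k c).1 - (gen k c).1 * x.1).map
        (C : k →+* MvPolynomial (SkewIdx m) k)) * genX k m =
        x.1.map C * (gen k c).1.map C * genX k m - (gen k c).1.map C * (x.1.map C * genX k m) := by
      rw [← Matrix.map_mul.symm.symm, ← mul_assoc, ← sub_mul]
      congr 1
      ext1 i j
      simp [mul_apply]
    rw [h1, trace_sub, trace_mul_comm (_ * _), ← mul_assoc, trace_mul_comm, ← trace_sub, ← mul_sub,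
      ← hN, hg, sub_mul, trace_sub, trace_single_mul, trace_single_mul, hNT c.1.1 c.1.2]
    simp only [smul_eq_mul, one_mul]
    ring
  rcases lt_trichotomy a b with h | rfl | h
  · rw [skewEntry_lt h, key]
  · have h1 := hNT a a
    rw [skewEntry_self, map_zero]
    have h2 : 2 * N a a = 0 := by linear_combination h1
    exact ((mul_eq_zero.1 h2).resolve_left two_ne_zero_mvPolynomial).symm
  · rw [skewEntry_swap, skewEntry_lt h, map_neg, key, hNT]; simp

variable {R : Type*} [CommRing R] [Algebra k R]

variable (k) in
/-- The skew-symmetric matrix with given coordinates. -/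
def skewOf (e : SkewIdx m → R) : Matrix (Fin m) (Fin m) R :=
  ∑ c, e c • (gen k c).1.map (algebraMap k R)

omit [NeZero (2 : k)] in
lemma skewOf_transpose (e : SkewIdx m → R) : (skewOf k e)ᵀ = - skewOf k e := by
  rw [skewOf, transpose_sum, ← Finset.sum_neg_distrib]
  refine Finset.sum_congr rfl fun c _ => ?_
  rw [transpose_smul, ← smul_neg, ← transpose_map,
    (LieAlgebra.Orthogonal.mem_so (Fin m) k (gen k c).1).1 (gen k c).2]
  congr 1; ext1 i j; simp

omit [NeZero (2 : k)] in
lemma skewOf_apply (e : SkewIdx m → R) (c : SkewIdx m) : skewOf k e c.1.1 c.1.2 = e c := by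
  rw [skewOf, Matrix.sum_apply, Finset.sum_eq_single c]
  · simp [gen_apply]
  · intro b _ hb
    simp only [Matrix.smul_apply, map_apply]
    rw [gen_apply, if_neg hb.symm]; simp
  · simp

omit [NeZero (2 : k)] in
lemma skewOf_sum {ι : Type*} (s : Finset ι) (g : ι → R) (e : ι → SkewIdx m → R) :
    skewOf k (∑ j ∈ s, g j • e j) = ∑ j ∈ s, g j • skewOf k (e j) := by
  simp only [skewOf, Finset.smul_sum, smul_smul]
  rw [Finset.sum_comm]
  refine Finset.sum_congr rfl fun c _ => ?_
  rw [Finset.sum_apply, Finset.sum_smul]; rfl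

lemma sum_hamil [Algebra (MvPolynomial (SkewIdx m) k) R]
    [IsScalarTower k (MvPolynomial (SkewIdx m) k) R] (e : SkewIdx m → R) (a b : Fin m) :
    ∑ c, e c * algebraMap (MvPolynomial (SkewIdx m) k) R (hamil (gen k c) (skewEntry k m a b)) =
      ((genX k m).map (algebraMap _ R) * skewOf k e - skewOf k e * (genX k m).map (algebraMap _ R) :
        Matrix (Fin m) (Fin m) R) a b := by
  rw [skewOf, Finset.mul_sum, Finset.sum_mul, ← Finset.sum_sub_distrib, Matrix.sum_apply]
  refine Finset.sum_congr rfl fun c _ => ?_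
  rw [mul_smul_comm, smul_mul_assoc, ← smul_sub, Matrix.smul_apply, smul_eq_mul, hamil_skewEntry]
  congr 1
  simp only [Matrix.sub_apply, mul_apply, map_sub, map_sum, map_mul, map_apply]
  simp only [IsScalarTower.algebraMap_apply k (MvPolynomial (SkewIdx m) k) R, algebraMap_eq]

end Hamil

end SoGK

namespace SoGK

open MvPolynomial Matrix

lemma aeval_X_mul_ne_zero {σ k R : Type*} [Field k] [CommRing R] [IsDomain R] [Algebra k R]
    {Z : σ → Polynomial R}
    (hZ : Function.Injective (aeval (R := k) fun c => (Z c).eval 0)) {f : MvPolynomial σ k}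
    (hf : f ≠ 0) : aeval (fun c => Polynomial.X * Z c) f ≠ 0 := by
  classical
  obtain ⟨s₀, hs₀, hmin⟩ := f.support.exists_min_image Finsupp.degree
    (Finset.nonempty_iff_ne_empty.2 fun h => hf (support_eq_empty.1 h))
  set d := s₀.degree with hd
  have h1 : aeval (fun c => Polynomial.X * Z c) f = Polynomial.X ^ d *
      ∑ s ∈ f.support, Polynomial.X ^ (s.degree - d) * aeval Z (monomial s (coeff s f)) := by
    conv_lhs => rw [f.as_sum]
    rw [map_sum, Finset.mul_sum]
    refine Finset.sum_congr rfl fun s hs => ?_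
    rw [← mul_assoc, ← pow_add, Nat.add_sub_cancel' (hmin s hs), aeval_monomial, aeval_monomial]
    simp only [Finsupp.prod, mul_pow, Finset.prod_mul_distrib, Finset.prod_pow_eq_pow_sum,
      Finsupp.degree_apply]
    ring
  rw [h1]
  refine mul_ne_zero (pow_ne_zero _ Polynomial.X_ne_zero) fun h0 => ?_
  have h2 := congrArg (Polynomial.eval 0) h0
  have h3 : ∀ g : MvPolynomial σ k, (aeval Z g).eval 0 = aeval (fun c => (Z c).eval 0) g := by
    intro g
    induction g using MvPolynomial.induction_on with
    | C a => simp [aeval_C, Polynomial.algebraMap_apply]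
    | add _ _ h h' => simp [h, h']
    | mul_X _ _ h => simp [h]
  rw [Polynomial.eval_finsetSum, Polynomial.eval_zero] at h2
  have h4 : homogeneousComponent d f = 0 := by
    apply hZ
    rw [map_zero, homogeneousComponent_apply, map_sum, Finset.sum_filter]
    refine Eq.trans (Finset.sum_congr rfl fun s hs => ?_) h2
    rw [Polynomial.eval_mul, h3]
    split_ifs with h
    · rw [h, Nat.sub_self, pow_zero, Polynomial.eval_one, one_mul]
    · simp [Nat.sub_eq_zero_iff_le, not_le, lt_of_le_of_ne (hmin s hs) (Ne.symm h)]
  have h5 := congrArg (coeff s₀) h4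
  rw [coeff_homogeneousComponent, if_pos rfl, coeff_zero] at h5
  exact (mem_support_iff.1 hs₀) h5

lemma smul_pow_sub {m : ℕ} {R : Type*} [CommRing R] {n : ℕ} (hn : 1 ≤ n) (t : R)
    (M : Matrix (Fin m) (Fin m) R) : (t • M) ^ n - t • M = t • (t ^ (n - 1) • M ^ n - M) := by
  rw [smul_pow, smul_sub, smul_smul, ← pow_succ', Nat.sub_add_cancel hn]

variable {k : Type} [Field k] {m : ℕ} [NeZero (2 : k)] (p : ℕ) [Fact p.Prime] [CharP k p]

section PsiAt

variable {R S : Type*} [CommRing R] [Algebra k R] [CommRing S] [Algebra k S]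

variable (k) in
/-- The homomorphism from the abstract `p`-centre given by the entries of `Z ^ p - Z`. -/
def psiAt (Z : Matrix (Fin m) (Fin m) R) : YAlg k m p →ₐ[k] R :=
  aeval fun c => (Z ^ p - Z : Matrix (Fin m) (Fin m) R) c.idx.1.1 c.idx.1.2

omit [NeZero (2 : k)] [Fact p.Prime] [CharP k p] in
lemma map_psiAt (f : R →ₐ[k] S) (Z : Matrix (Fin m) (Fin m) R) (a : YAlg k m p) :
    f (psiAt k p Z a) = psiAt k p (f.mapMatrix Z) a := by
  change (f.comp (psiAt k p Z)) a = _
  congr 1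
  refine MvPolynomial.algHom_ext fun c => ?_
  simp only [AlgHom.comp_apply, psiAt, aeval_X]
  rw [← map_pow, ← map_sub]; rfl

omit [Fact p.Prime] [CharP k p] in
lemma evalSkew_psiAt {Z : Matrix (Fin m) (Fin m) R} (hZ : Zᵀ = -Z) (a : YAlg k m p) :
    evalSkew k Z (psiAt k p (genX k m) a) = psiAt k p Z a := by
  rw [map_psiAt]; congr 2; exact evalSkew_genX hZ

lemma psiAt_genX_injective : Function.Injective (psiAt k p (genX k m)) := by
  have hp : p.Prime := Fact.out
  rw [injective_iff_map_eq_zero]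
  intro f hf
  by_contra hne
  let T : MvPolynomial (SkewIdx m) k →ₐ[k] Polynomial (MvPolynomial (SkewIdx m) k) := aeval fun c => Polynomial.X * Polynomial.C (X c)
  let X₁ : Matrix (Fin m) (Fin m) (Polynomial (MvPolynomial (SkewIdx m) k)) := (genX k m).map Polynomial.C
  have hT : T.mapMatrix (genX k m) = (Polynomial.X : Polynomial (MvPolynomial (SkewIdx m) k)) • X₁ := by
    refine Matrix.ext fun a b => ?_
    change T (skewEntry k m a b) = Polynomial.X * Polynomial.C (skewEntry k m a b)
    unfold skewEntry
    split_ifs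
    · exact aeval_X _ _
    · rw [map_neg T, map_neg Polynomial.C, mul_neg (Polynomial.X : Polynomial (MvPolynomial (SkewIdx m) k))]
      exact congrArg Neg.neg (aeval_X _ _)
    · rw [map_zero, map_zero, mul_zero]
  let Z : YVar m p → Polynomial (MvPolynomial (SkewIdx m) k) := fun c =>
    ((Polynomial.X : Polynomial (MvPolynomial (SkewIdx m) k)) ^ (p - 1) • X₁ ^ p - X₁ : Matrix _ _ _) c.idx.1.1 c.idx.1.2
  have h1 : T (psiAt k p (genX k m) f) = aeval (fun c => Polynomial.X * Z c) f := by
    rw [map_psiAt, hT, psiAt]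
    congr 2
    funext c
    exact congrFun (congrFun (smul_pow_sub hp.one_le Polynomial.X X₁) c.idx.1.1) c.idx.1.2
  refine aeval_X_mul_ne_zero ?_ hne (h1.symm.trans (by rw [hf, map_zero]))
  have h2 : ∀ c, (Z c).eval 0 = - X c.idx := by
    intro c
    simp only [Z, Matrix.sub_apply, Matrix.smul_apply, smul_eq_mul, Polynomial.eval_sub,
      Polynomial.eval_mul, Polynomial.eval_pow, Polynomial.eval_X]
    rw [zero_pow (by have := hp.two_le; omega), zero_mul, zero_sub]
    change - Polynomial.eval 0 (Polynomial.C (skewEntry k m c.idx.1.1 c.idx.1.2)) = _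
    rw [Polynomial.eval_C, skewEntry_lt c.idx.2]
  simp only [h2]
  let B : MvPolynomial (SkewIdx m) k →ₐ[k] YAlg k m p := aeval fun c => - X ⟨c⟩
  have h3 : Function.LeftInverse B (aeval fun c : YVar m p => - (X c.idx : MvPolynomial (SkewIdx m) k)) := by
    intro g
    change (B.comp (aeval fun c : YVar m p => - (X c.idx : MvPolynomial (SkewIdx m) k))) g = AlgHom.id k _ g
    congr 1
    refine MvPolynomial.algHom_ext fun c => ?_
    simp only [AlgHom.comp_apply, aeval_X, map_neg, B, neg_neg, AlgHom.id_apply]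
  exact h3.injective

end PsiAt

section Omega

variable {Ω : Type} [Field Ω] [IsAlgClosed Ω] [Algebra (MvPolynomial (SkewIdx m) k) Ω] [Algebra k Ω]
  [IsScalarTower k (MvPolynomial (SkewIdx m) k) Ω]

include p in
lemma exists_generic_eigenBasis [IsAlgClosed k]
    (hinj : Function.Injective (algebraMap (MvPolynomial (SkewIdx m) k) Ω)) :
    ∃ x W, GenericWeights (R := Ω) x ∧ EigenBasis ((genX k m).map (algebraMap _ Ω)) x W := by
  obtain ⟨x, hx, hroot⟩ := exists_generic_roots p Ω hinj
  have h2 : (2 : Ω) ≠ 0 := by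
    rw [← map_ofNat (algebraMap k Ω) 2]
    exact (map_ne_zero _).2 (NeZero.ne _)
  have hskew : ((genX k m).map (algebraMap _ Ω))ᵀ = - (genX k m).map (algebraMap _ Ω) := by
    rw [← transpose_map, genX_transpose]
    exact Matrix.ext fun a b => map_neg (algebraMap _ Ω) _
  obtain ⟨W, hW⟩ := exists_eigenBasis hskew (hx.injective h2) hx.odd hroot
  exact ⟨x, W, hx, hW⟩

omit [IsAlgClosed Ω] in
lemma evalSkew_injective_of_pow_sub
    (hinj : Function.Injective (algebraMap (MvPolynomial (SkewIdx m) k) Ω))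
    {Z : Matrix (Fin m) (Fin m) Ω} (hZ : Zᵀ = -Z)
    (h : Z ^ p - Z = ((genX k m).map (algebraMap _ Ω)) ^ p - (genX k m).map (algebraMap _ Ω)) :
    Function.Injective (evalSkew k Z) := by
  have h1 : Function.Injective (psiAt k p Z) := by
    have h2 : psiAt k p Z = (IsScalarTower.toAlgHom k (MvPolynomial (SkewIdx m) k) Ω).comp
        (psiAt k p (genX k m)) := by
      refine AlgHom.ext fun a => ?_
      rw [AlgHom.comp_apply, map_psiAt, psiAt, psiAt, h]; rfl
    rw [h2]
    exact hinj.comp (psiAt_genX_injective p)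
  let B := Algebra.adjoin k (Set.range fun c : SkewIdx m => Z c.1.1 c.1.2)
  have hB : ∀ a, evalSkew k Z a ∈ B := fun a => by
    have h3 : evalSkew k Z a ∈ (evalSkew k Z).range := ⟨a, rfl⟩
    rwa [evalSkew, ← Algebra.adjoin_range_eq_range_aeval] at h3
  let z : SkewIdx m → B := fun c => ⟨Z c.1.1 c.1.2, Algebra.subset_adjoin ⟨c, rfl⟩⟩
  have hz : Algebra.adjoin k (Set.range z) = ⊤ := by
    have := Algebra.adjoin_adjoin_coe_preimage (R := k) (s := Set.range fun c : SkewIdx m => Z c.1.1 c.1.2)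
    rw [← this]; congr 1
    ext ⟨w, hw⟩
    simp [z, Subtype.ext_iff, B]
  let y : SkewIdx m → B := fun c => ⟨psiAt k p Z (X ⟨c⟩), by
    rw [← evalSkew_psiAt p hZ]; exact hB _⟩
  have hy : AlgebraicIndependent k y := by
    have h4 : AlgebraicIndependent k fun c : SkewIdx m => psiAt k p Z (X ⟨c⟩) := by
      rw [AlgebraicIndependent]
      have h5 : (aeval fun c : SkewIdx m => psiAt k p Z (X ⟨c⟩)) =
          (psiAt k p Z).comp (rename (YVar.equiv p).symm) := by
        refine MvPolynomial.algHom_ext fun c => ?_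
        simp [YVar.equiv]
      rw [h5]
      exact h1.comp (rename_injective _ (YVar.equiv p).symm.injective)
    refine AlgebraicIndependent.of_comp B.val h4
  have hle : Cardinal.mk (SkewIdx m) ≤ Algebra.trdeg k B := hy.cardinalMk_le_trdeg
  have : FaithfulSMul k B := inferInstance
  have : Algebra.IsAlgebraic (Algebra.adjoin k (Set.range z)) B := by
    rw [hz]; exact ⟨fun b => isAlgebraic_algebraMap (A := B) (⟨b, trivial⟩ : (⊤ : Subalgebra k B))⟩
  have h6 := Algebra.IsAlgebraic.isTranscendenceBasis_of_le_trdeg_of_finite k z hle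
  have h7 := h6.1.map' (f := B.val) Subtype.val_injective
  exact h7

end Omega

end SoGK

namespace SoGK

open MvPolynomial Matrix

lemma exists_dual_subfamily {F V ι : Type*} [Field F] [AddCommGroup V] [Module F V]
    [FiniteDimensional F V] (ev : ι → Module.Dual F V) (h : ∀ v, (∀ i, ev i v = 0) → v = 0) :
    ∃ (c : Fin (Module.finrank F V) → ι) (w : Fin (Module.finrank F V) → V),
      Function.Injective c ∧ ∀ i j, ev (c i) (w j) = if i = j then 1 else 0 := by
  classical
  have h1 : Submodule.span F (Set.range ev) = ⊤ := by
    rw [← Subspace.dualCoannihilator_dualAnnihilator_eq (W := Submodule.span F (Set.range ev))]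
    have h2 : (Submodule.span F (Set.range ev)).dualCoannihilator = ⊥ := by
      rw [eq_bot_iff]
      intro v hv
      refine h v fun i => (Submodule.mem_dualCoannihilator _).1 hv _ (Submodule.subset_span ⟨i, rfl⟩)
    rw [h2, Submodule.dualAnnihilator_bot]
  obtain ⟨κ, a, ha, hspan, hli⟩ := exists_linearIndependent' F ev
  rw [h1] at hspan
  let b := Module.Basis.mk hli hspan.ge
  have : Finite κ := Module.Finite.finite_basis b
  have : Fintype κ := Fintype.ofFinite κ
  have hcard : Module.finrank F V = Fintype.card κ := by
    rw [← Subspace.dual_finrank_eq, Module.finrank_eq_card_basis b]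
  let e : Fin (Module.finrank F V) ≃ κ := (finCongr hcard).trans (Fintype.equivFin κ).symm
  refine ⟨fun i => a (e i), fun j => (Module.evalEquiv F V).symm (b.dualBasis (e j)),
    ha.comp e.injective, fun i j => ?_⟩
  rw [Module.apply_evalEquiv_symm_apply]
  have : ev (a (e i)) = b (e i) := (Module.Basis.mk_apply hli hspan.ge (e i)).symm
  rw [this, Module.Basis.dualBasis_apply_self]
  simp [eq_comm]

section Extension

variable {k A F : Type*} [Field k] [CommRing A] [Algebra k A] [Field F] [Algebra A F]
  [IsFractionRing A F] [Algebra k F] [IsScalarTower k A F]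

/-- The ring homomorphism to the dual numbers attached to a derivation. -/
def dualHom (D : Derivation k A A) : A →+* TrivSqZeroExt F F where
  toFun a := (algebraMap A F a, algebraMap A F (D a))
  map_one' := by
    refine TrivSqZeroExt.ext (map_one (algebraMap A F)) ?_
    change algebraMap A F (D 1) = 0
    rw [D.map_one_eq_zero, map_zero]
  map_zero' := by
    refine TrivSqZeroExt.ext (map_zero (algebraMap A F)) ?_
    change algebraMap A F (D 0) = 0
    rw [map_zero, map_zero]
  map_mul' a b := by
    refine TrivSqZeroExt.ext (map_mul (algebraMap A F) a b) ?_
    change algebraMap A F (D (a * b)) = algebraMap A F a * algebraMap A F (D b) +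
      algebraMap A F (D a) * algebraMap A F b
    rw [D.leibniz, map_add, smul_eq_mul, smul_eq_mul, map_mul (algebraMap A F),
      map_mul (algebraMap A F), mul_comm (algebraMap A F b)]
  map_add' a b := by
    refine TrivSqZeroExt.ext (map_add (algebraMap A F) a b) ?_
    change algebraMap A F (D (a + b)) = algebraMap A F (D a) + algebraMap A F (D b)
    rw [map_add, map_add]

omit [IsFractionRing A F] in
lemma fst_dualHom (D : Derivation k A A) (a : A) :
    (dualHom (F := F) D a).fst = algebraMap A F a := rfl

omit [IsFractionRing A F] in
lemma snd_dualHom (D : Derivation k A A) (a : A) :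
    (dualHom (F := F) D a).snd = algebraMap A F (D a) := rfl

variable (F) in
/-- The homomorphism from the fraction field to the dual numbers attached to a derivation. -/
def fracDualHom (D : Derivation k A A) : F →+* TrivSqZeroExt F F :=
  IsLocalization.lift (M := nonZeroDivisors A) (S := F) (g := dualHom D) fun a => by
    rw [TrivSqZeroExt.isUnit_iff_isUnit_fst, fst_dualHom]
    exact (IsLocalization.map_units F a)

lemma fracDualHom_algebraMap (D : Derivation k A A) (a : A) :
    fracDualHom F D (algebraMap A F a) = dualHom D a := IsLocalization.lift_eq _ _

lemma fst_fracDualHom (D : Derivation k A A) (a : F) : (fracDualHom F D a).fst = a := by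
  have : ((TrivSqZeroExt.fstHom F F F).toRingHom).comp (fracDualHom F D) = RingHom.id F := by
    refine IsLocalization.ringHom_ext (nonZeroDivisors A) (RingHom.ext fun a => ?_)
    change (fracDualHom F D (algebraMap A F a)).fst = algebraMap A F a
    rw [fracDualHom_algebraMap, fst_dualHom]
  exact congrArg (fun f => f a) this

variable (F) in
/-- The extension of a derivation to the fraction field. -/
def derExt (D : Derivation k A A) : Derivation k F F :=
  Derivation.mk'
    { toFun := fun a => (fracDualHom F D a).snd
      map_add' := fun a b => by rw [map_add]; rfl
      map_smul' := fun c a => by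
        rw [Algebra.smul_def, map_mul (fracDualHom F D), TrivSqZeroExt.snd_mul, fst_fracDualHom,
          fst_fracDualHom, IsScalarTower.algebraMap_apply k A F, fracDualHom_algebraMap,
          snd_dualHom, D.map_algebraMap, map_zero, smul_zero, add_zero,
          ← IsScalarTower.algebraMap_apply, RingHom.id_apply, ← algebra_compatible_smul] }
    fun a b => by
      change (fracDualHom F D (a * b)).snd = _
      rw [map_mul (fracDualHom F D), TrivSqZeroExt.snd_mul, fst_fracDualHom, fst_fracDualHom,
        op_smul_eq_smul]
      rfl

lemma derExt_algebraMap (D : Derivation k A A) (a : A) :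
    derExt F D (algebraMap A F a) = algebraMap A F (D a) := by
  change (fracDualHom F D (algebraMap A F a)).snd = _
  rw [fracDualHom_algebraMap, snd_dualHom]

end Extension

section Rank

/-- Polynomial functions on skew-symmetric matrices. -/
abbrev Pol (k : Type) [Field k] (m : ℕ) : Type := MvPolynomial (SkewIdx m) k

/-- Rational functions on skew-symmetric matrices. -/
abbrev Fr (k : Type) [Field k] (m : ℕ) : Type := FractionRing (Pol k m)

/-- Algebraic functions on skew-symmetric matrices. -/
abbrev Cl (k : Type) [Field k] (m : ℕ) : Type := AlgebraicClosure (Fr k m)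

variable {k : Type} [Field k] {m : ℕ} [NeZero (2 : k)]

/-- The rank of the orthogonal Lie algebra. -/
def rk (m : ℕ) : ℕ := Fintype.card {i : Fin m // i < i.rev}

lemma EigenBasis.eq_zero_of_commute {Ω : Type*} [Field Ω] {X : Matrix (Fin m) (Fin m) Ω}
    {x : Fin m → Ω} {W : Fin m → Fin m → Ω} (h : EigenBasis X x W) (h2 : (2 : Ω) ≠ 0)
    (hX : Xᵀ = -X) (hinj : Function.Injective x) (hodd : ∀ i, x i.rev = - x i)
    {B : Matrix (Fin m) (Fin m) Ω} (hB : Bᵀ = -B) (hXB : X * B - B * X = 0)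
    (h0 : ∀ i : Fin m, i < i.rev → (B *ᵥ W i) ⬝ᵥ W i.rev = 0) : B = 0 := by
  have hdiag : ∀ i, (B *ᵥ W i) ⬝ᵥ W i.rev = 0 := by
    have hswap : ∀ i, (B *ᵥ W i) ⬝ᵥ W i.rev = - ((B *ᵥ W i.rev) ⬝ᵥ W i) := fun i => by
      rw [← neg_eq_iff_eq_neg, ← dotProduct_mulVec_skew hB, dotProduct_comm]
    intro i
    rcases lt_trichotomy i i.rev with hi | hi | hi
    · exact h0 i hi
    · have := hswap i
      rw [← hi] at this ⊢
      have h3 : 2 * ((B *ᵥ W i) ⬝ᵥ W i) = 0 := by linear_combination this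
      exact (mul_eq_zero.1 h3).resolve_left h2
    · have := h0 i.rev (by rwa [Fin.rev_rev])
      rw [Fin.rev_rev] at this
      rw [hswap, this, neg_zero]
  have hoff : ∀ i j, (B *ᵥ W i) ⬝ᵥ W j = 0 := by
    intro i j
    by_cases hij : j = i.rev
    · rw [hij]; exact hdiag i
    · have h3 : X *ᵥ (B *ᵥ W i) = x i • (B *ᵥ W i) := by
        rw [mulVec_mulVec, sub_eq_zero.1 hXB, ← mulVec_mulVec, h.eig, mulVec_smul]
      have h4 : (B *ᵥ W i) ⬝ᵥ X *ᵥ W j = - ((X *ᵥ (B *ᵥ W i)) ⬝ᵥ W j) :=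
        dotProduct_mulVec_skew hX _ _
      rw [h3, h.eig, dotProduct_smul, smul_dotProduct, smul_eq_mul, smul_eq_mul] at h4
      have h5 : (x j + x i) * ((B *ᵥ W i) ⬝ᵥ W j) = 0 := by linear_combination h4
      refine (mul_eq_zero.1 h5).resolve_left fun h6 => hij (hinj ?_)
      rw [hodd]; linear_combination h6
  refine h.ext_mulVec fun i => ?_
  have h7 : (Matrix.of W) *ᵥ (B *ᵥ W i) = 0 := funext fun j => by
    rw [mulVec, dotProduct_comm]; exact hoff i j
  have h8 : Function.Injective (Matrix.of W).mulVec := by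
    rw [mulVec_injective_iff_isUnit]
    have h9 : Matrix.of W * (Matrix.of fun i (j : Fin m) => W j.rev i) = 1 := Matrix.ext fun a (b : Fin m) => by
      have := h.dot a b.rev
      simp only [Fin.rev_inj, eq_comm (a := b)] at this
      rw [Matrix.one_apply]
      exact this
    exact IsUnit.of_mul_eq_one _ h9
  rw [zero_mulVec]
  exact h8 (h7.trans (mulVec_zero _).symm)

variable (k m) in
/-- `F`-linear combinations of the Hamiltonian derivations. -/
def hamComb : (SkewIdx m → Fr k m) →ₗ[
    Fr k m]
    Derivation k (Fr k m)
      (Fr k m) :=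
  Fintype.linearCombination _ fun c => derExt _ (hamil (gen k c))

omit [NeZero (2 : k)] in
lemma hamComb_algebraMap (e : SkewIdx m → Fr k m)
    (a : Pol k m) : hamComb k m e (algebraMap _ _ a) =
      ∑ c, e c * algebraMap _ _ (hamil (gen k c) a) := by
  rw [hamComb, Fintype.linearCombination_apply, ← Derivation.coeFnAddMonoidHom_apply, map_sum, Finset.sum_apply]
  refine Finset.sum_congr rfl fun c _ => ?_
  rw [Derivation.coeFnAddMonoidHom_apply, Derivation.smul_apply, derExt_algebraMap, smul_eq_mul]

lemma finrank_ker_hamComb_le [IsAlgClosed k] (p : ℕ) [Fact p.Prime] [CharP k p] :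
    Module.finrank (Fr k m)
      (LinearMap.ker (hamComb k m)) ≤ rk m := by
  classical
  have hinj : Function.Injective (algebraMap (Pol k m) (Cl k m)) := by
    rw [IsScalarTower.algebraMap_eq (Pol k m) (Fr k m) (Cl k m)]
    exact (algebraMap (Fr k m) (Cl k m)).injective.comp (IsFractionRing.injective (Pol k m) (Fr k m))
  obtain ⟨x, W, hx, hW⟩ := exists_generic_eigenBasis p hinj
  have h2 : (2 : Cl k m) ≠ 0 := by
    rw [← map_ofNat (algebraMap k (Cl k m)) 2]
    exact (map_ne_zero _).2 (NeZero.ne _)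
  have hX : ((genX k m).map (algebraMap (Pol k m) (Cl k m)))ᵀ = - (genX k m).map (algebraMap (Pol k m) (Cl k m)) := by
    rw [← transpose_map, genX_transpose]
    exact Matrix.ext fun a b => map_neg (algebraMap (Pol k m) (Cl k m)) (genX k m a b)
  let K := LinearMap.ker (hamComb k m)
  let b := Module.finBasis (Fr k m) K
  let bΩ : Fin (Module.finrank (Fr k m) K) → SkewIdx m → Cl k m := fun i => algebraMap (Fr k m) (Cl k m) ∘ (b i).1
  have hli : LinearIndependent (Cl k m) bΩ := by
    rw [linearIndependent_algebraMap_comp_iff]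
    exact b.linearIndependent.map' K.subtype K.ker_subtype
  have hcomm : ∀ i, (genX k m).map (algebraMap (Pol k m) (Cl k m)) * skewOf k (bΩ i) -
      skewOf k (bΩ i) * (genX k m).map (algebraMap (Pol k m) (Cl k m)) = 0 := by
    intro i
    refine Matrix.ext fun u v => ?_
    rw [← sum_hamil]
    have h3 : hamComb k m (b i).1 = 0 := (b i).2
    have h4 := congrArg (fun D => algebraMap (Fr k m) (Cl k m) (D (algebraMap (Pol k m) (Fr k m) (skewEntry k m u v)))) h3
    simp only [hamComb_algebraMap] at h4
    rw [map_sum] at h4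
    refine Eq.trans (Finset.sum_congr rfl fun c _ => ?_) (h4.trans (map_zero _))
    rw [map_mul (algebraMap (Fr k m) (Cl k m)), ← IsScalarTower.algebraMap_apply (Pol k m) (Fr k m) (Cl k m)]
    rfl
  let Θ : Fin (Module.finrank (Fr k m) K) → {i : Fin m // i < i.rev} → Cl k m := fun i j =>
    (skewOf k (bΩ i) *ᵥ W j.1) ⬝ᵥ W j.1.rev
  have hΘ : LinearIndependent (Cl k m) Θ := by
    rw [Fintype.linearIndependent_iff]
    intro g hg
    have h5 : skewOf k (∑ i, g i • bΩ i) = 0 := by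
      refine hW.eq_zero_of_commute h2 hX (hx.injective h2) hx.odd (skewOf_transpose _) ?_ ?_
      · rw [skewOf_sum, Finset.mul_sum, Finset.sum_mul, ← Finset.sum_sub_distrib]
        refine Finset.sum_eq_zero fun i _ => ?_
        rw [mul_smul_comm, smul_mul_assoc, ← smul_sub, hcomm, smul_zero]
      · intro i hi
        have h6 := congrFun hg ⟨i, hi⟩
        rw [Finset.sum_apply] at h6
        rw [skewOf_sum, sum_mulVec, sum_dotProduct]
        refine Eq.trans (Finset.sum_congr rfl fun c _ => ?_) h6
        rw [smul_mulVec, smul_dotProduct]; rfl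
    refine Fintype.linearIndependent_iff.1 hli g (funext fun c => ?_)
    rw [← skewOf_apply (k := k) (∑ i, g i • bΩ i) c, h5]; rfl
  have := hΘ.fintype_card_le_finrank
  simpa [rk] using this

lemma le_finrank_range_hamComb [IsAlgClosed k] (p : ℕ) [Fact p.Prime] [CharP k p] :
    Fintype.card (SkewIdx m) - rk m ≤ Module.finrank (Fr k m)
      (LinearMap.range (hamComb k m)) := by
  have h1 := LinearMap.finrank_range_add_finrank_ker (hamComb k m)
  have h2 := finrank_ker_hamComb_le (k := k) (m := m) p
  rw [Module.finrank_fintype_fun_eq_card] at h1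
  omega

end Rank

end SoGK

namespace SoGK

open MvPolynomial Matrix

attribute [local instance] LieRing.ofAssociativeRing

section Lift

variable {K : Type} [Field K] {m : ℕ} {R : Type*} [Ring R]

/-- The relations satisfied by the standard generators `e_ij - e_ji` of the orthogonal Lie algebra. -/
structure SoRel (G : Fin m → Fin m → R) : Prop where
  swap : ∀ i j, G j i = - G i j
  comm : ∀ i j a b, G i j * G a b - G a b * G i j =
    (if j = a then G i b else 0) - (if j = b then G i a else 0) -
      (if i = a then G j b else 0) + (if i = b then G j a else 0)

lemma soRel_ι : SoRel fun i j => envι K (skewGen K m i j) where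
  swap i j := by
    rw [← map_neg]; congr 1
    exact Subtype.ext (neg_sub _ _).symm
  comm i j a b := by
    have h0 : ∀ (P : Prop) [Decidable P] (x : So K m),
        (if P then envι K x else 0) = envι K (if P then x else 0) := by
      intro P _ x; split_ifs <;> simp
    rw [← LieRing.of_associative_ring_bracket, ← LieHom.map_lie]
    simp only [h0, ← map_sub, ← map_add]
    congr 1
    have h1 : ∀ (P : Prop) [Decidable P] (x : So K m),
        ((if P then x else 0 : So K m) : Matrix (Fin m) (Fin m) K) = if P then x.1 else 0 := by
      intro P _ x; split_ifs <;> rfl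
    refine Subtype.ext ?_
    change skewMat K m i j * skewMat K m a b - skewMat K m a b * skewMat K m i j =
      ((if j = a then _ else 0 : So K m) : Matrix (Fin m) (Fin m) K) -
      ((if j = b then _ else 0 : So K m) : Matrix (Fin m) (Fin m) K) -
      ((if i = a then _ else 0 : So K m) : Matrix (Fin m) (Fin m) K) +
      ((if i = b then _ else 0 : So K m) : Matrix (Fin m) (Fin m) K)
    simp only [h1]
    change _ = (if j = a then skewMat K m i b else 0) - (if j = b then skewMat K m i a else 0) -
      (if i = a then skewMat K m j b else 0) + (if i = b then skewMat K m j a else 0)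
    have h2 : ∀ i j a b : Fin m, Matrix.single i j (1 : K) * Matrix.single a b (1 : K) =
        if j = a then Matrix.single i b 1 else 0 := by
      intro i j a b
      split_ifs with h
      · subst h; simp
      · exact Matrix.single_mul_single_of_ne _ _ _ _ h _
    simp only [skewMat, sub_mul, mul_sub, h2]
    simp only [eq_comm (a := b) (b := i), eq_comm (a := a) (b := i), eq_comm (a := b) (b := j),
      eq_comm (a := a) (b := j)]
    have h3 : ∀ (P : Prop) [Decidable P] (x y : Matrix (Fin m) (Fin m) K),
        (if P then x - y else 0) = (if P then x else 0) - if P then y else 0 := by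
      intro P _ x y; split_ifs <;> simp
    simp only [h3]
    abel

variable [Algebra K R] [NeZero (2 : K)]

lemma SoRel.sum_mul_sum {G : Fin m → Fin m → R} (h : SoRel G) {x y : Matrix (Fin m) (Fin m) K}
    (hx : xᵀ = -x) (hy : yᵀ = -y) :
    (∑ i, ∑ j, x i j • G i j) * (∑ i, ∑ j, y i j • G i j) -
      (∑ i, ∑ j, y i j • G i j) * (∑ i, ∑ j, x i j • G i j) =
      4 • ∑ i, ∑ j, (x * y) i j • G i j := by
  have hx' : ∀ i j, x j i = - x i j := fun i j => by simpa using congrFun (congrFun hx i) j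
  have hy' : ∀ i j, y j i = - y i j := fun i j => by simpa using congrFun (congrFun hy i) j
  have h1 : (∑ i, ∑ j, x i j • G i j) * (∑ i, ∑ j, y i j • G i j) -
      (∑ i, ∑ j, y i j • G i j) * (∑ i, ∑ j, x i j • G i j) =
      ∑ i, ∑ j, ∑ a, ∑ b, (x i j * y a b) • (G i j * G a b - G a b * G i j) := by
    have h2 : (∑ i, ∑ j, y i j • G i j) * (∑ i, ∑ j, x i j • G i j) =
        ∑ i, ∑ j, ∑ a, ∑ b, (x i j * y a b) • (G a b * G i j) := by
      rw [Finset.mul_sum]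
      refine Finset.sum_congr rfl fun i _ => ?_
      rw [Finset.mul_sum]
      refine Finset.sum_congr rfl fun j _ => ?_
      rw [Finset.sum_mul]
      refine Finset.sum_congr rfl fun a _ => ?_
      rw [Finset.sum_mul]
      refine Finset.sum_congr rfl fun b _ => ?_
      rw [smul_mul_smul_comm, mul_comm (y a b)]
    have h3 : (∑ i, ∑ j, x i j • G i j) * (∑ i, ∑ j, y i j • G i j) =
        ∑ i, ∑ j, ∑ a, ∑ b, (x i j * y a b) • (G i j * G a b) := by
      rw [Finset.sum_mul]
      refine Finset.sum_congr rfl fun i _ => ?_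
      rw [Finset.sum_mul]
      refine Finset.sum_congr rfl fun j _ => ?_
      rw [Finset.mul_sum]
      refine Finset.sum_congr rfl fun a _ => ?_
      rw [Finset.mul_sum]
      refine Finset.sum_congr rfl fun b _ => ?_
      rw [smul_mul_smul_comm]
    rw [h2, h3]
    simp only [smul_sub, Finset.sum_sub_distrib]
  rw [h1]
  simp only [h.comm, smul_add, smul_sub, Finset.sum_sub_distrib, Finset.sum_add_distrib, smul_ite,
    smul_zero]
  have hA : ∑ i, ∑ j, ∑ a, ∑ b, (if j = a then (x i j * y a b) • G i b else 0) =
      ∑ i, ∑ j, (x * y) i j • G i j := by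
    refine Finset.sum_congr rfl fun i _ => ?_
    simp only [mul_apply, Finset.sum_smul]
    rw [Finset.sum_comm (γ := Fin m) (s := Finset.univ) (t := Finset.univ) (f := fun b j => (x i j * y j b) • G i b)]
    refine Finset.sum_congr rfl fun j _ => ?_
    rw [Finset.sum_comm]
    refine Finset.sum_congr rfl fun b _ => ?_
    simp
  have hB : ∑ i, ∑ j, ∑ a, ∑ b, (if j = b then (x i j * y a b) • G i a else 0) =
      - ∑ i, ∑ j, (x * y) i j • G i j := by
    rw [← hA, ← Finset.sum_neg_distrib]
    refine Finset.sum_congr rfl fun i _ => ?_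
    rw [← Finset.sum_neg_distrib]
    refine Finset.sum_congr rfl fun j _ => ?_
    rw [Finset.sum_comm, ← Finset.sum_neg_distrib]
    refine Finset.sum_congr rfl fun a _ => ?_
    rw [← Finset.sum_neg_distrib]
    refine Finset.sum_congr rfl fun b _ => ?_
    rw [hy' a b]
    split_ifs <;> simp
  have hC : ∑ i, ∑ j, ∑ a, ∑ b, (if i = a then (x i j * y a b) • G j b else 0) =
      - ∑ i, ∑ j, (x * y) i j • G i j := by
    rw [← hA, ← Finset.sum_neg_distrib, Finset.sum_comm]
    refine Finset.sum_congr rfl fun i _ => ?_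
    rw [← Finset.sum_neg_distrib]
    refine Finset.sum_congr rfl fun j _ => ?_
    rw [← Finset.sum_neg_distrib]
    refine Finset.sum_congr rfl fun a _ => ?_
    rw [← Finset.sum_neg_distrib]
    refine Finset.sum_congr rfl fun b _ => ?_
    rw [hx' i j]
    split_ifs <;> simp
  have hD : ∑ i, ∑ j, ∑ a, ∑ b, (if i = b then (x i j * y a b) • G j a else 0) =
      ∑ i, ∑ j, (x * y) i j • G i j := by
    rw [← neg_inj, ← hB, ← Finset.sum_neg_distrib, Finset.sum_comm]
    refine Finset.sum_congr rfl fun i _ => ?_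
    rw [← Finset.sum_neg_distrib]
    refine Finset.sum_congr rfl fun j _ => ?_
    rw [← Finset.sum_neg_distrib]
    refine Finset.sum_congr rfl fun a _ => ?_
    rw [← Finset.sum_neg_distrib]
    refine Finset.sum_congr rfl fun b _ => ?_
    rw [hx' i j]
    split_ifs <;> simp
  rw [hA, hB, hC, hD]
  abel

/-- The homomorphism from the orthogonal Lie algebra determined by a solution of its relations. -/
def soHom {G : Fin m → Fin m → R} (h : SoRel G) : So K m →ₗ⁅K⁆ R where
  toFun x := (2 : K)⁻¹ • ∑ i, ∑ j, x.1 i j • G i j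
  map_add' x y := by
    have h1 : ∀ i j, (x + y).1 i j = x.1 i j + y.1 i j := fun _ _ => rfl
    simp only [h1, add_smul, Finset.sum_add_distrib, smul_add]
  map_smul' c x := by
    have h1 : ∀ i j, (c • x).1 i j = c * x.1 i j := fun _ _ => rfl
    simp only [h1, mul_smul, ← Finset.smul_sum, RingHom.id_apply]
    rw [smul_comm]
  map_lie' {x y} := by
    have hx := (LieAlgebra.Orthogonal.mem_so (Fin m) K x.1).1 x.2
    have hy := (LieAlgebra.Orthogonal.mem_so (Fin m) K y.1).1 y.2
    rw [LieRing.of_associative_ring_bracket, smul_mul_smul_comm, smul_mul_smul_comm, ← smul_sub,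
      h.sum_mul_sum hx hy]
    have h1 : ∑ i, ∑ j, ⁅x, y⁆.1 i j • G i j = (2 : K) • ∑ i, ∑ j, (x.1 * y.1) i j • G i j := by
      have h2 : ∀ i j, ⁅x, y⁆.1 i j = (x.1 * y.1) i j - (x.1 * y.1) j i := by
        intro i j
        have h3 : (y.1 * x.1 : Matrix _ _ K) = (x.1 * y.1)ᵀ := by
          rw [transpose_mul, hx, hy, neg_mul_neg]
        change (x.1 * y.1 - y.1 * x.1 : Matrix _ _ K) i j = _
        rw [h3]; rfl
      simp only [h2, sub_smul, Finset.sum_sub_distrib]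
      have h4 : ∑ i, ∑ j, (x.1 * y.1) j i • G i j = - ∑ i, ∑ j, (x.1 * y.1) i j • G i j := by
        rw [Finset.sum_comm, ← Finset.sum_neg_distrib]
        refine Finset.sum_congr rfl fun i _ => ?_
        rw [← Finset.sum_neg_distrib]
        refine Finset.sum_congr rfl fun j _ => ?_
        rw [h.swap i j, smul_neg]
      rw [h4, sub_neg_eq_add, two_smul]
    rw [h1, smul_smul, ← Nat.cast_smul_eq_nsmul K, smul_smul]
    congr 1
    have := NeZero.ne (2 : K)
    push_cast
    field_simp
    norm_num

lemma soHom_apply {G : Fin m → Fin m → R} (h : SoRel G) (x : So K m) :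
    soHom h x = (2 : K)⁻¹ • ∑ i, ∑ j, x.1 i j • G i j := rfl

/-- The matrix `a bᵀ - b aᵀ` as an element of the orthogonal Lie algebra. -/
def wedge (a b : Fin m → K) : So K m :=
  ⟨vecMulVec a b - vecMulVec b a, by
    rw [LieAlgebra.Orthogonal.mem_so, transpose_sub, transpose_vecMulVec, transpose_vecMulVec,
      neg_sub]⟩

omit [NeZero (2 : K)] in
lemma wedge_apply (a b : Fin m → K) (i j : Fin m) :
    (wedge a b).1 i j = a i * b j - b i * a j := rfl

lemma soHom_wedge {G : Fin m → Fin m → R} (h : SoRel G) (a b : Fin m → K) :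
    soHom h (wedge a b) = ∑ i, ∑ j, (a i * b j) • G i j := by
  have h1 : ∑ i, ∑ j, (wedge a b).1 i j • G i j = (2 : K) • ∑ i, ∑ j, (a i * b j) • G i j := by
    simp only [wedge_apply, sub_smul, Finset.sum_sub_distrib]
    have h4 : ∑ i, ∑ j, (b i * a j) • G i j = - ∑ i, ∑ j, (a i * b j) • G i j := by
      rw [Finset.sum_comm, ← Finset.sum_neg_distrib]
      refine Finset.sum_congr rfl fun i _ => ?_
      rw [← Finset.sum_neg_distrib]
      refine Finset.sum_congr rfl fun j _ => ?_
      rw [h.swap i j, smul_neg, mul_comm]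
    rw [h4, sub_neg_eq_add, two_smul]
  rw [soHom_apply, h1, smul_smul, inv_mul_cancel₀ (NeZero.ne _), one_smul]

lemma soHom_skewGen {G : Fin m → Fin m → R} (h : SoRel G) (i j : Fin m) :
    soHom h (skewGen K m i j) = G i j := by
  have h1 : skewGen K m i j = wedge (Pi.single i 1) (Pi.single j 1) := by
    refine Subtype.ext (Matrix.ext fun a b => ?_)
    rw [wedge_apply]
    change skewMat K m i j a b = _
    rw [skewMat_apply]
    rw [ite_and, ite_and]
    simp only [Pi.single_apply, eq_comm (a := i) (b := a), eq_comm (a := j) (b := b),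
      eq_comm (a := j) (b := a), eq_comm (a := i) (b := b)]
    by_cases h1 : a = i <;> by_cases h2 : b = j <;> by_cases h3 : a = j <;> by_cases h4 : b = i <;>
      by_cases h5 : i = j <;> simp [h1, h2, h3, h4, h5, eq_comm (a := j) (b := i)]
  rw [h1, soHom_wedge, Finset.sum_eq_single i, Finset.sum_eq_single j]
  · simp
  · intro b _ hb; simp [hb]
  · simp
  · intro b _ hb; simp [hb]
  · simp

omit [NeZero (2 : K)] in
lemma lie_wedge (a b c d : Fin m → K) : ⁅wedge a b, wedge c d⁆ =
    (b ⬝ᵥ c) • wedge a d - (b ⬝ᵥ d) • wedge a c - (a ⬝ᵥ c) • wedge b d + (a ⬝ᵥ d) • wedge b c := by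
  refine Subtype.ext ?_
  change (vecMulVec a b - vecMulVec b a) * (vecMulVec c d - vecMulVec d c) -
    (vecMulVec c d - vecMulVec d c) * (vecMulVec a b - vecMulVec b a) =
    (b ⬝ᵥ c) • (vecMulVec a d - vecMulVec d a) - (b ⬝ᵥ d) • (vecMulVec a c - vecMulVec c a) -
      (a ⬝ᵥ c) • (vecMulVec b d - vecMulVec d b) + (a ⬝ᵥ d) • (vecMulVec b c - vecMulVec c b)
  refine Matrix.ext fun i j => ?_
  simp only [sub_mul, mul_sub, vecMulVec_mul_vecMulVec]
  simp only [Matrix.sub_apply, Matrix.add_apply, Matrix.smul_apply, vecMulVec_apply, smul_eq_mul]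
  simp only [dotProduct_comm d, dotProduct_comm c]
  simp [Pi.smul_apply]
  ring

end Lift

end SoGK

namespace SoGK

open MvPolynomial Matrix

attribute [local instance] LieRing.ofAssociativeRing

section CommonVectors

variable {Ω V : Type*} [Field Ω] [AddCommGroup V] [Module Ω V]

lemma exists_common_kernel [Nontrivial V] {κ : Type*} [Fintype κ] [DecidableEq κ]
    (b : κ → Module.End Ω V) (ht : κ → ℕ) (hnil : ∀ i, IsNilpotent (b i))
    (hbr : ∀ i j, b i * b j - b j * b i ∈
      Submodule.span Ω (b '' {l | ht i < ht l ∧ ht j < ht l})) :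
    ∃ v ≠ 0, ∀ i, b i v = 0 := by
  suffices H : ∀ s : Finset κ, (∀ i ∈ s, ∀ l, ht i < ht l → l ∈ s) →
      ∃ v ≠ 0, ∀ i ∈ s, b i v = 0 by
    obtain ⟨v, hv, h⟩ := H Finset.univ (by simp)
    exact ⟨v, hv, fun i => h i (Finset.mem_univ i)⟩
  intro s
  induction s using Finset.induction_on_min_value ht with
  | empty =>
    obtain ⟨v, hv⟩ := exists_ne (0 : V)
    exact fun _ => ⟨v, hv, by simp⟩
  | insert a s has hmin ih =>
    intro hup
    obtain ⟨v, hv, hs⟩ := ih fun i hi l hl => by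
      rcases Finset.mem_insert.1 (hup i (Finset.mem_insert_of_mem hi) l hl) with rfl | h
      · exact absurd (hmin i hi) (not_le.2 hl)
      · exact h
    have hstab : ∀ w : V, (∀ i ∈ s, b i w = 0) → ∀ i ∈ s, b i (b a w) = 0 := by
      intro w hw i hi
      have h1 : ∀ T ∈ Submodule.span Ω (b '' {l | ht i < ht l ∧ ht a < ht l}), T w = 0 := by
        intro T hT
        induction hT using Submodule.span_induction with
        | mem x hx =>
          obtain ⟨l, hl, rfl⟩ := hx
          refine hw l ?_
          rcases Finset.mem_insert.1 (hup a (Finset.mem_insert_self _ _) l hl.2) with rfl | h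
          · exact absurd hl.2 (lt_irrefl _)
          · exact h
        | zero => rfl
        | add x y _ _ hx hy => rw [LinearMap.add_apply, hx, hy, add_zero]
        | smul c x _ hx => rw [LinearMap.smul_apply, hx, smul_zero]
      have h2 := h1 _ (hbr i a)
      rw [LinearMap.sub_apply, Module.End.mul_apply, Module.End.mul_apply, hw i hi, map_zero,
        sub_zero] at h2
      exact h2
    have hstab' : ∀ n, ∀ i ∈ s, b i ((b a ^ n) v) = 0 := by
      intro n
      induction n with
      | zero => exact hs
      | succ n ih => rw [pow_succ']; exact hstab _ ih
    classical
    have hex : ∃ n, (b a ^ n) v = 0 := by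
      obtain ⟨n, hn⟩ := hnil a
      exact ⟨n, by rw [hn]; rfl⟩
    have h0 : Nat.find hex ≠ 0 := fun h => hv (by simpa [h] using Nat.find_spec hex)
    obtain ⟨n, hn⟩ := Nat.exists_eq_succ_of_ne_zero h0
    refine ⟨(b a ^ n) v, Nat.find_min hex (by omega), fun i hi => ?_⟩
    rcases Finset.mem_insert.1 hi with rfl | hi
    · have := Nat.find_spec hex
      rwa [hn, pow_succ'] at this
    · exact hstab' n i hi

lemma exists_common_eigenvector [IsAlgClosed Ω] [FiniteDimensional Ω V] {κ : Type*} [Fintype κ]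
    (f : κ → Module.End Ω V) (hf : ∀ i j, Commute (f i) (f j)) (N : Submodule Ω V) (hN : N ≠ ⊥)
    (hst : ∀ i, ∀ v ∈ N, f i v ∈ N) : ∃ v ∈ N, v ≠ 0 ∧ ∃ c : κ → Ω, ∀ i, f i v = c i • v := by
  classical
  suffices H : ∀ s : Finset κ, ∃ N' ≤ N, N' ≠ ⊥ ∧ (∀ i, ∀ v ∈ N', f i v ∈ N') ∧
      ∀ i ∈ s, ∃ c : Ω, ∀ v ∈ N', f i v = c • v by
    obtain ⟨N', hle, hne, -, h⟩ := H Finset.univ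
    obtain ⟨v, hv, hv0⟩ := Submodule.exists_mem_ne_zero_of_ne_bot hne
    choose c hc using fun i => h i (Finset.mem_univ i)
    exact ⟨v, hle hv, hv0, c, fun i => hc i v hv⟩
  intro s
  induction s using Finset.induction_on with
  | empty => exact ⟨N, le_rfl, hN, hst, by simp⟩
  | insert a s _ ih =>
    obtain ⟨N', hle, hne, hst', h⟩ := ih
    haveI : Nontrivial N' := Submodule.nontrivial_iff_ne_bot.2 hne
    obtain ⟨c, hc⟩ := Module.End.exists_eigenvalue ((f a).restrict (hst' a))
    obtain ⟨w, hw⟩ := hc.exists_hasEigenvector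
    have hw1 : f a w.1 = c • w.1 := congrArg Subtype.val hw.apply_eq_smul
    refine ⟨N' ⊓ (f a).eigenspace c, inf_le_left.trans hle, ?_, ?_, ?_⟩
    · refine (Submodule.ne_bot_iff _).2 ⟨w.1, ⟨w.2, Module.End.mem_eigenspace_iff.2 hw1⟩, ?_⟩
      exact fun h0 => hw.2 (Subtype.ext h0)
    · rintro i v ⟨hv, hva⟩
      refine ⟨hst' i v hv, Module.End.mem_eigenspace_iff.2 ?_⟩
      have h1 : f a (f i v) = f i (f a v) := LinearMap.congr_fun (hf a i).eq v
      rw [h1, Module.End.mem_eigenspace_iff.1 hva, map_smul]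
    · intro i hi
      rcases Finset.mem_insert.1 hi with rfl | hi
      · exact ⟨c, fun v hv => Module.End.mem_eigenspace_iff.1 hv.2⟩
      · obtain ⟨d, hd⟩ := h i hi
        exact ⟨d, fun v hv => hd v hv.1⟩

end CommonVectors

section HighestWeight

/-- The relations of the orthogonal Lie algebra in a basis `w` with `w i ⬝ w j = δ_{j, rev i}`. -/
structure WittRel {m : ℕ} {R : Type*} [Ring R] (β : Fin m → Fin m → R) : Prop where
  swap : ∀ i j, β j i = - β i j
  comm : ∀ i j a b, β i j * β a b - β a b * β i j =
    (if a = j.rev then β i b else 0) - (if b = j.rev then β i a else 0) -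
      (if a = i.rev then β j b else 0) + (if b = i.rev then β j a else 0)

/-- The integer shifts occurring in the Casimir eigenvalue. -/
def rhoCount {m : ℕ} (i : Fin m) : ℕ := Fintype.card {j : Fin m // i < j.rev ∧ j ≠ i}

variable {m : ℕ} {Ω V : Type*} [Field Ω] [AddCommGroup V] [Module Ω V]
  {β : Fin m → Fin m → Module.End Ω V}

lemma WittRel.self [NeZero (2 : Ω)] (h : WittRel β) (i : Fin m) : β i i = 0 := by
  have h1 : (2 : Ω) • β i i = 0 := by
    rw [two_smul]; nth_rewrite 1 [h.swap i i]; exact neg_add_cancel _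
  exact (smul_eq_zero.1 h1).resolve_left (NeZero.ne _)

lemma WittRel.exists_highestWeight [IsAlgClosed Ω] [NeZero (2 : Ω)] [FiniteDimensional Ω V]
    [Nontrivial V] (h : WittRel β)
    (hnil : ∀ i j, i < j.rev → IsNilpotent (β i j)) :
    ∃ v ≠ 0, (∀ i j, i < j.rev → β i j v = 0) ∧
      ∃ c : Fin m → Ω, ∀ i, β i i.rev v = c i • v := by
  let N : Submodule Ω V := ⨅ c : {c : Fin m × Fin m // c.1 < c.2.rev}, LinearMap.ker (β c.1.1 c.1.2)
  have hmem : ∀ v, v ∈ N ↔ ∀ i j, i < j.rev → β i j v = 0 := by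
    intro v
    simp only [N, Submodule.mem_iInf, LinearMap.mem_ker, Subtype.forall, Prod.forall]
  suffices H : (∀ i j, Commute (β i i.rev) (β j j.rev)) ∧ N ≠ ⊥ ∧
      ∀ i, ∀ v ∈ N, β i i.rev v ∈ N by
    obtain ⟨v, hvN, hv0, c, hc⟩ := exists_common_eigenvector (fun i => β i i.rev) H.1 N H.2.1 H.2.2
    exact ⟨v, hv0, (hmem v).1 hvN, c, hc⟩
  refine ⟨?_, ?_, ?_⟩
  · intro i j
    rw [commute_iff_eq, ← sub_eq_zero, h.comm]
    by_cases h1 : i = j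
    · subst h1
      by_cases h2 : i = i.rev
      · rw [← h2, h.self]; simp
      · simp [h2, Ne.symm h2, h.swap i i.rev]
    · by_cases h2 : j = i.rev
      · subst h2
        simp only [Fin.rev_rev, Fin.rev_inj, if_true, h.self]
        simp [h1, Ne.symm h1, h.swap i i.rev]
      · have h3 : ¬ j.rev = i := fun hh => h2 (by rw [← hh, Fin.rev_rev])
        simp [h1, h2, h3, Ne.symm h1]
  · suffices H : ∃ v ≠ 0, ∀ c : {c : Fin m × Fin m // c.1 < c.2.rev}, β c.1.1 c.1.2 v = 0 by
      obtain ⟨v, hv, hv0⟩ := H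
      exact (Submodule.ne_bot_iff _).2 ⟨v, (hmem v).2 fun i j hij => hv0 ⟨(i, j), hij⟩, hv⟩
    refine exists_common_kernel
      (fun c : {c : Fin m × Fin m // c.1 < c.2.rev} => β c.1.1 c.1.2)
      (fun c => m - 1 - c.1.1 - c.1.2) (fun c => hnil _ _ c.2) ?_
    · rintro ⟨⟨i, j⟩, hij⟩ ⟨⟨a, b⟩, hab⟩
      rw [h.comm]
      dsimp only
      replace hij : (i : ℕ) < m - (j + 1) := by rwa [← Fin.val_rev, ← Fin.lt_def]
      replace hab : (a : ℕ) < m - (b + 1) := by rwa [← Fin.val_rev, ← Fin.lt_def]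
      have key : ∀ (P : Prop) [Decidable P] (x y : Fin m), (P → x < y.rev ∧
          m - 1 - i - j < m - 1 - x - y ∧ m - 1 - a - b < m - 1 - x - y) →
          (if P then β x y else 0) ∈ Submodule.span Ω
            ((fun c : {c : Fin m × Fin m // c.1 < c.2.rev} => β c.1.1 c.1.2) ''
            {l | m - 1 - (i : ℕ) - j < m - 1 - l.1.1 - l.1.2 ∧
              m - 1 - (a : ℕ) - b < m - 1 - l.1.1 - l.1.2}) := by
        intro P _ x y hP
        split_ifs with hp
        · exact Submodule.subset_span ⟨⟨(x, y), (hP hp).1⟩, (hP hp).2, rfl⟩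
        · exact zero_mem _
      refine add_mem (sub_mem (sub_mem ?_ ?_) ?_) ?_
      all_goals
        refine key _ _ _ fun hp => ?_
        have := congrArg Fin.val hp
        rw [Fin.val_rev] at this
        rw [Fin.lt_def, Fin.val_rev]
        omega
  · intro l v hv
    rw [hmem] at hv ⊢
    intro i j hij
    have h1 := LinearMap.congr_fun (h.comm i j l l.rev) v
    rw [LinearMap.sub_apply, Module.End.mul_apply, Module.End.mul_apply, hv i j hij, map_zero,
      sub_zero] at h1
    have h2 : β i j v = 0 := hv i j hij
    have h3 : β j i v = 0 := by rw [h.swap i j, LinearMap.neg_apply, h2, neg_zero]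
    rw [h1]
    simp only [LinearMap.add_apply, LinearMap.sub_apply]
    have key : ∀ (P : Prop) [Decidable P] (T : Module.End Ω V), (P → T v = 0) →
        (if P then T else 0 : Module.End Ω V) v = 0 := by
      intro P _ T hT
      split_ifs with hp
      · exact hT hp
      · rfl
    rw [key, key, key, key]
    · simp
    · intro hp; rwa [show l = i by simpa using hp]
    · intro hp; subst hp; rwa [Fin.rev_rev]
    · intro hp; rwa [show l = j by simpa using hp]
    · intro hp; subst hp; rwa [Fin.rev_rev]

lemma WittRel.casimir_apply [NeZero (2 : Ω)] (h : WittRel β) {v : V} {c : Fin m → Ω}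
    (hv : ∀ i j, i < j.rev → β i j v = 0) (hc : ∀ i, β i i.rev v = c i • v) :
    (∑ i, ∑ j, β i j * β j.rev i.rev) v =
      (∑ i, c i ^ 2 + 2 * ∑ i, (rhoCount i : Ω) * c i) • v := by
  have h1 : ∀ i j, (β i j * β j.rev i.rev) v =
      ((if j = i.rev then c i ^ 2 else 0) + ((if i < j.rev ∧ j ≠ i then c i else 0) +
        (if j < i.rev ∧ i ≠ j then c j else 0))) • v := by
    intro i j
    have hrev : j < i.rev ↔ i < j.rev := by
      rw [Fin.lt_def, Fin.lt_def, Fin.val_rev, Fin.val_rev]; omega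
    rcases lt_trichotomy j.rev i with hlt | heq | hgt
    · have h2 : β j.rev i.rev v = 0 := hv _ _ (by rwa [Fin.rev_rev])
      have h3 : ¬ i < j.rev := not_lt.2 hlt.le
      have h4 : ¬ j = i.rev := fun hh => by subst hh; simp at hlt
      simp [h2, h3, h4, hrev]
    · have h5 : j = i.rev := by rw [← heq, Fin.rev_rev]
      subst h5
      simp only [Fin.rev_rev, lt_self_iff_false, false_and, if_false, if_true, add_zero]
      rw [Module.End.mul_apply, hc, map_smul, hc, smul_smul, sq]
    · have h4 : ¬ j = i.rev := fun hh => by subst hh; simp at hgt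
      have h2 := LinearMap.congr_fun (h.comm i j j.rev i.rev) v
      rw [LinearMap.sub_apply, Module.End.mul_apply (β j.rev i.rev), hv i j hgt, map_zero,
        sub_zero] at h2
      rw [h2]
      by_cases hij : j = i
      · subst hij
        simp [h4]
      · have h6 : ¬ i.rev = j.rev := fun hh => hij (Fin.rev_injective hh).symm
        simp [h4, hij, Ne.symm hij, hrev, hgt, h6, Ne.symm h6, hc, add_smul]
  have h2 : ∀ i : Fin m, ∑ j, (if i < j.rev ∧ j ≠ i then c i else 0) = rhoCount i * c i := by
    intro i
    rw [← Finset.sum_filter, Finset.sum_const, nsmul_eq_mul, rhoCount, Fintype.card_subtype]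
  simp only [LinearMap.sum_apply, h1, ← Finset.sum_smul]
  congr 1
  simp only [Finset.sum_add_distrib]
  rw [Finset.sum_comm (f := fun i j => if j < i.rev ∧ i ≠ j then c j else 0)]
  simp only [h2]
  simp
  ring

end HighestWeight

end SoGK

namespace SoGK

open MvPolynomial Matrix

attribute [local instance] LieRing.ofAssociativeRing

section Wedge

variable {K : Type} [Field K] {m : ℕ}

lemma wedge_swap (a b : Fin m → K) : wedge b a = - wedge a b :=
  Subtype.ext (neg_sub _ _).symm

lemma wedge_pow_three (a b : Fin m → K) (h : a ⬝ᵥ b = 0) (h' : (a ⬝ᵥ a) * (b ⬝ᵥ b) = 0) :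
    (wedge a b).1 ^ 3 = 0 := by
  have hb : b ⬝ᵥ a = 0 := by rw [dotProduct_comm, h]
  change (vecMulVec a b - vecMulVec b a) ^ 3 = 0
  refine Matrix.ext fun i j => ?_
  simp only [pow_succ, pow_zero, one_mul, sub_mul, mul_sub, vecMulVec_mul_vecMulVec, smul_mul_assoc,
    Matrix.smul_mul, h, hb, zero_smul, smul_zero, sub_zero, zero_sub, Matrix.sub_apply, Matrix.smul_apply, vecMulVec_apply,
    vecMulVec_smul, smul_vecMulVec, Matrix.neg_apply, Matrix.zero_apply, smul_eq_mul]
  simp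
  linear_combination (-(a i * b j - b i * a j)) * h'

lemma wedge_pow_three' (a b : Fin m → K) (h : a ⬝ᵥ b = 1) (ha : a ⬝ᵥ a = 0) (hb : b ⬝ᵥ b = 0) :
    (wedge a b).1 ^ 3 = (wedge a b).1 := by
  have h' : b ⬝ᵥ a = 1 := by rw [dotProduct_comm, h]
  change (vecMulVec a b - vecMulVec b a) ^ 3 = vecMulVec a b - vecMulVec b a
  simp only [pow_succ, pow_zero, one_mul, sub_mul, mul_sub, vecMulVec_mul_vecMulVec,
    h, h', ha, hb, zero_smul, one_smul, sub_zero, zero_sub, vecMulVec_zero, zero_vecMulVec]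
  simp [vecMulVec_mul_vecMulVec, h, h', ha, hb]

lemma pow_odd_of_pow_three {R : Type*} [Monoid R] {x : R} (h : x ^ 3 = x) {n : ℕ} (hn : Odd n) :
    x ^ n = x := by
  obtain ⟨j, rfl⟩ := hn
  induction j with
  | zero => simp
  | succ j ih => rw [show 2 * (j + 1) + 1 = (2 * j + 1) + 2 by ring, pow_add, ih, ← pow_succ', h]

end Wedge

section Casimir

variable {k : Type} [Field k] {m : ℕ} [NeZero m] (p : ℕ) [Fact p.Prime] [CharP k p]
  [NeZero (2 : k)]

variable (k m) in
/-- The quadratic Casimir element of the orthogonal Lie algebra. -/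
def casimir : Env k m := ∑ a, ∑ b, envι k (skewGen k m a b) * envι k (skewGen k m b a)

/-- The half-sum-of-roots shift. -/
def rhoShift (R : Type*) [DivisionRing R] (i : Fin m) : R := ((rhoCount i : R) - rhoCount i.rev) / 2

variable {Ω : Type} [Field Ω] [Algebra k Ω]

variable (k Ω) in
/-- Extension of scalars of skew-symmetric matrices. -/
def soMap (x : So k m) : So Ω m := ⟨x.1.map (algebraMap k Ω), by
  have hx := (LieAlgebra.Orthogonal.mem_so (Fin m) k x.1).1 x.2
  rw [LieAlgebra.Orthogonal.mem_so, ← transpose_map, hx]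
  ext i j; simp⟩


lemma soMap_gen (c : SkewIdx m) : soMap k Ω (gen k c) = gen Ω c := by
  refine Subtype.ext (Matrix.ext fun a b => ?_)
  change algebraMap k Ω (skewMat k m c.1.1 c.1.2 a b) = skewMat Ω m c.1.1 c.1.2 a b
  rw [skewMat_apply, skewMat_apply, map_sub, apply_ite (algebraMap k Ω), apply_ite (algebraMap k Ω),
    map_one, map_zero]

lemma sum_skewIdx_sub {R : Type*} [CommRing R] [NoZeroDivisors R] [NeZero (2 : R)]
    {Y : Matrix (Fin m) (Fin m) R} (hY : Yᵀ = -Y) (f : Fin m → Fin m → R) :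
    ∑ c : SkewIdx m, (f c.1.1 c.1.2 - f c.1.2 c.1.1) * Y c.1.1 c.1.2 = ∑ i, ∑ j, f i j * Y i j := by
  have hY' : ∀ i j, Y j i = - Y i j := fun i j => by simpa using congrFun (congrFun hY i) j
  have hd : ∀ i, Y i i = 0 := fun i => by
    have h1 : 2 * Y i i = 0 := by rw [two_mul]; nth_rewrite 1 [hY' i i]; exact neg_add_cancel _
    exact (mul_eq_zero.1 h1).resolve_left (NeZero.ne _)
  rw [← sum_skewIdx fun a b _ => (f a b - f b a) * Y a b]
  have h1 : ∀ i j, f i j * Y i j = (if i < j then f i j * Y i j else 0) +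
      (if j < i then f i j * Y i j else 0) := by
    intro i j
    rcases lt_trichotomy i j with h | rfl | h
    · simp [h, h.not_gt]
    · simp [hd]
    · simp [h, h.not_gt]
  rw [Finset.sum_congr rfl fun i _ => Finset.sum_congr rfl fun j _ => h1 i j]
  simp only [Finset.sum_add_distrib]
  rw [Finset.sum_comm (f := fun i j => if j < i then f i j * Y i j else 0)]
  rw [← Finset.sum_add_distrib]
  refine Finset.sum_congr rfl fun i _ => ?_
  rw [← Finset.sum_add_distrib]
  refine Finset.sum_congr rfl fun j _ => ?_
  by_cases h : i < j
  · simp only [h, dif_pos, if_true]; rw [hY' i j]; ring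
  · simp [h]

/-- The defect of a representation of the orthogonal Lie algebra from being restricted. -/
def powDefect {R : Type*} [Ring R] [Algebra Ω R] [CharP Ω p] [NeZero (2 : Ω)]
    (ρ : So Ω m →ₗ⁅Ω⁆ R) [Nontrivial R] : So Ω m →+ R :=
  AddMonoidHom.mk' (fun x => ρ x ^ p - ρ (powSo p x)) fun x y => by
    haveI : CharP R p := charP_of_injective_algebraMap (algebraMap Ω R).injective p
    exact pow_defect_add p (odd_char Ω p) (So Ω m) (fun x hx => pow_mem_so p hx) ρ x y

section

variable {R : Type*} [Ring R] [Algebra Ω R] [CharP Ω p] [NeZero (2 : Ω)] [Nontrivial R]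
  {ρ : So Ω m →ₗ⁅Ω⁆ R}

lemma powDefect_apply (x : So Ω m) : powDefect p ρ x = ρ x ^ p - ρ (powSo p x) := rfl

lemma powDefect_smul (c : Ω) (x : So Ω m) : powDefect p ρ (c • x) = c ^ p • powDefect p ρ x := by
  have h : powSo p (c • x) = c ^ p • powSo p x := Subtype.ext (smul_pow c x.1 p)
  rw [powDefect_apply, powDefect_apply, h, map_smul, map_smul, smul_pow, smul_sub]

lemma powDefect_wedge {Y : Matrix (Fin m) (Fin m) Ω} (hY : Yᵀ = -Y)
    (hρ : ∀ c : SkewIdx m, powDefect p ρ (gen Ω c) = algebraMap Ω R (Y c.1.1 c.1.2))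
    (a b : Fin m → Ω) :
    powDefect p ρ (wedge a b) =
      algebraMap Ω R ((fun i => a i ^ p) ⬝ᵥ Y *ᵥ fun i => b i ^ p) := by
  have h1 : (fun i => a i ^ p) ⬝ᵥ Y *ᵥ (fun i => b i ^ p) = ∑ i, ∑ j, (a i ^ p * b j ^ p) * Y i j := by
    simp only [dotProduct, mulVec, Finset.mul_sum]
    refine Finset.sum_congr rfl fun i _ => Finset.sum_congr rfl fun j _ => ?_
    ring
  rw [h1, ← sum_skewIdx_sub hY fun i j => a i ^ p * b j ^ p, So.eq_sum (wedge a b), map_sum, map_sum]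
  refine Finset.sum_congr rfl fun c _ => ?_
  rw [powDefect_smul, hρ, Algebra.smul_def, ← map_mul, wedge_apply, sub_pow_char, mul_pow, mul_pow]
  congr 2
  ring

end

lemma EigenBasis.sum_mul_sum {R : Type*} [Ring R] [Algebra Ω R] {X : Matrix (Fin m) (Fin m) Ω}
    {x : Fin m → Ω} {w : Fin m → Fin m → Ω} (h : EigenBasis X x w) (H H' : Fin m → R) :
    ∑ j, (∑ b, w j b • H b) * (∑ c, w j.rev c • H' c) = ∑ b, H b * H' b := by
  have h1 : ∀ b c, ∑ j, w j b * w j.rev c = if b = c then 1 else 0 := by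
    intro b c
    rw [← Matrix.one_apply, ← h.specMat_one, specMat, Matrix.sum_apply]
    exact Finset.sum_congr rfl fun j _ => by
      rw [Matrix.smul_apply, vecMulVec_apply, Pi.one_apply, one_smul]
  simp_rw [Finset.sum_mul, Finset.mul_sum, smul_mul_smul_comm]
  rw [Finset.sum_comm]
  refine Finset.sum_congr rfl fun b _ => ?_
  rw [Finset.sum_comm]
  simp_rw [← Finset.sum_smul, h1]
  simp

/-- A representation of the enveloping algebra on which the `p`-centre acts through the entries of
a diagonalisable skew-symmetric matrix has an eigenvector for the Casimir element. -/
theorem exists_casimir_eigenvector [IsAlgClosed Ω] [CharP Ω p] [NeZero (2 : Ω)] {V : Type*}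
    [AddCommGroup V] [Module Ω V] [FiniteDimensional Ω V] [Nontrivial V]
    (φ : Env k m →+* Module.End Ω V)
    (hφ0 : ∀ c, φ (algebraMap k _ c) = algebraMap Ω _ (algebraMap k Ω c))
    {Y : Matrix (Fin m) (Fin m) Ω} {s : Fin m → Ω} {W : Fin m → Fin m → Ω} (hY : Yᵀ = -Y)
    (hW : EigenBasis Y s W)
    (hφ : ∀ c : SkewIdx m, φ (ycen p (gen k c)) = algebraMap Ω _ (Y c.1.1 c.1.2)) :
    ∃ T : Fin m → Ω, (∀ i, T i.rev = - T i) ∧ (∀ i, T i ^ p - T i = s i) ∧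
      ∃ v ≠ 0, φ (casimir k m) v = (∑ i, T i ^ 2 - ∑ i : Fin m, rhoShift Ω i ^ 2) • v := by
  have hodd := odd_char Ω p
  set G : Fin m → Fin m → Module.End Ω V := fun a b => φ (envι k (skewGen k m a b)) with hGdef
  have hG : SoRel G := by
    refine ⟨fun i j => ?_, fun i j a b => ?_⟩
    · rw [hGdef]; dsimp only; rw [← map_neg]; exact congrArg φ (soRel_ι.swap i j)
    · have := congrArg φ ((soRel_ι (K := k)).comm i j a b)
      simpa only [map_sub, map_add, map_mul, apply_ite φ, map_zero] using this
  set ρ : So Ω m →ₗ⁅Ω⁆ Module.End Ω V := soHom hG with hρdef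
  have hρ : ∀ x : So k m, ρ (soMap k Ω x) = φ (envι k x) := by
    intro x
    have h1 : envι k x = ∑ c : SkewIdx m, x.1 c.1.1 c.1.2 • envι k (gen k c) := by
      conv_lhs => rw [So.eq_sum x]
      exact (map_sum (UniversalEnvelopingAlgebra.ι k : So k m →ₗ⁅k⁆ Env k m) _ _).trans (Finset.sum_congr rfl fun c _ => map_smul _ _ _)
    have h2 : ρ (soMap k Ω x) = ∑ c : SkewIdx m, (soMap k Ω x).1 c.1.1 c.1.2 • ρ (gen Ω c) := by
      conv_lhs => rw [So.eq_sum (soMap k Ω x)]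
      exact (map_sum ρ _ _).trans (Finset.sum_congr rfl fun c _ => map_smul _ _ _)
    rw [h1, h2, map_sum]
    refine Finset.sum_congr rfl fun c _ => ?_
    rw [Algebra.smul_def (R := k), map_mul (φ), hφ0, ← Algebra.smul_def]
    congr 1
    exact soHom_skewGen hG _ _
  have hχ : ∀ c : SkewIdx m, powDefect p ρ (gen Ω c) = algebraMap Ω _ (Y c.1.1 c.1.2) := by
    intro c
    have h1 : powSo p (gen Ω c) = soMap k Ω (powSo p (gen k c)) := by
      rw [← soMap_gen (k := k)]
      exact Subtype.ext (Matrix.map_pow (gen k c).1 (algebraMap k Ω) p).symm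
    rw [powDefect_apply, h1, ← soMap_gen (k := k), hρ, hρ, ← hφ, ycen, map_sub, map_pow]
  choose w hw using fun i a => IsAlgClosed.exists_pow_nat_eq (W i a) (Fact.out : p.Prime).pos
  have hw' : ∀ i, (fun a => w i a ^ p) = W i := fun i => funext (hw i)
  have hdot : ∀ i j, w i ⬝ᵥ w j = if j = i.rev then 1 else 0 := by
    intro i j
    have h1 : frobenius Ω p (w i ⬝ᵥ w j) = frobenius Ω p (if j = i.rev then 1 else 0) := by
      rw [apply_ite (frobenius Ω p), map_one, map_zero, ← hW.dot, dotProduct, map_sum]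
      refine Finset.sum_congr rfl fun a _ => ?_
      rw [frobenius_def, mul_pow, hw, hw]
    exact frobenius_inj Ω p h1
  have hB : EigenBasis (0 : Matrix (Fin m) (Fin m) Ω) 0 w := ⟨fun i => by simp, hdot⟩
  have hχw : ∀ i j, powDefect p ρ (wedge (w i) (w j)) =
      algebraMap Ω _ (if j = i.rev then s j else 0) := by
    intro i j
    rw [powDefect_wedge p hY hχ, hw', hw', hW.eig, dotProduct_smul, hW.dot, smul_eq_mul]
    split_ifs <;> simp
  set β : Fin m → Fin m → Module.End Ω V := fun i j => ρ (wedge (w i) (w j)) with hβ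
  have hrel : WittRel β := by
    refine ⟨fun i j => ?_, fun i j a b => ?_⟩
    · rw [hβ]; dsimp only; rw [wedge_swap, map_neg]
    · have h1 : ∀ (P : Prop) [Decidable P] (x : So Ω m),
          (if P then (1 : Ω) else 0) • x = if P then x else 0 := by
        intro P _ x; split_ifs <;> simp
      rw [hβ]; dsimp only
      rw [← LieRing.of_associative_ring_bracket, ← LieHom.map_lie, lie_wedge]
      simp only [hdot, h1, map_sub, map_add, apply_ite ρ, map_zero]
  have hnil : ∀ i j, i < j.rev → IsNilpotent (β i j) := by
    intro i j hij
    have hne : ¬ j = i.rev := fun h => by subst h; simp at hij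
    have h3 : (wedge (w i) (w j)).1 ^ 3 = 0 := by
      refine wedge_pow_three _ _ (by rw [hdot, if_neg hne]) ?_
      rw [hdot, hdot]
      by_cases h1 : i = i.rev
      · by_cases h2 : j = j.rev
        · exfalso
          rw [Fin.ext_iff, Fin.val_rev] at h1 h2
          rw [Fin.lt_def, Fin.val_rev] at hij
          omega
        · rw [if_neg h2, mul_zero]
      · rw [if_neg h1, zero_mul]
    have h4 : powSo p (wedge (w i) (w j)) = 0 := by
      refine Subtype.ext ?_
      have h5 : 3 ≤ p := by
        have := (Fact.out : p.Prime).two_le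
        obtain ⟨q, rfl⟩ := hodd; omega
      change (wedge (w i) (w j)).1 ^ p = 0
      rw [← Nat.sub_add_cancel h5, pow_add, h3, mul_zero]
    refine ⟨p, ?_⟩
    have h5 := hχw i j
    rwa [powDefect_apply, h4, map_zero, sub_zero, if_neg hne, map_zero] at h5
  obtain ⟨v, hv0, hv, c, hc⟩ := hrel.exists_highestWeight hnil
  have hcodd : ∀ i, c i.rev = - c i := by
    intro i
    have h1 : β i.rev i v = - β i i.rev v := by rw [hrel.swap i i.rev, LinearMap.neg_apply]
    have h2 := hc i.rev
    rw [Fin.rev_rev, h1, hc, ← neg_smul] at h2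
    exact (smul_left_injective Ω hv0 h2).symm
  have hcp : ∀ i, c i ^ p - c i = - s i := by
    intro i
    have h3 : powSo p (wedge (w i) (w i.rev)) = wedge (w i) (w i.rev) := by
      refine Subtype.ext (pow_odd_of_pow_three ?_ hodd)
      by_cases h1 : i = i.rev
      · rw [← h1]
        have : wedge (w i) (w i) = 0 := Subtype.ext (sub_self _)
        rw [this]
        exact zero_pow three_ne_zero
      · refine wedge_pow_three' _ _ (by simp [hdot]) ?_ ?_
        · rw [hdot, if_neg h1]
        · rw [hdot, Fin.rev_rev, if_neg (Ne.symm h1)]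
    have h4 : powDefect p ρ (wedge (w i) (w i.rev)) = algebraMap Ω _ (- s i) := by
      rw [← neg_inj, ← map_neg, ← wedge_swap, hχw, Fin.rev_rev, if_pos rfl, map_neg, neg_neg]
    rw [powDefect_apply, h3] at h4
    have h5 := LinearMap.congr_fun h4 v
    have h6 : ∀ n : ℕ, (β i i.rev ^ n) v = c i ^ n • v := by
      intro n
      induction n with
      | zero => simp
      | succ n ih => rw [pow_succ', Module.End.mul_apply, ih, map_smul, hc, smul_smul, pow_succ]
    rw [LinearMap.sub_apply, Module.algebraMap_end_apply] at h5
    change (β i i.rev ^ p) v - β i i.rev v = _ at h5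
    rw [h6, hc, ← sub_smul] at h5
    exact smul_left_injective Ω hv0 h5
  have hcas : φ (casimir k m) = ∑ i, ∑ j, β i j * β j.rev i.rev := by
    have hβ1 : ∀ i j, β i j = ∑ b, w j b • ∑ a, w i a • G a b := by
      intro i j
      rw [hβ]; dsimp only
      rw [soHom_wedge, Finset.sum_comm]
      refine Finset.sum_congr rfl fun b _ => ?_
      rw [Finset.smul_sum]
      exact Finset.sum_congr rfl fun a _ => by rw [smul_smul, mul_comm]
    have hβ2 : ∀ i j, β i j = ∑ c, w i c • ∑ d, w j d • G c d := by
      intro i j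
      rw [hβ]; dsimp only
      rw [soHom_wedge]
      refine Finset.sum_congr rfl fun b _ => ?_
      rw [Finset.smul_sum]
      exact Finset.sum_congr rfl fun a _ => by rw [smul_smul]
    have h1 : ∀ i, ∑ j, β i j * β j.rev i.rev =
        ∑ b, (∑ a, w i a • G a b) * ∑ d, w i.rev d • G b d := by
      intro i
      refine Eq.trans (Finset.sum_congr rfl fun j _ => ?_)
        (hB.sum_mul_sum (fun b => ∑ a, w i a • G a b) fun b => ∑ d, w i.rev d • G b d)
      rw [hβ1 i j, hβ2 j.rev i.rev]
    simp_rw [h1]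
    rw [Finset.sum_comm]
    simp_rw [hB.sum_mul_sum]
    rw [Finset.sum_comm, casimir]
    simp_rw [map_sum, map_mul]
    rfl
  have hshift : ∀ i : Fin m, rhoShift Ω i ^ p = rhoShift Ω i := by
    intro i
    have h2 : frobenius Ω p (rhoShift Ω i) = rhoShift Ω i := by
      rw [rhoShift, map_div₀, map_sub, map_natCast, map_natCast, map_ofNat]
    exact h2
  have hshift' : ∀ i : Fin m, rhoShift Ω i.rev = - rhoShift Ω i := by
    intro i
    rw [rhoShift, rhoShift, Fin.rev_rev, ← neg_div, neg_sub]
  refine ⟨fun i => - (c i + rhoShift Ω i), fun i => ?_, fun i => ?_, v, hv0, ?_⟩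
  · dsimp only; rw [hcodd, hshift']; ring
  · dsimp only
    rw [hodd.neg_pow, add_pow_char, hshift]
    linear_combination - hcp i
  · rw [hcas, hrel.casimir_apply hv hc]
    congr 1
    have h1 : ∑ i, (rhoCount i : Ω) * c i = - ∑ i : Fin m, (rhoCount i.rev : Ω) * c i := by
      rw [← Equiv.sum_comp Fin.revPerm, ← Finset.sum_neg_distrib]
      refine Finset.sum_congr rfl fun i _ => ?_
      rw [Fin.revPerm_apply, hcodd, mul_neg]
    have h2 : ∀ i : Fin m, (-(c i + rhoShift Ω i)) ^ 2 - rhoShift Ω i ^ 2 =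
        c i ^ 2 + (rhoCount i * c i - rhoCount i.rev * c i) := by
      intro i
      have h3 : rhoShift Ω i * 2 = rhoCount i - rhoCount i.rev := div_mul_cancel₀ _ (NeZero.ne _)
      linear_combination c i * h3
    rw [← Finset.sum_sub_distrib]
    simp only [h2, Finset.sum_add_distrib, Finset.sum_sub_distrib]
    linear_combination h1

end Casimir

end SoGK

namespace SoGK

open MvPolynomial Matrix

section Casimir

variable {m : ℕ} {R : Type*} [Ring R]

lemma SoRel.casimir_commute {G : Fin m → Fin m → R} (h : SoRel G) (i j : Fin m) :
    Commute (∑ a, ∑ b, G a b * G b a) (G i j) := by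
  have h1 : ∀ a b, G i j * (G a b * G b a) - G a b * G b a * G i j =
      (G i j * G a b - G a b * G i j) * G b a + G a b * (G i j * G b a - G b a * G i j) := by
    intro a b; noncomm_ring
  have h2 : ∑ a, ∑ b, (G i j * (G a b * G b a) - G a b * G b a * G i j) = 0 := by
    simp only [h1, h.comm, add_mul, sub_mul, mul_add, mul_sub, ite_mul, mul_ite, zero_mul, mul_zero,
      Finset.sum_add_distrib, Finset.sum_sub_distrib]
    have e1 : ∀ a b c d, G a b * G c d = G b a * G d c := by
      intro a b c d; rw [h.swap b a, h.swap d c, neg_mul_neg]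
    have e2 : ∀ a b c d, G a b * G c d = - (G b a * G c d) := by
      intro a b c d; rw [h.swap b a, neg_mul]
    simp only [Finset.sum_ite_eq, Finset.sum_ite_eq', Finset.mem_univ, if_true,
      Finset.sum_ite_irrel, Finset.sum_const_zero]
    have e3 : ∀ a b c, G a b * G a c = - (G b a * G a c) := fun a b c => e2 _ _ _ _
    have e4 : ∀ a b c, G a b * G c b = - (G a b * G b c) := by
      intro a b c; rw [h.swap b c, mul_neg]
    have e5 : ∀ a b c, G b a * G c b = G a b * G b c := fun a b c => e1 _ _ _ _
    simp only [e3, e4, e5, Finset.sum_neg_distrib]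
    abel
  rw [Commute, SemiconjBy, eq_comm, ← sub_eq_zero, ← h2]
  simp only [Finset.mul_sum, Finset.sum_mul, Finset.sum_sub_distrib]

end Casimir

variable (k : Type) [Field k] (m : ℕ) [NeZero m] (p : ℕ) [Fact p.Prime] [CharP k p]
  [NeZero (2 : k)]

lemma casimir_commute (u : Env k m) : Commute (casimir k m) u :=
  commute_of_ι (fun c => soRel_ι.casimir_commute c.1.1 c.1.2) u

/-- The fraction field of the `p`-centre. -/
abbrev QZ : Type := FractionRing (YAlg k m p)

variable {k m} in
/-- An element commuting with the enveloping algebra is central in its division ring of fractions. -/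
lemma commute_of_envD {z : DEnv k m p} (h : ∀ u, Commute z (envD k m p u)) (d : DEnv k m p) :
    Commute z d := by
  obtain ⟨a, ha, u, hu⟩ := CFrac.exists_smul_eq d
  have h0 : toCFrac (YAlg k m p) (Env k m) (algebraMap _ _ a) ≠ 0 := by
    rw [toCFrac_algebraMap]; simpa using ha
  have h1 := h u
  rw [← hu] at h1
  have h2 := h (algebraMap (YAlg k m p) _ a)
  refine mul_left_cancel₀ h0 ?_
  rw [← mul_assoc, ← h2.eq, mul_assoc, h1.eq, mul_assoc]

/-- The Casimir element in the division ring of fractions. -/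
def casD : DEnv k m p := envD k m p (casimir k m)

lemma casD_commute (d : DEnv k m p) : Commute (casD k m p) d :=
  commute_of_envD p (fun u => (casimir_commute k m u).map (envD k m p)) d

/-- The fraction field of the `p`-centre maps to the field of rational functions by evaluating at
`X ^ p - X`. -/
def psiF : QZ k m p →+* Fr k m :=
  IsFractionRing.lift (A := YAlg k m p)
    (g := (algebraMap (Pol k m) (Fr k m)).comp (psiAt k p (genX k m)).toRingHom)
    ((IsFractionRing.injective (Pol k m) (Fr k m)).comp (psiAt_genX_injective p))

instance : Algebra (QZ k m p) (Fr k m) := (psiF k m p).toAlgebra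

variable {k m}

lemma algebraMap_QZ_Fr (a : YAlg k m p) : algebraMap (QZ k m p) (Fr k m) (algebraMap _ _ a) =
    algebraMap (Pol k m) (Fr k m) (psiAt k p (genX k m) a) := by
  change psiF k m p _ = _
  rw [psiF, IsFractionRing.lift_algebraMap]; rfl

lemma algebraMap_QZ_Cl (a : YAlg k m p) : algebraMap (QZ k m p) (Cl k m) (algebraMap _ _ a) =
    algebraMap (Pol k m) (Cl k m) (psiAt k p (genX k m) a) := by
  rw [IsScalarTower.algebraMap_apply (QZ k m p) (Fr k m) (Cl k m),
    algebraMap_QZ_Fr, ← IsScalarTower.algebraMap_apply]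

instance : IsScalarTower k (QZ k m p) (Fr k m) := IsScalarTower.of_algebraMap_eq fun c => by
  rw [IsScalarTower.algebraMap_apply k (YAlg k m p) (QZ k m p), algebraMap_QZ_Fr,
    AlgHom.commutes, ← IsScalarTower.algebraMap_apply]

variable (k m) in
/-- The image of the Casimir element in the field of rational functions. -/
def casF : Fr k m := algebraMap (Pol k m) (Fr k m)
  ((genX k m * genX k m).trace - C (∑ i : Fin m, rhoShift k i ^ 2))

section Specialise

variable {Z : Matrix (Fin m) (Fin m) (Cl k m)} (hZ : Zᵀ = -Z)
    (h : Z ^ p - Z = ((genX k m).map (algebraMap _ (Cl k m))) ^ p -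
      (genX k m).map (algebraMap _ (Cl k m)))

include hZ h in
lemma exists_specialise : ∃ g : Fr k m →+* Cl k m,
    g.comp (algebraMap (QZ k m p) (Fr k m)) = algebraMap (QZ k m p) (Cl k m) ∧
    g (casF k m) = (Z * Z).trace - ∑ i : Fin m, rhoShift (Cl k m) i ^ 2 := by
  have hinj : Function.Injective (algebraMap (Pol k m) (Cl k m)) := by
    rw [IsScalarTower.algebraMap_eq (Pol k m) (Fr k m) (Cl k m)]
    exact (algebraMap (Fr k m) (Cl k m)).injective.comp (IsFractionRing.injective _ _)
  have hev := evalSkew_injective_of_pow_sub p hinj hZ h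
  refine ⟨IsFractionRing.lift (A := Pol k m) (g := (evalSkew k Z).toRingHom) hev, ?_, ?_⟩
  · refine IsLocalization.ringHom_ext (nonZeroDivisors (YAlg k m p)) (RingHom.ext fun a => ?_)
    simp only [RingHom.comp_apply]
    rw [algebraMap_QZ_Fr, IsFractionRing.lift_algebraMap, algebraMap_QZ_Cl]
    change evalSkew k Z _ = _
    rw [evalSkew_psiAt p hZ]
    have := map_psiAt p (IsScalarTower.toAlgHom k (Pol k m) (Cl k m)) (genX k m) a
    refine Eq.trans ?_ this.symm
    simp only [psiAt]
    congr 1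
    congr 1
    funext c
    exact congrFun (congrFun h _) _
  · rw [casF, IsFractionRing.lift_algebraMap]
    change evalSkew k Z _ = _
    rw [map_sub]
    congr 1
    · have := evalSkew_genX (k := k) hZ
      have h1 : ∀ a b, evalSkew k Z (genX k m a b) = Z a b :=
        fun a b => congrFun (congrFun this a) b
      simp only [Matrix.trace, Matrix.diag_apply, Matrix.mul_apply, map_sum, map_mul, h1]
    · rw [← algebraMap_eq, AlgHom.commutes, map_sum]
      simp only [rhoShift, map_pow, map_div₀, map_sub, map_natCast, map_ofNat]

end Specialise

variable (k m)

instance : CharP (Cl k m) p := charP_of_injective_algebraMap (algebraMap k (Cl k m)).injective p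

omit [NeZero m] in
lemma two_ne_zero_Cl : (2 : Cl k m) ≠ 0 := by
  rw [← map_ofNat (algebraMap k (Cl k m)) 2]
  exact (map_ne_zero _).2 (NeZero.ne _)

instance : NeZero (2 : Cl k m) := ⟨two_ne_zero_Cl k m⟩

variable {k m} in
lemma exists_casimir_root {s : Fin m → Cl k m} {W : Fin m → Fin m → Cl k m}
    (hW : EigenBasis (((genX k m).map (algebraMap _ (Cl k m))) ^ p -
      (genX k m).map (algebraMap _ (Cl k m))) s W) :
    ∃ T : Fin m → Cl k m, (∀ i, T i.rev = - T i) ∧ (∀ i, T i ^ p - T i = s i) ∧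
      Polynomial.aeval (∑ i, T i ^ 2 - ∑ i : Fin m, rhoShift (Cl k m) i ^ 2)
        (minpoly (QZ k m p) (casD k m p)) = 0 := by
  set φD : DEnv k m p →ₐ[QZ k m p] Module.End (Cl k m) (TensorProduct (QZ k m p) (Cl k m) (DEnv k m p)) :=
    (Module.End.baseChangeHom (QZ k m p) (Cl k m) (DEnv k m p)).comp
      (Algebra.lmul (QZ k m p) (DEnv k m p)) with hφD
  have hsc : ∀ q : QZ k m p, φD (algebraMap _ _ q) = algebraMap (Cl k m) _ (algebraMap _ (Cl k m) q) := by
    intro q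
    rw [AlgHom.commutes, ← IsScalarTower.algebraMap_apply]
  haveI : Nontrivial (TensorProduct (QZ k m p) (Cl k m) (DEnv k m p)) :=
    (Algebra.TensorProduct.includeRight_injective (R := QZ k m p) (A := Cl k m) (B := DEnv k m p)
      (algebraMap (QZ k m p) (Cl k m)).injective).nontrivial
  haveI : Module.Finite (Cl k m) (TensorProduct (QZ k m p) (Cl k m) (DEnv k m p)) :=
    Module.Finite.base_change _ _ _
  have ha : ∀ a : YAlg k m p, φD (envD k m p (algebraMap _ _ a)) =
      algebraMap (Cl k m) _ (algebraMap (Pol k m) (Cl k m) (psiAt k p (genX k m) a)) := by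
    intro a
    rw [toCFrac_algebraMap, hsc, algebraMap_QZ_Cl]
  have hc : ∀ c, φD (envD k m p (algebraMap k _ c)) =
      algebraMap (Cl k m) _ (algebraMap k (Cl k m) c) := by
    intro c
    rw [IsScalarTower.algebraMap_apply k (YAlg k m p) (Env k m), ha, AlgHom.commutes,
      ← IsScalarTower.algebraMap_apply k (Pol k m) (Cl k m)]
  have hy : ∀ c : SkewIdx m, φD (envD k m p (ycen p (gen k c))) = algebraMap (Cl k m) _
      ((((genX k m).map (algebraMap _ (Cl k m))) ^ p - (genX k m).map (algebraMap _ (Cl k m)))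
        c.1.1 c.1.2) := by
    intro c
    have h0 := algebraMap_yX (k := k) p ⟨c⟩
    rw [show ycen p (gen k c) = _ from h0.symm, ha, psiAt, aeval_X]
    congr 1
    rw [Matrix.sub_apply, Matrix.sub_apply, map_sub, ← RingHom.mapMatrix_apply, ← map_pow]
    rfl
  have hX : ((genX k m).map (algebraMap (Pol k m) (Cl k m)))ᵀ =
      - (genX k m).map (algebraMap (Pol k m) (Cl k m)) := by
    rw [← transpose_map, genX_transpose, Matrix.map_neg]; exact map_neg _
  obtain ⟨T, hT, hTs, v, hv, hcas⟩ := exists_casimir_eigenvector p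
    (φD.toRingHom.comp (envD k m p)) hc (by
      rw [transpose_sub, transpose_pow, hX, (odd_char k p).neg_pow, neg_sub, sub_neg_eq_add, neg_add_eq_sub])
     hW hy
  refine ⟨T, hT, hTs, ?_⟩
  have h1 := Module.End.aeval_apply_of_hasEigenvector
    (p := (minpoly (QZ k m p) (casD k m p)).map (algebraMap _ (Cl k m)))
    (Module.End.hasEigenvector_iff.2 ⟨Module.End.mem_eigenspace_iff.2 hcas, hv⟩)
  rw [Polynomial.aeval_map_algebraMap, Polynomial.eval_map_algebraMap] at h1
  have h2 : Polynomial.aeval (φD (casD k m p)) (minpoly (QZ k m p) (casD k m p)) = 0 := by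
    rw [Polynomial.aeval_algHom_apply, minpoly.aeval, map_zero]
  rw [show Polynomial.aeval ((φD.toRingHom.comp (envD k m p)) (casimir k m)) _ = _ from h2] at h1
  exact (smul_eq_zero.1 h1.symm).resolve_right hv

variable {k m} in
lemma EigenBasis.pow_sub {X : Matrix (Fin m) (Fin m) (Cl k m)} {x : Fin m → Cl k m}
    {W : Fin m → Fin m → Cl k m} (hW : EigenBasis X x W) :
    EigenBasis (X ^ p - X) (x ^ p - x) W where
  eig i := by
    nth_rw 1 2 [hW.eq_specMat]
    rw [hW.specMat_pow, ← specMat_sub, hW.specMat_mulVec]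
  dot := hW.dot

variable {k m} in
lemma EigenBasis.exists_specialise {x t : Fin m → Cl k m}
    {W : Fin m → Fin m → Cl k m}
    (hW : EigenBasis ((genX k m).map (algebraMap _ (Cl k m))) x W) (ht : ∀ i, t i.rev = - t i)
    (hx : t ^ p - t = x ^ p - x) :
    ∃ g : Fr k m →+* Cl k m,
    g.comp (algebraMap (QZ k m p) (Fr k m)) = algebraMap (QZ k m p) (Cl k m) ∧
    g (casF k m) = ∑ i, t i ^ 2 - ∑ i : Fin m, rhoShift (Cl k m) i ^ 2 := by
  obtain ⟨g, hg, hgc⟩ := SoGK.exists_specialise p (Z := specMat W t)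
    (by rw [specMat_transpose, ← specMat_neg]; congr 1; exact funext ht)
    (by rw [hW.specMat_pow, ← specMat_sub, hx, hW.eq_specMat, hW.specMat_pow, ← specMat_sub])
  refine ⟨g, hg, ?_⟩
  rw [hgc, hW.specMat_mul, hW.specMat_trace]
  simp [sq]

lemma aeval_casF [IsAlgClosed k] :
    Polynomial.aeval (casF k m) (minpoly (QZ k m p) (casD k m p)) = 0 := by
  have hinj : Function.Injective (algebraMap (Pol k m) (Cl k m)) := by
    rw [IsScalarTower.algebraMap_eq (Pol k m) (Fr k m) (Cl k m)]
    exact (algebraMap (Fr k m) (Cl k m)).injective.comp (IsFractionRing.injective _ _)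
  obtain ⟨x, W, hx, hW⟩ := exists_generic_eigenBasis p hinj
  obtain ⟨T, hT, hTs, h⟩ := exists_casimir_root p (hW.pow_sub p)
  obtain ⟨g, hg, hgc⟩ := hW.exists_specialise p hT (funext hTs)
  rw [← hgc, Polynomial.aeval_def, ← hg, ← Polynomial.hom_eval₂] at h
  rw [Polynomial.aeval_def]
  exact (map_eq_zero g).1 h

lemma pow_rk_le_natDegree_minpoly [IsAlgClosed k] :
    p ^ rk m ≤ (minpoly (QZ k m p) (casD k m p)).natDegree := by
  classical
  have hinj : Function.Injective (algebraMap (Pol k m) (Cl k m)) := by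
    rw [IsScalarTower.algebraMap_eq (Pol k m) (Fr k m) (Cl k m)]
    exact (algebraMap (Fr k m) (Cl k m)).injective.comp (IsFractionRing.injective _ _)
  obtain ⟨x, W, hx, hW⟩ := exists_generic_eigenBasis p hinj
  let b : ({i : Fin m // i < i.rev} → Fin p) → Fin m → ℤ := fun a i =>
    if h : i < i.rev then (a ⟨i, h⟩ : ℕ) else
      if h : i.rev < i then - ((a ⟨i.rev, by rwa [Fin.rev_rev]⟩ : ℕ) : ℤ) else 0
  have hb : ∀ a i, b a i.rev = - b a i := by
    intro a i
    simp only [b, Fin.rev_rev]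
    split_ifs with h1 h2 h3
    · exact absurd h1 (not_lt.2 h2.le)
    · simp
    · rfl
    · simp
  set μ := minpoly (QZ k m p) (casD k m p) with hμ
  have h_int : IsIntegral (QZ k m p) (casD k m p) := Algebra.IsIntegral.isIntegral _
  let ρ : ({i : Fin m // i < i.rev} → Fin p) → Cl k m := fun a =>
    ∑ i, (x i + b a i) ^ 2 - ∑ i : Fin m, rhoShift (Cl k m) i ^ 2
  have hroot : ∀ a, Polynomial.aeval (ρ a) μ = 0 := by
    intro a
    obtain ⟨g, hg, hgc⟩ := hW.exists_specialise p (t := fun i => x i + (b a i : Cl k m))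
      (fun i => by rw [hx.odd, hb]; push_cast; ring) (by
        funext i
        have : ((b a i : ℤ) : Cl k m) ^ p = b a i := by
          rw [← frobenius_def, map_intCast]
        simp only [Pi.sub_apply, Pi.pow_apply]
        rw [add_pow_char, this]; ring)
    have h := aeval_casF k m p
    rw [Polynomial.aeval_def] at h
    have h1 := congrArg g h
    rw [Polynomial.hom_eval₂, hg, hgc, map_zero] at h1
    exact h1
  have hρ : Function.Injective ρ := by
    intro a a' h
    have h1 := hx.sum_sq_injective (two_ne_zero_Cl k m) (b a) (b a') (hb a) (hb a') (sub_left_injective h)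
    funext i
    have h2 := h1 i.1
    simp only [b, dif_pos i.2, Int.cast_natCast] at h2
    exact Fin.ext (CharP.natCast_injOn_Iio (Cl k m) p (a i).2 (a' i).2 h2)
  have hne : μ.map (algebraMap _ (Cl k m)) ≠ 0 :=
    Polynomial.map_ne_zero (minpoly.ne_zero h_int)
  have h1 : (Finset.univ.image ρ).card ≤ (μ.map (algebraMap _ (Cl k m))).natDegree := by
    refine Polynomial.card_le_degree_of_subset_roots fun y hy => ?_
    obtain ⟨a, -, rfl⟩ := Finset.mem_image.1 hy
    rw [Polynomial.mem_roots hne, Polynomial.IsRoot, Polynomial.eval_map_algebraMap]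
    exact hroot a
  rw [Finset.card_image_of_injective _ hρ, Polynomial.natDegree_map] at h1
  simpa [rk] using h1

end SoGK

namespace SoGK

open MvPolynomial Matrix

section Symbols

variable {k : Type} [Field k] {m : ℕ}

lemma symb_ordMon {ι : Type} [Fintype ι] {w : ι → Env k m} {f : ι → Pol k m}
    (hw : ∀ i, w i ∈ fil k m 1) (hf : ∀ i, symb k m 1 (w i) = f i) (b : ι → ℕ) :
    ordMon w b ∈ fil k m (∑ i, b i) ∧ symb k m (∑ i, b i) (ordMon w b) = ordMon f b := by
  have hpow : ∀ i n, w i ^ n ∈ fil k m n ∧ symb k m n (w i ^ n) = f i ^ n := by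
    intro i n
    induction n with
    | zero => simpa using ⟨one_mem_fil 0, symb_one⟩
    | succ n ih =>
      rw [pow_succ, pow_succ]
      exact ⟨mul_mem_fil ih.1 (hw i), by rw [symb_mul ih.1 (hw i), ih.2, hf]⟩
  have h : ∀ L : List ι, (L.map fun i => w i ^ b i).prod ∈ fil k m (L.map b).sum ∧
      symb k m (L.map b).sum (L.map fun i => w i ^ b i).prod = (L.map fun i => f i ^ b i).prod := by
    intro L
    induction L with
    | nil => simpa using ⟨one_mem_fil 0, symb_one⟩
    | cons i L ih =>
      simp only [List.map_cons, List.prod_cons, List.sum_cons]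
      exact ⟨mul_mem_fil (hpow i _).1 ih.1, by rw [symb_mul (hpow i _).1 ih.1, ih.2, (hpow i _).2]⟩
  have h1 := h Finset.univ.toList
  rwa [Finset.sum_map_toList] at h1

lemma derivation_eq_zero {D : Derivation k (Fr k m) (Fr k m)}
    (h : ∀ c, D (algebraMap (Pol k m) (Fr k m) (X c)) = 0) : D = 0 := by
  have h1 : ∀ a : Pol k m, D (algebraMap (Pol k m) (Fr k m) a) = 0 := by
    intro a
    induction a using MvPolynomial.induction_on with
    | C r =>
      rw [← algebraMap_eq, ← IsScalarTower.algebraMap_apply, D.map_algebraMap]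
    | add a b ha hb => rw [map_add, map_add, ha, hb, add_zero]
    | mul_X a c ha => rw [map_mul, D.leibniz, ha, h, smul_zero, smul_zero, add_zero]
  refine Derivation.ext fun x => ?_
  obtain ⟨a, b, hb, rfl⟩ := IsFractionRing.div_surjective (A := Pol k m) x
  rw [D.leibniz_div, h1, h1]
  simp

end Symbols

/-- The subfield of constants of a family of derivations. -/
def constants {k F ι : Type*} [Field k] [Field F] [Algebra k F] (D : ι → Derivation k F F) :
    Subfield F where
  carrier := {x | ∀ i, D i x = 0}
  mul_mem' {x y} hx hy i := by rw [(D i).leibniz, hx i, hy i, smul_zero, smul_zero, add_zero]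
  one_mem' i := (D i).map_one_eq_zero
  add_mem' {x y} hx hy i := by rw [map_add, hx i, hy i, add_zero]
  zero_mem' i := map_zero _
  neg_mem' {x} hx i := by rw [map_neg, hx i, neg_zero]
  inv_mem' x hx i := by rw [(D i).leibniz_inv, hx i, smul_zero]

/-- A derivation as a linear map over a field of constants. -/
def constantsLinear {k F ι : Type*} [Field k] [Field F] [Algebra k F] (D : ι → Derivation k F F)
    (i : ι) : F →ₗ[constants D] F where
  toFun := D i
  map_add' := map_add _
  map_smul' c x := by
    change D i (c.1 * x) = c.1 * D i x
    rw [(D i).leibniz, c.2 i, smul_zero, add_zero, smul_eq_mul]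

lemma eq_zero_of_sum_monomials {k F : Type*} {ι : Type} [Field k] [Field F] [Algebra k F] [Fintype ι]
    [DecidableEq ι] (p : ℕ) [Fact p.Prime] [CharP F p] (D : ι → Derivation k F F) (x : ι → F)
    (hD : ∀ i j, D i (x j) = if i = j then 1 else 0) (f : (ι → Fin p) → F)
    (hf : ∀ a i, D i (f a) = 0) (h : ∑ a, f a * ∏ i, x i ^ (a i : ℕ) = 0) (a : ι → Fin p) :
    f a = 0 := by
  haveI : CharP (constants D) p :=
    (RingHom.charP_iff (algebraMap (constants D) F) (algebraMap (constants D) F).injective p).2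
      inferInstance
  have hli := linearIndependent_ordMon (C := constants D) p x (constantsLinear D) (fun i x y => by
    change D i (x * y) = D i x * y + x * D i y
    rw [(D i).leibniz, smul_eq_mul, smul_eq_mul, add_comm, mul_comm y]) hD
  rw [Fintype.linearIndependent_iff] at hli
  refine congrArg Subtype.val (hli (fun a => ⟨f a, hf a⟩) ?_ a)
  rw [← h]
  refine Finset.sum_congr rfl fun a _ => ?_
  rw [ordMon_comm]; rfl

section Denominators

variable {A U : Type} [CommRing A] [IsDomain A] [Ring U] [IsDomain U] [Algebra A U]

lemma CFrac.exists_common_denominator {ι : Type*} (S : Finset ι) (x : ι → CFrac A U) :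
    ∃ a : A, a ≠ 0 ∧ ∀ i ∈ S, ∃ u : U, toCFrac A U (algebraMap A U a) * x i = toCFrac A U u := by
  classical
  induction S using Finset.induction_on with
  | empty => exact ⟨1, one_ne_zero, by simp⟩
  | insert j S hj ih =>
    obtain ⟨a, ha, h⟩ := ih
    obtain ⟨b, hb, v, hv⟩ := CFrac.exists_smul_eq (x j)
    refine ⟨a * b, mul_ne_zero ha hb, fun i hi => ?_⟩
    rcases Finset.mem_insert.1 hi with rfl | hi
    · exact ⟨algebraMap A U a * v, by rw [map_mul, map_mul, mul_assoc, hv, map_mul]⟩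
    · obtain ⟨u, hu⟩ := h i hi
      exact ⟨algebraMap A U b * u, by rw [mul_comm a b, map_mul, map_mul, mul_assoc, hu, map_mul]⟩

end Denominators

variable (k : Type) [Field k] (m : ℕ) [NeZero m] (p : ℕ) [Fact p.Prime] [CharP k p]
  [NeZero (2 : k)]

/-- The centre of the division ring of fractions of the enveloping algebra. -/
abbrev ZD : Type := Subring.center (DEnv k m p)

variable {k m} in
lemma commute_of_symb {N : ℕ} {z : Env k m} (hz : z ∈ fil k m N) (h : ∀ u, Commute z u)
    (x : So k m) : hamil x (symb k m N z) = 0 := by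
  rw [← (symb_lie x hz).2, (h (envι k x)).eq, sub_self, map_zero]

lemma linearIndependent_center [IsAlgClosed k] : ∃ w : Fin (Module.finrank (Fr k m)
      (LinearMap.range (hamComb k m))) → DEnv k m p,
    LinearIndependent (ZD k m p) fun a : Fin _ → Fin p => ordMon w fun i => a i := by
  classical
  haveI : CharP (Fr k m) p := charP_of_injective_algebraMap (algebraMap k (Fr k m)).injective p
  let ev : SkewIdx m → Module.Dual (Fr k m) (LinearMap.range (hamComb k m)) := fun c =>
    { toFun := fun D => D.1 (algebraMap (Pol k m) (Fr k m) (X c))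
      map_add' := fun _ _ => rfl
      map_smul' := fun _ _ => rfl }
  have hev : ∀ v, (∀ i, ev i v = 0) → v = 0 := by
    rintro ⟨v, hv⟩ h
    have h1 : v = 0 := derivation_eq_zero h
    exact Subtype.ext h1
  obtain ⟨c, D, hc, hD⟩ := exists_dual_subfamily (F := Fr k m) (V := LinearMap.range (hamComb k m)) (ι := SkewIdx m) ev hev
  set w₀ := fun i => envι k (gen k (c i)) with hw₀
  refine ⟨fun i => envD k m p (w₀ i), ?_⟩
  rw [Fintype.linearIndependent_iff]
  intro γ hγ
  by_contra hne
  obtain ⟨q, hq, hqu⟩ := CFrac.exists_common_denominator (A := YAlg k m p) (U := Env k m)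
    Finset.univ fun a => ((γ a : ZD k m p) : DEnv k m p)
  choose z hz using fun a => hqu a (Finset.mem_univ a)
  have hinj : Function.Injective (envD k m p) := toCFrac_injective
  have hcomm : ∀ a u, Commute (z a) u := by
    intro a u
    refine hinj ?_
    have h1 : Commute (envD k m p (algebraMap _ _ q) * γ a) (envD k m p u) := by
      refine Commute.mul_left ?_ (Subring.mem_center_iff.1 (γ a).2 _).symm
      exact (Algebra.commute_algebraMap_left q u).map (envD k m p)
    rw [hz] at h1
    rw [map_mul, map_mul]; exact h1.eq
  have hmon : ∀ b : Fin _ → ℕ, ordMon (fun i => envD k m p (w₀ i)) b = envD k m p (ordMon w₀ b) := by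
    intro b
    rw [ordMon, ordMon, map_list_prod, List.map_map]
    simp only [Function.comp_def, map_pow]
  have hsum : ∑ a, z a * ordMon w₀ (fun i => a i) = 0 := by
    refine hinj ?_
    rw [map_zero, map_sum, ← mul_zero (envD k m p (algebraMap _ _ q)), ← hγ, Finset.mul_sum]
    refine Finset.sum_congr rfl fun a _ => ?_
    rw [map_mul, ← hz, hmon, mul_assoc]; rfl
  have hz0 : ∃ a, z a ≠ 0 := by
    by_contra h0
    push Not at h0
    refine hne fun a => ?_
    have h1 := hz a
    rw [h0 a, map_zero, mul_eq_zero] at h1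
    refine Subtype.ext (h1.resolve_left ?_)
    rw [toCFrac_algebraMap]; simpa using hq
  have hdeg : ∀ a, ∃ d, z a ∈ fil k m d ∧ (z a ≠ 0 → symb k m d (z a) ≠ 0) := by
    intro a
    by_cases h : z a = 0
    · exact ⟨0, by rw [h]; exact zero_mem _, fun h' => absurd h h'⟩
    · obtain ⟨d, h1, h2⟩ := exists_symb_ne_zero h
      exact ⟨d, h1, fun _ => h2⟩
  choose d hd hds using hdeg
  obtain ⟨a₀, ha₀, hmax⟩ := (Finset.univ.filter fun a => z a ≠ 0).exists_max_image
    (fun a => d a + ∑ i, (a i : ℕ)) (by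
      obtain ⟨a, ha⟩ := hz0; exact ⟨a, by simpa using ha⟩)
  set N := d a₀ + ∑ i, (a₀ i : ℕ) with hN
  have hw1 : ∀ i, w₀ i ∈ fil k m 1 := fun i => ι_mem_fil _
  have hsymb := symb_ordMon hw1 (fun i => (symb_ι _).trans (linForm_gen (c i)))
  let f : (Fin _ → Fin p) → Pol k m := fun a =>
    if d a + ∑ i, (a i : ℕ) = N then symb k m (d a) (z a) else 0
  have hf : ∀ a, symb k m N (z a * ordMon w₀ fun i => a i) =
      f a * ordMon (fun i => X (c i)) fun i => a i := by
    intro a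
    have hs := hsymb fun i => a i
    simp only [f]
    split_ifs with h
    · rw [← h, symb_mul (hd a) hs.1, hs.2]
    · rw [zero_mul]
      by_cases h0 : z a = 0
      · rw [h0, zero_mul, map_zero]
      · exact symb_of_lt (lt_of_le_of_ne (hmax a (by simpa using h0)) h) (mul_mem_fil (hd a) hs.1)
  have hfc : ∀ a x, hamil x (f a) = 0 := by
    intro a x
    simp only [f]
    split_ifs
    · exact commute_of_symb (hd a) (hcomm a) x
    · exact map_zero _
  have hfL : ∀ a j, (D j).1 (algebraMap (Pol k m) (Fr k m) (f a)) = 0 := by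
    intro a j
    obtain ⟨e, he⟩ := (D j).2
    rw [← he, hamComb_algebraMap]
    exact Finset.sum_eq_zero fun c _ => by rw [hfc, map_zero, mul_zero]
  have h4 := eq_zero_of_sum_monomials p (fun j => (D j).1)
    (fun i => algebraMap (Pol k m) (Fr k m) (X (c i)))
    (fun i j => (hD j i).trans (by simp only [eq_comm])) _ hfL (by
      have h2 := congrArg (symb k m N) hsum
      rw [map_sum, map_zero, Finset.sum_congr rfl fun a _ => hf a] at h2
      have h3 := congrArg (algebraMap (Pol k m) (Fr k m)) h2
      rw [map_sum, map_zero] at h3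
      rw [← h3]
      refine Finset.sum_congr rfl fun a _ => ?_
      rw [map_mul, ordMon_comm, map_prod]
      simp only [map_pow]) a₀
  rw [map_eq_zero_iff _ (IsFractionRing.injective (Pol k m) (Fr k m))] at h4
  simp only [f, if_pos hN.symm] at h4
  exact hds a₀ (by simpa using ha₀) h4

end SoGK

namespace SoGK

open MvPolynomial Matrix

variable (k : Type) [Field k] (m : ℕ) [NeZero m] (p : ℕ) [Fact p.Prime] [CharP k p]
  [NeZero (2 : k)]

instance : Algebra (QZ k m p) (ZD k m p) :=
  ((algebraMap (QZ k m p) (DEnv k m p)).codRestrict (Subring.center (DEnv k m p)) fun q =>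
    Subring.mem_center_iff.2 fun d => (Algebra.commutes q d).symm).toAlgebra

instance : IsScalarTower (QZ k m p) (ZD k m p) (DEnv k m p) :=
  IsScalarTower.of_algebraMap_eq fun _ => rfl

/-- The Casimir element as an element of the centre. -/
def casZ : ZD k m p := ⟨casD k m p, Subring.mem_center_iff.2 fun d => (casD_commute k m p d).symm⟩

instance : Module.Finite (QZ k m p) (ZD k m p) :=
  Module.Finite.of_injective (IsScalarTower.toAlgHom (QZ k m p) (ZD k m p) (DEnv k m p)).toLinearMap
    Subtype.val_injective

instance : Module.Finite (ZD k m p) (DEnv k m p) :=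
  Module.Finite.of_restrictScalars_finite (QZ k m p) _ _

instance : Module.Free (ZD k m p) (DEnv k m p) := Module.Free.of_divisionRing (ZD k m p) (DEnv k m p)

lemma rk_le_card : rk m ≤ Fintype.card (SkewIdx m) :=
  Fintype.card_le_of_injective (fun i => ⟨(i.1, i.1.rev), i.2⟩) fun i j h => by
    have := congrArg (fun c : SkewIdx m => c.1.1) h
    exact Subtype.ext this

lemma minpoly_casZ : minpoly (QZ k m p) (casZ k m p) = minpoly (QZ k m p) (casD k m p) :=
  (minpoly.algebraMap_eq (A := QZ k m p) (B := ZD k m p) (B' := DEnv k m p)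
    Subtype.val_injective (casZ k m p)).symm

lemma finrank_counts [IsAlgClosed k] :
    Module.finrank (QZ k m p) (ZD k m p) = (minpoly (QZ k m p) (casZ k m p)).natDegree ∧
    Module.finrank (ZD k m p) (DEnv k m p) = p ^ (Fintype.card (SkewIdx m) - rk m) := by
  have hp : 1 < p := (Fact.out : p.Prime).one_lt
  obtain ⟨w, hw⟩ := linearIndependent_center k m p
  have h1 : p ^ (Fintype.card (SkewIdx m) - rk m) ≤ Module.finrank (ZD k m p) (DEnv k m p) := by
    have := hw.fintype_card_le_finrank
    rw [Fintype.card_fun, Fintype.card_fin, Fintype.card_fin] at this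
    exact (Nat.pow_le_pow_right hp.le (le_finrank_range_hamComb p)).trans this
  have h2 := pow_rk_le_natDegree_minpoly k m p
  rw [← minpoly_casZ] at h2
  have h3 : (minpoly (QZ k m p) (casZ k m p)).natDegree ≤ Module.finrank (QZ k m p) (ZD k m p) :=
    minpoly.natDegree_le _
  have h4 := finrank_DEnv_le k m p
  rw [← Module.finrank_mul_finrank (QZ k m p) (ZD k m p) (DEnv k m p)] at h4
  have h5 : p ^ Fintype.card (SkewIdx m) = p ^ rk m * p ^ (Fintype.card (SkewIdx m) - rk m) := by
    rw [← pow_add, Nat.add_sub_cancel' (rk_le_card m)]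
  rw [h5] at h4
  have hpos1 : 0 < p ^ rk m := by positivity
  have hpos2 : 0 < p ^ (Fintype.card (SkewIdx m) - rk m) := by positivity
  constructor
  · refine le_antisymm ?_ h3
    refine le_trans ?_ h2
    by_contra hlt
    push Not at hlt
    exact absurd h4 (not_le.2 (Nat.mul_lt_mul_of_lt_of_le hlt h1 (hpos2.trans_le h1)))
  · refine le_antisymm ?_ h1
    by_contra hlt
    push Not at hlt
    exact absurd h4 (not_le.2 (Nat.mul_lt_mul_of_le_of_lt (h2.trans h3) hlt (hpos1.trans_le (h2.trans h3))))

lemma exists_aeval_casZ [IsAlgClosed k] (c : ZD k m p) :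
    ∃ P : Polynomial (QZ k m p), Polynomial.aeval (casZ k m p) P = c := by
  have h := (Field.primitive_element_iff_minpoly_natDegree_eq (QZ k m p) (casZ k m p)).2
    (finrank_counts k m p).1.symm
  have h1 : (⊤ : IntermediateField (QZ k m p) (ZD k m p)).toSubalgebra =
      Algebra.adjoin (QZ k m p) {casZ k m p} := by
    rw [← h]
    exact IntermediateField.adjoin_simple_toSubalgebra_of_isAlgebraic
      (Algebra.IsAlgebraic.isAlgebraic (casZ k m p))
  have h2 : c ∈ Algebra.adjoin (QZ k m p) {casZ k m p} := h1 ▸ Algebra.mem_top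
  rwa [Algebra.adjoin_singleton_eq_range_aeval] at h2

lemma exists_centerHom [IsAlgClosed k] : ∃ θ : ZD k m p →ₐ[QZ k m p] Fr k m,
    θ (casZ k m p) = casF k m := by
  let ev := Polynomial.aeval (R := QZ k m p) (casZ k m p)
  have hev : Function.Surjective ev := exists_aeval_casZ k m p
  have hker : ∀ a ∈ RingHom.ker ev, Polynomial.aeval (casF k m) a = 0 := fun a ha => by
    obtain ⟨b, rfl⟩ := minpoly.dvd (QZ k m p) (casZ k m p) (RingHom.mem_ker.1 ha)
    rw [map_mul, minpoly_casZ, aeval_casF, zero_mul]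
  let θ : ZD k m p →ₐ[QZ k m p] Fr k m :=
    (Ideal.Quotient.liftₐ (RingHom.ker ev) (Polynomial.aeval (casF k m)) hker).comp
    (Ideal.quotientKerAlgEquivOfSurjective hev).symm.toAlgHom
  refine ⟨θ, ?_⟩
  have h : casZ k m p = Ideal.quotientKerAlgEquivOfSurjective hev (Ideal.Quotient.mk _ Polynomial.X) := by
    change _ = ev Polynomial.X
    exact (Polynomial.aeval_X _).symm
  change Ideal.Quotient.liftₐ (RingHom.ker ev) (Polynomial.aeval (casF k m)) hker
    ((Ideal.quotientKerAlgEquivOfSurjective hev).symm _) = _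
  rw [h, AlgEquiv.symm_apply_apply]
  change Polynomial.aeval (casF k m) Polynomial.X = _
  rw [Polynomial.aeval_X]

end SoGK

namespace SoGK

section Straightening

variable {L D ι : Type*} [Field L] [Ring D] [Algebra L D]

/-- The span of the restricted ordered monomials in a list of variables. -/
def monSpan (L : Type*) {D ι : Type*} [Field L] [Ring D] [Algebra L D] (p : ℕ) (w : ι → D)
    (l : List ι) : Submodule L D :=
  Submodule.span L (Set.range fun a : ι → Fin p => (l.map fun i => w i ^ (a i : ℕ)).prod)

variable {p : ℕ} {w : ι → D}

lemma pow_mul_mem_monSpan [DecidableEq ι] (hp : 0 < p) (hw : ∀ i, ∃ c : L, w i ^ p = algebraMap L D c)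
    {i : ι} {l : List ι} (hi : i ∉ l) (n : ℕ) {x : D} (hx : x ∈ monSpan L p w l) :
    w i ^ n * x ∈ monSpan L p w (i :: l) := by
  obtain ⟨c, hc⟩ := hw i
  have h1 : w i ^ n = algebraMap L D (c ^ (n / p)) * w i ^ (n % p) := by
    rw [map_pow, ← hc, ← pow_mul, ← pow_add, Nat.div_add_mod]
  rw [h1, mul_assoc, ← Algebra.smul_def]
  refine Submodule.smul_mem _ _ ?_
  have h2 : monSpan L p w l ≤ (monSpan L p w (i :: l)).comap (LinearMap.mulLeft L (w i ^ (n % p))) := by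
    refine Submodule.span_le.2 ?_
    rintro _ ⟨a, rfl⟩
    refine Submodule.subset_span ⟨Function.update a i ⟨n % p, Nat.mod_lt _ hp⟩, ?_⟩
    simp only [List.map_cons, List.prod_cons, Function.update_self, LinearMap.mulLeft_apply]
    congr 2
    refine List.map_congr_left fun j hj => ?_
    rw [Function.update_of_ne]
    rintro rfl; exact hi hj
  exact h2 hx

lemma exists_mul_pow (hcomm : ∀ i j, ∃ c : L, w i * w j = w j * w i + algebraMap L D c) (i j : ι)
    (n : ℕ) : ∃ c : L, w i * w j ^ n = w j ^ n * w i + c • w j ^ (n - 1) := by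
  obtain ⟨b, hb⟩ := hcomm i j
  refine ⟨n * b, ?_⟩
  induction n with
  | zero => simp
  | succ n ih =>
    rw [pow_succ, ← mul_assoc, ih, add_mul, mul_assoc, hb, mul_add, Nat.add_sub_cancel,
      ← Algebra.commutes, ← Algebra.smul_def, smul_mul_assoc, mul_assoc, add_assoc, Nat.cast_succ,
      add_mul, one_mul, add_smul, add_comm (b • _)]
    rcases n with _ | n
    · simp
    · rw [Nat.add_sub_cancel, ← pow_succ]

lemma mul_mem_monSpan [DecidableEq ι] (hp : 0 < p) (hw : ∀ i, ∃ c : L, w i ^ p = algebraMap L D c)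
    (hcomm : ∀ i j, ∃ c : L, w i * w j = w j * w i + algebraMap L D c) (i : ι) (l : List ι)
    (hl : l.Nodup) (hi : i ∈ l) {x : D} (hx : x ∈ monSpan L p w l) :
    w i * x ∈ monSpan L p w l := by
  induction l generalizing x with
  | nil => simp at hi
  | cons j l ih =>
    rw [List.nodup_cons] at hl
    have h2 : monSpan L p w (j :: l) ≤ (monSpan L p w (j :: l)).comap (LinearMap.mulLeft L (w i)) := by
      refine Submodule.span_le.2 ?_
      rintro _ ⟨a, rfl⟩
      have hy : (l.map fun i => w i ^ (a i : ℕ)).prod ∈ monSpan L p w l :=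
        Submodule.subset_span ⟨a, rfl⟩
      simp only [List.map_cons, List.prod_cons, SetLike.mem_coe, Submodule.mem_comap,
        LinearMap.mulLeft_apply]
      rcases eq_or_ne i j with rfl | hij
      · rw [← mul_assoc, ← pow_succ']
        exact pow_mul_mem_monSpan hp hw hl.1 _ hy
      · obtain ⟨c, hc⟩ := exists_mul_pow hcomm i j (a j)
        rw [← mul_assoc, hc, add_mul, mul_assoc, smul_mul_assoc]
        refine Submodule.add_mem _ ?_ (Submodule.smul_mem _ _ ?_)
        · exact pow_mul_mem_monSpan hp hw hl.1 _
            (ih hl.2 ((List.mem_cons.1 hi).resolve_left hij) hy)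
        · exact pow_mul_mem_monSpan hp hw hl.1 _ hy
    exact h2 hx

end Straightening

lemma exists_mul_eq_one_of_finite {L D : Type*} [Field L] [DivisionRing D] [Algebra L D]
    (S : Subalgebra L D) (hS : Module.Finite L S.toSubmodule) {x : D} (hx : x ∈ S) : x⁻¹ ∈ S := by
  rcases eq_or_ne x 0 with rfl | h0
  · simp
  let f : S.toSubmodule →ₗ[L] S.toSubmodule := (LinearMap.mulLeft L x).restrict
    (p := S.toSubmodule) (q := S.toSubmodule) fun y hy => S.mul_mem hx hy
  have hf : Function.Injective f := fun a b h =>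
    Subtype.ext (mul_left_cancel₀ h0 (congrArg Subtype.val h))
  obtain ⟨y, hy⟩ := LinearMap.injective_iff_surjective.1 hf ⟨1, S.one_mem⟩
  have h1 : x * y.1 = 1 := congrArg Subtype.val hy
  rw [← eq_inv_of_mul_eq_one_right h1]
  exact y.2

lemma span_ordMon_eq_top {L D : Type*} {ι : Type} [Fintype ι] [DecidableEq ι] [Field L]
    [DivisionRing D] [Algebra L D] {p : ℕ} (hp : 0 < p) {w : ι → D}
    (hw : ∀ i, ∃ c : L, w i ^ p = algebraMap L D c)
    (hcomm : ∀ i j, ∃ c : L, w i * w j = w j * w i + algebraMap L D c)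
    (hgen : ∀ S : Subalgebra L D, (∀ x ∈ S, x⁻¹ ∈ S) → (∀ i, w i ∈ S) → S = ⊤) :
    Submodule.span L (Set.range fun a : ι → Fin p => ordMon w fun i => a i) = ⊤ := by
  set M := monSpan L p w Finset.univ.toList with hM
  have hmem : ∀ i, ∀ x ∈ M, w i * x ∈ M := fun i x hx =>
    mul_mem_monSpan hp hw hcomm i _ (Finset.nodup_toList _) (by simp) hx
  have hone : (1 : D) ∈ M := Submodule.subset_span ⟨fun _ => ⟨0, hp⟩, by simp⟩
  have hl : ∀ (l : List ι) (a : ι → Fin p), ∀ x ∈ M,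
      (l.map fun i => w i ^ (a i : ℕ)).prod * x ∈ M := by
    intro l a x hx
    induction l with
    | nil => simpa using hx
    | cons i l ih =>
      have hpow : ∀ n : ℕ, ∀ z ∈ M, w i ^ n * z ∈ M := by
        intro n z hz
        induction n with
        | zero => simpa using hz
        | succ n ih => rw [pow_succ', mul_assoc]; exact hmem i _ ih
      rw [List.map_cons, List.prod_cons, mul_assoc]
      exact hpow _ _ ih
  have hmul : ∀ x ∈ M, ∀ y ∈ M, x * y ∈ M := by
    intro x hx y hy
    have h2 : M ≤ M.comap (LinearMap.mulRight L y) := by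
      refine Submodule.span_le.2 ?_
      rintro _ ⟨a, rfl⟩
      exact hl _ a y hy
    exact h2 hx
  let S : Subalgebra L D := M.toSubalgebra hone fun x y hx hy => hmul x hx y hy
  have hfin : Module.Finite L S.toSubmodule :=
    Module.Finite.iff_fg.2 (Submodule.fg_span (Set.finite_range _))
  have hS := hgen S (fun x hx => exists_mul_eq_one_of_finite S hfin hx) fun i => by
    have := hmem i 1 hone
    rw [mul_one] at this
    exact this
  refine eq_top_iff.2 fun x _ => ?_
  have hx : x ∈ S := hS ▸ Algebra.mem_top
  exact hx

/-- Families satisfying the relations of the Weyl algebra with central parameters. -/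
structure WeylSystem {R : Type*} [Ring R] {r s : ℕ} (u v : Fin r → R) (y : Fin s → R) : Prop where
  uu : ∀ i j, Commute (u i) (u j)
  vv : ∀ i j, Commute (v i) (v j)
  uv : ∀ i j, u i * v j = v j * u i + if i = j then 1 else 0
  yu : ∀ a i, Commute (y a) (u i)
  yv : ∀ a i, Commute (y a) (v i)
  yy : ∀ a b, Commute (y a) (y b)

/-- Every subalgebra closed under inverses and containing the families is everything. -/
def GeneratesDivision (k : Type*) {D : Type*} [Field k] [DivisionRing D] [Algebra k D] {r s : ℕ}
    (u v : Fin r → D) (y : Fin s → D) : Prop :=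
  ∀ S : Subalgebra k D, (∀ x ∈ S, x⁻¹ ∈ S) → (∀ i, u i ∈ S) → (∀ i, v i ∈ S) → (∀ a, y a ∈ S) →
    S = ⊤

section Generated

variable {k D : Type*} [Field k] [DivisionRing D] [Algebra k D] {r s : ℕ}
  {u v : Fin r → D} {y : Fin s → D}

lemma GeneratesDivision.mem_center (hg : GeneratesDivision k u v y) {z : D}
    (hu : ∀ i, Commute (u i) z) (hv : ∀ i, Commute (v i) z) (hy : ∀ a, Commute (y a) z) :
    z ∈ Subring.center D := by
  have h := hg (Subalgebra.centralizer k {z}) (fun x hx => by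
      rw [Subalgebra.mem_centralizer_iff] at hx ⊢
      intro g hg
      have hgx : Commute g x := hx g hg
      exact hgx.inv_right₀.eq)
    (fun i => by
      rw [Subalgebra.mem_centralizer_iff]
      rintro g rfl; exact (hu i).eq.symm)
    (fun i => by
      rw [Subalgebra.mem_centralizer_iff]
      rintro g rfl; exact (hv i).eq.symm)
    (fun i => by
      rw [Subalgebra.mem_centralizer_iff]
      rintro g rfl; exact (hy i).eq.symm)
  refine Subring.mem_center_iff.2 fun x => ?_
  have hx : x ∈ Subalgebra.centralizer k {z} := h ▸ Algebra.mem_top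
  rw [Subalgebra.mem_centralizer_iff] at hx
  exact (hx z rfl).symm

lemma commute_pow_char {R : Type*} [Ring R] (p : ℕ) [CharP R p] {a b c : R} (hc : Commute b c)
    (h : a * b = b * a + c) : Commute a (b ^ p) := by
  have h1 : ∀ n : ℕ, a * b ^ n = b ^ n * a + n • (c * b ^ (n - 1)) := by
    intro n
    induction n with
    | zero => simp
    | succ n ih =>
      rw [pow_succ, ← mul_assoc, ih, add_mul, mul_assoc, h, mul_add, Nat.add_sub_cancel,
        smul_mul_assoc, mul_assoc, mul_assoc, add_assoc, (hc.pow_left n).eq, add_smul, one_smul,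
        add_comm (n • _)]
      rcases n with _ | n
      · simp
      · rw [Nat.add_sub_cancel, ← pow_succ]
  have h2 := h1 p
  rwa [← Nat.cast_smul_eq_nsmul R, CharP.cast_eq_zero, zero_smul, add_zero] at h2

variable (p : ℕ) [Fact p.Prime] [CharP D p]

lemma WeylSystem.mem_center_y (h : WeylSystem u v y) (hg : GeneratesDivision k u v y) (a : Fin s) :
    y a ∈ Subring.center D :=
  hg.mem_center (fun i => (h.yu a i).symm) (fun i => (h.yv a i).symm) (fun b => h.yy b a)

omit [Fact p.Prime] in
lemma WeylSystem.mem_center_u (h : WeylSystem u v y) (hg : GeneratesDivision k u v y) (i : Fin r) :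
    u i ^ p ∈ Subring.center D := by
  refine hg.mem_center (fun j => (h.uu j i).pow_right p) (fun j => ?_)
    (fun b => (h.yu b i).pow_right p)
  refine commute_pow_char p (c := - if i = j then 1 else 0) ?_ ?_
  · split_ifs <;> simp
  · rw [h.uv]; abel

omit [Fact p.Prime] in
lemma WeylSystem.mem_center_v (h : WeylSystem u v y) (hg : GeneratesDivision k u v y) (i : Fin r) :
    v i ^ p ∈ Subring.center D := by
  refine hg.mem_center (fun j => ?_) (fun j => (h.vv j i).pow_right p)
    (fun b => (h.yv b i).pow_right p)
  refine commute_pow_char p (c := if j = i then 1 else 0) ?_ (h.uv j i)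
  split_ifs <;> simp

lemma WeylSystem.linearIndependent (h : WeylSystem u v y) :
    LinearIndependent (Subring.center D) fun a : Fin r ⊕ Fin r → Fin p =>
      ordMon (Sum.elim u v) fun i => a i := by
  haveI : CharP (Subring.center D) p :=
    (RingHom.charP_iff (Subring.center D).subtype Subtype.val_injective p).2 inferInstance
  let C := Subring.center D
  let d : Fin r ⊕ Fin r → D →ₗ[C] D := Sum.elim
    (fun i => LinearMap.mulRight C (v i) - LinearMap.mulLeft C (v i))
    (fun i => LinearMap.mulLeft C (u i) - LinearMap.mulRight C (u i))
  refine linearIndependent_ordMon p (Sum.elim u v) d ?_ ?_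
  · rintro (i | i) x y <;> simp [d] <;> noncomm_ring
  · rintro (i | i) (j | j)
    · simp [d, h.uv, eq_comm]
    · simp [d, (h.vv i j).eq]
    · simp [d, (h.uu i j).eq]
    · simp [d, h.uv]

lemma WeylSystem.pow_le_finrank (h : WeylSystem u v y) [Module.Finite (Subring.center D) D] :
    p ^ (r + r) ≤ Module.finrank (Subring.center D) D := by
  have := (h.linearIndependent p).fintype_card_le_finrank
  rwa [Fintype.card_fun, Fintype.card_fin, Fintype.card_sum, Fintype.card_fin] at this

lemma WeylSystem.center_eq_top (h : WeylSystem u v y) (hg : GeneratesDivision k u v y)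
    (F : Subfield (Subring.center D))
    (hk : ∀ c : k, ∃ f ∈ F, (f : D) = algebraMap k D c)
    (hu : ∀ i, ∃ f ∈ F, (f : D) = u i ^ p) (hv : ∀ i, ∃ f ∈ F, (f : D) = v i ^ p)
    (hy : ∀ a, ∃ f ∈ F, (f : D) = y a) : F = ⊤ := by
  letI : Algebra F D := Algebra.compHom D F.subtype
  have halg : ∀ f : F, algebraMap F D f = ((f : Subring.center D) : D) := fun _ => rfl
  have hp : 0 < p := (Fact.out : p.Prime).pos
  have hspan := span_ordMon_eq_top (L := F) hp (w := Sum.elim u v) (by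
      rintro (i | i)
      · obtain ⟨f, hf, h⟩ := hu i; exact ⟨⟨f, hf⟩, by rw [halg, h]; rfl⟩
      · obtain ⟨f, hf, h⟩ := hv i; exact ⟨⟨f, hf⟩, by rw [halg, h]; rfl⟩) (by
      rintro (i | i) (j | j)
      · exact ⟨0, by simp [(h.uu i j).eq]⟩
      · refine ⟨if i = j then 1 else 0, ?_⟩
        simp only [Sum.elim_inl, Sum.elim_inr, h.uv]
        split_ifs <;> simp
      · refine ⟨-if j = i then 1 else 0, ?_⟩
        simp only [Sum.elim_inl, Sum.elim_inr, h.uv]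
        split_ifs <;> simp
      · exact ⟨0, by simp [(h.vv i j).eq]⟩) (by
      intro S hS hw
      let S' : Subalgebra k D := { S.toSubring with
        algebraMap_mem' := fun c => by
          obtain ⟨f, hf, h⟩ := hk c
          rw [← h]; exact S.algebraMap_mem ⟨f, hf⟩ }
      have h' := hg S' hS (fun i => hw (.inl i)) (fun i => hw (.inr i)) (fun a => by
        obtain ⟨f, hf, h⟩ := hy a
        rw [← h]; exact S.algebraMap_mem ⟨f, hf⟩)
      refine eq_top_iff.2 fun x _ => ?_
      have : x ∈ S' := h' ▸ Algebra.mem_top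
      exact this)
  refine eq_top_iff.2 fun c _ => ?_
  have hc : (c : D) ∈ Submodule.span F (Set.range fun a : Fin r ⊕ Fin r → Fin p =>
    ordMon (Sum.elim u v) fun i => (a i : ℕ)) := hspan ▸ Submodule.mem_top
  obtain ⟨g, hg'⟩ := (Submodule.mem_span_range_iff_exists_fun F).1 hc
  have hli := Fintype.linearIndependent_iff.1 (h.linearIndependent p)
  have hone : ordMon (Sum.elim u v) (fun i => (((fun _ => ⟨0, hp⟩ : Fin r ⊕ Fin r → Fin p) i : Fin p) : ℕ)) = 1 := by
    simp [ordMon]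
  classical
  have h0 := hli (fun a => (g a : Subring.center D) - if a = fun _ => ⟨0, hp⟩ then c else 0) (by
    simp only [sub_smul, ite_smul, zero_smul, Finset.sum_sub_distrib, Finset.sum_ite_eq',
      Finset.sum_ite_eq, Finset.mem_univ, if_true]
    rw [hone, sub_eq_zero]
    refine Eq.trans (b := (c : D)) ?_ (by rw [Algebra.smul_def, mul_one]; rfl)
    rw [← hg']
    rfl) (fun _ => ⟨0, hp⟩)
  rw [if_pos rfl, sub_eq_zero] at h0
  rw [← h0]
  exact (g _).2

end Generated

end SoGK

namespace SoGK

open Matrix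

section Reflections

variable {k : Type*} [Field k] {n : Type*} [Fintype n] [DecidableEq n]

/-- The reflection in a unit vector. -/
def reflMat (u : n → k) : Matrix n n k := 1 - (2 : k) • vecMulVec u u

/-- The Siegel transformation attached to an isotropic vector and an orthogonal unit vector. -/
def siegel (w u : n → k) : Matrix n n k :=
  1 + (vecMulVec w u - vecMulVec u w) - (2⁻¹ : k) • vecMulVec w w

lemma reflMat_mulVec (u x : n → k) : reflMat u *ᵥ x = x - (2 * (u ⬝ᵥ x)) • u := by
  rw [reflMat, sub_mulVec, one_mulVec, smul_mulVec, vecMulVec_mulVec, mul_smul]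
  simp

lemma reflMat_mul_self {u : n → k} (hu : u ⬝ᵥ u = 1) : reflMat u * reflMat u = 1 := by
  simp only [reflMat, mul_sub, sub_mul, one_mul, mul_one, smul_mul_assoc, mul_smul_comm,
    vecMulVec_mul_vecMulVec, hu, one_smul, smul_smul]
  module

lemma reflMat_transpose (u : n → k) : (reflMat u)ᵀ = reflMat u := by
  rw [reflMat, transpose_sub, transpose_one, transpose_smul, transpose_vecMulVec]

lemma reflMat_neg (u : n → k) : reflMat (-u) = reflMat u := by
  rw [reflMat, vecMulVec_neg, neg_vecMulVec, neg_neg, reflMat]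

lemma det_reflMat {u : n → k} (hu : u ⬝ᵥ u = 1) : (reflMat u).det = -1 := by
  have h : reflMat u = 1 + replicateCol Unit (-(2 : k) • u) * replicateRow Unit u := by
    rw [← vecMulVec_eq, smul_vecMulVec, reflMat, neg_smul, sub_eq_add_neg]
  rw [h, det_one_add_replicateCol_mul_replicateRow, dotProduct_smul, hu]
  norm_num

lemma siegel_eq_mul [NeZero (2 : k)] {u v : n → k} (hu : u ⬝ᵥ u = 1) (hv : v ⬝ᵥ v = 1)
    (huv : u ⬝ᵥ v = 1) : reflMat u * reflMat v = siegel ((2 : k) • (u - v)) u := by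
  have h2 : (2 : k) ≠ 0 := NeZero.ne 2
  simp only [reflMat, siegel, mul_sub, sub_mul, one_mul, mul_one, smul_mul_assoc, mul_smul_comm,
    vecMulVec_mul_vecMulVec, huv, one_smul, smul_smul, vecMulVec_sub, sub_vecMulVec, smul_vecMulVec,
    vecMulVec_smul]
  have h3 : (2⁻¹ * (2 * 2) : k) = 2 := by field_simp
  simp only [smul_sub, smul_smul, h3, inv_mul_cancel₀ h2, one_smul]
  module

lemma exists_unit_vector [IsAlgClosed k] {v : n → k} (hv : v ⬝ᵥ v ≠ 0) :
    ∃ (t : k) (u : n → k), t ≠ 0 ∧ v = t • u ∧ u ⬝ᵥ u = 1 := by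
  obtain ⟨t, ht⟩ := IsAlgClosed.exists_pow_nat_eq (v ⬝ᵥ v) (n := 2) (by norm_num)
  have ht0 : t ≠ 0 := by
    rintro rfl; exact hv (by rw [← ht]; norm_num)
  refine ⟨t, t⁻¹ • v, ht0, by rw [smul_smul, mul_inv_cancel₀ ht0, one_smul], ?_⟩
  rw [dotProduct_smul, smul_dotProduct, ← ht, smul_eq_mul, smul_eq_mul]
  field_simp

lemma exists_reflMat_swap [IsAlgClosed k] [NeZero (2 : k)] {a b : n → k} (h : a ⬝ᵥ a = b ⬝ᵥ b)
    (hv : (a - b) ⬝ᵥ (a - b) ≠ 0) : ∃ u : n → k, u ⬝ᵥ u = 1 ∧ reflMat u *ᵥ a = b ∧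
      ∀ x, x ⬝ᵥ a = 0 → x ⬝ᵥ b = 0 → reflMat u *ᵥ x = x := by
  obtain ⟨t, u, ht, htu, hu⟩ := exists_unit_vector hv
  have h2 : (2 : k) ≠ 0 := NeZero.ne 2
  refine ⟨u, hu, ?_, fun x hxa hxb => ?_⟩
  · have h1 : 2 * (u ⬝ᵥ a) = t := by
      have h3 : (a - b) ⬝ᵥ (a - b) = 2 * ((a - b) ⬝ᵥ a) := by
        simp only [sub_dotProduct, dotProduct_sub, dotProduct_comm b a, ← h]
        ring
      have h4 : t * t = t * (2 * (u ⬝ᵥ a)) := by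
        have h5 := h3
        rw [htu, smul_dotProduct, smul_dotProduct, dotProduct_smul, hu] at h5
        simp only [smul_eq_mul] at h5
        linear_combination h5
      exact (mul_left_cancel₀ ht h4).symm
    rw [reflMat_mulVec, h1, ← htu]
    abel
  · have h1 : u ⬝ᵥ x = 0 := by
      have : (a - b) ⬝ᵥ x = 0 := by
        rw [sub_dotProduct, dotProduct_comm, hxa, dotProduct_comm, hxb, sub_zero]
      rw [htu, smul_dotProduct, smul_eq_mul] at this
      exact (mul_eq_zero.1 this).resolve_left ht
    rw [reflMat_mulVec, h1, mul_zero, zero_smul, sub_zero]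

lemma mulVec_dotProduct_mulVec {g : Matrix n n k} (hg : gᵀ * g = 1) (x y : n → k) :
    (g *ᵥ x) ⬝ᵥ (g *ᵥ y) = x ⬝ᵥ y := by
  rw [dotProduct_mulVec, vecMul_mulVec, hg, vecMul_one]

end Reflections

section Generation

variable {k : Type*} [Field k] [IsAlgClosed k] [NeZero (2 : k)] {m : ℕ}

lemma exists_refl_list_aux (N : ℕ) : ∀ g : Matrix (Fin m) (Fin m) k, gᵀ * g = 1 →
    (∀ i : Fin m, N ≤ i → g *ᵥ Pi.single i 1 = Pi.single i 1) →
    ∃ L : List (Fin m → k), (∀ u ∈ L, u ⬝ᵥ u = 1) ∧ g = (L.map reflMat).prod := by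
  induction N with
  | zero =>
    intro g _ h
    refine ⟨[], by simp, ?_⟩
    rw [List.map_nil, List.prod_nil]
    refine Matrix.ext_of_mulVec_single fun i => ?_
    rw [h i (Nat.zero_le _), one_mulVec]
  | succ N ih =>
    intro g hg h
    by_cases hN : N < m
    swap
    · exact ih g hg fun i hi => absurd i.2 (by omega)
    set e : Fin m → Fin m → k := fun i => Pi.single i 1 with he
    have hee : ∀ i j, e i ⬝ᵥ e j = if i = j then 1 else 0 := fun i j => by
      simp [he, Pi.single_apply, eq_comm]
    set j : Fin m := ⟨N, hN⟩ with hj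
    have step : ∀ (g : Matrix (Fin m) (Fin m) k) (u : Fin m → k), u ⬝ᵥ u = 1 →
        (∃ L : List (Fin m → k), (∀ u ∈ L, u ⬝ᵥ u = 1) ∧ reflMat u * g = (L.map reflMat).prod) →
        ∃ L : List (Fin m → k), (∀ u ∈ L, u ⬝ᵥ u = 1) ∧ g = (L.map reflMat).prod := by
      rintro g u hu ⟨L, hL, hLg⟩
      refine ⟨u :: L, by simpa using ⟨hu, hL⟩, ?_⟩
      rw [List.map_cons, List.prod_cons, ← hLg, ← mul_assoc, reflMat_mul_self hu, one_mul]
    have horth : ∀ u : Fin m → k, u ⬝ᵥ u = 1 → ∀ h : Matrix (Fin m) (Fin m) k, hᵀ * h = 1 →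
        (reflMat u * h)ᵀ * (reflMat u * h) = 1 := fun u hu h hh => by
      rw [transpose_mul, mul_assoc, ← mul_assoc (reflMat u)ᵀ, reflMat_transpose,
        reflMat_mul_self hu, one_mul, hh]
    have hnorm : (g *ᵥ e j) ⬝ᵥ (g *ᵥ e j) = e j ⬝ᵥ e j := mulVec_dotProduct_mulVec hg _ _
    have hperp : ∀ i : Fin m, N + 1 ≤ i → e i ⬝ᵥ (g *ᵥ e j) = 0 ∧ e i ⬝ᵥ e j = 0 := fun i hi => by
      have hij : i ≠ j := fun h => by rw [h] at hi; simp [hj] at hi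
      have h1 : e i ⬝ᵥ e j = 0 := by rw [hee, if_neg hij]
      refine ⟨?_, h1⟩
      have h3 := mulVec_dotProduct_mulVec hg (e i) (e j)
      rwa [show g *ᵥ e i = e i from h i hi, h1] at h3
    by_cases hv : (g *ᵥ e j - e j) ⬝ᵥ (g *ᵥ e j - e j) = 0
    · have hv2 : (g *ᵥ e j - -e j) ⬝ᵥ (g *ᵥ e j - -e j) ≠ 0 := by
        intro h0
        have h1 : (4 : k) = 0 := by
          simp only [sub_neg_eq_add, sub_dotProduct, dotProduct_sub, add_dotProduct, dotProduct_add, hnorm, hee, if_true] at h0 hv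
          linear_combination h0 + hv
        exact NeZero.ne (2 : k) (by
          have : (2 : k) * 2 = 0 := by rw [← h1]; norm_num
          simpa using this)
      obtain ⟨u, hu, hus, hux⟩ := exists_reflMat_swap (by simpa using hnorm) hv2
      have hj1 : e j ⬝ᵥ e j = 1 := by rw [hee, if_pos rfl]
      refine step _ u hu (step _ (e j) hj1 (ih _ (horth _ hj1 _ (horth u hu g hg)) fun i hi => ?_))
      rw [← mulVec_mulVec, ← mulVec_mulVec]
      rcases Nat.lt_or_ge N i with hi' | hi'
      · rw [h i hi', hux (Pi.single i 1) (hperp i hi').1 (by rw [dotProduct_neg]; exact neg_eq_zero.2 (hperp i hi').2),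
          reflMat_mulVec, dotProduct_comm, (hperp i hi').2]
        simp
      · obtain rfl : i = j := Fin.ext (le_antisymm hi' hi)
        change reflMat (e j) *ᵥ (reflMat u *ᵥ (g *ᵥ e j)) = e j
        rw [hus, reflMat_mulVec, dotProduct_neg, hj1]
        module
    · obtain ⟨u, hu, hus, hux⟩ := exists_reflMat_swap hnorm hv
      refine step _ u hu (ih _ (horth u hu g hg) fun i hi => ?_)
      rw [← mulVec_mulVec]
      rcases Nat.lt_or_ge N i with hi' | hi'
      · rw [h i hi']
        exact hux _ (hperp i hi').1 (hperp i hi').2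
      · obtain rfl : i = j := Fin.ext (le_antisymm hi' hi)
        exact hus

lemma exists_refl_list {g : Matrix (Fin m) (Fin m) k} (hg : gᵀ * g = 1) :
    ∃ L : List (Fin m → k), (∀ u ∈ L, u ⬝ᵥ u = 1) ∧ g = (L.map reflMat).prod :=
  exists_refl_list_aux m g hg fun i hi => absurd i.2 (by omega)

lemma exists_perp (hm : 5 ≤ m) (u v : Fin m → k) :
    ∃ z : Fin m → k, u ⬝ᵥ z = 0 ∧ v ⬝ᵥ z = 0 ∧ z ⬝ᵥ z ≠ 0 := by
  by_contra! hcon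
  let f : (Fin m → k) →ₗ[k] (Fin 2 → k) := (Matrix.of ![u, v]).mulVecLin
  have hf : ∀ z, z ∈ LinearMap.ker f ↔ u ⬝ᵥ z = 0 ∧ v ⬝ᵥ z = 0 := fun z => by
    rw [LinearMap.mem_ker, funext_iff, Fin.forall_fin_two]
    rfl
  have h0 : ∀ z ∈ LinearMap.ker f, z ⬝ᵥ z = 0 := fun z hz =>
    hcon z ((hf z).1 hz).1 ((hf z).1 hz).2
  have h2 : (2 : k) ≠ 0 := NeZero.ne 2
  have h1 : ∀ z ∈ LinearMap.ker f, ∀ z' ∈ LinearMap.ker f, z ⬝ᵥ z' = 0 := fun z hz z' hz' => by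
    have h := h0 _ (Submodule.add_mem _ hz hz')
    rw [add_dotProduct, dotProduct_add, dotProduct_add, h0 z hz, h0 z' hz', dotProduct_comm z' z] at h
    have h3 : 2 * (z ⬝ᵥ z') = 0 := by linear_combination h
    exact (mul_eq_zero.1 h3).resolve_left h2
  let φ : (Fin m → k) →ₗ[k] Module.Dual k (Fin m → k) := dotProductBilin k k
  have hφ : Function.Injective φ := by
    rw [← LinearMap.ker_eq_bot, LinearMap.ker_eq_bot']
    intro x hx
    funext i
    have := LinearMap.congr_fun hx (Pi.single i 1)
    simpa [φ] using this
  have h3 : (LinearMap.ker f).map φ ≤ (LinearMap.ker f).dualAnnihilator := by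
    rintro _ ⟨z, hz, rfl⟩
    rw [Submodule.mem_dualAnnihilator]
    exact fun z' hz' => h1 z hz z' hz'
  have h4 := Submodule.finrank_mono h3
  rw [← (Submodule.equivMapOfInjective φ hφ (LinearMap.ker f)).finrank_eq] at h4
  have h5 := Subspace.finrank_add_finrank_dualAnnihilator_eq (LinearMap.ker f)
  have h6 := f.finrank_range_add_finrank_ker
  have h7 := (LinearMap.range f).finrank_le
  rw [Module.finrank_fin_fun] at h5 h6 h7
  omega

/-- A multiplicative property of Siegel transformations holds for the whole rotation group. -/
lemma so_induction (hm : 5 ≤ m) {P : Matrix (Fin m) (Fin m) k → Prop} (h1 : P 1)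
    (hmul : ∀ g h, P g → P h → P (g * h))
    (hs : ∀ w u : Fin m → k, w ⬝ᵥ w = 0 → w ⬝ᵥ u = 0 → u ⬝ᵥ u = 1 → P (siegel w u))
    {g : Matrix (Fin m) (Fin m) k} (hg : gᵀ * g = 1) (hdet : g.det = 1) : P g := by
  have h2 : (2 : k) ≠ 0 := NeZero.ne 2
  have base : ∀ u v : Fin m → k, u ⬝ᵥ u = 1 → v ⬝ᵥ v = 1 → u ⬝ᵥ v = 1 →
      P (reflMat u * reflMat v) := by
    intro u v hu hv huv
    rw [siegel_eq_mul hu hv huv]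
    refine hs _ _ ?_ ?_ hu
    · simp only [smul_dotProduct, dotProduct_smul, sub_dotProduct, dotProduct_sub, hu, hv, huv,
        dotProduct_comm v u]
      simp
    · simp only [smul_dotProduct, sub_dotProduct, hu, huv, dotProduct_comm v u]
      simp
  have pair' : ∀ u v : Fin m → k, u ⬝ᵥ u = 1 → v ⬝ᵥ v = 1 → 1 + u ⬝ᵥ v ≠ 0 →
      P (reflMat u * reflMat v) := by
    intro u v hu hv huv
    obtain ⟨z, huz, hvz, hz⟩ := exists_perp hm u v
    obtain ⟨t, ht⟩ := IsAlgClosed.exists_pow_nat_eq ((1 - 2 * (1 + u ⬝ᵥ v)⁻¹) / (z ⬝ᵥ z)) (n := 2)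
      (by norm_num)
    set a := (1 + u ⬝ᵥ v)⁻¹ with ha
    have ha' : a * (1 + u ⬝ᵥ v) = 1 := inv_mul_cancel₀ huv
    have ht' : t ^ 2 * (z ⬝ᵥ z) = 1 - 2 * a := by rw [ht, div_mul_cancel₀ _ hz]
    set x := a • (u + v) + t • z with hx
    have hux : u ⬝ᵥ x = 1 := by
      simp only [hx, dotProduct_add, dotProduct_smul, hu, huz, smul_eq_mul]
      linear_combination ha'
    have hxv : x ⬝ᵥ v = 1 := by
      simp only [hx, add_dotProduct, smul_dotProduct, hv, dotProduct_comm z v, hvz, smul_eq_mul]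
      linear_combination ha'
    have hxx : x ⬝ᵥ x = 1 := by
      nth_rewrite 2 [hx]
      simp only [dotProduct_add, dotProduct_smul, hxv, dotProduct_comm x u, hux, smul_eq_mul]
      simp only [hx, add_dotProduct, smul_dotProduct, huz, hvz, smul_eq_mul]
      linear_combination ht'
    have h3 := hmul _ _ (base u x hu hxx hux) (base x v hxx hv hxv)
    rwa [mul_assoc, ← mul_assoc (reflMat x), reflMat_mul_self hxx, one_mul] at h3
  have pair : ∀ u v : Fin m → k, u ⬝ᵥ u = 1 → v ⬝ᵥ v = 1 → P (reflMat u * reflMat v) := by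
    intro u v hu hv
    by_cases huv : 1 + u ⬝ᵥ v = 0
    · rw [← reflMat_neg v]
      refine pair' u (-v) hu (by simpa using hv) fun h => h2 ?_
      rw [dotProduct_neg] at h
      linear_combination huv + h
    · exact pair' u v hu hv huv
  obtain ⟨L, hL, rfl⟩ := exists_refl_list hg
  have hlist : ∀ (N : ℕ) (L : List (Fin m → k)), L.length = N → (∀ u ∈ L, u ⬝ᵥ u = 1) →
      (L.map reflMat).prod.det = 1 → P (L.map reflMat).prod := by
    intro N
    induction N using Nat.strong_induction_on with
    | _ N ih =>
      intro L hN hL hd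
      match L, hN, hL, hd with
      | [], _, _, _ => simpa using h1
      | [u], _, hL, hd =>
        rw [List.map_singleton, List.prod_singleton, det_reflMat (hL u (by simp))] at hd
        exact absurd (by linear_combination -hd : (2 : k) = 0) h2
      | u :: v :: L, hN, hL, hd =>
        have hu := hL u (by simp)
        have hv := hL v (by simp)
        simp only [List.map_cons, List.prod_cons, det_mul, det_reflMat hu, det_reflMat hv] at hd ⊢
        rw [← mul_assoc]
        refine hmul _ _ (pair u v hu hv) (ih L.length (by rw [← hN]; simp) L rfl
          (fun u hu => hL u (by simp [hu])) (by simpa using hd))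
  exact hlist _ L rfl hL hdet

end Generation

end SoGK

namespace SoGK

attribute [local instance] LieRing.ofAssociativeRing

open Matrix

section TruncatedExp

variable {k R : Type*} [Field k] [Ring R] [Algebra k R]

open Finset in
lemma leibniz_pow_apply {d : R →ₗ[k] R} (hd : ∀ x y, d (x * y) = d x * y + x * d y) (n : ℕ)
    (x y : R) : (d ^ n) (x * y) =
      ∑ ij ∈ antidiagonal n, n.choose ij.1 • ((d ^ ij.1) x * (d ^ ij.2) y) := by
  induction n with
  | zero => simp
  | succ n ih =>
    rw [Finset.sum_antidiagonal_choose_succ_nsmul (M := R) (fun i j => (d ^ i) x * (d ^ j) y) n]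
    simp only [pow_succ', Module.End.mul_apply, ih, map_sum, map_nsmul, hd, smul_add,
      sum_add_distrib]
    rw [add_comm]
    congr 1
    refine sum_congr rfl fun ij hij => ?_
    rw [n.choose_symm_of_eq_add (mem_antidiagonal.1 hij).symm]

lemma pow_apply_mul_eq_zero {d : R →ₗ[k] R} (hd : ∀ x y, d (x * y) = d x * y + x * d y) {A B : ℕ}
    {x y : R} (hx : ∀ i, A < i → (d ^ i) x = 0) (hy : ∀ i, B < i → (d ^ i) y = 0) (n : ℕ)
    (hn : A + B < n) : (d ^ n) (x * y) = 0 := by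
  rw [leibniz_pow_apply hd]
  refine Finset.sum_eq_zero fun ij hij => ?_
  rw [Finset.HasAntidiagonal.mem_antidiagonal] at hij
  rcases lt_or_ge A ij.1 with h | h
  · rw [hx _ h, zero_mul, smul_zero]
  · rw [hy _ (by omega), mul_zero, smul_zero]

/-- The exponential series truncated at `p`. -/
def truncExp (p : ℕ) (d : R →ₗ[k] R) (x : R) : R :=
  ∑ j ∈ Finset.range p, ((j.factorial : k)⁻¹) • (d ^ j) x

lemma truncExp_add (p : ℕ) (d : R →ₗ[k] R) (x y : R) :
    truncExp p d (x + y) = truncExp p d x + truncExp p d y := by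
  simp only [truncExp, map_add, smul_add, Finset.sum_add_distrib]

lemma truncExp_mul (p : ℕ) [Fact p.Prime] [CharP k p] {d : R →ₗ[k] R}
    (hd : ∀ x y, d (x * y) = d x * y + x * d y) {A B : ℕ}
    {x y : R} (hx : ∀ i, A < i → (d ^ i) x = 0) (hy : ∀ i, B < i → (d ^ i) y = 0) (h : A + B < p) :
    truncExp p d (x * y) = truncExp p d x * truncExp p d y := by
  have hfac : ∀ n, n < p → (n.factorial : k) ≠ 0 := fun n hn => by
    rw [Ne, CharP.cast_eq_zero_iff k p, (Fact.out : p.Prime).dvd_factorial]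
    omega
  have h1 : ∀ n ∈ Finset.range p, ((n.factorial : k)⁻¹) • (d ^ n) (x * y) =
      ∑ ij ∈ Finset.HasAntidiagonal.antidiagonal n, (((ij.1.factorial : k)⁻¹) • (d ^ ij.1) x) *
        (((ij.2.factorial : k)⁻¹) • (d ^ ij.2) y) := by
    intro n hn
    rw [leibniz_pow_apply hd, Finset.smul_sum]
    refine Finset.sum_congr rfl fun ij hij => ?_
    rw [Finset.mem_range] at hn
    rw [Finset.HasAntidiagonal.mem_antidiagonal] at hij
    rw [smul_mul_smul_comm, ← Nat.cast_smul_eq_nsmul k, smul_smul]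
    congr 1
    rw [← hij, Nat.choose_symm_add, Nat.add_choose, Nat.cast_div (Nat.factorial_mul_factorial_dvd_factorial_add _ _),
      Nat.cast_mul]
    · have := hfac (ij.1 + ij.2) (by omega)
      have h2 := hfac ij.1 (by omega)
      have h3 := hfac ij.2 (by omega)
      field_simp
    · rw [Nat.cast_mul]
      exact mul_ne_zero (hfac _ (by omega)) (hfac _ (by omega))
  rw [truncExp, Finset.sum_congr rfl h1, truncExp, truncExp, Finset.sum_mul_sum, ← Finset.sum_product',
    Finset.sum_sigma']
  symm
  refine Finset.sum_bij_ne_zero (fun ij _ _ => ⟨ij.1 + ij.2, ij⟩) ?_ ?_ ?_ ?_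
  · intro ij _ hne
    simp only [Finset.mem_sigma, Finset.mem_range, Finset.HasAntidiagonal.mem_antidiagonal, and_true]
    by_contra hge
    apply hne
    rcases lt_or_ge A ij.1 with h | h
    · rw [hx _ h, smul_zero, zero_mul]
    · rw [hy _ (by omega), smul_zero, mul_zero]
  · intro a _ _ b _ _ hab
    simp only [Sigma.mk.injEq] at hab
    exact eq_of_heq hab.2
  · rintro ⟨n, ij⟩ hb hne
    simp only [Finset.mem_sigma, Finset.mem_range, Finset.HasAntidiagonal.mem_antidiagonal] at hb
    refine ⟨ij, ?_, hne, ?_⟩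
    · simp only [Finset.mem_product, Finset.mem_range]; omega
    · obtain ⟨h1, rfl⟩ := hb; rfl
  · intro ij _ _; rfl

end TruncatedExp

section Conjugation

variable {k : Type} [Field k] {m : ℕ}

lemma conj_mem_so (g : Matrix (Fin m) (Fin m) k) (x : So k m) :
    g * x.1 * gᵀ ∈ LieAlgebra.Orthogonal.so (Fin m) k := by
  rw [LieAlgebra.Orthogonal.mem_so, transpose_mul, transpose_mul, transpose_transpose,
    (LieAlgebra.Orthogonal.mem_so (Fin m) k x.1).1 x.2, neg_mul, mul_neg, mul_assoc]

/-- Conjugation by an orthogonal matrix as an automorphism of the Lie algebra. -/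
def conjSo (g : Matrix (Fin m) (Fin m) k) (hg : gᵀ * g = 1) : So k m →ₗ⁅k⁆ So k m where
  toFun x := ⟨g * x.1 * gᵀ, conj_mem_so g x⟩
  map_add' x y := Subtype.ext (by
    change g * (x.1 + y.1) * gᵀ = g * x.1 * gᵀ + g * y.1 * gᵀ
    rw [mul_add, add_mul])
  map_smul' c x := Subtype.ext (by
    change g * (c • x.1) * gᵀ = c • (g * x.1 * gᵀ)
    rw [mul_smul_comm, smul_mul_assoc])
  map_lie' {x y} := Subtype.ext (by
    change g * (x.1 * y.1 - y.1 * x.1) * gᵀ =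
      g * x.1 * gᵀ * (g * y.1 * gᵀ) - g * y.1 * gᵀ * (g * x.1 * gᵀ)
    have h : ∀ a b : Matrix (Fin m) (Fin m) k, g * a * gᵀ * (g * b * gᵀ) = g * (a * b) * gᵀ := by
      intro a b
      calc g * a * gᵀ * (g * b * gᵀ) = g * a * (gᵀ * g) * b * gᵀ := by simp only [mul_assoc]
        _ = _ := by rw [hg, mul_one]; simp only [mul_assoc]
    rw [h, h, mul_sub, sub_mul])

/-- The automorphism of the enveloping algebra induced by an orthogonal matrix. -/
def envConj (g : Matrix (Fin m) (Fin m) k) (hg : gᵀ * g = 1) : Env k m →ₐ[k] Env k m :=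
  UniversalEnvelopingAlgebra.lift k ((UniversalEnvelopingAlgebra.ι k).comp (conjSo g hg))

lemma envConj_ι (g : Matrix (Fin m) (Fin m) k) (hg : gᵀ * g = 1) (x : So k m) :
    envConj g hg (envι k x) = envι k (conjSo g hg x) :=
  UniversalEnvelopingAlgebra.lift_ι_apply k _ x

lemma envConj_injective (g : Matrix (Fin m) (Fin m) k) (hg : gᵀ * g = 1) :
    Function.Injective (envConj g hg) := by
  have hg' : gᵀᵀ * gᵀ = 1 := by rw [transpose_transpose]; exact mul_eq_one_comm.1 hg
  have h : (envConj gᵀ hg').comp (envConj g hg) = AlgHom.id k _ := by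
    refine UniversalEnvelopingAlgebra.hom_ext _ (LieHom.ext fun x => ?_)
    change envConj gᵀ hg' (envConj g hg (envι k x)) = envι k x
    rw [envConj_ι, envConj_ι]
    congr 1
    refine Subtype.ext ?_
    change gᵀ * (g * x.1 * gᵀ) * gᵀᵀ = x.1
    rw [transpose_transpose]
    calc gᵀ * (g * x.1 * gᵀ) * g = (gᵀ * g) * x.1 * (gᵀ * g) := by simp only [mul_assoc]
      _ = x.1 := by rw [hg, one_mul, mul_one]
  intro a b hab
  have := congrArg (envConj gᵀ hg') hab
  rw [← AlgHom.comp_apply, ← AlgHom.comp_apply, h] at this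
  exact this

variable (k) in
/-- The inner derivation of the enveloping algebra given by an element of the Lie algebra. -/
def adEnv (e : So k m) : Env k m →ₗ[k] Env k m :=
  LinearMap.mulLeft k (envι k e) - LinearMap.mulRight k (envι k e)

lemma adEnv_apply (e : So k m) (a : Env k m) : adEnv k e a = envι k e * a - a * envι k e := rfl

lemma adEnv_mul (e : So k m) (a b : Env k m) :
    adEnv k e (a * b) = adEnv k e a * b + a * adEnv k e b := by
  simp only [adEnv_apply]; noncomm_ring

lemma adEnv_ι (e x : So k m) : adEnv k e (envι k x) = envι k ⁅e, x⁆ := by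
  rw [adEnv_apply, ι_lie_eq]

lemma pow_apply_eq_zero_of_le {R : Type*} [AddCommGroup R] [Module k R] {d : R →ₗ[k] R} {x : R}
    {n : ℕ} (h : (d ^ n) x = 0) {i : ℕ} (hi : n ≤ i) : (d ^ i) x = 0 := by
  obtain ⟨j, rfl⟩ := Nat.exists_eq_add_of_le hi
  rw [add_comm, pow_add, Module.End.mul_apply, h, map_zero]

variable (p : ℕ) [Fact p.Prime] [CharP k p]

lemma envConj_eq_truncExp {g : Matrix (Fin m) (Fin m) k} (hg : gᵀ * g = 1) {e : So k m}
    (h3 : ∀ x : So k m, ⁅e, ⁅e, ⁅e, x⁆⁆⁆ = 0)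
    (hexp : ∀ x : So k m, conjSo g hg x = x + ⁅e, x⁆ + (2⁻¹ : k) • ⁅e, ⁅e, x⁆⁆) (N : ℕ)
    {a : Env k m} (ha : a ∈ fil k m N) (hN : 2 * N < p) :
    envConj g hg a = truncExp p (adEnv k e) a := by
  have hone : ∀ (r : k) i, 0 < i → (adEnv k e ^ i) (algebraMap k _ r) = 0 := fun r i hi =>
    pow_apply_eq_zero_of_le (n := 1) (by
      rw [pow_one, adEnv_apply, Algebra.commutes, sub_self]) hi
  have hι : ∀ (x : So k m) i, 2 < i → (adEnv k e ^ i) (envι k x) = 0 := fun x i hi =>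
    pow_apply_eq_zero_of_le (n := 3) (by
      rw [pow_succ, pow_two, Module.End.mul_apply, Module.End.mul_apply, adEnv_ι, adEnv_ι, adEnv_ι,
        h3]; exact map_zero (UniversalEnvelopingAlgebra.ι k)) hi
  have hp1 : 1 ≤ p := (Fact.out : p.Prime).one_le
  have hexp0 : ∀ r : k, truncExp p (adEnv k e) (algebraMap k _ r) = algebraMap k _ r := fun r => by
    rw [truncExp, Finset.sum_eq_single 0]
    · simp
    · intro i _ hi; rw [hone r i (Nat.pos_of_ne_zero hi), smul_zero]
    · intro h; simp at h; omega
  suffices h : ∀ N, 2 * N < p → ∀ a ∈ fil k m N, (∀ i, 2 * N < i → (adEnv k e ^ i) a = 0) ∧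
      envConj g hg a = truncExp p (adEnv k e) a from (h N hN a ha).2
  clear ha hN N
  intro N
  induction N with
  | zero =>
    intro _ a ha
    rw [fil, pow_zero] at ha
    obtain ⟨r, rfl⟩ := Submodule.mem_one.1 ha
    exact ⟨fun i hi => hone r i (by omega), by rw [AlgHom.commutes, hexp0]⟩
  | succ N ih =>
    intro hN a ha
    have hfil1 : ∀ b ∈ filOne k m, (∀ i, 2 < i → (adEnv k e ^ i) b = 0) ∧
        envConj g hg b = truncExp p (adEnv k e) b := by
      intro b hb
      obtain ⟨r, x, rfl⟩ := mem_filOne hb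
      constructor
      · intro i hi
        rw [map_add, hone r i (by omega)]
        exact (zero_add _).trans (hι x i hi)
      · rw [truncExp_add, hexp0, map_add, AlgHom.commutes]
        congr 1
        refine (envConj_ι g hg x).trans ?_
        rw [hexp, truncExp]
        obtain ⟨q, rfl⟩ : ∃ q, p = q + 3 := ⟨p - 3, by omega⟩
        rw [add_comm q 3, Finset.sum_range_add, Finset.sum_eq_zero (s := Finset.range q)]
        · rw [Finset.sum_range_succ, Finset.sum_range_succ, Finset.sum_range_one, add_zero]
          have e1 : (adEnv k e ^ 1) (envι k x) = envι k ⁅e, x⁆ := by rw [pow_one, adEnv_ι]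
          have e2 : (adEnv k e ^ 2) (envι k x) = envι k ⁅e, ⁅e, x⁆⁆ := by
            rw [pow_two, Module.End.mul_apply, adEnv_ι, adEnv_ι]
          rw [show UniversalEnvelopingAlgebra.ι k x = envι k x from rfl, e1, e2]
          have e3 : envι k (x + ⁅e, x⁆ + (2⁻¹ : k) • ⁅e, ⁅e, x⁆⁆) =
              envι k x + envι k ⁅e, x⁆ + (2⁻¹ : k) • envι k ⁅e, ⁅e, x⁆⁆ := by
            exact (map_add _ _ _).trans (congrArg₂ (· + ·) (map_add _ _ _) (map_smul _ _ _))
          rw [e3, pow_zero, Module.End.one_apply]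
          generalize envι k x = x₀
          generalize envι k ⁅e, x⁆ = x₁
          generalize envι k ⁅e, ⁅e, x⁆⁆ = x₂
          simp [Nat.factorial]
        · intro j _
          rw [show UniversalEnvelopingAlgebra.ι k x = envι k x from rfl, hι x _ (by omega), smul_zero]
    rw [fil, pow_succ] at ha
    induction ha using Submodule.mul_induction_on' with
    | mem_mul_mem a ha b hb =>
      obtain ⟨h1, h2⟩ := ih (by omega) a ha
      obtain ⟨h4, h5⟩ := hfil1 b hb
      refine ⟨fun i hi => pow_apply_mul_eq_zero (adEnv_mul e) h1 h4 i (by omega), ?_⟩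
      rw [map_mul, h2, h5, truncExp_mul p (adEnv_mul e) h1 h4 (by omega)]
    | add a _ b _ ha hb =>
      refine ⟨fun i hi => by rw [map_add, ha.1 i hi, hb.1 i hi, add_zero], ?_⟩
      rw [map_add, ha.2, hb.2, truncExp_add]

end Conjugation

end SoGK

namespace SoGK

attribute [local instance] LieRing.ofAssociativeRing

open Matrix

section Siegel

variable {k : Type} [Field k] {m : ℕ}

/-- The skew-symmetric matrix `w uᵀ - u wᵀ`. -/
def siegelSkew (w u : Fin m → k) : So k m :=
  ⟨vecMulVec w u - vecMulVec u w, (LieAlgebra.Orthogonal.mem_so (Fin m) k _).2 (by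
    rw [transpose_sub, transpose_vecMulVec, transpose_vecMulVec, neg_sub])⟩

variable {w u : Fin m → k}

lemma siegelSkew_sq (hw : w ⬝ᵥ w = 0) (hwu : w ⬝ᵥ u = 0) (hu : u ⬝ᵥ u = 1) :
    (siegelSkew w u).1 * (siegelSkew w u).1 = -vecMulVec w w := by
  have huw : u ⬝ᵥ w = 0 := by rw [dotProduct_comm, hwu]
  simp only [siegelSkew, mul_sub, sub_mul, vecMulVec_mul_vecMulVec, hw, hwu, hu, huw]
  simp

lemma siegelSkew_mul_vecMulVec (hw : w ⬝ᵥ w = 0) (hwu : w ⬝ᵥ u = 0) :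
    (siegelSkew w u).1 * vecMulVec w w = 0 := by
  have huw : u ⬝ᵥ w = 0 := by rw [dotProduct_comm, hwu]
  simp only [siegelSkew, sub_mul, vecMulVec_mul_vecMulVec, hw, huw]
  simp

lemma siegel_eq_exp (hw : w ⬝ᵥ w = 0) (hwu : w ⬝ᵥ u = 0) (hu : u ⬝ᵥ u = 1) :
    siegel w u = 1 + (siegelSkew w u).1 +
      (2⁻¹ : k) • ((siegelSkew w u).1 * (siegelSkew w u).1) := by
  rw [siegelSkew_sq hw hwu hu, siegel, smul_neg, sub_eq_add_neg]
  rfl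

lemma siegel_add (hw : w ⬝ᵥ w = 0) (hwu : w ⬝ᵥ u = 0) (hu : u ⬝ᵥ u = 1) [NeZero (2 : k)]
    (s t : k) : siegel (s • w) u * siegel (t • w) u = siegel ((s + t) • w) u := by
  have huw : u ⬝ᵥ w = 0 := by rw [dotProduct_comm, hwu]
  have h2 : (2 : k) ≠ 0 := NeZero.ne 2
  have h : ∀ s t : k, (s • vecMulVec w u - s • vecMulVec u w) *
      (t • vecMulVec w u - t • vecMulVec u w) = -((s * t) • vecMulVec w w) := by
    intro s t
    rw [← smul_sub, ← smul_sub, smul_mul_smul_comm]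
    rw [show vecMulVec w u - vecMulVec u w = (siegelSkew w u).1 from rfl, siegelSkew_sq hw hwu hu,
      smul_neg]
  simp only [siegel, smul_vecMulVec, vecMulVec_smul, mul_sub, sub_mul, mul_add, add_mul, mul_one,
    one_mul, vecMulVec_mul_vecMulVec, hw, huw, hwu, hu, smul_mul_assoc, mul_smul_comm,
    smul_smul, smul_zero, zero_smul]
  ext i j
  simp
  field_simp
  ring

lemma siegel_transpose_mul (hw : w ⬝ᵥ w = 0) (hwu : w ⬝ᵥ u = 0) (hu : u ⬝ᵥ u = 1)
    [NeZero (2 : k)] : (siegel w u)ᵀ * siegel w u = 1 := by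
  have h : (siegel w u)ᵀ = siegel ((-1 : k) • w) u := by
    simp only [siegel, transpose_sub, transpose_add, transpose_vecMulVec, transpose_one,
      transpose_smul, smul_vecMulVec, vecMulVec_smul]
    ext i j
    simp
    ring
  have := siegel_add hw hwu hu (-1) 1
  rw [one_smul, neg_add_cancel, zero_smul] at this
  rw [h, this]
  simp [siegel]

lemma siegel_det (hw : w ⬝ᵥ w = 0) (hwu : w ⬝ᵥ u = 0) (hu : u ⬝ᵥ u = 1) [NeZero (2 : k)] :
    (siegel w u).det = 1 := by
  have h2 : (2 : k) ≠ 0 := NeZero.ne 2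
  have h := siegel_add hw hwu hu (2⁻¹ : k) 2⁻¹
  rw [← two_mul, mul_inv_cancel₀ h2, one_smul] at h
  have h' : (siegel ((2⁻¹ : k) • w) u)ᵀ * siegel ((2⁻¹ : k) • w) u = 1 :=
    siegel_transpose_mul (by simp [hw]) (by simp [hwu]) hu
  rw [← h, det_mul]
  simpa [det_mul] using congrArg det h'

lemma siegelSkew_conj (hw : w ⬝ᵥ w = 0) (hwu : w ⬝ᵥ u = 0) (hu : u ⬝ᵥ u = 1) [NeZero (2 : k)]
    (x : So k m) :
    (siegelSkew w u).1 * x.1 * ((siegelSkew w u).1 * (siegelSkew w u).1) =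
        (siegelSkew w u).1 * (siegelSkew w u).1 * x.1 * (siegelSkew w u).1 ∧
      (siegelSkew w u).1 * (siegelSkew w u).1 * x.1 *
        ((siegelSkew w u).1 * (siegelSkew w u).1) = 0 := by
  have hx : ∀ a b : Fin m → k, a ⬝ᵥ (x.1 *ᵥ b) = -(b ⬝ᵥ (x.1 *ᵥ a)) := by
    intro a b
    rw [dotProduct_comm, ← vecMul_transpose, ← dotProduct_mulVec,
      (LieAlgebra.Orthogonal.mem_so (Fin m) k x.1).1 x.2, neg_mulVec, dotProduct_neg]
  have h2 : (2 : k) ≠ 0 := NeZero.ne 2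
  have hxw : w ⬝ᵥ (x.1 *ᵥ w) = 0 := by
    have := hx w w
    rw [eq_neg_iff_add_eq_zero, ← two_mul] at this
    exact (mul_eq_zero.1 this).resolve_left h2
  rw [siegelSkew_sq hw hwu hu]
  have hm : ∀ a b c d : Fin m → k, vecMulVec a b * x.1 * vecMulVec c d =
      (b ⬝ᵥ (x.1 *ᵥ c)) • vecMulVec a d := by
    intro a b c d
    rw [mul_assoc, mul_vecMulVec, vecMulVec_mul_vecMulVec, vecMulVec_smul]
  constructor
  · simp only [siegelSkew, neg_mul, mul_neg, sub_mul, mul_sub, hm, hxw, zero_smul]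
    rw [hx u w]
    simp
  · simp only [neg_mul, mul_neg, hm, hxw, zero_smul, neg_zero]

lemma ad_cube_eq {R : Type*} [Ring R] {e x : R} (h1 : e * e * e = 0)
    (h2 : e * x * (e * e) = e * e * x * e) :
    e * (e * (e * x - x * e) - (e * x - x * e) * e) -
      (e * (e * x - x * e) - (e * x - x * e) * e) * e = 0 := by
  have : e * (e * (e * x - x * e) - (e * x - x * e) * e) -
      (e * (e * x - x * e) - (e * x - x * e) * e) * e =
      e * e * e * x - x * (e * e * e) + 3 * (e * x * (e * e) - e * e * x * e) := by
    noncomm_ring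
  rw [this, h1, h2]
  simp

lemma siegelSkew_ad_cube (hw : w ⬝ᵥ w = 0) (hwu : w ⬝ᵥ u = 0) (hu : u ⬝ᵥ u = 1)
    [NeZero (2 : k)] (x : So k m) :
    ⁅siegelSkew w u, ⁅siegelSkew w u, ⁅siegelSkew w u, x⁆⁆⁆ = 0 := by
  refine Subtype.ext (ad_cube_eq ?_ (siegelSkew_conj hw hwu hu x).1)
  rw [mul_assoc, siegelSkew_sq hw hwu hu, mul_neg, siegelSkew_mul_vecMulVec hw hwu, neg_zero]

lemma exp_conj_eq {R : Type*} [Ring R] [Algebra k R] {e x : R}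
    (h2 : e * x * (e * e) = e * e * x * e) (h3 : e * e * x * (e * e) = 0) [NeZero (2 : k)] :
    (1 + e + (2⁻¹ : k) • (e * e)) * x * (1 - e + (2⁻¹ : k) • (e * e)) =
      x + (e * x - x * e) + (2⁻¹ : k) • (e * (e * x - x * e) - (e * x - x * e) * e) := by
  have h2' : (2 : k) ≠ 0 := NeZero.ne 2
  have h4 : e * x * e = (2⁻¹ : k) • (e * x * e) + (2⁻¹ : k) • (e * x * e) := by
    rw [← two_smul k, smul_smul, mul_inv_cancel₀ h2', one_smul]
  have : (1 + e + (2⁻¹ : k) • (e * e)) * x * (1 - e + (2⁻¹ : k) • (e * e)) =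
      x + (e * x - x * e) + (2⁻¹ : k) • (e * e * x + x * (e * e)) - e * x * e +
      (2⁻¹ : k) • (e * x * (e * e) - e * e * x * e) +
      ((2⁻¹ : k) * 2⁻¹) • (e * e * x * (e * e)) := by
    simp only [add_mul, mul_add, mul_sub, sub_mul, one_mul, mul_one, smul_mul_assoc,
      mul_smul_comm, smul_smul, smul_add, smul_sub]
    abel
  rw [this, h2, h3, sub_self, smul_zero, smul_zero, add_zero, add_zero]
  simp only [mul_sub, sub_mul, smul_sub, smul_add, ← mul_assoc]
  generalize (2⁻¹ : k) • (e * x * e) = y at h4 ⊢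
  rw [h4]
  abel

lemma conjSo_siegel (hw : w ⬝ᵥ w = 0) (hwu : w ⬝ᵥ u = 0) (hu : u ⬝ᵥ u = 1) [NeZero (2 : k)]
    (x : So k m) :
    conjSo (siegel w u) (siegel_transpose_mul hw hwu hu) x =
      x + ⁅siegelSkew w u, x⁆ + (2⁻¹ : k) • ⁅siegelSkew w u, ⁅siegelSkew w u, x⁆⁆ := by
  refine Subtype.ext ?_
  obtain ⟨h2, h3⟩ := siegelSkew_conj hw hwu hu x
  refine Eq.trans ?_ (exp_conj_eq h2 h3)
  change siegel w u * x.1 * (siegel w u)ᵀ = _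
  have ht : (siegelSkew w u).1ᵀ = -(siegelSkew w u).1 :=
    (LieAlgebra.Orthogonal.mem_so (Fin m) k _).1 (siegelSkew w u).2
  rw [siegel_eq_exp hw hwu hu, transpose_add, transpose_add, transpose_one, transpose_smul,
    transpose_mul, ht, neg_mul_neg, ← sub_eq_add_neg]

end Siegel

end SoGK

namespace SoGK

open MvPolynomial Matrix

variable {k : Type} [Field k] {m : ℕ} [NeZero (2 : k)]

/-- The generic skew-symmetric matrix conjugated by an orthogonal matrix. -/
def conjX (g : Matrix (Fin m) (Fin m) k) : Matrix (Fin m) (Fin m) (Pol k m) :=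
  (g.map C)ᵀ * genX k m * g.map C

omit [NeZero (2 : k)] in
lemma conjX_transpose (g : Matrix (Fin m) (Fin m) k) : (conjX g)ᵀ = -conjX g := by
  rw [conjX, transpose_mul, transpose_mul, genX_transpose, transpose_transpose, neg_mul, mul_neg,
    mul_assoc]

omit [NeZero (2 : k)] in
lemma conjSubst_eq {g : Matrix (Fin m) (Fin m) k} (hg : gᵀ * g = 1) :
    conjSubst k m g = evalSkew k (conjX g) := by
  have hinv : g⁻¹ = gᵀ := inv_eq_left_inv hg
  refine MvPolynomial.algHom_ext fun c => ?_
  rw [conjSubst, evalSkew, aeval_X, aeval_X, conjX, mul_apply]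
  simp only [mul_apply, Finset.sum_mul, transpose_apply, map_apply, hinv, C_mul, genX, of_apply]
  rw [Finset.sum_comm]
  exact Finset.sum_congr rfl fun _ _ => Finset.sum_congr rfl fun _ _ => by ring

lemma map_conjSubst {R : Type*} [CommRing R] [Algebra k R]
    {g : Matrix (Fin m) (Fin m) k}
    (hg : gᵀ * g = 1) {Z : Matrix (Fin m) (Fin m) R} (hZ : Zᵀ = -Z) (a : Pol k m) :
    evalSkew k Z (conjSubst k m g a) =
      evalSkew k ((g.map (algebraMap k R))ᵀ * Z * g.map (algebraMap k R)) a := by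
  rw [conjSubst_eq hg, ← AlgHom.comp_apply]
  congr 1
  refine MvPolynomial.algHom_ext fun c => ?_
  rw [AlgHom.comp_apply]
  refine (congrArg (evalSkew k Z) (aeval_X _ c)).trans (Eq.trans ?_ (aeval_X _ c).symm)
  have h1 : (evalSkew k Z).toRingHom.mapMatrix (conjX g) =
      (g.map (algebraMap k R))ᵀ * Z * g.map (algebraMap k R) := by
    have h2 : (evalSkew k Z).toRingHom.mapMatrix (g.map C) = g.map (algebraMap k R) :=
      Matrix.ext fun i j => (evalSkew k Z).commutes (g i j)
    have h3 : (evalSkew k Z).toRingHom.mapMatrix (g.map C)ᵀ = (g.map (algebraMap k R))ᵀ :=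
      Matrix.ext fun i j => (evalSkew k Z).commutes (g j i)
    rw [conjX, map_mul, map_mul, h2, h3, evalSkew_genX hZ]
  exact congrFun (congrFun h1 c.1.1) c.1.2

lemma conjSubst_conjSubst {g h : Matrix (Fin m) (Fin m) k} (hg : gᵀ * g = 1) (hh : hᵀ * h = 1)
    (a : Pol k m) : conjSubst k m h (conjSubst k m g a) = conjSubst k m (h * g) a := by
  have hgh : (h * g)ᵀ * (h * g) = 1 := by
    rw [transpose_mul, mul_assoc, ← mul_assoc hᵀ, hh, one_mul, hg]
  rw [conjSubst_eq hh, map_conjSubst hg (conjX_transpose h), conjSubst_eq hgh]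
  have h1 : (h * g).map C = h.map C * g.map (C : k →+* Pol k m) := Matrix.map_mul
  have h2 : (g.map (algebraMap k (Pol k m)))ᵀ * conjX h * g.map (algebraMap k (Pol k m)) =
      conjX (h * g) := by
    rw [conjX, conjX, h1, transpose_mul]
    simp only [mul_assoc]
    rfl
  rw [h2]

omit [NeZero (2 : k)] in
lemma conjSubst_one (a : Pol k m) : conjSubst k m 1 a = a := by
  rw [conjSubst_eq (by simp)]
  have : evalSkew k (conjX (1 : Matrix (Fin m) (Fin m) k)) = AlgHom.id k (Pol k m) := by
    refine MvPolynomial.algHom_ext fun c => ?_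
    rw [evalSkew, aeval_X, conjX]
    have : (1 : Matrix (Fin m) (Fin m) k).map (C : k →+* Pol k m) = 1 :=
      Matrix.map_one _ (map_zero _) (map_one _)
    rw [this, transpose_one, one_mul, mul_one, genX, of_apply, skewEntry_lt c.2]
    rfl
  rw [this]
  rfl

lemma conjSubst_injective {g : Matrix (Fin m) (Fin m) k} (hg : gᵀ * g = 1) :
    Function.Injective (conjSubst k m g) := by
  have hg' : gᵀᵀ * gᵀ = 1 := by rw [transpose_transpose]; exact mul_eq_one_comm.1 hg
  refine Function.LeftInverse.injective (g := conjSubst k m gᵀ) fun a => ?_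
  rw [conjSubst_conjSubst hg hg', hg, conjSubst_one]

/-- The action of an orthogonal matrix on the field of rational functions. -/
def conjFr (g : Matrix (Fin m) (Fin m) k) (hg : gᵀ * g = 1) : Fr k m →+* Fr k m :=
  IsFractionRing.lift (A := Pol k m)
    (g := (algebraMap (Pol k m) (Fr k m)).comp (conjSubst k m g).toRingHom)
    ((IsFractionRing.injective (Pol k m) (Fr k m)).comp (conjSubst_injective hg))

lemma conjFr_algebraMap {g : Matrix (Fin m) (Fin m) k} (hg : gᵀ * g = 1) (a : Pol k m) :
    conjFr g hg (algebraMap _ _ a) = algebraMap _ _ (conjSubst k m g a) :=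
  IsFractionRing.lift_algebraMap _ a

lemma conjFr_conjFr {g h : Matrix (Fin m) (Fin m) k} (hg : gᵀ * g = 1) (hh : hᵀ * h = 1)
    (hgh : (h * g)ᵀ * (h * g) = 1) (x : Fr k m) :
    conjFr h hh (conjFr g hg x) = conjFr (h * g) hgh x := by
  obtain ⟨a, b, hb, rfl⟩ := IsFractionRing.div_surjective (A := Pol k m) x
  simp only [map_div₀, conjFr_algebraMap, conjSubst_conjSubst hg hh]

lemma conjFr_eq_iff {g : Matrix (Fin m) (Fin m) k} (hg : gᵀ * g = 1) {x : Fr k m} {a b : Pol k m}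
    (hb : b ≠ 0) (hx : algebraMap _ (Fr k m) b * x = algebraMap _ _ a) :
    conjFr g hg x = x ↔ algebraMap _ (Fr k m) (conjSubst k m g b) * x =
      algebraMap _ _ (conjSubst k m g a) := by
  have h1 := congrArg (conjFr g hg) hx
  rw [map_mul, conjFr_algebraMap, conjFr_algebraMap] at h1
  have h2 : algebraMap _ (Fr k m) (conjSubst k m g b) ≠ 0 := by
    rw [Ne, IsFractionRing.to_map_eq_zero_iff (R := Pol k m)]
    exact fun h => hb (conjSubst_injective hg (h.trans (map_zero _).symm))
  rw [← h1]
  exact ⟨fun h => by rw [h], fun h => (mul_left_cancel₀ h2 h).symm⟩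

lemma soConjInvariant_iff (x : Fr k m) : SOConjInvariant k m x ↔
    ∀ g : Matrix (Fin m) (Fin m) k, ∀ hg : gᵀ * g = 1, g.det = 1 → conjFr g hg x = x := by
  constructor
  · intro h g hg hdet
    obtain ⟨a, b, hb, rfl⟩ := IsFractionRing.div_surjective (A := Pol k m) x
    have hb0 := nonZeroDivisors.ne_zero hb
    have hx : algebraMap _ (Fr k m) b * (algebraMap _ (Fr k m) a / algebraMap _ (Fr k m) b) =
        algebraMap _ _ a := mul_div_cancel₀ _ (by
          rwa [Ne, IsFractionRing.to_map_eq_zero_iff (R := Pol k m)])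
    exact (conjFr_eq_iff hg hb0 hx).2 (h g hg hdet a b hb0 hx)
  · intro h g hg hdet a b hb hx
    exact (conjFr_eq_iff hg hb hx).1 (h g hg hdet)

variable (k m) in
/-- The field of invariant rational functions. -/
def invField : Subfield (Fr k m) where
  carrier := {x | SOConjInvariant k m x}
  mul_mem' {a b} ha hb := by
    rw [Set.mem_setOf, soConjInvariant_iff] at *
    intro g hg hd; rw [map_mul, ha g hg hd, hb g hg hd]
  one_mem' := by
    rw [Set.mem_setOf, soConjInvariant_iff]; intro g hg hd; exact map_one _
  add_mem' {a b} ha hb := by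
    rw [Set.mem_setOf, soConjInvariant_iff] at *
    intro g hg hd; rw [map_add, ha g hg hd, hb g hg hd]
  zero_mem' := by
    rw [Set.mem_setOf, soConjInvariant_iff]; intro g hg hd; exact map_zero _
  neg_mem' {a} ha := by
    rw [Set.mem_setOf, soConjInvariant_iff] at *
    intro g hg hd; rw [map_neg, ha g hg hd]
  inv_mem' a ha := by
    rw [Set.mem_setOf, soConjInvariant_iff] at *
    intro g hg hd; rw [map_inv₀, ha g hg hd]

lemma mem_invField {x : Fr k m} : x ∈ invField k m ↔
    ∀ g : Matrix (Fin m) (Fin m) k, ∀ hg : gᵀ * g = 1, g.det = 1 → conjFr g hg x = x :=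
  soConjInvariant_iff x

lemma mem_invField_of_siegel [IsAlgClosed k] (hm : 5 ≤ m) {x : Fr k m}
    (h : ∀ w u : Fin m → k, ∀ (hw : w ⬝ᵥ w = 0) (hwu : w ⬝ᵥ u = 0) (hu : u ⬝ᵥ u = 1),
      conjFr (siegel w u) (siegel_transpose_mul hw hwu hu) x = x) : x ∈ invField k m := by
  rw [mem_invField]
  intro g hg hdet
  suffices H : ∃ hg : gᵀ * g = 1, conjFr g hg x = x from H.2
  refine so_induction (P := fun g => ∃ hg : gᵀ * g = 1, conjFr g hg x = x) hm ?_ ?_ ?_ hg hdet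
  · refine ⟨by simp, ?_⟩
    obtain ⟨a, b, hb, rfl⟩ := IsFractionRing.div_surjective (A := Pol k m) x
    simp only [map_div₀, conjFr_algebraMap, conjSubst_one]
  · rintro g h ⟨hg, hgx⟩ ⟨hh, hhx⟩
    have hgh : (g * h)ᵀ * (g * h) = 1 := by
      rw [transpose_mul, mul_assoc, ← mul_assoc gᵀ, hg, one_mul, hh]
    refine ⟨hgh, ?_⟩
    rw [← conjFr_conjFr hh hg hgh, hhx, hgx]
  · intro w u hw hwu hu
    exact ⟨siegel_transpose_mul hw hwu hu, h w u hw hwu hu⟩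

/-- Conjugation-invariance of the generic Casimir value. -/
lemma conjFr_casF {g : Matrix (Fin m) (Fin m) k} (hg : gᵀ * g = 1) :
    conjFr g hg (casF k m) = casF k m := by
  have hC : (g.map C) * (g.map (C : k →+* Pol k m))ᵀ = 1 := by
    rw [← transpose_map, ← Matrix.map_mul, mul_eq_one_comm.1 hg]
    exact Matrix.map_one _ (map_zero _) (map_one _)
  have h1 : ∀ M : Matrix (Fin m) (Fin m) (Pol k m), evalSkew k (conjX g) M.trace =
      ((evalSkew k (conjX g)).toRingHom.mapMatrix M).trace := fun M =>
    (AddMonoidHom.map_trace (evalSkew k (conjX g)).toRingHom M)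
  rw [casF, conjFr_algebraMap, conjSubst_eq hg]
  congr 1
  rw [map_sub]
  congr 1
  · rw [h1, map_mul, evalSkew_genX (conjX_transpose g), conjX]
    calc ((g.map C)ᵀ * genX k m * g.map C * ((g.map C)ᵀ * genX k m * g.map C)).trace =
        ((g.map C)ᵀ * genX k m * (g.map C * (g.map C)ᵀ) * genX k m * g.map C).trace := by
          simp only [mul_assoc]
      _ = _ := by
        rw [hC, mul_one, mul_assoc, mul_assoc, trace_mul_comm, mul_assoc, mul_assoc, hC, mul_one]
  · exact AlgHom.commutes (evalSkew k (conjX g)) _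

end SoGK

namespace SoGK

attribute [local instance] LieRing.ofAssociativeRing

open MvPolynomial Matrix

section Twist

variable {k : Type} [Field k] {m : ℕ} [NeZero m] (p : ℕ) [Fact p.Prime] [CharP k p]
  [NeZero (2 : k)]

/-- The action of a matrix on the polynomial algebra of the `p`-centre. -/
def yTwist (h : Matrix (Fin m) (Fin m) k) : YAlg k m p →ₐ[k] YAlg k m p :=
  aeval fun c => ∑ b : SkewIdx m,
    (h b.1.1 c.idx.1.1 * h b.1.2 c.idx.1.2 - h b.1.2 c.idx.1.1 * h b.1.1 c.idx.1.2) • X ⟨b⟩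

omit [NeZero m] [Fact p.Prime] [CharP k p] [NeZero (2 : k)] in
lemma conjSo_gen_apply {g : Matrix (Fin m) (Fin m) k} (hg : gᵀ * g = 1) (c : SkewIdx m)
    (a b : Fin m) : (conjSo g hg (gen k c)).1 a b = g a c.1.1 * g b c.1.2 - g b c.1.1 * g a c.1.2 := by
  have h1 : skewMat k m c.1.1 c.1.2 = vecMulVec (Pi.single c.1.1 1) (Pi.single c.1.2 1) -
      vecMulVec (Pi.single c.1.2 1) (Pi.single c.1.1 1) := by
    ext a b
    rw [skewMat_apply, Matrix.sub_apply, vecMulVec_apply, vecMulVec_apply]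
    simp only [Pi.single_apply, eq_comm (a := a), eq_comm (a := b), ite_and, mul_ite, mul_one,
      mul_zero]
    split_ifs <;> rfl
  change (g * skewMat k m c.1.1 c.1.2 * gᵀ) a b = _
  rw [h1, mul_sub, sub_mul, mul_vecMulVec, mul_vecMulVec, vecMulVec_mul, vecMulVec_mul,
    vecMul_transpose, vecMul_transpose, mulVec_single_one, mulVec_single_one, Matrix.sub_apply,
    vecMulVec_apply, vecMulVec_apply]
  simp only [col_apply]
  ring

lemma ycen_eq_sum (x : So k m) :
    ycen p x = ∑ b : SkewIdx m, x.1 b.1.1 b.1.2 ^ p • ycen p (gen k b) := by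
  have hz : ycen p (0 : So k m) = 0 := by
    have := ycen_add p (0 : So k m) 0
    rw [add_zero] at this
    exact left_eq_add.1 this
  let f : So k m →+ Env k m := ⟨⟨ycen p, hz⟩, ycen_add p⟩
  conv_lhs => rw [So.eq_sum x]
  refine (map_sum f _ _).trans (Finset.sum_congr rfl fun b _ => ycen_smul p _ _)

lemma envConj_algebraMap {g : Matrix (Fin m) (Fin m) k} (hg : gᵀ * g = 1) (q : YAlg k m p) :
    envConj g hg (algebraMap (YAlg k m p) (Env k m) q) = algebraMap (YAlg k m p) (Env k m) (yTwist p (g.map (· ^ p)) q) := by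
  have h : (envConj g hg).comp (IsScalarTower.toAlgHom k (YAlg k m p) (Env k m)) =
      (IsScalarTower.toAlgHom k (YAlg k m p) (Env k m)).comp (yTwist p (g.map (· ^ p))) := by
    refine MvPolynomial.algHom_ext fun c => ?_
    change envConj g hg (algebraMap (YAlg k m p) (Env k m) (X c)) = algebraMap (YAlg k m p) (Env k m) (yTwist p _ (X c))
    have h1 : envConj g hg (ycen p (gen k c.idx)) = ycen p (conjSo g hg (gen k c.idx)) := by
      have h2 : powSo p (conjSo g hg (gen k c.idx)) = conjSo g hg (powSo p (gen k c.idx)) := by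
        refine Subtype.ext ?_
        have h3 : ∀ (M : Matrix (Fin m) (Fin m) k) n, (g * M * gᵀ) ^ n = g * M ^ n * gᵀ := by
          intro M n
          induction n with
          | zero => rw [pow_zero, pow_zero, mul_one, mul_eq_one_comm.1 hg]
          | succ n ih =>
            rw [pow_succ, ih, pow_succ]
            calc g * M ^ n * gᵀ * (g * M * gᵀ) = g * M ^ n * (gᵀ * g) * M * gᵀ := by
                  simp only [mul_assoc]
              _ = _ := by rw [hg, mul_one]; simp only [mul_assoc]
        exact h3 _ _
      rw [ycen, ycen, h2, map_sub, map_pow, envConj_ι, envConj_ι]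
    rw [algebraMap_yX, h1, ycen_eq_sum, yTwist, aeval_X, map_sum]
    refine Finset.sum_congr rfl fun b _ => ?_
    rw [conjSo_gen_apply, Algebra.smul_def (A := YAlg k m p), map_mul (algebraMap _ (Env k m)),
      algebraMap_yX, ← IsScalarTower.algebraMap_apply k (YAlg k m p) (Env k m), ← Algebra.smul_def,
      sub_pow_char, mul_pow, mul_pow]
    rfl
  exact AlgHom.congr_fun h q

lemma psiAt_yTwist {h : Matrix (Fin m) (Fin m) k} (hh : hᵀ * h = 1) (q : YAlg k m p) :
    psiAt k p (genX k m) (yTwist p h q) = conjSubst k m h (psiAt k p (genX k m) q) := by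
  haveI : NeZero (2 : Pol k m) := ⟨two_ne_zero_mvPolynomial⟩
  rw [conjSubst_eq hh, evalSkew_psiAt p (conjX_transpose h), ← AlgHom.comp_apply]
  congr 1
  refine MvPolynomial.algHom_ext fun c => ?_
  rw [AlgHom.comp_apply, yTwist, aeval_X, map_sum, psiAt, psiAt, aeval_X]
  set Y := genX k m ^ p - genX k m with hY
  have hYt : Yᵀ = -Y := by
    rw [hY, transpose_sub, transpose_pow, genX_transpose, (odd_char k p).neg_pow]
    abel
  have hhC : h.map C * (h.map (C : k →+* Pol k m))ᵀ = 1 := by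
    rw [← transpose_map, ← Matrix.map_mul, mul_eq_one_comm.1 hh]
    exact Matrix.map_one _ (map_zero _) (map_one _)
  have hconj : conjX h ^ p - conjX h = (h.map C)ᵀ * Y * h.map C := by
    have h3 : ∀ n, conjX h ^ n = (h.map C)ᵀ * genX k m ^ n * h.map C := by
      intro n
      induction n with
      | zero => rw [pow_zero, pow_zero, mul_one, mul_eq_one_comm.1 hhC]
      | succ n ih =>
        rw [pow_succ, ih, pow_succ, conjX]
        calc _ = (h.map C)ᵀ * genX k m ^ n * (h.map C * (h.map C)ᵀ) * genX k m * h.map C := by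
              simp only [mul_assoc]
          _ = _ := by rw [hhC, mul_one]; simp only [mul_assoc]
    rw [h3, hY, mul_sub, sub_mul]
    rfl
  rw [hconj, mul_assoc, mul_apply]
  simp only [mul_apply, transpose_apply, map_apply, Finset.mul_sum]
  have := sum_skewIdx_sub hYt fun i j => C (h i c.idx.1.1) * C (h j c.idx.1.2)
  refine Eq.trans ?_ (this.trans ?_)
  · refine Finset.sum_congr rfl fun b _ => ?_
    rw [map_smul, aeval_X, smul_eq_C_mul, C_sub, C_mul, C_mul]
  · exact Finset.sum_congr rfl fun _ _ => Finset.sum_congr rfl fun _ _ => by ring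

end Twist

section Invariance

variable {k : Type} [Field k] {m : ℕ} [NeZero m] (p : ℕ) [Fact p.Prime] [CharP k p]
  [NeZero (2 : k)]

lemma envD_adEnv {y : DEnv k m p} (hy : ∀ x, x * y = y * x) {a b : Env k m}
    (h : envD k m p a * y = envD k m p b) (e : So k m) :
    envD k m p (adEnv k e a) * y = envD k m p (adEnv k e b) := by
  rw [adEnv_apply, adEnv_apply, map_sub, map_sub, map_mul (envD k m p), map_mul (envD k m p),
    map_mul (envD k m p), map_mul (envD k m p), sub_mul, mul_assoc, h, mul_assoc,
    hy (envD k m p (envι k e)), ← mul_assoc, h]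

lemma envD_truncExp {y : DEnv k m p} (hy : ∀ x, x * y = y * x) {a b : Env k m}
    (h : envD k m p a * y = envD k m p b) (e : So k m) :
    envD k m p (truncExp p (adEnv k e) a) * y = envD k m p (truncExp p (adEnv k e) b) := by
  have hj : ∀ j : ℕ, envD k m p ((adEnv k e ^ j) a) * y = envD k m p ((adEnv k e ^ j) b) := by
    intro j
    induction j with
    | zero => exact h
    | succ j ih =>
      rw [pow_succ', Module.End.mul_apply, Module.End.mul_apply]
      exact envD_adEnv p hy ih e
  simp only [truncExp, map_sum, Finset.sum_mul]
  refine Finset.sum_congr rfl fun j _ => ?_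
  rw [toCFrac_smul, toCFrac_smul, smul_mul_assoc, hj]

lemma casimir_mem_fil : casimir k m ∈ fil k m 2 :=
  Submodule.sum_mem _ fun _ _ => Submodule.sum_mem _ fun _ _ =>
    mul_mem_fil (d := 1) (e := 1) (ι_mem_fil _) (ι_mem_fil _)

lemma envConj_siegel_casimir (hp : 4 < p) {w u : Fin m → k} (hw : w ⬝ᵥ w = 0) (hwu : w ⬝ᵥ u = 0)
    (hu : u ⬝ᵥ u = 1) :
    envConj (siegel w u) (siegel_transpose_mul hw hwu hu) (casimir k m) = casimir k m := by
  rw [envConj_eq_truncExp p _ (siegelSkew_ad_cube hw hwu hu) (conjSo_siegel hw hwu hu) 2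
    casimir_mem_fil hp, truncExp, Finset.sum_eq_single 0]
  · simp
  · intro j _ hj
    obtain ⟨i, rfl⟩ := Nat.exists_eq_succ_of_ne_zero hj
    have h0 : adEnv k (siegelSkew w u) (casimir k m) = 0 := by
      rw [adEnv_apply, casimir_commute, sub_self]
    rw [pow_succ, Module.End.mul_apply, h0, map_zero, smul_zero]
  · intro h; simp at h; omega

lemma exists_numerator [IsAlgClosed k] (c : ZD k m p) : ∃ q : YAlg k m p, q ≠ 0 ∧
    ∃ P : Polynomial (YAlg k m p),
      algebraMap (QZ k m p) (ZD k m p) (algebraMap _ _ q) * c =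
        Polynomial.aeval (casZ k m p) (P.map (algebraMap (YAlg k m p) (QZ k m p))) := by
  obtain ⟨P, rfl⟩ := exists_aeval_casZ k m p c
  obtain ⟨q, hq, hP⟩ := IsLocalization.integerNormalization_spec
    (nonZeroDivisors (YAlg k m p)) P
  refine ⟨q, nonZeroDivisors.ne_zero hq,
    IsLocalization.integerNormalization (nonZeroDivisors (YAlg k m p)) P, ?_⟩
  rw [hP, algebra_compatible_smul (QZ k m p) q P, map_smul, Algebra.smul_def]

lemma coe_aeval_casZ (P : Polynomial (YAlg k m p)) :
    ((Polynomial.aeval (casZ k m p) (P.map (algebraMap (YAlg k m p) (QZ k m p))) : ZD k m p) :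
      DEnv k m p) = envD k m p (Polynomial.aeval (casimir k m) P) := by
  rw [Polynomial.aeval_def, Polynomial.aeval_def, Polynomial.eval₂_map, Polynomial.hom_eval₂]
  have h := Polynomial.hom_eval₂ P ((algebraMap (QZ k m p) (ZD k m p)).comp
    (algebraMap (YAlg k m p) (QZ k m p))) (Subring.center (DEnv k m p)).subtype (casZ k m p)
  refine h.trans ?_
  congr 1
  refine RingHom.ext fun q => ?_
  exact (toCFrac_algebraMap q).symm

lemma theta_aeval_casZ {θ : ZD k m p →ₐ[QZ k m p] Fr k m} (hθ : θ (casZ k m p) = casF k m)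
    (P : Polynomial (YAlg k m p)) :
    θ (Polynomial.aeval (casZ k m p) (P.map (algebraMap (YAlg k m p) (QZ k m p)))) =
      P.eval₂ ((algebraMap (Pol k m) (Fr k m)).comp (psiAt k p (genX k m)).toRingHom)
        (casF k m) := by
  rw [← Polynomial.aeval_algHom_apply, hθ, Polynomial.aeval_def, Polynomial.eval₂_map]
  congr 1
  exact RingHom.ext fun q => algebraMap_QZ_Fr p q

omit [NeZero m] [CharP k p] [NeZero (2 : k)] in
lemma exists_pow_preimage [IsAlgClosed k] (w : Fin m → k) : ∃ w' : Fin m → k, ∀ i, w' i ^ p = w i :=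
  ⟨_, fun i => (IsAlgClosed.exists_pow_nat_eq (w i) (Fact.out : p.Prime).pos).choose_spec⟩

lemma conjFr_theta [IsAlgClosed k] (hp : 4 < p)
    (θ : ZD k m p →ₐ[QZ k m p] Fr k m) (hθ : θ (casZ k m p) = casF k m) {y : ZD k m p} {N : ℕ}
    (hN : 2 * N < p) {a b : Env k m} (ha0 : a ≠ 0) (ha : a ∈ fil k m N) (hb : b ∈ fil k m N)
    (hy : envD k m p a * (y : DEnv k m p) = envD k m p b) {w u : Fin m → k}
    (hw : w ⬝ᵥ w = 0) (hwu : w ⬝ᵥ u = 0) (hu : u ⬝ᵥ u = 1) {h : Matrix (Fin m) (Fin m) k}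
    (hh : hᵀ * h = 1) (hgh : (siegel w u).map (· ^ p) = h) : conjFr h hh (θ y) = θ y := by
  have hyc : ∀ x, x * (y : DEnv k m p) = y * x := Subring.mem_center_iff.1 y.2
  have hg := siegel_transpose_mul hw hwu hu
  set g := siegel w u
  obtain ⟨q, hq, P, hP⟩ := exists_numerator p y
  have hqc : ∀ q : YAlg k m p, ((algebraMap (QZ k m p) (ZD k m p) (algebraMap _ _ q) : ZD k m p) :
      DEnv k m p) = envD k m p (algebraMap _ _ q) := fun q => (toCFrac_algebraMap q).symm
  have hinj : Function.Injective (envD k m p) := toCFrac_injective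
  set c := Polynomial.aeval (casimir k m) P with hc
  have hPD : envD k m p (algebraMap _ _ q) * y = envD k m p c := by
    rw [← hqc, ← coe_aeval_casZ, ← hP]; rfl
  have hU : algebraMap _ (Env k m) q * b = a * c := by
    apply hinj
    rw [map_mul (envD k m p), map_mul (envD k m p), ← hy, ← hPD, ← mul_assoc, ← mul_assoc,
      ← map_mul (envD k m p), ← map_mul (envD k m p), Algebra.commutes q a]
  set q' := yTwist p h q with hq'
  set c' := Polynomial.aeval (casimir k m) (P.map (yTwist p h).toRingHom) with hc'
  have hαq : envConj g hg (algebraMap _ _ q) = algebraMap (YAlg k m p) (Env k m) q' := by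
    rw [envConj_algebraMap, hgh]
  have hαc : envConj g hg c = c' := by
    rw [hc, hc', Polynomial.aeval_def, Polynomial.aeval_def, Polynomial.eval₂_map]
    refine (Polynomial.hom_eval₂ P _ (envConj g hg).toRingHom _).trans ?_
    rw [show (envConj g hg).toRingHom (casimir k m) = casimir k m from
      envConj_siegel_casimir p hp hw hwu hu]
    congr 1
    refine RingHom.ext fun q => ?_
    refine (envConj_algebraMap p hg q).trans ?_
    rw [hgh]; rfl
  have hαy : envD k m p (envConj g hg a) * y = envD k m p (envConj g hg b) := by
    rw [envConj_eq_truncExp p _ (siegelSkew_ad_cube hw hwu hu) (conjSo_siegel hw hwu hu) N ha hN,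
      envConj_eq_truncExp p _ (siegelSkew_ad_cube hw hwu hu) (conjSo_siegel hw hwu hu) N hb hN]
    exact envD_truncExp p hyc hy _
  have hαa : envD k m p (envConj g hg a) ≠ 0 := fun h0 => ha0 (envConj_injective g hg
    ((hinj (h0.trans (map_zero _).symm)).trans (map_zero _).symm))
  have hD : envD k m p (algebraMap _ _ q') * y = envD k m p c' := by
    refine mul_left_cancel₀ hαa ?_
    rw [← mul_assoc, ← map_mul (envD k m p), ← Algebra.commutes q', map_mul (envD k m p), mul_assoc,
      hαy, ← map_mul (envD k m p), ← map_mul (envD k m p), ← hαq, ← hαc,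
      ← map_mul (envConj g hg), hU, map_mul (envConj g hg)]
  have hZ : algebraMap (QZ k m p) (ZD k m p) (algebraMap _ _ q') * y =
      Polynomial.aeval (casZ k m p) ((P.map (yTwist p h).toRingHom).map
        (algebraMap (YAlg k m p) (QZ k m p))) := by
    refine Subtype.ext ?_
    rw [coe_aeval_casZ, ← hc', ← hD, ← hqc]; rfl
  have h1 := congrArg (conjFr h hh) (congrArg θ hP)
  have h2 := congrArg θ hZ
  rw [theta_aeval_casZ p hθ, map_mul θ, AlgHom.commutes, algebraMap_QZ_Fr] at h1 h2
  rw [map_mul (conjFr h hh), conjFr_algebraMap, Polynomial.hom_eval₂, conjFr_casF,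
    ← psiAt_yTwist p hh] at h1
  rw [Polynomial.eval₂_map] at h2
  have h3 : (conjFr h hh).comp ((algebraMap (Pol k m) (Fr k m)).comp
      (psiAt k p (genX k m)).toRingHom) = ((algebraMap (Pol k m) (Fr k m)).comp
      (psiAt k p (genX k m)).toRingHom).comp (yTwist p h).toRingHom := by
    refine RingHom.ext fun q => ?_
    refine (conjFr_algebraMap hh _).trans ?_
    exact congrArg _ (psiAt_yTwist p hh q).symm
  rw [h3, ← h2] at h1
  refine mul_left_cancel₀ ?_ h1
  rw [psiAt_yTwist p hh, Ne, IsFractionRing.to_map_eq_zero_iff (R := Pol k m)]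
  exact fun h0 => hq (psiAt_genX_injective p ((conjSubst_injective hh
    (h0.trans (map_zero _).symm)).trans (map_zero _).symm))

lemma theta_mem_invField [IsAlgClosed k] (hm : 5 ≤ m) (hp : 4 < p)
    (θ : ZD k m p →ₐ[QZ k m p] Fr k m) (hθ : θ (casZ k m p) = casF k m) {y : ZD k m p} {N : ℕ}
    (hN : 2 * N < p) {a b : Env k m} (ha0 : a ≠ 0) (ha : a ∈ fil k m N) (hb : b ∈ fil k m N)
    (hy : envD k m p a * (y : DEnv k m p) = envD k m p b) : θ y ∈ invField k m := by
  refine mem_invField_of_siegel hm fun w u hw hwu hu => ?_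
  obtain ⟨w', hw'⟩ := exists_pow_preimage p w
  obtain ⟨u', hu'⟩ := exists_pow_preimage p u
  have hdot : ∀ x y x' y' : Fin m → k, (∀ i, x' i ^ p = x i) → (∀ i, y' i ^ p = y i) →
      (x' ⬝ᵥ y') ^ p = x ⬝ᵥ y := by
    intro x y x' y' hx hy
    rw [dotProduct, ← frobenius_def, map_sum]
    exact Finset.sum_congr rfl fun i _ => by rw [map_mul, frobenius_def, frobenius_def, hx, hy]
  have hp0 : p ≠ 0 := (Fact.out : p.Prime).ne_zero
  refine conjFr_theta p hp θ hθ hN ha0 ha hb hy (w := w') (u := u') ?_ ?_ ?_ _ ?_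
  · exact pow_eq_zero_iff hp0 |>.1 ((hdot w w w' w' hw' hw').trans hw)
  · exact pow_eq_zero_iff hp0 |>.1 ((hdot w u w' u' hw' hu').trans hwu)
  · apply frobenius_inj k p
    rw [frobenius_def, hdot u u u' u' hu' hu', hu, map_one]
  · ext i j
    have h2 : (2 : k) ^ p = 2 := map_ofNat (frobenius k p) 2
    simp only [siegel, map_apply, Matrix.sub_apply, Matrix.add_apply, vecMulVec_apply,
      Matrix.smul_apply, smul_eq_mul, sub_pow_char, add_pow_char, mul_pow, hw', hu', inv_pow, h2]
    congr 2
    rw [one_apply]; split_ifs <;> simp [hp0]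

end Invariance

end SoGK

namespace SoGK

attribute [local instance] LieRing.ofAssociativeRing

open MvPolynomial Matrix

section Infinitesimal

variable {k : Type} [Field k] {m : ℕ} [NeZero (2 : k)]

/-- A one-parameter group of Siegel matrices. -/
def flowG (w u : Fin m → k) : Matrix (Fin m) (Fin m) (Polynomial (Pol k m)) :=
  1 + (Polynomial.X : Polynomial (Pol k m)) • (siegelSkew w u).1.map (algebraMap k _) +
    (Polynomial.X ^ 2 : Polynomial (Pol k m)) •
      ((2⁻¹ : k) • ((siegelSkew w u).1 * (siegelSkew w u).1)).map (algebraMap k _)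

/-- The generic skew-symmetric matrix moved along a one-parameter group of Siegel matrices. -/
def flowX (w u : Fin m → k) : Matrix (Fin m) (Fin m) (Polynomial (Pol k m)) :=
  (flowG w u)ᵀ * (genX k m).map Polynomial.C * flowG w u

omit [NeZero (2 : k)] in
lemma flowX_transpose (w u : Fin m → k) : (flowX w u)ᵀ = - flowX w u := by
  have h : ((genX k m).map (Polynomial.C : Pol k m →+* _))ᵀ = - (genX k m).map Polynomial.C := by
    rw [← transpose_map, genX_transpose]
    exact Matrix.ext fun a b => map_neg Polynomial.C _
  rw [flowX, transpose_mul, transpose_mul, transpose_transpose, h]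
  rw [Matrix.neg_mul, Matrix.mul_neg, Matrix.mul_assoc]

omit [NeZero (2 : k)] in
lemma flow_expand {R : Type*} [CommRing R] (T : R) (e f' f x : Matrix (Fin m) (Fin m) R) :
    (1 + T • -e + T ^ 2 • f') * x * (1 + T • e + T ^ 2 • f) = x + T • (x * e - e * x) +
      T ^ 2 • (f' * x + x * f - e * x * e + T • (f' * x * e - e * x * f) +
        T ^ 2 • (f' * x * f)) := by
  simp only [add_mul, mul_add, one_mul, mul_one, smul_mul_assoc, mul_smul_comm, smul_neg, neg_mul,
    mul_neg, mul_assoc]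
  module

omit [NeZero (2 : k)] in
lemma exists_flowX (w u : Fin m → k) : ∃ Z : Matrix (Fin m) (Fin m) (Polynomial (Pol k m)),
    flowX w u = (genX k m).map Polynomial.C + (Polynomial.X : Polynomial (Pol k m)) •
      (genX k m * (siegelSkew w u).1.map C - (siegelSkew w u).1.map C * genX k m :
        Matrix (Fin m) (Fin m) (Pol k m)).map Polynomial.C +
      (Polynomial.X ^ 2 : Polynomial (Pol k m)) • Z := by
  have he : (siegelSkew w u).1ᵀ = - (siegelSkew w u).1 :=
    (LieAlgebra.Orthogonal.mem_so (Fin m) k _).1 (siegelSkew w u).2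
  have h1 : ∀ A B : Matrix (Fin m) (Fin m) (Pol k m),
      (A * B - B * A).map (Polynomial.C : Pol k m →+* _) =
      A.map Polynomial.C * B.map Polynomial.C - B.map Polynomial.C * A.map Polynomial.C :=
    fun A B => by
      have := (Polynomial.C : Pol k m →+* Polynomial (Pol k m)).mapMatrix.map_sub (A * B) (B * A)
      rwa [map_mul, map_mul] at this
  have h2 : ((siegelSkew w u).1.map (C : k →+* Pol k m)).map (Polynomial.C : Pol k m →+* _) =
      (siegelSkew w u).1.map (algebraMap k (Polynomial (Pol k m))) := rfl
  have h3 : ((siegelSkew w u).1.map (algebraMap k (Polynomial (Pol k m))))ᵀ =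
      - (siegelSkew w u).1.map (algebraMap k (Polynomial (Pol k m))) := by
    rw [← transpose_map, he]
    exact Matrix.ext fun a b => map_neg (algebraMap k (Polynomial (Pol k m))) _
  rw [h1, h2]
  rw [flowX, flowG, transpose_add, transpose_add, transpose_smul, transpose_smul, transpose_one, h3]
  generalize (siegelSkew w u).1.map (algebraMap k (Polynomial (Pol k m))) = e
  generalize ((2⁻¹ : k) • ((siegelSkew w u).1 * (siegelSkew w u).1)).map
    (algebraMap k (Polynomial (Pol k m))) = f
  generalize (genX k m).map (Polynomial.C : Pol k m →+* _) = x
  generalize (Polynomial.X : Polynomial (Pol k m)) = T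
  exact ⟨_, flow_expand T e fᵀ f x⟩

omit [NeZero (2 : k)] in
lemma map_evalSkew {R S : Type*} [CommRing R] [CommRing S] [Algebra k R] [Algebra k S]
    (f : R →ₐ[k] S) (Z : Matrix (Fin m) (Fin m) R) (a : Pol k m) :
    f (evalSkew k Z a) = evalSkew k (f.mapMatrix Z) a := by
  change (f.comp (evalSkew k Z)) a = _
  congr 1
  refine MvPolynomial.algHom_ext fun c => ?_
  simp only [AlgHom.comp_apply, evalSkew, aeval_X]; rfl

lemma evalSkew_self (a : Pol k m) : evalSkew k (genX k m) a = a := by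
  refine (congrArg (fun f : Pol k m →ₐ[k] Pol k m => f a) (?_ : _ = AlgHom.id k _))
  refine MvPolynomial.algHom_ext fun c => ?_
  rw [evalSkew, aeval_X, AlgHom.id_apply]
  exact skewEntry_lt c.2

lemma coeff_zero_flow (w u : Fin m → k) (a : Pol k m) :
    (evalSkew k (flowX w u) a).coeff 0 = a := by
  obtain ⟨Z, hZ⟩ := exists_flowX w u
  have h := map_evalSkew (((Polynomial.aeval (0 : Pol k m)).restrictScalars k)) (flowX w u) a
  rw [AlgHom.restrictScalars_apply, ← Polynomial.coeff_zero_eq_aeval_zero] at h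
  rw [h]
  refine Eq.trans ?_ (evalSkew_self a)
  congr 1
  congr 1
  rw [hZ]
  refine Matrix.ext fun i j => ?_
  change Polynomial.aeval (0 : Pol k m) _ = _
  rw [← Polynomial.coeff_zero_eq_aeval_zero]
  simp [Matrix.add_apply, Matrix.smul_apply, pow_two]

lemma coeff_one_flow (w u : Fin m → k) (a : Pol k m) :
    (evalSkew k (flowX w u) a).coeff 1 = hamil (siegelSkew w u) a := by
  obtain ⟨Z, hZ⟩ := exists_flowX w u
  let D : Derivation k (Pol k m) (Pol k m) := Derivation.mk'
    { toFun := fun a => (evalSkew k (flowX w u) a).coeff 1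
      map_add' := fun a b => by rw [map_add, Polynomial.coeff_add]
      map_smul' := fun c a => by rw [map_smul, Polynomial.coeff_smul]; rfl }
    fun a b => by
      change (evalSkew k (flowX w u) (a * b)).coeff 1 = _
      rw [map_mul, Polynomial.mul_coeff_one, coeff_zero_flow, coeff_zero_flow]
      simp only [smul_eq_mul, LinearMap.coe_mk, AddHom.coe_mk]
      ring
  have h : D = hamil (siegelSkew w u) := by
    refine MvPolynomial.derivation_ext fun c => ?_
    change (evalSkew k (flowX w u) (X c)).coeff 1 = _
    rw [show (X c : Pol k m) = skewEntry k m c.1.1 c.1.2 from (skewEntry_lt c.2).symm,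
      hamil_skewEntry, evalSkew_skewEntry (flowX_transpose w u), hZ]
    simp [Matrix.add_apply, Matrix.smul_apply, pow_two, mul_assoc]
  exact congrArg (fun D : Derivation k (Pol k m) (Pol k m) => D a) h

lemma eval_flowG {w u : Fin m → k} (hw : w ⬝ᵥ w = 0) (hwu : w ⬝ᵥ u = 0) (hu : u ⬝ᵥ u = 1)
    (t : k) : (flowG w u).map (Polynomial.evalRingHom (C t : Pol k m)) =
      (siegel (t • w) u).map C := by
  have he := siegel_eq_exp (w := t • w) (u := u) (by simp [hw]) (by simp [hwu]) hu
  have hs : (siegelSkew (t • w) u).1 = t • (siegelSkew w u).1 := by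
    simp [siegelSkew, smul_vecMulVec, vecMulVec_smul, smul_sub]
  rw [he, hs, flowG]
  generalize (siegelSkew w u).1 = e
  rw [smul_mul_smul_comm]
  generalize e * e = f
  have h1 : ∀ c : k, Polynomial.evalRingHom (C t : Pol k m)
      (algebraMap k (Polynomial (Pol k m)) c) = C c := fun c => Polynomial.eval_C
  generalize hφ : Polynomial.evalRingHom (C t : Pol k m) = φ at *
  have hX : φ Polynomial.X = C t := by rw [← hφ]; exact Polynomial.eval_X
  refine Matrix.ext fun i j => ?_
  have h2 : φ ((1 : Matrix (Fin m) (Fin m) (Polynomial (Pol k m))) i j) =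
      C ((1 : Matrix (Fin m) (Fin m) k) i j) := by
    rw [Matrix.one_apply, Matrix.one_apply]
    split_ifs
    · rw [map_one, C_1]
    · rw [map_zero, C_0]
  rw [map_apply, map_apply, Matrix.add_apply, Matrix.add_apply, Matrix.smul_apply,
    Matrix.smul_apply, map_apply, map_apply, map_add, map_add, h2, smul_eq_mul, smul_eq_mul,
    map_mul φ, map_mul φ, map_pow φ, hX, h1, h1, Matrix.add_apply, Matrix.add_apply, C_add, C_add,
    Matrix.smul_apply, Matrix.smul_apply, Matrix.smul_apply, Matrix.smul_apply, smul_eq_mul,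
    smul_eq_mul, smul_eq_mul, smul_eq_mul, C_mul, C_mul, C_mul, C_mul, C_mul]
  ring

lemma eval_flow {w u : Fin m → k} (hw : w ⬝ᵥ w = 0) (hwu : w ⬝ᵥ u = 0) (hu : u ⬝ᵥ u = 1) (t : k)
    (hg : (siegel (t • w) u)ᵀ * siegel (t • w) u = 1) (a : Pol k m) :
    (evalSkew k (flowX w u) a).eval (C t) = conjSubst k m (siegel (t • w) u) a := by
  let φ : Polynomial (Pol k m) →ₐ[k] Pol k m :=
    { Polynomial.evalRingHom (C t : Pol k m) with commutes' := fun c => Polynomial.eval_C }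
  refine (map_evalSkew φ (flowX w u) a).trans ?_
  rw [conjSubst_eq hg]
  congr 1
  congr 1
  have hX : φ.mapMatrix ((genX k m).map Polynomial.C) = genX k m :=
    Matrix.ext fun i j => Polynomial.eval_C
  have hG : φ.mapMatrix (flowG w u) = (siegel (t • w) u).map C := eval_flowG hw hwu hu t
  have hGT : φ.mapMatrix (flowG w u)ᵀ = ((siegel (t • w) u).map C)ᵀ := by
    rw [← hG]; rfl
  rw [flowX, conjX, map_mul, map_mul, hG, hX, hGT]

lemma hamil_siegelSkew_mul [Infinite k] {w u : Fin m → k} (hw : w ⬝ᵥ w = 0) (hwu : w ⬝ᵥ u = 0)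
    (hu : u ⬝ᵥ u = 1) {a b : Pol k m} (hb : b ≠ 0)
    (h : algebraMap _ (Fr k m) a / algebraMap _ _ b ∈ invField k m) :
    hamil (siegelSkew w u) b * a = hamil (siegelSkew w u) a * b := by
  have h1 : evalSkew k (flowX w u) b * Polynomial.C a =
      evalSkew k (flowX w u) a * Polynomial.C b := by
    refine Polynomial.eq_of_infinite_eval_eq _ _ ((Set.infinite_range_of_injective
      (MvPolynomial.C_injective (SkewIdx m) k)).mono ?_)
    rintro _ ⟨t, rfl⟩
    have hw' : (t • w) ⬝ᵥ (t • w) = 0 := by simp [hw]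
    have hwu' : (t • w) ⬝ᵥ u = 0 := by simp [hwu]
    have hg := siegel_transpose_mul hw' hwu' hu
    have h2 := mem_invField.1 h _ hg (siegel_det hw' hwu' hu)
    have hb0 : algebraMap _ (Fr k m) b ≠ 0 := by
      rwa [Ne, IsFractionRing.to_map_eq_zero_iff (R := Pol k m)]
    rw [conjFr_eq_iff hg hb (mul_div_cancel₀ _ hb0), mul_div_assoc', div_eq_iff hb0,
      ← map_mul, ← map_mul] at h2
    have h3 := IsFractionRing.injective (Pol k m) (Fr k m) h2
    change Polynomial.eval _ _ = Polynomial.eval _ _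
    rw [Polynomial.eval_mul, Polynomial.eval_mul, Polynomial.eval_C, Polynomial.eval_C,
      eval_flow hw hwu hu t hg, eval_flow hw hwu hu t hg, h3]
  have h2 := congrArg (fun P => Polynomial.coeff P 1) h1
  simpa only [Polynomial.coeff_mul_C, coeff_one_flow] using h2

lemma hamil_eq_siegel [IsAlgClosed k] (hm : 3 ≤ m) (c : SkewIdx m) :
    ∃ w w' u : Fin m → k, w ⬝ᵥ w = 0 ∧ w ⬝ᵥ u = 0 ∧ w' ⬝ᵥ w' = 0 ∧ w' ⬝ᵥ u = 0 ∧ u ⬝ᵥ u = 1 ∧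
      ∀ a, (2 : k) • hamil (gen k c) a = hamil (siegelSkew w u) a + hamil (siegelSkew w' u) a := by
  obtain ⟨l, hl⟩ : ∃ l : Fin m, l ∉ ({c.1.1, c.1.2} : Finset (Fin m)) := by
    by_contra! h
    have h1 := Finset.card_le_card (fun l _ => h l : (Finset.univ : Finset (Fin m)) ⊆ _)
    have h2 := Finset.card_le_two (a := c.1.1) (b := c.1.2)
    rw [Finset.card_univ, Fintype.card_fin] at h1
    omega
  rw [Finset.mem_insert, Finset.mem_singleton, not_or] at hl
  obtain ⟨z, hz⟩ := IsAlgClosed.exists_pow_nat_eq (-1 : k) (n := 2) (by norm_num)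
  have h12 := c.2.ne
  have hz' : z * z = -1 := by rw [← hz, pow_two]
  refine ⟨Pi.single c.1.1 1 + z • Pi.single l 1, Pi.single c.1.1 1 - z • Pi.single l 1,
    Pi.single c.1.2 1, ?_, ?_, ?_, ?_, ?_, fun a => ?_⟩
  · simp [hl.1, Ne.symm hl.1, hz']
  · simp [hl.2, Ne.symm hl.2, h12, h12.symm]
  · simp [hl.1, Ne.symm hl.1, hz']
  · simp [hl.2, Ne.symm hl.2, h12, h12.symm]
  · simp
  · have h1 : (2 : k) • hamil (gen k c) = hamil (siegelSkew
        (Pi.single c.1.1 1 + z • Pi.single l 1) (Pi.single c.1.2 1)) +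
        hamil (siegelSkew (Pi.single c.1.1 1 - z • Pi.single l 1) (Pi.single c.1.2 1)) := by
      refine MvPolynomial.derivation_ext fun d => ?_
      rw [Derivation.smul_apply, Derivation.add_apply, hamil, hamil, hamil, mkDerivation_X,
        mkDerivation_X, mkDerivation_X, ← linForm_smul, ← linForm_add]
      congr 1
      have h2 : siegelSkew (Pi.single c.1.1 1 + z • Pi.single l 1) (Pi.single c.1.2 1) +
          siegelSkew (Pi.single c.1.1 1 - z • Pi.single l 1) (Pi.single c.1.2 1) =
          (2 : k) • gen k c := by
        refine Subtype.ext (Matrix.ext fun i j => ?_)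
        change (vecMulVec _ _ - vecMulVec _ _ + (vecMulVec _ _ - vecMulVec _ _) :
          Matrix (Fin m) (Fin m) k) i j = 2 * skewMat k m _ _ i j
        simp only [Matrix.add_apply, Matrix.sub_apply, vecMulVec_apply, skewMat_apply,
          Pi.add_apply, Pi.sub_apply, Pi.smul_apply, smul_eq_mul]
        simp only [Pi.single_apply, eq_comm (a := i), eq_comm (a := j), ite_and]
        split_ifs <;> ring
      exact congrArg Subtype.val (show (2 : k) • ⁅gen k c, gen k d⁆ =
        ⁅siegelSkew _ _, gen k d⁆ + ⁅siegelSkew _ _, gen k d⁆ by rw [← add_lie, h2, smul_lie])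
    exact congrArg (fun D : Derivation k (Pol k m) (Pol k m) => D a) h1

lemma hamComb_eq_zero_of_mem [IsAlgClosed k] (hm : 3 ≤ m) (e : SkewIdx m → Fr k m) {x : Fr k m}
    (hx : x ∈ invField k m) : hamComb k m e x = 0 := by
  haveI : Infinite k := IsAlgClosed.instInfinite
  obtain ⟨a, b, hb, rfl⟩ := IsFractionRing.div_surjective (A := Pol k m) x
  have hb0 := nonZeroDivisors.ne_zero hb
  have hb1 : algebraMap _ (Fr k m) b ≠ 0 := by
    rwa [Ne, IsFractionRing.to_map_eq_zero_iff (R := Pol k m)]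
  have h1 : ∀ c, hamil (gen k c) b * a = hamil (gen k c) a * b := by
    intro c
    obtain ⟨w, w', u, h1, h2, h3, h4, h5, h6⟩ := hamil_eq_siegel (k := k) hm c
    have h7 := congrArg₂ (· + ·) (hamil_siegelSkew_mul h1 h2 h5 hb0 hx)
      (hamil_siegelSkew_mul h3 h4 h5 hb0 hx)
    simp only [← add_mul, ← h6] at h7
    rw [smul_mul_assoc, smul_mul_assoc] at h7
    exact smul_right_injective _ (NeZero.ne (2 : k)) h7
  have h2 : hamComb k m e (algebraMap _ (Fr k m) b) * algebraMap _ _ a =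
      hamComb k m e (algebraMap _ (Fr k m) a) * algebraMap _ _ b := by
    rw [hamComb_algebraMap, hamComb_algebraMap, Finset.sum_mul, Finset.sum_mul]
    refine Finset.sum_congr rfl fun c _ => ?_
    rw [mul_assoc, mul_assoc, ← map_mul, ← map_mul, h1]
  have h3 := (hamComb k m e).leibniz (algebraMap _ (Fr k m) b)
    (algebraMap _ (Fr k m) a / algebraMap _ (Fr k m) b)
  rw [mul_div_cancel₀ _ hb1, smul_eq_mul, smul_eq_mul] at h3
  refine mul_left_cancel₀ hb1 (mul_left_cancel₀ hb1 ?_)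
  have h4 : algebraMap _ (Fr k m) b * (algebraMap _ (Fr k m) b * hamComb k m e
      (algebraMap _ (Fr k m) a / algebraMap _ (Fr k m) b)) = algebraMap _ (Fr k m) b *
      hamComb k m e (algebraMap _ (Fr k m) a) - algebraMap _ (Fr k m) a *
      hamComb k m e (algebraMap _ (Fr k m) b) := by
    rw [h3]; field_simp; ring
  rw [h4]
  linear_combination -h2

end Infinitesimal

end SoGK

namespace SoGK

open MvPolynomial Matrix

section Generation

/-- A matrix whose characteristic polynomial has coefficients in a subfield is a polynomial
over that subfield in any of its polynomials having independent powers. -/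
lemma exists_polynomial_of_pow_sub {F : Type*} [Field F] {m : ℕ} (E : Subfield F)
    (X Y : Matrix (Fin m) (Fin m) F) (hX : ∀ i, X.charpoly.coeff i ∈ E)
    (hY : Y ∈ Algebra.adjoin E {X}) (hli : LinearIndependent F fun i : Fin m => Y ^ (i : ℕ)) :
    ∃ c : Fin m → E, X = ∑ i, c i • Y ^ (i : ℕ) := by
  obtain ⟨χ, hχ, hdeg, hmon⟩ := Polynomial.lifts_and_natDegree_eq_and_monic (f := E.subtype)
    (p := X.charpoly) ((Polynomial.lifts_iff_coeff_lifts _).2 fun i => ⟨⟨_, hX i⟩, rfl⟩)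
    (Matrix.charpoly_monic X)
  rw [Matrix.charpoly_natDegree_eq_dim, Fintype.card_fin] at hdeg
  have hχX : Polynomial.aeval X χ = 0 := by
    rw [Polynomial.aeval_def, IsScalarTower.algebraMap_eq E F, ← Polynomial.eval₂_map]
    change Polynomial.eval₂ _ X (χ.map E.subtype) = 0
    rw [hχ]
    exact Matrix.aeval_self_charpoly X
  have hM : ∀ Z ∈ Algebra.adjoin E {X},
      Z ∈ Submodule.span E (Set.range fun i : Fin m => X ^ (i : ℕ)) := by
    intro Z hZ
    rw [Algebra.adjoin_singleton_eq_range_aeval] at hZ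
    obtain ⟨P, rfl⟩ := hZ
    change Polynomial.aeval X P ∈ _
    rw [← Polynomial.aeval_modByMonic_eq_self_of_root hχX]
    rcases Nat.eq_zero_or_pos m with rfl | hm
    · rw [Subsingleton.elim (Polynomial.aeval X _) 0]; exact zero_mem _
    have h1 : (P %ₘ χ).natDegree < m := by
      rw [← hdeg]
      refine Polynomial.natDegree_modByMonic_lt P hmon fun h => ?_
      rw [h, Polynomial.natDegree_one] at hdeg
      omega
    rw [Polynomial.aeval_eq_sum_range' h1]
    refine Submodule.sum_mem _ fun i hi => Submodule.smul_mem _ _ (Submodule.subset_span ?_)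
    exact ⟨⟨i, Finset.mem_range.1 hi⟩, rfl⟩
  have hle : Submodule.span E (Set.range fun i : Fin m => Y ^ (i : ℕ)) ≤
      Submodule.span E (Set.range fun i : Fin m => X ^ (i : ℕ)) := by
    rw [Submodule.span_le]
    rintro _ ⟨i, rfl⟩
    exact hM _ (pow_mem hY _)
  have hliE : LinearIndependent E fun i : Fin m => Y ^ (i : ℕ) := hli.restrict_scalars (by
    intro a b h
    exact Subtype.ext (by simpa [Subfield.smul_def] using h))
  haveI : FiniteDimensional E (Submodule.span E (Set.range fun i : Fin m => X ^ (i : ℕ))) :=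
    FiniteDimensional.span_of_finite E (Set.finite_range _)
  have heq := Submodule.eq_of_le_of_finrank_le hle (by
    rw [finrank_span_eq_card hliE]
    exact finrank_range_le_card _)
  have h2 := hM X (Algebra.subset_adjoin rfl)
  rw [← heq, Submodule.mem_span_range_iff_exists_fun] at h2
  obtain ⟨c, hc⟩ := h2
  exact ⟨c, hc.symm⟩

variable {k : Type} [Field k] {m : ℕ} [NeZero (2 : k)]

lemma charpoly_mem_invField (i : ℕ) :
    ((genX k m).map (algebraMap (Pol k m) (Fr k m))).charpoly.coeff i ∈ invField k m := by
  rw [mem_invField, Matrix.charpoly_map, Polynomial.coeff_map]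
  intro g hg _
  have hgC : (g.map C) * (g.map (C : k →+* Pol k m))ᵀ = 1 := by
    rw [← transpose_map, ← Matrix.map_mul, mul_eq_one_comm.1 hg]
    exact Matrix.map_one _ (map_zero _) (map_one _)
  have h1 : (genX k m).map (conjSubst k m g) = conjX g := by
    rw [conjSubst_eq hg]
    exact evalSkew_genX (conjX_transpose g)
  have h2 := congrArg (fun P => Polynomial.coeff P i)
    (Matrix.charpoly_map (genX k m) (conjSubst k m g).toRingHom)
  rw [conjFr_algebraMap]
  congr 1
  simp only [Polynomial.coeff_map] at h2
  refine h2.symm.trans ?_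
  change ((genX k m).map (conjSubst k m g)).charpoly.coeff i = _
  rw [h1, conjX, Matrix.charpoly_mul_comm, ← Matrix.mul_assoc, hgC, Matrix.one_mul]

lemma linearIndependent_genX_pow [NeZero m] [IsAlgClosed k] (p : ℕ) [Fact p.Prime] [CharP k p] :
    LinearIndependent (Fr k m) fun i : Fin m =>
      ((genX k m).map (algebraMap (Pol k m) (Fr k m)) ^ p -
        (genX k m).map (algebraMap (Pol k m) (Fr k m))) ^ (i : ℕ) := by
  have hinj : Function.Injective (algebraMap (Pol k m) (Cl k m)) := by
    rw [IsScalarTower.algebraMap_eq (Pol k m) (Fr k m) (Cl k m)]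
    exact (algebraMap (Fr k m) (Cl k m)).injective.comp (IsFractionRing.injective _ _)
  obtain ⟨x, W, hx, hW⟩ := exists_generic_eigenBasis p hinj
  have h2 : (2 : Cl k m) ≠ 0 := by
    rw [← map_ofNat (algebraMap k (Cl k m)) 2]
    exact (map_ne_zero _).2 (NeZero.ne _)
  haveI : CharP (Cl k m) p := charP_of_injective_algebraMap (algebraMap k (Cl k m)).injective p
  have hY := hW.pow_sub p
  set Y := (genX k m).map (algebraMap (Pol k m) (Fr k m)) ^ p -
        (genX k m).map (algebraMap (Pol k m) (Fr k m)) with hYdef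
  have hYmap : Y.map (algebraMap (Fr k m) (Cl k m)) = (genX k m).map (algebraMap _ (Cl k m)) ^ p -
      (genX k m).map (algebraMap _ (Cl k m)) := by
    have h3 : ((genX k m).map (algebraMap (Pol k m) (Fr k m))).map
        (algebraMap (Fr k m) (Cl k m)) = (genX k m).map (algebraMap _ (Cl k m)) :=
      Matrix.ext fun i j => (IsScalarTower.algebraMap_apply (Pol k m) (Fr k m) (Cl k m) _).symm
    change (algebraMap (Fr k m) (Cl k m)).mapMatrix Y = _
    rw [hYdef, map_sub, map_pow]
    change (((genX k m).map (algebraMap (Pol k m) (Fr k m))).map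
      (algebraMap (Fr k m) (Cl k m))) ^ p - ((genX k m).map (algebraMap (Pol k m) (Fr k m))).map
      (algebraMap (Fr k m) (Cl k m)) = _
    rw [h3]
  rw [← hYmap] at hY
  rw [Fintype.linearIndependent_iff]
  intro c hc
  have hW0 : ∀ i, W i ≠ 0 := by
    intro i h
    have := hW.dot i i.rev
    rw [h, zero_dotProduct, if_pos rfl] at this
    exact zero_ne_one this
  have hpow : ∀ (n : ℕ) i, (Y.map (algebraMap (Fr k m) (Cl k m)) ^ n) *ᵥ W i =
      (x ^ p - x) i ^ n • W i := by
    intro n i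
    induction n with
    | zero => rw [pow_zero, pow_zero, one_smul, one_mulVec]
    | succ n ih => rw [pow_succ', ← mulVec_mulVec, ih, mulVec_smul, hY.eig, smul_smul, pow_succ]
  have hroot : ∀ i, ∑ j : Fin m, algebraMap (Fr k m) (Cl k m) (c j) * (x ^ p - x) i ^ (j : ℕ) = 0 := by
    intro i
    have h4 := congrArg (fun M => ((algebraMap (Fr k m) (Cl k m)).mapMatrix M) *ᵥ W i) hc
    simp only [map_sum, map_zero, zero_mulVec, sum_mulVec] at h4
    have h5 : ∀ j : Fin m, (algebraMap (Fr k m) (Cl k m)).mapMatrix (c j • Y ^ (j : ℕ)) *ᵥ W i =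
        (algebraMap (Fr k m) (Cl k m) (c j) * (x ^ p - x) i ^ (j : ℕ)) • W i := by
      intro j
      have : (algebraMap (Fr k m) (Cl k m)).mapMatrix (c j • Y ^ (j : ℕ)) =
          algebraMap (Fr k m) (Cl k m) (c j) • Y.map (algebraMap (Fr k m) (Cl k m)) ^ (j : ℕ) := by
        rw [show Y.map (algebraMap (Fr k m) (Cl k m)) = (algebraMap (Fr k m) (Cl k m)).mapMatrix Y
          from rfl, ← map_pow]
        exact Matrix.ext fun a b => map_mul (algebraMap (Fr k m) (Cl k m)) _ _
      rw [this, smul_mulVec, hpow, smul_smul]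
    rw [Finset.sum_congr rfl fun j _ => h5 j, ← Finset.sum_smul] at h4
    exact (smul_eq_zero.1 h4).resolve_right (hW0 i)
  have hinj' : Function.Injective (x ^ p - x) := hx.artinSchreier_injective p h2
  have h6 : (Matrix.vandermonde (x ^ p - x)) *ᵥ (fun j => algebraMap (Fr k m) (Cl k m) (c j)) = 0 := by
    funext i
    rw [mulVec, dotProduct]
    refine Eq.trans (Finset.sum_congr rfl fun j _ => ?_) (hroot i)
    rw [vandermonde_apply, mul_comm]
  have h7 := Matrix.eq_zero_of_mulVec_eq_zero (Matrix.det_vandermonde_ne_zero_iff.2 hinj') h6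
  exact fun i => (map_eq_zero (algebraMap (Fr k m) (Cl k m))).1 (congrFun h7 i)

lemma subfield_eq_top_of_entries [NeZero m] [IsAlgClosed k] (p : ℕ) [Fact p.Prime] [CharP k p]
    (E' : Subfield (Fr k m)) (hE : invField k m ≤ E')
    (h : ∀ a b, algebraMap (Pol k m) (Fr k m) ((genX k m ^ p - genX k m) a b) ∈ E') : E' = ⊤ := by
  set X := (genX k m).map (algebraMap (Pol k m) (Fr k m)) with hX
  have hXY : X ∈ Algebra.adjoin (invField k m) {X} := Algebra.subset_adjoin rfl
  obtain ⟨c, hc⟩ := exists_polynomial_of_pow_sub (invField k m) X (X ^ p - X)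
    charpoly_mem_invField (sub_mem (pow_mem hXY _) hXY) (linearIndependent_genX_pow p)
  have hY : ∀ a b, (X ^ p - X) a b ∈ E' := by
    intro a b
    have h1 : X ^ p - X = (algebraMap (Pol k m) (Fr k m)).mapMatrix (genX k m ^ p - genX k m) := by
      rw [map_sub, map_pow]; rfl
    rw [h1]
    exact h a b
  have hYn : ∀ (n : ℕ) a b, ((X ^ p - X) ^ n) a b ∈ E' := by
    intro n
    induction n with
    | zero =>
      intro a b
      rw [pow_zero, Matrix.one_apply]
      split_ifs
      exacts [one_mem _, zero_mem _]
    | succ n ih =>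
      intro a b
      rw [pow_succ, Matrix.mul_apply]
      exact sum_mem fun c _ => mul_mem (ih _ _) (hY _ _)
  have hXm : ∀ a b, X a b ∈ E' := by
    intro a b
    rw [hc, Matrix.sum_apply]
    exact sum_mem fun i _ => mul_mem (hE (c i).2) (hYn _ _ _)
  have hk : ∀ z : k, algebraMap (Pol k m) (Fr k m) (C z) ∈ E' := by
    intro z
    refine hE (mem_invField.2 fun g hg _ => ?_)
    rw [conjFr_algebraMap]
    exact congrArg _ (AlgHom.commutes (conjSubst k m g) z)
  have hP : ∀ a : Pol k m, algebraMap (Pol k m) (Fr k m) a ∈ E' := by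
    intro a
    induction a using MvPolynomial.induction_on with
    | C z => exact hk z
    | add a b ha hb => rw [map_add]; exact add_mem ha hb
    | mul_X a c ha =>
      rw [map_mul]
      refine mul_mem ha ?_
      rw [← skewEntry_lt c.2]
      exact hXm _ _
  rw [eq_top_iff]
  intro x _
  obtain ⟨a, b, hb, rfl⟩ := IsFractionRing.div_surjective (A := Pol k m) x
  exact div_mem (hP a) (hP b)

end Generation

end SoGK

namespace SoGK
open MvPolynomial

section independence
variable {F : Type*} [Field F] (E : Subfield F)

lemma eq_zero_of_forall_aut (hE : ∀ x : F, (∀ σ : F ≃ₐ[E] F, σ x = x) → x ∈ E)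
    {ι : Type*} [Fintype ι] {z : ι → F} (hz : LinearIndependent E z) {e : ι → F}
    (he : ∀ σ : F ≃ₐ[E] F, ∑ i, e i * σ (z i) = 0) : e = 0 := by
  classical
  have hfix : ∀ x : F, x ∈ FixedPoints.subfield (F ≃ₐ[E] F) F → x ∈ E := fun x hx => hE x hx
  have h1 : LinearIndependent (FixedPoints.subfield (F ≃ₐ[E] F) F) z := by
    rw [Fintype.linearIndependent_iff] at hz ⊢
    intro g hg i
    have h2 := hz (fun j => ⟨(g j : F), hfix _ (g j).2⟩) hg i
    exact Subtype.ext (congrArg (Subtype.val : E → F) h2)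
  have h3 : LinearIndepOn (FixedPoints.subfield (F ≃ₐ[E] F) F) id
      (↑(Finset.univ.image z) : Set F) := by
    rw [Finset.coe_image, Finset.coe_univ, Set.image_univ]
    exact h1.linearIndepOn_id
  have h4 := FixedPoints.linearIndependent_smul_of_linearIndependent (F ≃ₐ[E] F) F h3
  have h5 : LinearIndependent F
      (fun x : (↑(Finset.univ.image z) : Set F) => MulAction.toFun (F ≃ₐ[E] F) F (x : F)) := h4
  have h6 := h5.comp (fun i => ⟨z i, by simp⟩) (fun i j hij => h1.injective (Subtype.ext_iff.1 hij))
  rw [Fintype.linearIndependent_iff] at h6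
  funext i
  refine h6 e ?_ i
  funext σ
  have := he σ
  simpa [Finset.sum_apply] using this

lemma linearIndependent_pow (p : ℕ) [Fact p.Prime] [CharP F p]
    (hE : ∀ x : F, (∀ σ : F ≃ₐ[E] F, σ x = x) → x ∈ E)
    {ι : Type*} [Fintype ι] {z : ι → F} (hz : LinearIndependent E z) :
    LinearIndependent E (fun i => z i ^ p) := by
  rw [Fintype.linearIndependent_iff]
  intro c hc
  let Ω := AlgebraicClosure F
  haveI : CharP Ω p := charP_of_injective_algebraMap (algebraMap F Ω).injective p
  have hp : p.Prime := Fact.out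
  choose d hd using fun i =>
    IsAlgClosed.exists_pow_nat_eq (algebraMap F Ω (c i : F)) hp.pos
  have h1 : ∀ σ : F ≃ₐ[E] F, ∑ i, d i * algebraMap F Ω (σ (z i)) = 0 := by
    intro σ
    refine eq_zero_of_pow_eq_zero (n := p) ?_
    rw [sum_pow_char]
    have h2 := congrArg (fun x => algebraMap F Ω (σ x)) hc
    simp only [map_sum, map_zero] at h2
    rw [← h2]
    refine Finset.sum_congr rfl fun i _ => ?_
    rw [mul_pow, hd, map_smul, map_pow, Subfield.smul_def, smul_eq_mul, map_mul, map_pow]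
  have h2 : ∀ i, d i = 0 := by
    intro i
    rw [← Module.forall_dual_apply_eq_zero_iff F]
    intro φ
    refine congrFun (eq_zero_of_forall_aut E hE hz (e := fun i => φ (d i)) fun σ => ?_) i
    have := congrArg φ (h1 σ)
    rw [map_sum, map_zero] at this
    rw [← this]
    refine Finset.sum_congr rfl fun j _ => ?_
    rw [mul_comm (d j), ← Algebra.smul_def, map_smul, smul_eq_mul, mul_comm]
  intro i
  have h3 := hd i
  rw [h2 i, zero_pow hp.ne_zero] at h3
  exact Subtype.ext ((map_eq_zero _).1 h3.symm)

lemma totalDegree_pderiv_lt {R ι : Type*} [CommRing R] [IsDomain R] (i : ι) {f : MvPolynomial ι R}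
    (hf : pderiv i f ≠ 0) : (pderiv i f).totalDegree < f.totalDegree := by
  classical
  obtain ⟨s, hs, hs'⟩ := Finset.exists_mem_eq_sup (pderiv i f).support
    (Finsupp.support_nonempty_iff.2 (by simpa using hf)) (fun s => s.sum fun _ e => e)
  have h1 : coeff (s + Finsupp.single i 1) f ≠ 0 := by
    intro h0
    rw [mem_support_iff, coeff_pderiv, h0, zero_mul] at hs
    exact hs rfl
  have h2 := le_totalDegree (mem_support_iff.2 h1)
  rw [Finsupp.sum_add_index' (by simp) (by simp), Finsupp.sum_single_index rfl] at h2
  have h3 : (pderiv i f).totalDegree = s.sum fun _ e => e := hs'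
  omega

lemma aeval_pderiv {k : Type*} [CommRing k] [Algebra k F] {ι : Type*} [DecidableEq ι] {f : ι → F}
    (D : Derivation k F F) (hD : ∀ x ∈ E, D x = 0) (i : ι) (h : ∀ j, D (f j) = if i = j then 1 else 0)
    (R : MvPolynomial ι E) : D (aeval f R) = aeval f (pderiv i R) := by
  induction R using MvPolynomial.induction_on with
  | C a => simp only [aeval_C, pderiv_C, map_zero]; exact hD _ a.2
  | add a b ha hb => simp only [map_add, ha, hb]
  | mul_X a j ha =>
    rw [map_mul, aeval_X, D.leibniz, ha, h, (pderiv i).leibniz, pderiv_X, map_add]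
    simp only [smul_eq_mul, map_mul, aeval_X, Pi.single_apply, eq_comm (a := j) (b := i)]
    split_ifs <;> simp

lemma algebraicIndependent_of_derivations (p : ℕ) [Fact p.Prime] [CharP F p]
    (hE : ∀ x : F, (∀ σ : F ≃ₐ[E] F, σ x = x) → x ∈ E)
    {k : Type*} [CommRing k] [Algebra k F] {ι : Type*} [DecidableEq ι]
    {f : ι → F} (D : ι → Derivation k F F) (hD : ∀ i, ∀ x ∈ E, D i x = 0)
    (h : ∀ i j, D i (f j) = if i = j then 1 else 0) : AlgebraicIndependent E f := by
  rw [algebraicIndependent_iff]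
  suffices H : ∀ n, ∀ R : MvPolynomial ι E, R.totalDegree ≤ n → aeval f R = 0 → R = 0 from
    fun R hR => H _ R le_rfl hR
  intro n
  induction n using Nat.strong_induction_on with
  | _ n ih =>
  intro R hn hR
  have hp : p.Prime := Fact.out
  haveI : CharP E p := (RingHom.charP_iff E.subtype E.subtype.injective p).2 inferInstance
  have h1 : ∀ i, pderiv i R = 0 := by
    intro i
    by_contra hne
    have h2 := totalDegree_pderiv_lt i hne
    refine hne (ih _ (h2.trans_le hn) _ le_rfl ?_)
    rw [← aeval_pderiv E (D i) (hD i) i (h i), hR, map_zero]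
  have h2 : ∀ a ∈ R.support, ∀ i, p ∣ a i := by
    intro a ha i
    by_contra hpa
    have hi : a i ≠ 0 := fun h0 => hpa (h0 ▸ dvd_zero p)
    have h3 := congrArg (coeff (a - Finsupp.single i 1)) (h1 i)
    have h4 : a - Finsupp.single i 1 + Finsupp.single i 1 = a := by
      ext j
      by_cases hj : i = j
      · subst hj; simp; omega
      · simp [Finsupp.single_apply, hj]
    rw [coeff_pderiv, h4, coeff_zero] at h3
    rcases mul_eq_zero.1 h3 with h5 | h5
    · exact (mem_support_iff.1 ha) h5
    · have h6 : ((a i : ℕ) : E) = 0 := by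
        rw [← h5]
        have : a i = (a i - 1) + 1 := by omega
        conv_lhs => rw [this]
        simp
      exact hpa ((CharP.cast_eq_zero_iff E p _).1 h6)
  rcases Nat.eq_zero_or_pos n with rfl | hpos
  · obtain hc := totalDegree_eq_zero_iff_eq_C.1 (Nat.le_zero.1 hn)
    rw [hc, aeval_C] at hR
    rw [hc, (map_eq_zero _).1 hR, C_0]
  choose! b hb using fun a (ha : a ∈ R.support) =>
    (show ∃ b : ι →₀ ℕ, p • b = a from ⟨a.mapRange (· / p) (by simp), by
      ext i
      simpa using Nat.mul_div_cancel' (h2 a ha i)⟩)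
  have hdeg : ∀ a ∈ R.support, ((b a).sum fun _ e => e) < n := by
    intro a ha
    have h3 := (le_totalDegree ha).trans hn
    rw [← hb a ha, Finsupp.sum_smul_index' (fun _ => rfl)] at h3
    simp only [smul_eq_mul, Finsupp.sum, ← Finset.mul_sum] at h3
    have h4 := Nat.mul_le_mul_right ((b a).sum fun _ e => e) hp.two_le
    simp only [Finsupp.sum] at h4 ⊢
    omega
  have hinj : ∀ a a' : R.support, b a = b a' → a = a' := fun a a' haa =>
    Subtype.ext (by rw [← hb a a.2, haa, hb a' a'.2])
  have hz : LinearIndependent E fun a : R.support => (b a).prod fun i e => f i ^ e := by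
    rw [Fintype.linearIndependent_iff]
    intro c hc a
    have h3 : (∑ a : R.support, monomial (b a) (c a)).totalDegree ≤ n - 1 := by
      refine totalDegree_finsetSum_le fun a _ => (totalDegree_monomial_le _ _).trans ?_
      have := hdeg a a.2
      simp only [Finsupp.sum, id] at this ⊢
      omega
    have h4 := ih (n - 1) (by omega) _ h3 (by
      rw [map_sum, ← hc]
      refine Finset.sum_congr rfl fun a _ => ?_
      rw [aeval_monomial, Algebra.smul_def])
    have h5 := congrArg (coeff (b a)) h4
    rw [coeff_sum, Finset.sum_eq_single a (fun a' _ hne => by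
      rw [coeff_monomial, if_neg fun h => hne (hinj _ _ h)]) (fun h => absurd (Finset.mem_univ _) h),
      coeff_monomial, if_pos rfl, coeff_zero] at h5
    exact h5
  have hzp := Fintype.linearIndependent_iff.1 (linearIndependent_pow E p hE hz)
    (fun a => coeff a.1 R) (by
      rw [← hR, aeval_def, eval₂_eq, ← Finset.sum_coe_sort R.support]
      refine Finset.sum_congr rfl fun a _ => ?_
      rw [Algebra.smul_def]
      congr 1
      have h3 : ∏ i ∈ a.1.support, f i ^ a.1 i = a.1.prod fun i e => f i ^ e := rfl
      rw [h3]
      conv_rhs => rw [← hb a a.2]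
      rw [Finsupp.prod_of_support_subset (p • b a.1) Finsupp.support_smul _
        (fun _ _ => pow_zero _), Finsupp.prod, ← Finset.prod_pow]
      refine Finset.prod_congr rfl fun i _ => ?_
      rw [Finsupp.smul_apply, smul_eq_mul, mul_comm, pow_mul])
  ext a
  by_cases ha : a ∈ R.support
  · rw [hzp ⟨a, ha⟩, coeff_zero]
  · rw [notMem_support_iff.1 ha, coeff_zero]

end independence

section orthogonal
variable {k : Type} [Field k] {m : ℕ} [NeZero (2 : k)]

lemma conjFr_one (h : (1 : Matrix (Fin m) (Fin m) k).transpose * 1 = 1) (x : Fr k m) :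
    conjFr 1 h x = x := by
  obtain ⟨a, b, -, rfl⟩ := IsFractionRing.div_surjective (A := Pol k m) x
  rw [map_div₀, conjFr_algebraMap, conjFr_algebraMap, conjSubst_one, conjSubst_one]

/-- Conjugation by an element of the special orthogonal group, as an automorphism of the function
field over the field of invariants. -/
def conjAut (g : Matrix (Fin m) (Fin m) k) (hg : g.transpose * g = 1) (hdet : g.det = 1) :
    Fr k m ≃ₐ[invField k m] Fr k m :=
  have hg' : g.transpose.transpose * g.transpose = 1 := by
    rw [Matrix.transpose_transpose]; exact mul_eq_one_comm.1 hg
  AlgEquiv.ofRingEquiv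
    (f := RingEquiv.ofRingHom (conjFr g hg) (conjFr g.transpose hg')
      (RingHom.ext fun x => by
        have h := hg'
        rw [Matrix.transpose_transpose] at h
        have h1 : (g * g.transpose).transpose * (g * g.transpose) = 1 := by rw [h]; simp
        rw [RingHom.comp_apply, conjFr_conjFr hg' hg h1]
        simp only [h]
        exact conjFr_one _ x)
      (RingHom.ext fun x => by
        have h1 : (g.transpose * g).transpose * (g.transpose * g) = 1 := by rw [hg]; simp
        rw [RingHom.comp_apply, conjFr_conjFr hg hg' h1]
        simp only [hg]
        exact conjFr_one _ x))
    fun x => mem_invField.1 x.2 g hg hdet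

lemma mem_invField_of_aut {x : Fr k m}
    (h : ∀ σ : Fr k m ≃ₐ[invField k m] Fr k m, σ x = x) : x ∈ invField k m :=
  mem_invField.2 fun g hg hdet => h (conjAut g hg hdet)

end orthogonal

end SoGK

namespace SoGK
open MvPolynomial Matrix

variable {k : Type} [Field k] {m : ℕ} [NeZero (2 : k)]

lemma algebraMap_mem_invField (c : k) : algebraMap k (Fr k m) c ∈ invField k m := by
  refine mem_invField.2 fun g hg _ => ?_
  rw [IsScalarTower.algebraMap_apply k (Pol k m) (Fr k m), conjFr_algebraMap, AlgHom.commutes]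

lemma exists_algebraicIndependent [IsAlgClosed k] (p : ℕ) [Fact p.Prime] [CharP k p] (hm : 3 ≤ m) {ι : Type} [Fintype ι] (f : ι → Fr k m)
    (hcard : Fintype.card ι ≤ Fintype.card (SkewIdx m) - rk m)
    (hf : Subfield.closure ((invField k m : Set (Fr k m)) ∪ Set.range f) = ⊤) :
    AlgebraicIndependent (invField k m) f := by
  classical
  haveI : CharP (Fr k m) p := charP_of_injective_algebraMap (algebraMap k (Fr k m)).injective p
  let V := LinearMap.range (hamComb k m)
  have hkill : ∀ D ∈ V, ∀ x ∈ invField k m, D x = 0 := by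
    rintro _ ⟨e, rfl⟩ x hx
    exact hamComb_eq_zero_of_mem hm e hx
  obtain ⟨c, w, hc, hcw⟩ := exists_dual_subfamily (F := Fr k m) (V := V) (ι := ι)
    (fun i => { toFun := fun D => D.1 (f i), map_add' := fun _ _ => rfl, map_smul' := fun _ _ => rfl })
    (fun D hD => Subtype.ext (by
      have h1 : constants (fun _ : Unit => D.1) = ⊤ := by
        rw [eq_top_iff, ← hf, Subfield.closure_le]
        rintro x (hx | ⟨i, rfl⟩)
        · exact fun _ => hkill D.1 D.2 x hx
        · exact fun _ => hD i
      ext x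
      have : x ∈ constants (fun _ : Unit => D.1) := h1 ▸ Subfield.mem_top x
      exact this ()))
  have hle : Fintype.card ι ≤ Fintype.card (Fin (Module.finrank (Fr k m) V)) := by
    rw [Fintype.card_fin]
    exact hcard.trans (le_finrank_range_hamComb p)
  have hbij : Function.Bijective c :=
    (Fintype.bijective_iff_injective_and_card c).2
      ⟨hc, le_antisymm (Fintype.card_le_of_injective c hc) hle⟩
  let e := Equiv.ofBijective c hbij
  refine algebraicIndependent_of_derivations (invField k m) p (fun x => mem_invField_of_aut)
    (k := k) (fun i => (w (e.symm i)).1) (fun i => hkill _ (w (e.symm i)).2) fun i j => ?_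
  have h1 := hcw (e.symm j) (e.symm i)
  have h2 : c (e.symm j) = j := e.apply_symm_apply j
  rw [h2] at h1
  refine h1.trans ?_
  simp [eq_comm]

theorem exists_purely_transcendental [NeZero m] [IsAlgClosed k] (p : ℕ) [Fact p.Prime] [CharP k p]
    (hm : 5 ≤ m) (hp : 4 < p) {r s : ℕ}
    {u v : Fin r → DEnv k m p} {y : Fin s → DEnv k m p} (h : WeylSystem u v y)
    (hg : GeneratesDivision k u v y)
    (hy : ∀ j, ∃ N, 2 * N < p ∧ ∃ a b : Env k m, a ≠ 0 ∧ a ∈ fil k m N ∧ b ∈ fil k m N ∧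
      envD k m p a * y j = envD k m p b) :
    ∃ (d : ℕ) (f : Fin d → Fr k m), AlgebraicIndependent (invField k m) f ∧
      Subfield.closure ((invField k m : Set (Fr k m)) ∪ Set.range f) = ⊤ := by
  obtain ⟨θ, hθ⟩ := exists_centerHom k m p
  haveI : CharP (DEnv k m p) p :=
    charP_of_injective_algebraMap (algebraMap k (DEnv k m p)).injective p
  let g : Fin r ⊕ Fin r → Fr k m :=
    Sum.elim (fun i => θ ⟨u i ^ p, h.mem_center_u p hg i⟩) (fun i => θ ⟨v i ^ p, h.mem_center_v p hg i⟩)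
  have hcl : Subfield.closure ((invField k m : Set (Fr k m)) ∪ Set.range g) = ⊤ := by
    set E' := Subfield.closure ((invField k m : Set (Fr k m)) ∪ Set.range g) with hE'
    have hinv : invField k m ≤ E' := fun x hx => Subfield.subset_closure (Or.inl hx)
    have hgE : ∀ i, g i ∈ E' := fun i => Subfield.subset_closure (Or.inr ⟨i, rfl⟩)
    have htop := h.center_eq_top p hg (E'.comap (θ : ZD k m p →+* Fr k m))
      (fun c => ⟨algebraMap (QZ k m p) (ZD k m p) (algebraMap k (QZ k m p) c), by
        rw [Subfield.mem_comap]
        refine hinv ?_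
        have := θ.commutes (algebraMap k (QZ k m p) c)
        refine this.symm ▸ ?_
        rw [← IsScalarTower.algebraMap_apply]
        exact algebraMap_mem_invField c,
        (IsScalarTower.algebraMap_apply k (QZ k m p) (DEnv k m p) c).symm⟩)
      (fun i => ⟨⟨u i ^ p, h.mem_center_u p hg i⟩, hgE (Sum.inl i), rfl⟩)
      (fun i => ⟨⟨v i ^ p, h.mem_center_v p hg i⟩, hgE (Sum.inr i), rfl⟩)
      (fun j => ⟨⟨y j, h.mem_center_y hg j⟩, hinv (by
        obtain ⟨N, hN, a, b, ha0, ha, hb, hab⟩ := hy j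
        exact theta_mem_invField p hm hp θ hθ hN ha0 ha hb hab), rfl⟩)
    have hmem : ∀ a : YAlg k m p, algebraMap (Pol k m) (Fr k m) (psiAt k p (genX k m) a) ∈ E' := by
      intro a
      rw [← algebraMap_QZ_Fr p a, ← θ.commutes]
      have : algebraMap (QZ k m p) (ZD k m p) (algebraMap _ _ a) ∈
        E'.comap (θ : ZD k m p →+* Fr k m) := htop ▸ Subfield.mem_top _
      exact this
    have hlt : ∀ a b : Fin m, a < b →
        algebraMap (Pol k m) (Fr k m) ((genX k m ^ p - genX k m) a b) ∈ E' := fun a b hab => by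
      have h1 := hmem (X ⟨⟨(a, b), hab⟩⟩)
      rwa [psiAt, aeval_X] at h1
    have hskew : (genX k m ^ p - genX k m)ᵀ = - (genX k m ^ p - genX k m) := by
      rw [Matrix.transpose_sub, Matrix.transpose_pow, genX_transpose, (odd_char k p).neg_pow,
        neg_sub, sub_neg_eq_add, neg_add_eq_sub]
    refine subfield_eq_top_of_entries p E' hinv fun a b => ?_
    rcases lt_trichotomy a b with hab | rfl | hab
    · exact hlt a b hab
    · rw [diag_eq_zero (k := k) hskew, map_zero]
      exact E'.zero_mem
    · rw [show (genX k m ^ p - genX k m) a b = - (genX k m ^ p - genX k m) b a from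
        congrFun (congrFun hskew b) a, map_neg]
      exact E'.neg_mem (hlt b a hab)
  refine ⟨r + r, g ∘ finSumFinEquiv.symm, ?_, ?_⟩
  · refine (exists_algebraicIndependent p (by omega) g ?_ hcl).comp _ finSumFinEquiv.symm.injective
    have h1 := h.pow_le_finrank p
    have h2 := (finrank_counts k m p).2
    rw [Fintype.card_sum, Fintype.card_fin]
    refine (Nat.pow_le_pow_iff_right (Fact.out : p.Prime).one_lt).1 ?_
    rw [← h2]
    exact h1
  · rw [finSumFinEquiv.symm.surjective.range_comp, hcl]

end SoGK

namespace SoGK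
open MvPolynomial

section ReducedProduct
variable {I : Type} (ℱ : Filter I) (D : I → Type) [∀ i, Ring (D i)]

/-- Eventual equality of families of ring elements. -/
def eventualCon : RingCon (∀ i, D i) where
  r x y := ∀ᶠ i in ℱ, x i = y i
  iseqv := ⟨fun _ => .of_forall fun _ => rfl, fun h => h.mono fun _ => Eq.symm,
    fun h h' => by filter_upwards [h, h'] with i hi hi' using hi.trans hi'⟩
  add' h h' := by filter_upwards [h, h'] with i hi hi' using congrArg₂ (· + ·) hi hi'
  mul' h h' := by filter_upwards [h, h'] with i h₁ h₂ using congrArg₂ (· * ·) h₁ h₂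

/-- The reduced product of a family of rings along a filter. -/
def ReducedProduct : Type := (eventualCon ℱ D).Quotient

instance : Ring (ReducedProduct ℱ D) := inferInstanceAs (Ring (eventualCon ℱ D).Quotient)

/-- The projection to the reduced product. -/
def toReduced : (∀ i, D i) →+* ReducedProduct ℱ D := (eventualCon ℱ D).mk'

variable {ℱ D}

lemma toReduced_eq {x y : ∀ i, D i} : toReduced ℱ D x = toReduced ℱ D y ↔ ∀ᶠ i in ℱ, x i = y i :=
  (eventualCon ℱ D).eq

lemma toReduced_surjective : Function.Surjective (toReduced ℱ D) := (eventualCon ℱ D).mk'_surjective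

lemma isUnit_toReduced {D : I → Type} [∀ i, DivisionRing (D i)] {x : ∀ i, D i}
    (hx : ∀ᶠ i in ℱ, x i ≠ 0) : IsUnit (toReduced ℱ D x) := by
  refine isUnit_iff_exists.2 ⟨toReduced ℱ D fun i => (x i)⁻¹, ?_, ?_⟩ <;>
    rw [← map_mul, ← map_one (toReduced ℱ D), toReduced_eq] <;>
    filter_upwards [hx] with i hi
  · exact mul_inv_cancel₀ hi
  · exact inv_mul_cancel₀ hi

lemma eventually_ne_zero {D : I → Type} [∀ i, DivisionRing (D i)] {x : ∀ i, D i}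
    (hx : IsUnit (toReduced ℱ D x)) : ∀ᶠ i in ℱ, x i ≠ 0 := by
  obtain ⟨z, hz⟩ := hx.exists_right_inv
  obtain ⟨z, rfl⟩ := toReduced_surjective z
  rw [← map_mul, ← map_one (toReduced ℱ D), toReduced_eq] at hz
  filter_upwards [hz] with i hi h0
  simp [h0] at hi

end ReducedProduct

lemma exists_fraction_lift {R D S : Type*} [Ring R] [DivisionRing D] [Ring S] (f : R →+* D)
    (hf : Function.Injective f) (hfrac : ∀ d : D, ∃ a b : R, b ≠ 0 ∧ f b * d = f a) (ψ : R →+* S)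
    (hψ : ∀ b, b ≠ 0 → IsUnit (ψ b)) : ∃ Φ : D →+* S, ∀ a, Φ (f a) = ψ a := by
  haveI : NoZeroDivisors R := hf.noZeroDivisors f (map_zero f) (map_mul f)
  have hf0 : ∀ {b}, b ≠ 0 → f b ≠ 0 := fun hb h0 => hb (hf (h0.trans (map_zero f).symm))
  have ore : ∀ a b : R, b ≠ 0 → ∃ e g : R, e ≠ 0 ∧ e * a = g * b := by
    intro a b hb
    obtain ⟨g, e, he, h⟩ := hfrac (f a * (f b)⁻¹)
    refine ⟨e, g, he, hf ?_⟩
    rw [map_mul, map_mul, ← h, mul_assoc, mul_assoc, inv_mul_cancel₀ (hf0 hb), mul_one]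
  have hex : ∀ d : D, ∃ x : S, ∀ a b : R, f b * d = f a → ψ b * x = ψ a := by
    intro d
    obtain ⟨a, b, hb, h⟩ := hfrac d
    obtain ⟨x, hx⟩ : ∃ x, ψ b * x = ψ a := by
      obtain ⟨z, hz⟩ := (hψ b hb).exists_right_inv
      exact ⟨z * ψ a, by rw [← mul_assoc, hz, one_mul]⟩
    refine ⟨x, fun a' b' h' => ?_⟩
    obtain ⟨e, g, he, heg⟩ := ore b' b hb
    refine (hψ e he).mul_left_cancel ?_
    have h1 : e * a' = g * a := hf (by
      rw [map_mul, map_mul, ← h', ← h, ← mul_assoc, ← mul_assoc, ← map_mul, ← map_mul, heg])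
    rw [← mul_assoc, ← map_mul, heg, map_mul, mul_assoc, hx, ← map_mul, ← h1, map_mul]
  choose Φ hΦ using hex
  have hone : Φ 1 = 1 := by simpa using hΦ 1 1 1 (by simp)
  refine ⟨{ toFun := Φ, map_one' := hone, map_mul' := fun d d' => ?_,
            map_zero' := by simpa using hΦ 0 0 1 (by simp), map_add' := fun d d' => ?_ }, fun a => ?_⟩
  · obtain ⟨a, b, hb, h⟩ := hfrac d
    obtain ⟨a', b', hb', h'⟩ := hfrac d'
    obtain ⟨e, g, he, heg⟩ := ore a b' hb'
    refine (hψ (e * b) (mul_ne_zero he hb)).mul_left_cancel ?_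
    rw [hΦ (d * d') (g * a') (e * b), map_mul ψ e, mul_assoc, ← mul_assoc (ψ b), hΦ d a b h,
      ← mul_assoc, ← map_mul ψ e, heg, map_mul ψ g b', mul_assoc, hΦ d' a' b' h', ← map_mul]
    rw [map_mul, mul_assoc, ← mul_assoc (f b), h, ← mul_assoc, ← map_mul, heg, map_mul, mul_assoc, h',
      ← map_mul]
  · obtain ⟨a, b, hb, h⟩ := hfrac d
    obtain ⟨a', b', hb', h'⟩ := hfrac d'
    obtain ⟨e, g, he, heg⟩ := ore b b' hb'
    refine (hψ (e * b) (mul_ne_zero he hb)).mul_left_cancel ?_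
    rw [mul_add, hΦ (d + d') (e * a + g * a') (e * b), hΦ d (e * a) (e * b),
      hΦ d' (g * a') (e * b), map_add]
    · rw [heg, map_mul, mul_assoc, h', ← map_mul]
    · rw [map_mul, mul_assoc, h, ← map_mul]
    · rw [mul_add, map_add, map_mul f e a, map_mul f g a', ← h, ← h', ← mul_assoc, ← map_mul,
        ← mul_assoc, ← map_mul, heg]
  · have := hΦ (f a) a 1 (by simp)
    simpa using this

section Reduction
variable {I : Type} (ℱ : Filter I) {K : Type} [Field K] (k : I → Type) [∀ i, Field (k i)]
  (D : I → Type) [∀ i, DivisionRing (D i)] [∀ i, Algebra (k i) (D i)]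

/-- A family of maps of fields which eventually respects any finite set of algebraic relations. -/
structure EventualHom (φ : ∀ i, K → k i) : Prop where
  one : ∀ᶠ i in ℱ, φ i 1 = 1
  add : ∀ a b, ∀ᶠ i in ℱ, φ i (a + b) = φ i a + φ i b
  mul : ∀ a b, ∀ᶠ i in ℱ, φ i (a * b) = φ i a * φ i b
  ne_zero : ∀ a, a ≠ 0 → ∀ᶠ i in ℱ, φ i a ≠ 0

variable {ℱ k}

lemma EventualHom.zero {φ : ∀ i, K → k i} (h : EventualHom ℱ k φ) : ∀ᶠ i in ℱ, φ i 0 = 0 := by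
  filter_upwards [h.add 0 0] with i hi
  simpa using hi

/-- The scalars of a reduced product. -/
def EventualHom.coeffHom {φ : ∀ i, K → k i} (h : EventualHom ℱ k φ) : K →+* ReducedProduct ℱ D where
  toFun c := toReduced ℱ D fun i => algebraMap (k i) (D i) (φ i c)
  map_one' := by
    rw [← map_one (toReduced ℱ D), toReduced_eq]
    filter_upwards [h.one] with i hi
    rw [hi, map_one]; rfl
  map_mul' a b := by
    rw [← map_mul, toReduced_eq]
    filter_upwards [h.mul a b] with i hi
    rw [hi, map_mul]; rfl
  map_zero' := by
    rw [← map_zero (toReduced ℱ D), toReduced_eq]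
    filter_upwards [h.zero] with i hi
    rw [hi, map_zero]; rfl
  map_add' a b := by
    rw [← map_add, toReduced_eq]
    filter_upwards [h.add a b] with i hi
    rw [hi, map_add]; rfl

/-- The algebra structure on a reduced product given by an eventual homomorphism. -/
abbrev EventualHom.algebra {φ : ∀ i, K → k i} (h : EventualHom ℱ k φ) :
    Algebra K (ReducedProduct ℱ D) :=
  RingHom.toAlgebra' (h.coeffHom D) fun c x => by
    obtain ⟨x, rfl⟩ := toReduced_surjective x
    change toReduced ℱ D _ * _ = _ * toReduced ℱ D _
    rw [← map_mul, ← map_mul]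
    exact congrArg _ (funext fun i => Algebra.commutes _ _)

end Reduction

end SoGK

namespace SoGK
open MvPolynomial

attribute [local instance] LieRing.ofAssociativeRing

lemma SoRel.map {m : ℕ} {R S : Type*} [Ring R] [Ring S] {G : Fin m → Fin m → R} (h : SoRel G)
    (f : R →+* S) : SoRel fun i j => f (G i j) where
  swap i j := by rw [← map_neg, h.swap]
  comm i j a b := by
    have := congrArg f (h.comm i j a b)
    simpa only [map_sub, map_add, map_mul, apply_ite f, map_zero] using this

lemma SoRel.pi {m : ℕ} {I : Type*} {R : I → Type*} [∀ i, Ring (R i)]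
    {G : ∀ i, Fin m → Fin m → R i} (h : ∀ i, SoRel (G i)) : SoRel fun a b i => G i a b where
  swap a b := funext fun i => (h i).swap a b
  comm a b c d := funext fun i => by
    have h1 : ∀ (P : Prop) [Decidable P] (x : ∀ i, R i), (if P then x else 0) i = if P then x i else 0 :=
      fun P _ x => by split_ifs <;> rfl
    simpa only [Pi.sub_apply, Pi.add_apply, Pi.mul_apply, h1] using (h i).comm a b c d

/-- Apply a map of coefficients to a polynomial. -/
def mapCoeffs {σ K L : Type*} [CommSemiring K] [CommSemiring L] (φ : K → L) (P : MvPolynomial σ K) :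
    MvPolynomial σ L :=
  ∑ s ∈ P.support, monomial s (φ (coeff s P))

lemma totalDegree_mapCoeffs_le {σ K L : Type*} [CommSemiring K] [CommSemiring L] (φ : K → L)
    (P : MvPolynomial σ K) : (mapCoeffs φ P).totalDegree ≤ P.totalDegree :=
  totalDegree_finsetSum_le fun _ hs => (totalDegree_monomial_le _ _).trans (le_totalDegree hs)

lemma mapCoeffs_ne_zero {σ K L : Type*} [CommSemiring K] [CommSemiring L] {φ : K → L}
    {P : MvPolynomial σ K} {s : σ →₀ ℕ} (hs : s ∈ P.support) (h : φ (coeff s P) ≠ 0) :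
    mapCoeffs φ P ≠ 0 := fun h0 => h (by
  classical
  have h1 := congrArg (coeff s) h0
  rwa [mapCoeffs, coeff_sum, Finset.sum_eq_single s (fun t _ ht => by rw [coeff_monomial, if_neg ht])
    (fun h => absurd hs h), coeff_monomial, if_pos rfl, coeff_zero] at h1)

section Reduction
variable {I : Type} {ℱ : Filter I} {K : Type} [Field K] {k : I → Type} [∀ i, Field (k i)]
  {D : I → Type} [∀ i, DivisionRing (D i)] [∀ i, Algebra (k i) (D i)] {m : ℕ} [NeZero (2 : K)]
  {φ : ∀ i, K → k i}

/-- The map of the enveloping algebra to a reduced product. -/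
def EventualHom.reduction (h : EventualHom ℱ k φ) (ε : ∀ i, Env (k i) m →+* D i) :
    Env K m →+* ReducedProduct ℱ D :=
  letI := h.algebra D
  (UniversalEnvelopingAlgebra.lift K (soHom (K := K) (((SoRel.pi fun i =>
    (soRel_ι (K := k i) (m := m)).map (ε i))).map (toReduced ℱ D)))).toRingHom

variable (h : EventualHom ℱ k φ) (ε : ∀ i, Env (k i) m →+* D i)

lemma EventualHom.reduction_skewGen (a b : Fin m) : h.reduction ε (envι K (skewGen K m a b)) =
    toReduced ℱ D fun i => ε i (envι (k i) (skewGen (k i) m a b)) := by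
  letI := h.algebra D
  exact (UniversalEnvelopingAlgebra.lift_ι_apply K _ _).trans (soHom_skewGen _ a b)

lemma EventualHom.reduction_algebraMap (c : K) : h.reduction ε (algebraMap K _ c) = h.coeffHom D c := by
  letI := h.algebra D
  exact AlgHom.commutes (UniversalEnvelopingAlgebra.lift K (soHom (K := K) (((SoRel.pi fun i =>
    (soRel_ι (K := k i) (m := m)).map (ε i))).map (toReduced ℱ D)))) c

lemma EventualHom.reduction_prodE (L : List (SkewIdx m)) : h.reduction ε (prodE K L) =
    toReduced ℱ D fun i => ε i (prodE (k i) L) := by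
  induction L with
  | nil =>
    have h1 : ∀ (k : Type) [Field k], prodE k ([] : List (SkewIdx m)) = 1 := fun _ _ => rfl
    simp only [h1, map_one]
    exact (map_one (toReduced ℱ D)).symm
  | cons c L ih =>
    simp only [prodE_cons, map_mul (ε _)]
    rw [map_mul, ih, h.reduction_skewGen, ← map_mul]
    rfl

lemma EventualHom.reduction_pbw (hε : ∀ i c, ε i (algebraMap (k i) _ c) = algebraMap (k i) (D i) c)
    (P : MvPolynomial (SkewIdx m) K) : h.reduction ε (pbw K m P) =
      toReduced ℱ D fun i => ε i (pbw (k i) m (mapCoeffs (φ i) P)) := by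
  have h1 : (fun i => ε i (pbw (k i) m (mapCoeffs (φ i) P))) = ∑ s ∈ P.support,
      (fun i => algebraMap (k i) (D i) (φ i (coeff s P))) * fun i => ε i (envMon (k i) s) := by
    funext i
    rw [Finset.sum_apply, mapCoeffs, map_sum, map_sum]
    refine Finset.sum_congr rfl fun s _ => ?_
    rw [pbw_monomial, Algebra.smul_def, map_mul (ε i), hε]
    rfl
  rw [h1, map_sum]
  conv_lhs => rw [P.as_sum, map_sum, map_sum]
  refine Finset.sum_congr rfl fun s _ => ?_
  rw [pbw_monomial, Algebra.smul_def, map_mul (h.reduction ε), map_mul (toReduced ℱ D),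
    h.reduction_algebraMap, envMon, h.reduction_prodE]
  rfl

lemma EventualHom.exists_reduction (hε : ∀ i c, ε i (algebraMap (k i) _ c) = algebraMap (k i) (D i) c)
    (a : Env K m) : ∃ d : ℕ, ∃ α : ∀ i, Env (k i) m, (∀ i, α i ∈ fil (k i) m d) ∧
      (a ≠ 0 → ∀ᶠ i in ℱ, α i ≠ 0) ∧ h.reduction ε a = toReduced ℱ D fun i => ε i (α i) := by
  obtain ⟨P, rfl⟩ := pbw_surjective a
  refine ⟨P.totalDegree, fun i => pbw (k i) m (mapCoeffs (φ i) P),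
    fun i => pbw_mem_fil (totalDegree_mapCoeffs_le _ _), fun ha => ?_, h.reduction_pbw ε hε P⟩
  obtain ⟨s, hs⟩ := MvPolynomial.ne_zero_iff.1 fun h0 : P = 0 => ha (by rw [h0, map_zero])
  filter_upwards [h.ne_zero _ hs] with i hi
  rw [Ne, ← map_zero (pbw (k i) m)]
  exact fun h0 => mapCoeffs_ne_zero (mem_support_iff.2 hs) hi (pbw_injective h0)

end Reduction

end SoGK

namespace SoGK
open MvPolynomial

attribute [local instance] LieRing.ofAssociativeRing

section Reduction

lemma generatesDivision_of_entries {k D : Type} [Field k] [DivisionRing D] [Algebra k D] {m : ℕ}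
    [NeZero (2 : k)] {r s : ℕ} {u v : Fin r → D} {y : Fin s → D} (ε : Env k m →+* D)
    (hε : ∀ c, ε (algebraMap k _ c) = algebraMap k D c) (hinj : Function.Injective ε)
    (hfrac : ∀ d : D, ∃ a b : Env k m, b ≠ 0 ∧ ε b * d = ε a)
    (h : ∀ c : SkewIdx m, ∃ A ∈ Algebra.adjoin k (Set.range u ∪ Set.range v ∪ Set.range y),
      ∃ B ∈ Algebra.adjoin k (Set.range u ∪ Set.range v ∪ Set.range y), B ≠ 0 ∧
        B * ε (envι k (gen k c)) = A) : GeneratesDivision k u v y := by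
  intro S hS hu hv hy
  have hle : Algebra.adjoin k (Set.range u ∪ Set.range v ∪ Set.range y) ≤ S := by
    refine Algebra.adjoin_le ?_
    rintro _ ((⟨i, rfl⟩ | ⟨i, rfl⟩) | ⟨i, rfl⟩)
    exacts [hu i, hv i, hy i]
  let εA : Env k m →ₐ[k] D := { ε with commutes' := hε }
  have hgen : ∀ c : SkewIdx m, εA (envι k (gen k c)) ∈ S := fun c => by
    obtain ⟨A, hA, B, hB, hB0, hBA⟩ := h c
    have h1 : εA (envι k (gen k c)) = B⁻¹ * A := by
      rw [← hBA, ← mul_assoc, inv_mul_cancel₀ hB0, one_mul]; rfl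
    rw [h1]
    exact S.mul_mem (hS _ (hle hB)) (hle hA)
  have hprod : ∀ L : List (SkewIdx m), εA (prodE k L) ∈ S := fun L => by
    induction L with
    | nil => exact (map_one εA).symm ▸ S.one_mem
    | cons c L ih => rw [prodE_cons, map_mul εA]; exact S.mul_mem (hgen c) ih
  have hall : ∀ a : Env k m, εA a ∈ S := fun a => by
    obtain ⟨P, rfl⟩ := pbw_surjective a
    rw [P.as_sum, map_sum, map_sum]
    refine sum_mem fun s _ => ?_
    rw [pbw_monomial, map_smul]
    exact S.smul_mem (hprod _) _
  rw [eq_top_iff]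
  intro d _
  obtain ⟨a, b, hb, hd⟩ := hfrac d
  have hb0 : ε b ≠ 0 := fun h0 => hb (hinj (h0.trans (map_zero ε).symm))
  have h1 : d = (ε b)⁻¹ * ε a := by rw [← hd, ← mul_assoc, inv_mul_cancel₀ hb0, one_mul]
  rw [h1]
  exact S.mul_mem (hS _ (hall b)) (hall a)

variable {I : Type} {ℱ : Filter I} {K : Type} [Field K] {k : I → Type} [∀ i, Field (k i)]
  {D : I → Type} [∀ i, DivisionRing (D i)] [∀ i, Algebra (k i) (D i)] {m : ℕ}
  {φ : ∀ i, K → k i}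

lemma EventualHom.exists_family (h : EventualHom ℱ k φ) {r s : ℕ}
    {W : Type} [Ring W] [Algebra K W] (f : FreeAlgebra K (WeylPolyGen r s) →ₐ[K] W)
    (Φ : W →+* ReducedProduct ℱ D) (hΦ : ∀ c, Φ (algebraMap K W c) = h.coeffHom D c)
    (g : ∀ i, WeylPolyGen r s → D i)
    (hg : ∀ z, Φ (f (FreeAlgebra.ι K z)) = toReduced ℱ D fun i => g i z)
    (w : FreeAlgebra K (WeylPolyGen r s)) : ∃ x : ∀ i, D i,
      (∀ i, x i ∈ Algebra.adjoin (k i) (Set.range (g i))) ∧ Φ (f w) = toReduced ℱ D x := by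
  induction w using FreeAlgebra.induction with
  | grade0 c => exact ⟨fun i => algebraMap (k i) (D i) (φ i c), fun i => Subalgebra.algebraMap_mem _ _,
      by rw [AlgHom.commutes, hΦ]; rfl⟩
  | grade1 z => exact ⟨fun i => g i z, fun i => Algebra.subset_adjoin ⟨z, rfl⟩, hg z⟩
  | mul a b ha hb =>
    obtain ⟨x, hx, hx'⟩ := ha
    obtain ⟨y, hy, hy'⟩ := hb
    exact ⟨x * y, fun i => Subalgebra.mul_mem _ (hx i) (hy i), by
      rw [map_mul f, map_mul Φ, hx', hy', map_mul]⟩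
  | add a b ha hb =>
    obtain ⟨x, hx, hx'⟩ := ha
    obtain ⟨y, hy, hy'⟩ := hb
    exact ⟨x + y, fun i => Subalgebra.add_mem _ (hx i) (hy i), by
      rw [map_add f, map_add Φ, hx', hy', map_add]⟩

theorem EventualHom.eventually_weylSystem [NeZero (2 : K)] [∀ i, NeZero (2 : k i)]
    (h : EventualHom ℱ k φ) (ε : ∀ i, Env (k i) m →+* D i)
    (hε : ∀ i c, ε i (algebraMap (k i) _ c) = algebraMap (k i) (D i) c)
    (hinj : ∀ i, Function.Injective (ε i))
    (hfrac : ∀ i, ∀ d : D i, ∃ a b : Env (k i) m, b ≠ 0 ∧ ε i b * d = ε i a)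
    (w : GelfandKirillovWitness K (So K m)) :
    ∃ N : ℕ, ∀ᶠ i in ℱ, ∃ (u v : Fin w.r → D i) (y : Fin w.s → D i), WeylSystem u v y ∧
      GeneratesDivision (k i) u v y ∧ ∀ j, ∃ a b : Env (k i) m, a ≠ 0 ∧ a ∈ fil (k i) m N ∧
        b ∈ fil (k i) m N ∧ ε i a * y j = ε i b := by
  obtain ⟨r, s, D₁, D₂, f₁, f₂, hfr₁, hfr₂, iso⟩ := w
  dsimp only
  have hunit : ∀ a, a ≠ 0 → IsUnit (h.reduction ε a) := fun a ha => by
    obtain ⟨-, α, -, hα, ha'⟩ := h.exists_reduction ε hε a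
    rw [ha']
    refine isUnit_toReduced ?_
    filter_upwards [hα ha] with i hi h0
    exact hi (hinj i (h0.trans (map_zero (ε i)).symm))
  obtain ⟨Φ, hΦ⟩ := exists_fraction_lift f₁.toRingHom hfr₁.1 hfr₁.2 (h.reduction ε) hunit
  have hΦK : ∀ c, Φ (algebraMap K D₁ c) = h.coeffHom D c := fun c => by
    rw [← f₁.commutes]; exact (hΦ _).trans (h.reduction_algebraMap ε c)
  let q : FreeAlgebra K (WeylPolyGen r s) →ₐ[K] D₁ :=
    (iso.symm : D₂ →ₐ[K] D₁).comp (f₂.comp (RingQuot.mkAlgHom K (WeylPolyRel K r s)))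
  have hq : ∀ x y, WeylPolyRel K r s x y → q x = q y := fun x y hxy =>
    congrArg (fun z => iso.symm (f₂ z)) (RingQuot.mkAlgHom_rel K hxy)
  choose g hg using fun z => toReduced_surjective (Φ (q (FreeAlgebra.ι K z)))
  have hgen : ∀ d : D₁, ∃ A B : FreeAlgebra K (WeylPolyGen r s), q B ≠ 0 ∧ q B * d = q A := by
    intro d
    obtain ⟨a, b, hb, hab⟩ := hfr₂.2 (iso d)
    obtain ⟨A, rfl⟩ := RingQuot.mkAlgHom_surjective K (WeylPolyRel K r s) a
    obtain ⟨B, rfl⟩ := RingQuot.mkAlgHom_surjective K (WeylPolyRel K r s) b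
    refine ⟨A, B, fun h0 => hb (hfr₂.1 ?_), ?_⟩
    · rw [map_zero]
      exact (map_eq_zero_iff iso.symm iso.symm.injective).1 h0
    · have := congrArg iso.symm hab
      rw [map_mul iso.symm, iso.symm_apply_apply] at this
      exact this
  have hmul : ∀ z z', Φ (q (FreeAlgebra.ι K z * FreeAlgebra.ι K z')) = toReduced ℱ D (g z * g z') :=
    fun z z' => by rw [map_mul q, map_mul Φ, ← hg, ← hg, ← map_mul]
  have hcomm : ∀ z z', WeylPolyRel K r s (FreeAlgebra.ι K z * FreeAlgebra.ι K z')
      (FreeAlgebra.ι K z' * FreeAlgebra.ι K z) → ∀ᶠ i in ℱ, Commute (g z i) (g z' i) := by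
    intro z z' hz
    have h1 := congrArg Φ (hq _ _ hz)
    rw [hmul, hmul, toReduced_eq] at h1
    exact h1
  have huv : ∀ a b : Fin r, ∀ᶠ i in ℱ, g (.u a) i * g (.v b) i =
      g (.v b) i * g (.u a) i + if a = b then 1 else 0 := by
    intro a b
    have h1 := congrArg Φ (hq _ _ (WeylPolyRel.uv a b))
    have h2 : Φ (q (if a = b then 1 else 0)) = toReduced ℱ D (if a = b then 1 else 0) := by
      split_ifs <;> simp
    rw [map_add q, map_add Φ, hmul, hmul, h2, ← map_add, toReduced_eq] at h1
    filter_upwards [h1] with i hi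
    refine hi.trans ?_
    split_ifs <;> rfl
  have hfam := h.exists_family q Φ hΦK (fun i z => g z i) (fun z => (hg z).symm)
  have hent : ∀ c : SkewIdx m, ∃ A B : ∀ i, D i,
      (∀ i, A i ∈ Algebra.adjoin (k i) (Set.range fun z => g z i)) ∧
      (∀ i, B i ∈ Algebra.adjoin (k i) (Set.range fun z => g z i)) ∧
      ∀ᶠ i in ℱ, B i ≠ 0 ∧ B i * ε i (envι (k i) (gen (k i) c)) = A i := by
    intro c
    obtain ⟨A, B, hB, hBA⟩ := hgen (f₁ (envι K (gen K c)))
    obtain ⟨A', hA', hAA⟩ := hfam A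
    obtain ⟨B', hB', hBB⟩ := hfam B
    refine ⟨A', B', hA', hB', ?_⟩
    have h1 := eventually_ne_zero (hBB ▸ (IsUnit.mk0 _ hB).map Φ)
    have h2 := congrArg Φ hBA
    have h3 : Φ (f₁ (envι K (gen K c))) = _ := (hΦ _).trans (h.reduction_skewGen ε c.1.1 c.1.2)
    rw [map_mul Φ, hBB, hAA, h3, ← map_mul, toReduced_eq] at h2
    filter_upwards [h1, h2] with i hi hi' using ⟨hi, hi'⟩
  have hdeg : ∀ j : Fin s, ∃ N, ∃ a b : ∀ i, Env (k i) m, (∀ i, a i ∈ fil (k i) m N) ∧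
      (∀ i, b i ∈ fil (k i) m N) ∧ ∀ᶠ i in ℱ, a i ≠ 0 ∧ ε i (a i) * g (.y j) i = ε i (b i) := by
    intro j
    obtain ⟨b, a, ha, hab⟩ := hfr₁.2 (q (FreeAlgebra.ι K (.y j)))
    obtain ⟨d, α, hα, hα0, hαr⟩ := h.exists_reduction ε hε a
    obtain ⟨e, β, hβ, -, hβr⟩ := h.exists_reduction ε hε b
    refine ⟨max d e, α, β, fun i => fil_mono (le_max_left d e) (hα i),
      fun i => fil_mono (le_max_right d e) (hβ i), ?_⟩
    have h2 := congrArg Φ hab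
    have h3 : ∀ x, Φ (f₁ x) = h.reduction ε x := hΦ
    rw [map_mul Φ, h3, h3, hαr, hβr, ← hg, ← map_mul, toReduced_eq] at h2
    filter_upwards [hα0 ha, h2] with i hi hi' using ⟨hi, hi'⟩
  choose A B hA hB hAB using hent
  choose N a b ha hb hab using hdeg
  refine ⟨Finset.univ.sup N, ?_⟩
  filter_upwards [Filter.eventually_all.2 fun a : Fin r => Filter.eventually_all.2 fun b : Fin r =>
      hcomm _ _ (WeylPolyRel.uu a b),
    Filter.eventually_all.2 fun a : Fin r => Filter.eventually_all.2 fun b : Fin r =>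
      hcomm _ _ (WeylPolyRel.vv a b),
    Filter.eventually_all.2 fun a : Fin r => Filter.eventually_all.2 fun b : Fin r => huv a b,
    Filter.eventually_all.2 fun a : Fin s => Filter.eventually_all.2 fun b : Fin r =>
      hcomm _ _ (WeylPolyRel.central a (.u b)),
    Filter.eventually_all.2 fun a : Fin s => Filter.eventually_all.2 fun b : Fin r =>
      hcomm _ _ (WeylPolyRel.central a (.v b)),
    Filter.eventually_all.2 fun a : Fin s => Filter.eventually_all.2 fun b : Fin s =>
      hcomm _ _ (WeylPolyRel.central a (.y b)),
    Filter.eventually_all.2 hAB, Filter.eventually_all.2 hab] with i h1 h2 h3 h4 h5 h6 h7 h8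
  have hsub : (Set.range fun z => g z i) ⊆ Set.range (fun j => g (.u j) i) ∪
      Set.range (fun j => g (.v j) i) ∪ Set.range (fun j => g (.y j) i) := by
    rintro _ ⟨z | z | z, rfl⟩
    exacts [Or.inl (Or.inl ⟨z, rfl⟩), Or.inl (Or.inr ⟨z, rfl⟩), Or.inr ⟨z, rfl⟩]
  refine ⟨fun j => g (.u j) i, fun j => g (.v j) i, fun j => g (.y j) i, ⟨h1, h2, h3, h4, h5, h6⟩,
    generatesDivision_of_entries (ε i) (hε i) (hinj i) (hfrac i) fun c =>
      ⟨A c i, Algebra.adjoin_mono hsub (hA c i), B c i, Algebra.adjoin_mono hsub (hB c i), h7 c⟩,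
    fun j => ⟨a j i, b j i, (h8 j).1, fil_mono (Finset.le_sup (Finset.mem_univ j)) (ha j i),
      fil_mono (Finset.le_sup (Finset.mem_univ j)) (hb j i), (h8 j).2⟩⟩

end Reduction

end SoGK

namespace SoGK
open MvPolynomial

section Specialization

/-- A finitely generated domain of characteristic zero has a point over an algebraic closure
of `𝔽_p` for all large `p`. -/
lemma exists_forall_nonempty_ringHom (R : Type) [CommRing R] [IsDomain R] [CharZero R]
    [Algebra.FiniteType ℤ R] :
    ∃ N : ℕ, ∀ (p : ℕ) [Fact p.Prime], N < p → Nonempty (R →+* AlgebraicClosure (ZMod p)) := by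
  haveI : Algebra.FinitePresentation ℤ R := Algebra.FinitePresentation.of_finiteType.1 inferInstance
  have hopen := (PrimeSpectrum.isOpenMap_comap_of_hasGoingDown_of_finitePresentation
    (R := ℤ) (S := R)).isOpen_range
  have hbot : (⟨⊥, Ideal.isPrime_bot⟩ : PrimeSpectrum ℤ) ∈
      Set.range (PrimeSpectrum.comap (algebraMap ℤ R)) := by
    refine ⟨⟨⊥, Ideal.isPrime_bot⟩, ?_⟩
    ext1
    change Ideal.comap (algebraMap ℤ R) ⊥ = ⊥
    rw [← RingHom.ker_eq_comap_bot, (RingHom.injective_iff_ker_eq_bot _).1]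
    exact (algebraMap ℤ R).injective_int
  obtain ⟨_, ⟨n, rfl⟩, hn, hsub⟩ :=
    PrimeSpectrum.isTopologicalBasis_basic_opens.exists_subset_of_mem_open hbot hopen
  have hn0 : n ≠ 0 := fun h => hn (by simp [h])
  refine ⟨n.natAbs, fun p _ hp => ?_⟩
  have hpp : Prime (p : ℤ) := Nat.prime_iff_prime_int.1 Fact.out
  have hpn : (⟨Ideal.span {(p : ℤ)}, (Ideal.span_singleton_prime hpp.ne_zero).2 hpp⟩ :
      PrimeSpectrum ℤ) ∈ (PrimeSpectrum.basicOpen n : Set (PrimeSpectrum ℤ)) := by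
    intro h
    have h1 : (p : ℤ) ∣ n := Ideal.mem_span_singleton.1 h
    have := Int.natAbs_dvd_natAbs.2 h1
    exact absurd (Nat.le_of_dvd (Int.natAbs_pos.2 hn0) this) (by simpa using hp)
  obtain ⟨P, hP⟩ := hsub hpn
  obtain ⟨M, hM, hPM⟩ := P.asIdeal.exists_le_maximal P.isPrime.ne_top
  have hpM : (p : R) ∈ M := hPM (by
    have : (p : ℤ) ∈ (PrimeSpectrum.comap (algebraMap ℤ R) P).asIdeal := by
      rw [hP]; exact Ideal.mem_span_singleton_self _
    simpa using this)
  letI := Ideal.Quotient.field M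
  haveI : CharP (R ⧸ M) p := by
    obtain ⟨q, hq⟩ := CharP.exists (R ⧸ M)
    have h0 : ((p : ℕ) : R ⧸ M) = 0 := by
      rw [← map_natCast (Ideal.Quotient.mk M)]; exact Ideal.Quotient.eq_zero_iff_mem.2 hpM
    have hqp := (CharP.cast_eq_zero_iff (R ⧸ M) q p).1 h0
    rcases (Nat.dvd_prime Fact.out).1 hqp with rfl | rfl
    · exact absurd ((Nat.cast_one (R := R ⧸ M)).symm.trans (CharP.cast_eq_zero (R ⧸ M) 1)) one_ne_zero
    · exact hq
  letI : Algebra (ZMod p) (R ⧸ M) := ZMod.algebra _ p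
  haveI : Algebra.FiniteType ℤ (R ⧸ M) :=
    Algebra.FiniteType.of_surjective (Ideal.Quotient.mkₐ ℤ M) Ideal.Quotient.mk_surjective
  haveI : Algebra.FiniteType (ZMod p) (R ⧸ M) :=
    Algebra.FiniteType.of_restrictScalars_finiteType ℤ (ZMod p) _
  haveI := finite_of_finite_type_of_isJacobsonRing (ZMod p) (R ⧸ M)
  exact ⟨(IsAlgClosed.lift (R := ZMod p) (S := R ⧸ M) (M := AlgebraicClosure (ZMod p)) :
    (R ⧸ M) →+* _).comp (Ideal.Quotient.mk M)⟩

/-- Respecting the field operations on a finite set, and nonvanishing there. -/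
structure RespectsOn {K L : Type} [Field K] [Field L] (T : Finset K) (φ : K → L) : Prop where
  one : φ 1 = 1
  add : ∀ a ∈ T, ∀ b ∈ T, φ (a + b) = φ a + φ b
  mul : ∀ a ∈ T, ∀ b ∈ T, φ (a * b) = φ a * φ b
  ne_zero : ∀ a ∈ T, a ≠ 0 → φ a ≠ 0

lemma RespectsOn.mono {K L : Type} [Field K] [Field L] {S T : Finset K} (h : S ⊆ T) {φ : K → L}
    (hφ : RespectsOn T φ) : RespectsOn S φ :=
  ⟨hφ.one, fun a ha b hb => hφ.add a (h ha) b (h hb), fun a ha b hb => hφ.mul a (h ha) b (h hb),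
    fun a ha => hφ.ne_zero a (h ha)⟩

open Classical in
lemma exists_respectsOn {K : Type} [Field K] [CharZero K] (T : Finset K) :
    ∃ N : ℕ, ∀ (p : ℕ) [Fact p.Prime], N < p →
      ∃ φ : K → AlgebraicClosure (ZMod p), RespectsOn T φ := by
  let R : Subalgebra ℤ K := Algebra.adjoin ℤ ((T ∪ T.image (·⁻¹) : Finset K) : Set K)
  have hT : ∀ a ∈ T, a ∈ R := fun a ha => Algebra.subset_adjoin (by simp [ha])
  have hTi : ∀ a ∈ T, a⁻¹ ∈ R := fun a ha => Algebra.subset_adjoin (by simp [ha])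
  haveI : Algebra.FiniteType ℤ R := R.fg_iff_finiteType.1 ⟨_, rfl⟩
  obtain ⟨N, hN⟩ := exists_forall_nonempty_ringHom R
  refine ⟨N, fun p _ hp => ?_⟩
  obtain ⟨ψ⟩ := hN p hp
  have hv : ∀ a (ha : a ∈ R), (if h : a ∈ R then ψ ⟨a, h⟩ else 0) = ψ ⟨a, ha⟩ :=
    fun a ha => dif_pos ha
  refine ⟨fun a => if h : a ∈ R then ψ ⟨a, h⟩ else 0, ?_, fun a ha b hb => ?_, fun a ha b hb => ?_,
    fun a ha h0 => ?_⟩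
  · beta_reduce
    rw [hv 1 R.one_mem]; exact map_one ψ
  · beta_reduce
    rw [hv _ (R.add_mem (hT a ha) (hT b hb)), hv _ (hT a ha), hv _ (hT b hb), ← map_add]; rfl
  · beta_reduce
    rw [hv _ (R.mul_mem (hT a ha) (hT b hb)), hv _ (hT a ha), hv _ (hT b hb), ← map_mul]; rfl
  · beta_reduce
    rw [hv _ (hT a ha)]
    refine left_ne_zero_of_mul_eq_one (b := ψ ⟨a⁻¹, hTi a ha⟩) ?_
    rw [← map_mul, ← map_one ψ]
    congr 1
    exact Subtype.ext (mul_inv_cancel₀ h0)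

/-- A prime from a given set together with a map approximating a specialization. -/
structure Specialization (K : Type) (B : ℕ → Prop) : Type where
  p : ℕ
  [prime : Fact p.Prime]
  mem : B p
  φ : K → AlgebraicClosure (ZMod p)

attribute [instance] Specialization.prime

variable {K : Type} [Field K] [CharZero K] {B : ℕ → Prop}

/-- The filter along which specializations become homomorphisms and the prime becomes large. -/
def specializationFilter (K : Type) [Field K] (B : ℕ → Prop) : Filter (Specialization K B) :=
  ⨅ t : Finset K × ℕ, Filter.principal {i | t.2 < i.p ∧ RespectsOn t.1 i.φ}

lemma eventually_specializationFilter (T : Finset K) (N : ℕ) :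
    ∀ᶠ i in specializationFilter K B, N < i.p ∧ RespectsOn T i.φ :=
  Filter.mem_iInf_of_mem (T, N) (Filter.mem_principal_self _)

open Classical in
lemma specializationFilter_neBot (hB : ∀ N, ∃ p, N < p ∧ p.Prime ∧ B p) :
    (specializationFilter K B).NeBot := by
  haveI : Nonempty (Specialization K B) := by
    obtain ⟨p, -, hp, h⟩ := hB 0
    exact ⟨@Specialization.mk K B p ⟨hp⟩ h fun _ => 0⟩
  refine Filter.iInf_neBot_of_directed ?_ fun t => ?_
  · rintro ⟨S, M⟩ ⟨T, N⟩
    refine ⟨(S ∪ T, max M N), ?_, ?_⟩ <;> refine Filter.principal_mono.2 ?_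
    · exact fun i hi => ⟨(le_max_left M N).trans_lt hi.1, hi.2.mono Finset.subset_union_left⟩
    · exact fun i hi => ⟨(le_max_right M N).trans_lt hi.1, hi.2.mono Finset.subset_union_right⟩
  · obtain ⟨N, hN⟩ := exists_respectsOn t.1
    obtain ⟨p, hp, hpp, h⟩ := hB (max t.2 N)
    haveI : Fact p.Prime := ⟨hpp⟩
    obtain ⟨φ, hφ⟩ := hN p ((le_max_right _ _).trans_lt hp)
    exact Filter.principal_neBot_iff.2 ⟨⟨p, h, φ⟩, (le_max_left _ _).trans_lt hp, hφ⟩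

open Classical in
lemma eventualHom_specialization :
    EventualHom (specializationFilter K B) (fun i => AlgebraicClosure (ZMod i.p)) fun i => i.φ where
  one := (eventually_specializationFilter ∅ 0).mono fun _ h => h.2.one
  add a b := (eventually_specializationFilter {a, b} 0).mono fun _ h =>
    h.2.add a (by simp) b (by simp)
  mul a b := (eventually_specializationFilter {a, b} 0).mono fun _ h =>
    h.2.mul a (by simp) b (by simp)
  ne_zero a ha := (eventually_specializationFilter {a} 0).mono fun _ h =>
    h.2.ne_zero a (by simp) ha

instance (p : ℕ) [Fact p.Prime] : CharP (AlgebraicClosure (ZMod p)) p :=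
  charP_of_injective_algebraMap (algebraMap (ZMod p) _).injective p

section DEnv

variable (k : Type) [Field k] (m : ℕ) [NeZero m] (p : ℕ) [Fact p.Prime] [CharP k p] [NeZero (2 : k)]

lemma envD_algebraMap (c : k) :
    envD k m p (algebraMap k (Env k m) c) = algebraMap k (DEnv k m p) c := by
  rw [Algebra.algebraMap_eq_smul_one, toCFrac_smul, map_one, Algebra.algebraMap_eq_smul_one]

variable {k m p}

lemma envD_injective : Function.Injective (envD k m p) := toCFrac_injective

lemma exists_envD_mul_eq (d : DEnv k m p) :
    ∃ a b : Env k m, b ≠ 0 ∧ envD k m p b * d = envD k m p a := by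
  obtain ⟨a, ha, u, hu⟩ := CFrac.exists_smul_eq d
  exact ⟨u, algebraMap _ _ a, fun h => ha (FaithfulSMul.algebraMap_injective _ _
    (h.trans (map_zero _).symm)), hu⟩

lemma EventualHom.exists_purely_transcendental {I : Type} {ℱ : Filter I} [ℱ.NeBot] {K : Type}
    [Field K] [NeZero (2 : K)] {k : I → Type} [∀ i, Field (k i)] [∀ i, IsAlgClosed (k i)]
    [∀ i, NeZero (2 : k i)] {φ : ∀ i, K → k i} (h : EventualHom ℱ k φ) {p : I → ℕ}
    [∀ i, Fact (p i).Prime] [∀ i, CharP (k i) (p i)] (hp : ∀ N, ∀ᶠ i in ℱ, N < p i)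
    (hm : 5 ≤ m) (w : GelfandKirillovWitness K (So K m)) :
    ∃ i, ∃ (d : ℕ) (f : Fin d → Fr (k i) m), AlgebraicIndependent (invField (k i) m) f ∧
      Subfield.closure ((invField (k i) m : Set (Fr (k i) m)) ∪ Set.range f) = ⊤ := by
  obtain ⟨N, hN⟩ := h.eventually_weylSystem (D := fun i => DEnv (k i) m (p i))
    (fun i => envD (k i) m (p i)) (fun i c => envD_algebraMap _ _ _ c) (fun i => envD_injective)
    (fun i => exists_envD_mul_eq) w
  obtain ⟨i, ⟨⟨u, v, y, hw, hg, hy⟩, hi⟩, h4⟩ := ((hN.and (hp (2 * N))).and (hp 4)).exists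
  exact ⟨i, SoGK.exists_purely_transcendental (p i) hm h4 hw hg fun j => ⟨N, hi, hy j⟩⟩

end DEnv

/-- The field of rational functions on the orthogonal Lie algebra is purely transcendental over
its invariants. -/
def PureOverInvariants (k : Type) [Field k] (m : ℕ) : Prop :=
  ∃ E : Subfield (FractionRing (MvPolynomial (SkewIdx m) k)),
    (∀ x, x ∈ E ↔ SOConjInvariant k m x) ∧
    ∃ (d : ℕ) (f : Fin d → FractionRing (MvPolynomial (SkewIdx m) k)),
      AlgebraicIndependent E f ∧
      Subfield.closure ((E : Set (FractionRing (MvPolynomial (SkewIdx m) k))) ∪ Set.range f) = ⊤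

lemma exists_pureOverInvariants {m : ℕ} (hm : 5 ≤ m)
    (w : GelfandKirillovWitness K (So K m)) (hB : ∀ N, ∃ p, N < p ∧ p.Prime ∧ B p)
    (hB4 : ∀ p, B p → 4 < p) :
    ∃ (p : ℕ) (_ : Fact p.Prime), B p ∧ PureOverInvariants (AlgebraicClosure (ZMod p)) m := by
  haveI : NeZero m := ⟨by omega⟩
  haveI hne : (specializationFilter K B).NeBot := specializationFilter_neBot hB
  haveI : ∀ i : Specialization K B, NeZero (2 : AlgebraicClosure (ZMod i.p)) := fun i => ⟨fun h => by
    have := (CharP.cast_eq_zero_iff (AlgebraicClosure (ZMod i.p)) i.p 2).1 (by exact_mod_cast h)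
    have := Nat.le_of_dvd two_pos this
    have := hB4 _ i.mem
    omega⟩
  obtain ⟨i, h⟩ := (eventualHom_specialization (K := K) (B := B)).exists_purely_transcendental
    (fun N => (eventually_specializationFilter ∅ N).mono fun _ h => h.1) hm w
  exact ⟨i.p, i.prime, i.mem, invField _ m, fun _ => Iff.rfl, h⟩

end Specialization

end SoGK

/-- **Purity of `k(so_m)/k(so_m)^{SO_m}` for `p ≫ 0` from the Gelfand–Kirillov conjecture.**
Let `K` be algebraically closed of characteristic `0` and `m ≥ 7`.  If `D(so_m(K)) ≅
D_{r,s}(K)` for some `r, s`, then there is an `N` such that for every prime `p > N`,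
with `k` an algebraic closure of `𝔽_p`, `R = k[so_m(k)]` the polynomial algebra on the
`m(m−1)/2` coordinates of a skew-symmetric matrix and `F = Frac R`, the fixed field
`F^{SO_m(k)}` (for the conjugation action) has a finite algebraically independent subset
of `F` generating `F` as a field extension, i.e. `F` is purely transcendental over
`F^{SO_m(k)}`. -/
theorem purity_from_gelfandKirillov_so (K : Type) [Field K] [IsAlgClosed K] [CharZero K]
    (m : ℕ) (hm : 7 ≤ m)
    (h : GelfandKirillovHolds K (LieAlgebra.Orthogonal.so (Fin m) K)) :
    ∃ N : ℕ, ∀ (p : ℕ) [Fact p.Prime], N < p →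
      ∃ E : Subfield (FractionRing (MvPolynomial (SkewIdx m) (AlgebraicClosure (ZMod p)))),
        (∀ x, x ∈ E ↔ SOConjInvariant (AlgebraicClosure (ZMod p)) m x) ∧
        ∃ (d : ℕ) (f : Fin d → FractionRing (MvPolynomial (SkewIdx m) (AlgebraicClosure (ZMod p)))),
          AlgebraicIndependent E f ∧
          Subfield.closure ((E : Set (FractionRing (MvPolynomial (SkewIdx m)
            (AlgebraicClosure (ZMod p))))) ∪ Set.range f) = ⊤ := by
  obtain ⟨w⟩ := h
  by_contra hcon
  rw [not_exists] at hcon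
  have hB : ∀ N, ∃ p, N < p ∧ p.Prime ∧ 4 < p ∧ ∀ _ : Fact p.Prime,
      ¬ SoGK.PureOverInvariants (AlgebraicClosure (ZMod p)) m := by
    intro N
    by_contra hN
    refine hcon (max 4 N) fun p hp hlt => ?_
    by_contra hE
    exact hN ⟨p, (le_max_right _ _).trans_lt hlt, hp.out, (le_max_left _ _).trans_lt hlt,
      fun _ => hE⟩
  obtain ⟨p, hF, ⟨-, hp⟩, h⟩ :=
    SoGK.exists_pureOverInvariants (by omega) w hB fun p hp => hp.1
  exact hp hF h

end
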